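/- Let ε > 0. Let b be a complex-valued function on the prime ideals 𝔭 of K with Σ_𝔭 |b(𝔭)| < ∞ and b(𝔭)=0 whenever N𝔭 ≤ y. Let H (mod 𝔮) be a primitive congruence class group of K. If T ≥ 1 and y ≥ { h_H · n_K^{5n_K/4} · D_K^{3/2} · Q^{1/2} · T^{n_K/2 + 1} }^{1+ε} · e^{O_ε(n_K)}, then Σ_{χ (mod 𝔮), χ(H)=1} ∫_{−T}^{T} | Σ_𝔭 b(𝔭) χ(𝔭) N𝔭^{−it} |² dt ≪_ε (1/log y) · Σ_𝔭 N𝔭 |b(𝔭)|². -/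

import Mathlib

open scoped BigOperators
open Complex NumberField Filter Topology

noncomputable section

namespace RTZ

/-- The degree `n_K = [K : ℚ]` of a number field. -/
def nK (K : Type*) [Field K] [NumberField K] : ℕ := Module.finrank ℚ K

/-- The absolute value `D_K` of the discriminant of `K`. -/
def DK (K : Type*) [Field K] [NumberField K] : ℕ := (NumberField.discr K).natAbs

/-- An algebraic integer is totally positive if it is positive under every real embedding. -/
def TotPos (K : Type*) [Field K] [NumberField K] (α : 𝓞 K) : Prop :=
  ∀ φ : K →+* ℝ, 0 < φ (algebraMap (𝓞 K) K α)

/-- A Hecke (narrow ray class) character modulo `𝔮`, regarded as a function on integral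
ideals extended by zero: it is completely multiplicative, vanishes on ideals not coprime
to `𝔮`, has modulus one on ideals coprime to `𝔮`, and is trivial on principal ideals
generated by totally positive elements `α ≡ 1 (mod 𝔮)`. -/
structure HeckeChar (K : Type*) [Field K] [NumberField K] (𝔮 : Ideal (𝓞 K)) where
  toFun : Ideal (𝓞 K) → ℂ
  map_mul' : ∀ 𝔞 𝔟 : Ideal (𝓞 K), toFun (𝔞 * 𝔟) = toFun 𝔞 * toFun 𝔟
  eq_zero' : ∀ 𝔞 : Ideal (𝓞 K), ¬ IsCoprime 𝔞 𝔮 → toFun 𝔞 = 0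
  norm_one' : ∀ 𝔞 : Ideal (𝓞 K), IsCoprime 𝔞 𝔮 → ‖toFun 𝔞‖ = 1
  ray_one' : ∀ α : 𝓞 K, TotPos K α → α - 1 ∈ 𝔮 → toFun (Ideal.span {α}) = 1

variable {K : Type*} [Field K] [NumberField K]

/-- The trivial (principal) Hecke character condition. -/
def IsTrivialChar {𝔮 : Ideal (𝓞 K)} (χ : HeckeChar K 𝔮) : Prop :=
  ∀ 𝔞, IsCoprime 𝔞 𝔮 → χ.toFun 𝔞 = 1

open scoped Classical in
/-- `δ(χ)`: the indicator of the trivial character. -/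
def delta {𝔮 : Ideal (𝓞 K)} (χ : HeckeChar K 𝔮) : ℝ :=
  if IsTrivialChar χ then 1 else 0

/-- `χ' (mod 𝔣)` induces `χ (mod 𝔮)`: `𝔣 ∣ 𝔮` and the two characters agree on ideals
coprime to `𝔮`. -/
def Induces {𝔣 𝔮 : Ideal (𝓞 K)} (χ' : HeckeChar K 𝔣) (χ : HeckeChar K 𝔮) : Prop :=
  𝔮 ≤ 𝔣 ∧ ∀ 𝔞, IsCoprime 𝔞 𝔮 → χ.toFun 𝔞 = χ'.toFun 𝔞

/-- `𝔣` is the conductor `𝔣_χ` of `χ`: `χ` is induced from a character mod `𝔣`, and `𝔣`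
divides every modulus from which `χ` is induced. -/
def IsConductor {𝔮 : Ideal (𝓞 K)} (χ : HeckeChar K 𝔮) (𝔣 : Ideal (𝓞 K)) : Prop :=
  (∃ χ' : HeckeChar K 𝔣, Induces χ' χ) ∧
    ∀ 𝔣' : Ideal (𝓞 K), (∃ χ' : HeckeChar K 𝔣', Induces χ' χ) → 𝔣' ≤ 𝔣

/-- A Hecke character is primitive if its conductor equals its modulus. -/
def IsPrimitiveChar {𝔮 : Ideal (𝓞 K)} (χ : HeckeChar K 𝔮) : Prop := IsConductor χ 𝔮

/-- Two integral ideals lie in the same narrow ray class mod `𝔮`: `(α)𝔞 = (β)𝔟` for some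
totally positive `α, β ≡ 1 (mod 𝔮)`. -/
def rayEquiv (𝔮 𝔞 𝔟 : Ideal (𝓞 K)) : Prop :=
  ∃ α β : 𝓞 K, TotPos K α ∧ TotPos K β ∧ α - 1 ∈ 𝔮 ∧ β - 1 ∈ 𝔮 ∧
    Ideal.span {α} * 𝔞 = Ideal.span {β} * 𝔟

/-- A congruence class group `H (mod 𝔮)`: a subgroup of `I(𝔮)` containing `P_𝔮`, described
by the set of integral ideals whose narrow ray class lies in the subgroup. -/
structure CongClassGroup (K : Type*) [Field K] [NumberField K] (𝔮 : Ideal (𝓞 K)) where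
  mem : Ideal (𝓞 K) → Prop
  coprime' : ∀ 𝔞, mem 𝔞 → IsCoprime 𝔞 𝔮
  princ_mem' : ∀ α : 𝓞 K, TotPos K α → α - 1 ∈ 𝔮 → mem (Ideal.span {α})
  mul_mem' : ∀ 𝔞 𝔟, mem 𝔞 → mem 𝔟 → mem (𝔞 * 𝔟)
  class_mem' : ∀ 𝔞 𝔟, IsCoprime 𝔟 𝔮 → rayEquiv 𝔮 𝔞 𝔟 → mem 𝔞 → mem 𝔟

/-- `χ(H) = 1`: the character is trivial on the congruence class group `H`. -/
def CharTrivOn {𝔮 : Ideal (𝓞 K)} (χ : HeckeChar K 𝔮) (H : CongClassGroup K 𝔮) : Prop :=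
  ∀ 𝔞, H.mem 𝔞 → χ.toFun 𝔞 = 1

/-- The coset of `H` in `I(𝔮)` determined by an integral ideal `𝔞₀`. -/
def coset {𝔮 : Ideal (𝓞 K)} (H : CongClassGroup K 𝔮) (𝔞₀ : Ideal (𝓞 K)) :
    Set (Ideal (𝓞 K)) :=
  {𝔞 | ∃ 𝔥, H.mem 𝔥 ∧ rayEquiv 𝔮 (𝔞₀ * 𝔥) 𝔞}

/-- `h_H = [I(𝔮) : H]`, the number of cosets of `H`. -/
def hH {𝔮 : Ideal (𝓞 K)} (H : CongClassGroup K 𝔮) : ℕ :=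
  Nat.card {C : Set (Ideal (𝓞 K)) // ∃ 𝔞₀, IsCoprime 𝔞₀ 𝔮 ∧ C = coset H 𝔞₀}

/-- `Q = Q_H = max { N𝔣_χ : χ (mod 𝔮), χ(H) = 1 }`. -/
def QH {𝔮 : Ideal (𝓞 K)} (H : CongClassGroup K 𝔮) : ℕ :=
  sSup {n | ∃ (χ : HeckeChar K 𝔮) (𝔣 : Ideal (𝓞 K)),
    CharTrivOn χ H ∧ IsConductor χ 𝔣 ∧ n = Ideal.absNorm 𝔣}

/-- `𝔣_H = lcm { 𝔣_χ : χ(H) = 1 }` (the lcm of ideals is their infimum). -/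
def fH {𝔮 : Ideal (𝓞 K)} (H : CongClassGroup K 𝔮) : Ideal (𝓞 K) :=
  sInf {𝔣 | ∃ χ : HeckeChar K 𝔮, CharTrivOn χ H ∧ IsConductor χ 𝔣}

/-- A congruence class group `H (mod 𝔮)` is primitive if `𝔮 = 𝔣_H`. -/
def IsPrimitiveCCG {𝔮 : Ideal (𝓞 K)} (H : CongClassGroup K 𝔮) : Prop := 𝔮 = fH H

/-- The Dirichlet series `Σ_𝔫 χ(𝔫) N𝔫^{-s}` of a Hecke character. -/
def LSer {𝔮 : Ideal (𝓞 K)} (χ : HeckeChar K 𝔮) (s : ℂ) : ℂ :=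
  ∑' 𝔞 : {I : Ideal (𝓞 K) // I ≠ ⊥}, χ.toFun 𝔞.1 * (Ideal.absNorm 𝔞.1 : ℂ) ^ (-s)

/-- `L` is "the" Hecke `L`-function of `χ`: analytic away from `s = 1` and given by the
Dirichlet series on `Re s > 1` (this determines `L` away from `s = 1`). -/
def IsLFun {𝔮 : Ideal (𝓞 K)} (χ : HeckeChar K 𝔮) (L : ℂ → ℂ) : Prop :=
  (∀ s : ℂ, s ≠ 1 → DifferentiableAt ℂ L s) ∧ ∀ s : ℂ, 1 < s.re → L s = LSer χ s

/-- The Dedekind zeta series of `K`. -/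
def zetaSer (K : Type*) [Field K] [NumberField K] (s : ℂ) : ℂ :=
  ∑' 𝔞 : {I : Ideal (𝓞 K) // I ≠ ⊥}, (Ideal.absNorm 𝔞.1 : ℂ) ^ (-s)

/-- `Z` is "the" Dedekind zeta function of `K`. -/
def IsZetaFun (K : Type*) [Field K] [NumberField K] (Z : ℂ → ℂ) : Prop :=
  (∀ s : ℂ, s ≠ 1 → DifferentiableAt ℂ Z s) ∧ ∀ s : ℂ, 1 < s.re → Z s = zetaSer K s

/-- `L` vanishes at `ρ` to order at least `m`. -/
def ZeroOrderAtLeast (L : ℂ → ℂ) (ρ : ℂ) (m : ℕ) : Prop :=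
  ∃ g : ℂ → ℂ, AnalyticAt ℂ g ρ ∧ ∀ᶠ z in nhds ρ, L z = (z - ρ) ^ m * g z

/-- `L` vanishes at `ρ` to order exactly `m`. -/
def ZeroOrderExact (L : ℂ → ℂ) (ρ : ℂ) (m : ℕ) : Prop :=
  ∃ g : ℂ → ℂ, AnalyticAt ℂ g ρ ∧ g ρ ≠ 0 ∧ ∀ᶠ z in nhds ρ, L z = (z - ρ) ^ m * g z

open scoped Classical in
/-- The von Mangoldt function `Λ_K` of the field `K`. -/
def ΛK (K : Type*) [Field K] [NumberField K] (𝔫 : Ideal (𝓞 K)) : ℝ :=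
  if h : ∃ (𝔭 : Ideal (𝓞 K)) (k : ℕ), 𝔭.IsPrime ∧ 𝔭 ≠ ⊥ ∧ 1 ≤ k ∧ 𝔫 = 𝔭 ^ k
  then Real.log (Ideal.absNorm h.choose) else 0

/-- The residue `κ_K` of `ζ_K` at `s = 1`, characterized as a limit of the real Dirichlet
series. -/
def IsResidue (K : Type*) [Field K] [NumberField K] (κ : ℝ) : Prop :=
  Filter.Tendsto (fun σ : ℝ => (σ - 1) *
      ∑' 𝔞 : {I : Ideal (𝓞 K) // I ≠ ⊥}, (Ideal.absNorm 𝔞.1 : ℝ) ^ (-σ))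
    (nhdsWithin 1 (Set.Ioi 1)) (nhds κ)

/-- `γ_K`, the Euler–Kronecker constant: `ζ_K(s) - κ_K/(s-1) → κ_K γ_K` as `s → 1⁺`. -/
def IsEulerKronecker (K : Type*) [Field K] [NumberField K] (κ γK : ℝ) : Prop :=
  Filter.Tendsto (fun σ : ℝ =>
      (∑' 𝔞 : {I : Ideal (𝓞 K) // I ≠ ⊥}, (Ideal.absNorm 𝔞.1 : ℝ) ^ (-σ)) - κ / (σ - 1))
    (nhdsWithin 1 (Set.Ioi 1)) (nhds (κ * γK))

open MeasureTheory mixedEmbedding mixedEmbedding.fundamentalCone InfinitePlace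
open scoped ENNReal NNReal nonZeroDivisors Classical ComplexConjugate Real
open Metric (mem_closedBall closedBall)
open Real (norm_eq_abs exp_pos norm_of_nonneg fourier_eq' pi_gt_three exp_le_exp log_nonneg)
open Finset (mul_sum sum_congr sum_add_distrib mem_filter sum_mul measurable_prod prod_congr
  prod_eq_zero mem_univ prod_ne_zero_iff sum_const card_univ sum_mul_sum sum_comm sum_filter
  sum_image sum_eq_zero sum_sub_distrib sum_le_sum prod_nonneg prod_const induction_on prod_insert
  prod_mul_distrib prod_le_prod' coe_empty coe_insert mem_image mem_biUnion sum_attach not_subset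
  prod_sdiff one_le_prod mem_powerset prod_pos sum_nonneg sdiff_subset mem_union prod_empty
  dvd_prod_of_mem card_map sum_subset filter_subset)
open Function (surjInv uncurry)
open ZSpan (fundamentalDomain fract)
open Fintype (sum_equiv ofFinite card)
open Ideal (absNorm absNorm_eq_zero_iff mul_mem_right span span_singleton_le_iff_mem mem_sup_left
  mem_span_singleton_self mem_sup_right span_singleton_eq_bot isCoprime_iff_sup_eq mul_le_left
  mul_le_right dvd_iff_le span_singleton_mul_span_singleton zero_eq_bot finite_setOfPred_absNorm_le
  absNorm_top)
open FractionalIdeal (coe_dual spanSingleton spanSingleton_le_iff_mem mem_spanSingleton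
  mem_spanSingleton_self coeIdeal_inj coeIdeal_ne_zero mem_coeIdeal coeIdeal_mul coeIdeal_bot
  spanSingleton_eq_zero_iff mem_dual coeIdeal_absNorm absNorm_span_singleton)
open LinearMap (mulLeft funLeft)
open Set (indicator_of_mem indicator_of_notMem mem_ofPred_eq indicator mem_Icc indicator_nonneg)
open Ideal.Quotient (mk_surjective eq_zero_iff_mem mk_out)
open ENNReal (tsum_le_tsum tsum_prod)
open Module (finrank finrank_pos Basis)
open Nat (le_floor cast_mul le_of_dvd cast_nonneg)
open ClassGroup (mk0_surjective mk0 mk0_eq_one_iff)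
open Units (inv_mul)
open Complex (sq_norm)
open UnitAddTorus (mFourier mFourierCoeff mFourierCoeff_eq_integral
  hasSum_mFourier_series_apply_of_summable)
open NumberField.Units (torsion torsionOrder torsionOrder_pos)

local notation "ℐ" => Ideal (𝓞 K)
local notation "ℐ₀" => {𝔫 : Ideal (𝓞 K) // 𝔫 ≠ ⊥}
local notation "ℱ" => FractionalIdeal (𝓞 K)⁰ K
local notation "𝓜" => mixedSpace K
local notation "𝓔" => mixedEmbedding K
local notation "𝒩" => mixedEmbedding.norm
local notation "exp" => Real.exp
local notation "log" => Real.log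
local notation "ofReal" => ENNReal.ofReal

section PoissonPi

variable {ι : Type*} [Fintype ι]

lemma finite_int_translates {s : Set (ι → ℝ)} (hs : Bornology.IsBounded s) {g : (ι → ℝ) → ℂ}
    (hc : HasCompactSupport g) :
    {m : ι → ℤ | ∃ y ∈ s, g (y + fun i => (m i : ℝ)) ≠ 0}.Finite := by
  classical
  obtain ⟨R, hR⟩ := hs.subset_closedBall 0
  obtain ⟨R', hR'⟩ := hc.isCompact.isBounded.subset_closedBall 0
  refine (Set.finite_Icc (fun _ : ι => -⌈R + R'⌉) (fun _ => ⌈R + R'⌉)).subset ?_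
  rintro m ⟨y, hy, hgy⟩
  have h1 := hR hy
  have h2 := hR' (subset_tsupport _ hgy)
  simp only [mem_closedBall, dist_zero_right] at h1 h2
  have h3 : ∀ i, |(m i : ℝ)| ≤ R + R' := fun i => by
    have a1 := (norm_le_pi_norm y i).trans h1
    have a2 := (norm_le_pi_norm _ i).trans h2
    simp only [Pi.add_apply, norm_eq_abs] at a1 a2
    rw [abs_le] at *
    constructor <;> linarith
  constructor
  · intro i
    have := (abs_le.1 (h3 i)).1
    have h4 := Int.le_ceil (R + R')
    have : (-⌈R + R'⌉ : ℝ) ≤ m i := by linarith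
    exact_mod_cast this
  · intro i
    have := (abs_le.1 (h3 i)).2
    have h4 := Int.le_ceil (R + R')
    have : (m i : ℝ) ≤ ⌈R + R'⌉ := by linarith
    exact_mod_cast this

/-- Fourier transform on `ι → ℝ`, evaluated at the integer point `k`. -/
def piFT (g : (ι → ℝ) → ℂ) (k : ι → ℤ) : ℂ :=
  ∫ v, cexp (-(2 * π * I * ∑ i, (k i : ℂ) * (v i : ℂ))) * g v

lemma mFourier_neg_coe (k : ι → ℤ) (x : ι → ℝ) :
    mFourier (-k) (fun i => (x i : UnitAddCircle)) =
      cexp (-(2 * π * I * ∑ i, (k i : ℂ) * (x i : ℂ))) := by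
  simp only [mFourier, ContinuousMap.coe_mk, fourier_coe_apply, ← Complex.exp_sum, Pi.neg_apply]
  congr 1
  rw [mul_sum, ← Finset.sum_neg_distrib]
  refine sum_congr rfl fun i _ => ?_
  push_cast
  ring

lemma integral_eq_tsum_box (f : (ι → ℝ) → ℂ) (hf : Integrable f) :
    ∫ x, f x = ∑' m : ι → ℤ, ∫ x in {x : ι → ℝ | ∀ i, x i ∈ Set.Ioc (0 : ℝ) (0 + 1)},
      f (x + fun i => (m i : ℝ)) := by
  classical
  have hb : MeasurableSet {x : ι → ℝ | ∀ i, x i ∈ Set.Ioc (0 : ℝ) (0 + 1)} :=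
    MeasurableSet.univ_pi' (fun i => measurableSet_Ioc)
  have hmp : ∀ m : ι → ℤ, MeasurePreserving (fun x : ι → ℝ => x + fun i => (m i : ℝ)) :=
    fun m => measurePreserving_add_right _ _
  have hun : (⋃ m : ι → ℤ, (fun x : ι → ℝ => x - fun i => (m i : ℝ)) ⁻¹'
      {x : ι → ℝ | ∀ i, x i ∈ Set.Ioc (0 : ℝ) (0 + 1)}) = Set.univ := by
    refine Set.eq_univ_of_forall fun x => Set.mem_iUnion.2 ⟨fun i => ⌈x i⌉ - 1, fun i => ?_⟩
    have h1 := Int.ceil_lt_add_one (x i)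
    have h2 := Int.le_ceil (x i)
    simp only [Pi.sub_apply, Int.cast_sub, Int.cast_one, Set.mem_Ioc]
    constructor <;> linarith
  rw [← setIntegral_univ, ← hun, integral_iUnion]
  · refine tsum_congr fun m => ?_
    rw [← (hmp m).setIntegral_preimage_emb (measurableEmbedding_addRight _)]
    congr 2
    ext x; simp
  · exact fun m => hb.preimage (by fun_prop)
  · intro m m' hmm
    rw [Function.onFun, Set.disjoint_left]
    intro x hx hx'
    apply hmm
    ext i
    have h1 := hx i
    have h2 := hx' i
    simp only [Pi.sub_apply, Set.mem_Ioc] at h1 h2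
    have a : (m i : ℝ) < m' i + 1 := by linarith
    have b : (m' i : ℝ) < m i + 1 := by linarith
    have a' : m i < m' i + 1 := by exact_mod_cast a
    have b' : m' i < m i + 1 := by exact_mod_cast b
    omega
  · exact hf.integrableOn

theorem poisson_pi (g : (ι → ℝ) → ℂ) (hg : Continuous g) (hc : HasCompactSupport g)
    (hs : Summable (piFT g)) :
    ∑' m : ι → ℤ, g (fun i => (m i : ℝ)) = ∑' k, piFT g k := by
  classical
  let G : (ι → ℝ) → ℂ := fun x => ∑ᶠ m : ι → ℤ, g (x + fun i => (m i : ℝ))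
  have hGc : Continuous G := by
    refine continuous_finsum (fun m => by fun_prop) fun x => ?_
    refine ⟨Metric.ball x 1, Metric.ball_mem_nhds _ one_pos, ?_⟩
    refine (finite_int_translates (Metric.isBounded_ball (x := x) (r := 1)) hc).subset ?_
    rintro m ⟨y, hy, hyb⟩
    exact ⟨y, hyb, hy⟩
  have hfin : ∀ x, (Function.support fun m : ι → ℤ => g (x + fun i => (m i : ℝ))).Finite := by
    intro x
    refine (finite_int_translates (Bornology.isBounded_singleton (x := x)) hc).subset ?_
    exact fun m hm => ⟨x, rfl, hm⟩
  have hGts : ∀ x, G x = ∑' m : ι → ℤ, g (x + fun i => (m i : ℝ)) := fun x =>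
    (tsum_eq_finsum (hfin x)).symm
  have hGper : ∀ x (m : ι → ℤ), G (x + fun i => (m i : ℝ)) = G x := by
    intro x m
    rw [hGts, hGts, ← (Equiv.addLeft m).tsum_eq (fun m : ι → ℤ => g (x + fun i => (m i : ℝ)))]
    refine tsum_congr fun m' => ?_
    congr 1
    ext i
    simp [add_assoc]
  let q : (ι → ℝ) → UnitAddTorus ι := fun x i => (x i : UnitAddCircle)
  have hq : IsOpenQuotientMap q :=
    IsOpenQuotientMap.piMap (f := fun (_ : ι) (x : ℝ) => (x : UnitAddCircle))
      fun _ => QuotientAddGroup.isOpenQuotientMap_mk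
  have hfac : ∃ F : UnitAddTorus ι → ℂ, ∀ x, F (q x) = G x := by
    refine ⟨fun y => G (surjInv hq.surjective y), fun x => ?_⟩
    have h1 := Function.surjInv_eq hq.surjective (q x)
    set x' := surjInv hq.surjective (q x)
    have h2 : ∀ i, ∃ n : ℤ, x' i = x i + n := by
      intro i
      have := congrFun h1 i
      obtain ⟨n, hn⟩ := AddSubgroup.mem_zmultiples_iff.1 (QuotientAddGroup.eq.1 this)
      refine ⟨-n, ?_⟩
      push_cast
      simp only [zsmul_eq_mul, mul_one] at hn
      linarith
    choose n hn using h2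
    have : x' = x + fun i => (n i : ℝ) := by ext i; simp [hn]
    change G x' = G x
    rw [this, hGper]
  obtain ⟨F, hF⟩ := hfac
  have hFc : Continuous F := hq.continuous_comp_iff.1 (by
    have : F ∘ q = G := funext hF
    rw [this]; exact hGc)
  have hint : ∀ k : ι → ℤ, Integrable (fun v : ι → ℝ =>
      cexp (-(2 * π * I * ∑ i, (k i : ℂ) * (v i : ℂ))) * g v) := fun k =>
    Continuous.integrable_of_hasCompactSupport (by fun_prop) hc.mul_left
  have hcoef : ∀ k, mFourierCoeff F k = piFT g k := by
    intro k
    rw [mFourierCoeff_eq_integral F k 0, piFT, integral_eq_tsum_box _ (hint k)]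
    have hbd : Bornology.IsBounded {x : ι → ℝ | ∀ i, x i ∈ Set.Ioc (0 : ℝ) (0 + 1)} := by
      refine (Metric.isBounded_Icc (0 : ι → ℝ) 1).subset fun x hx => ?_
      refine ⟨fun i => (hx i).1.le, fun i => ?_⟩
      have := (hx i).2
      simpa using this
    have hff := finite_int_translates hbd hc
    have hbm : MeasurableSet {x : ι → ℝ | ∀ i, x i ∈ Set.Ioc (0 : ℝ) (0 + 1)} :=
      MeasurableSet.univ_pi' (fun i => measurableSet_Ioc)
    rw [tsum_eq_sum (s := hff.toFinset), ← integral_finsetSum]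
    · refine setIntegral_congr_fun hbm fun x hx => ?_
      simp only [smul_eq_mul]
      rw [mFourier_neg_coe]
      have : F (fun i => (x i : UnitAddCircle)) = G x := hF x
      rw [this, hGts, tsum_eq_sum (s := hff.toFinset), mul_sum]
      · refine sum_congr rfl fun m _ => ?_
        congr 1
        rw [exp_eq_exp_iff_exists_int]
        refine ⟨∑ i, k i * m i, ?_⟩
        simp only [Pi.add_apply]
        push_cast
        simp only [mul_add, sum_add_distrib]
        ring
      · intro m hm
        by_contra h
        exact hm (hff.mem_toFinset.2 ⟨x, hx, h⟩)
    · intro m _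
      exact ((hint k).comp_add_right (fun i => (m i : ℝ))).integrableOn
    · intro m hm
      refine setIntegral_eq_zero_of_forall_eq_zero fun x hx => ?_
      have : g (x + fun i => (m i : ℝ)) = 0 := by
        by_contra h
        exact hm (hff.mem_toFinset.2 ⟨x, hx, h⟩)
      rw [this, mul_zero]
  have hs' : Summable (mFourierCoeff (⟨F, hFc⟩ : C(UnitAddTorus ι, ℂ))) := by
    have : mFourierCoeff F = piFT g := funext hcoef
    simpa [this] using hs
  have := (hasSum_mFourier_series_apply_of_summable hs' (q 0)).tsum_eq
  have h0 : ∀ k : ι → ℤ, mFourier k (q 0) = 1 := by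
    intro k
    simp [mFourier, q]
  simp only [h0, smul_eq_mul, mul_one, ContinuousMap.coe_mk, hF, hGts, zero_add, hcoef] at this
  exact this.symm

end PoissonPi

section PoissonBasis

variable {ι : Type*} [Fintype ι] {V : Type*} [NormedAddCommGroup V] [NormedSpace ℝ V]
  [FiniteDimensional ℝ V] [MeasurableSpace V] [BorelSpace V]

lemma integral_basis_coords (μ : Measure V) [μ.IsAddHaarMeasure] (b : Basis ι ℝ V) (f : V → ℂ) :
    ∫ v, f v ∂μ = (μ (fundamentalDomain b)).toReal • ∫ x : ι → ℝ, f (∑ i, x i • b i) := by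
  let e : (ι → ℝ) ≃L[ℝ] V := b.equivFun.symm.toContinuousLinearEquiv
  have he : ∀ x, e x = ∑ i, x i • b i := fun x => by simp [e, Basis.equivFun_symm_apply]
  have her : ∀ x i, b.repr (e x) i = x i := fun x i =>
    congrFun (b.equivFun.apply_symm_apply x) i
  let ν : Measure V := Measure.map e volume
  have : ν.IsAddHaarMeasure := ContinuousLinearEquiv.isAddHaarMeasure_map e volume
  have h1 : ∫ v, f v ∂ν = ∫ x : ι → ℝ, f (∑ i, x i • b i) := by
    rw [show ν = Measure.map e.toHomeomorph.toMeasurableEquiv volume from rfl,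
      integral_map_equiv]
    exact integral_congr_ae (.of_forall fun x => by simp only [← he]; rfl)
  have h2 : μ = Measure.addHaarScalarFactor μ ν • ν := Measure.isAddLeftInvariant_eq_smul μ ν
  have h3 : ν (fundamentalDomain b) = 1 := by
    have hpre : e ⁻¹' (fundamentalDomain b) = fundamentalDomain (Pi.basisFun ℝ ι) := by
      ext x
      simp [ZSpan.mem_fundamentalDomain, her]
    rw [Measure.map_apply e.continuous.measurable (ZSpan.fundamentalDomain_measurableSet b), hpre,
      ZSpan.fundamentalDomain_pi_basisFun, Real.volume_pi_Ico]
    simp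
  have h4 : (μ (fundamentalDomain b)).toReal = Measure.addHaarScalarFactor μ ν := by
    conv_lhs => rw [h2]
    simp [h3]
  rw [← h1, h4]
  conv_lhs => rw [h2]
  rw [integral_smul_nnreal_measure]
  rfl

theorem poisson_basis (μ : Measure V) [μ.IsAddHaarMeasure] (b : Basis ι ℝ V) (g : V → ℂ)
    (hg : Continuous g) (hc : HasCompactSupport g)
    (hs : Summable fun k : ι → ℤ => ∫ v, cexp (-(2 * π * I *
      ∑ i, (k i : ℂ) * (b.repr v i : ℂ))) * g v ∂μ) :
    ((μ (fundamentalDomain b)).toReal : ℂ) * ∑' m : ι → ℤ, g (∑ i, m i • b i) =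
      ∑' k : ι → ℤ, ∫ v, cexp (-(2 * π * I *
        ∑ i, (k i : ℂ) * (b.repr v i : ℂ))) * g v ∂μ := by
  let e : (ι → ℝ) ≃L[ℝ] V := b.equivFun.symm.toContinuousLinearEquiv
  have he : ∀ x, e x = ∑ i, x i • b i := fun x => by simp [e, Basis.equivFun_symm_apply]
  have her : ∀ x i, b.repr (e x) i = x i := fun x i =>
    congrFun (b.equivFun.apply_symm_apply x) i
  have hne : (μ (fundamentalDomain b)).toReal ≠ 0 :=
    ENNReal.toReal_ne_zero.2 ⟨ZSpan.measure_fundamentalDomain_ne_zero b,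
      (ZSpan.fundamentalDomain_isBounded b).measure_lt_top.ne⟩
  have key : ∀ k : ι → ℤ, ∫ v, cexp (-(2 * π * I *
      ∑ i, (k i : ℂ) * (b.repr v i : ℂ))) * g v ∂μ =
      (μ (fundamentalDomain b)).toReal * piFT (g ∘ e) k := by
    intro k
    rw [integral_basis_coords μ b, piFT, real_smul]
    congr 2
    ext x
    simp only [← he, Function.comp]
    congr 7
    ext i
    rw [her]
  simp_rw [key] at hs ⊢
  have hne' : ((μ (fundamentalDomain b)).toReal : ℂ) ≠ 0 := by exact_mod_cast hne
  rw [summable_mul_left_iff hne'] at hs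
  rw [tsum_mul_left, ← poisson_pi (g ∘ e) (hg.comp e.continuous)
    (hc.comp_homeomorph e.toHomeomorph) hs]
  congr 1
  refine tsum_congr fun m => ?_
  simp [he, Int.cast_smul_eq_zsmul]

end PoissonBasis

section Trace

/-- The trace form on the mixed space. -/
def trV (K : Type*) [Field K] [NumberField K] : mixedSpace K →ₗ[ℝ] ℝ where
  toFun v := ∑ w, v.1 w + 2 * ∑ w, (v.2 w).re
  map_add' x y := by
    simp only [Prod.fst_add, Prod.snd_add, Pi.add_apply, add_re, sum_add_distrib]
    ring
  map_smul' c x := by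
    simp only [Prod.smul_fst, Prod.smul_snd, Pi.smul_apply, smul_eq_mul, real_smul,
      mul_re, ofReal_re, ofReal_im, zero_mul, sub_zero, RingHom.id_apply,
      ← mul_sum]
    ring

lemma trV_apply (v : 𝓜) : trV K v = ∑ w, v.1 w + 2 * ∑ w, (v.2 w).re := rfl

lemma trV_mixedEmbedding (x : K) : trV K (𝓔 x) = Algebra.trace ℚ K x := by
  classical
  have h0 : ((Algebra.trace ℚ K x : ℝ) : ℂ) = ∑ φ : K →+* ℂ, φ x := by
    have := trace_eq_sum_embeddings (K := ℚ) (L := K) ℂ (x := x)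
    rw [eq_ratCast] at this
    rw [ofReal_ratCast, this]
    exact sum_equiv (RingHom.equivRatAlgHom K ℂ).symm _ _ fun σ => rfl
  have h1 : (Algebra.trace ℚ K x : ℝ) = ∑ φ : K →+* ℂ, (φ x).re := by
    rw [← ofReal_re (Algebra.trace ℚ K x : ℝ), h0, re_sum]
  rw [h1, ← Finset.sum_fiberwise Finset.univ InfinitePlace.mk (fun φ => (φ x).re)]
  have h2 : ∀ w : InfinitePlace K, ∑ φ with InfinitePlace.mk φ = w, (φ x).re =
      w.mult * (w.embedding x).re := by
    intro w
    rw [← card_filter_mk_eq w, ← nsmul_eq_mul]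
    refine Finset.sum_eq_card_nsmul fun φ hφ => ?_
    rw [mem_filter, ← mk_embedding w, mk_eq_iff] at hφ
    rcases hφ.2 with h | h
    · rw [h]
    · rw [← h]; simp [ComplexEmbedding.conjugate]
  simp_rw [h2]
  rw [trV_apply]
  rw [← Fintype.sum_subtype_add_sum_subtype (fun w : InfinitePlace K => w.IsReal)]
  congr 1
  · refine sum_congr rfl fun w _ => ?_
    rw [mixedEmbedding_apply_isReal, mult_isReal, ← embedding_of_isReal_apply w.2]
    rw [Nat.cast_one, one_mul, ofReal_re]
  · rw [mul_sum]
    refine sum_equiv (Equiv.subtypeEquivRight fun w => not_isReal_iff_isComplex.symm) _ _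
      fun w => ?_
    have : ((Equiv.subtypeEquivRight fun w => not_isReal_iff_isComplex.symm) w).1.mult = 2 :=
      mult_isComplex _
    rw [mixedEmbedding_apply_isComplex, this]
    simp

end Trace

/-- Fourier transform on the mixed space, with respect to the trace form. -/
def FT (g : 𝓜 → ℂ) (ξ : 𝓜) : ℂ :=
  ∫ v, cexp (-(2 * π * I * (trV K (ξ * v) : ℂ))) * g v

/-- The covolume of the ring of integers. -/
def cov (K : Type*) [Field K] [NumberField K] : ℝ :=
  (volume (fundamentalDomain (latticeBasis K))).toReal

/-- Integer combinations of a basis, as the elements of the span. -/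
def intCombEquiv {ι : Type*} [Fintype ι] (b : Basis ι ℚ K) (S : Set K)
    (hS : ∀ x, x ∈ S ↔ x ∈ Submodule.span ℤ (Set.range b)) : (ι → ℤ) ≃ S :=
  (b.restrictScalars ℤ).equivFun.symm.toEquiv.trans
    (Equiv.subtypeEquivRight fun x => (hS x).symm)

lemma intCombEquiv_apply {ι : Type*} [Fintype ι] (b : Basis ι ℚ K) (S : Set K)
    (hS : ∀ x, x ∈ S ↔ x ∈ Submodule.span ℤ (Set.range b)) (m : ι → ℤ) :
    ((intCombEquiv b S hS m : S) : K) = ∑ i, m i • b i := by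
  simp [intCombEquiv, Basis.equivFun_symm_apply]

theorem poisson_ideal (J : ℱˣ) (g : 𝓜 → ℂ)
    (hg : Continuous g) (hc : HasCompactSupport g)
    (hs : Summable fun β : {β : K // β ∈ FractionalIdeal.dual ℤ ℚ J.1} =>
      FT g (𝓔 β)) :
    ((cov K * FractionalIdeal.absNorm J.1 : ℝ) : ℂ) *
      ∑' α : {α : K // α ∈ J.1}, g (𝓔 α) =
    ∑' β : {β : K // β ∈ FractionalIdeal.dual ℤ ℚ J.1}, FT g (𝓔 β) := by
  let b := basisOfFractionalIdeal K J
  let e₁ := intCombEquiv b {α : K | α ∈ J.1} fun x => (mem_span_basisOfFractionalIdeal K).symm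
  have hdual : ∀ x, x ∈ {β : K | β ∈ FractionalIdeal.dual ℤ ℚ J.1} ↔
      x ∈ Submodule.span ℤ (Set.range b.traceDual) := by
    intro x
    rw [← Submodule.traceDual_span_of_basis (B := 𝓞 K) ℤ (J.1 : Submodule (𝓞 K) K) b,
      ← coe_dual ℤ ℚ J.ne_zero]
    · rfl
    · ext x
      exact (mem_span_basisOfFractionalIdeal K).symm
  let e₂ := intCombEquiv b.traceDual {β : K | β ∈ FractionalIdeal.dual ℤ ℚ J.1} hdual
  have hpair : ∀ (k : _ → ℤ) (v : 𝓜), trV K (𝓔 (e₂ k).1 * v) =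
      ∑ i, (k i : ℝ) * (fractionalIdealLatticeBasis K J).repr v i := by
    intro k v
    let l₁ : 𝓜 →ₗ[ℝ] ℝ := trV K ∘ₗ mulLeft ℝ (𝓔 (e₂ k).1)
    let l₂ : 𝓜 →ₗ[ℝ] ℝ := ∑ i, (k i : ℝ) • (fractionalIdealLatticeBasis K J).coord i
    have : l₁ = l₂ := by
      refine (fractionalIdealLatticeBasis K J).ext fun j => ?_
      have h2 : l₂ (fractionalIdealLatticeBasis K J j) = k j := by
        simp only [l₂, LinearMap.sum_apply, LinearMap.smul_apply, Basis.coord_apply, Basis.repr_self]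
        simp [Finsupp.single_apply]
      rw [h2]
      change trV K (𝓔 (e₂ k).1 * fractionalIdealLatticeBasis K J j) = k j
      rw [fractionalIdealLatticeBasis_apply]
      rw [← map_mul, trV_mixedEmbedding, intCombEquiv_apply, sum_mul, map_sum]
      simp_rw [smul_mul_assoc, map_zsmul]
      have h3 : ∀ i, Algebra.trace ℚ K (b.traceDual i * basisOfFractionalIdeal K J j) =
          if j = i then 1 else 0 := fun i => Basis.trace_traceDual_mul b i j
      simp [h3]
    have h := LinearMap.congr_fun this v
    simpa [l₁, l₂] using h
  have hFT : ∀ k : _ → ℤ, FT g (𝓔 (e₂ k).1) = ∫ v, cexp (-(2 * π * I *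
      ∑ i, (k i : ℂ) * ((fractionalIdealLatticeBasis K J).repr v i : ℂ))) * g v := by
    intro k
    simp_rw [FT, hpair]
    push_cast
    rfl
  have hvol : cov K * FractionalIdeal.absNorm J.1 =
      (volume (fundamentalDomain (fractionalIdealLatticeBasis K J))).toReal := by
    rw [volume_fundamentalDomain_fractionalIdealLatticeBasis, ENNReal.toReal_mul, cov,
      ENNReal.toReal_ofReal (by exact_mod_cast FractionalIdeal.absNorm_nonneg _), mul_comm]
  have hP := poisson_basis volume (fractionalIdealLatticeBasis K J) g hg hc (by
    simp_rw [← hFT]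
    exact e₂.summable_iff.2 hs)
  rw [hvol]
  simp_rw [← hFT] at hP
  have t₁ := e₁.tsum_eq (fun α : {α : K | α ∈ J.1} => g (𝓔 α))
  have t₂ := e₂.tsum_eq (fun β : {β : K | β ∈ FractionalIdeal.dual ℤ ℚ J.1} =>
    FT g (𝓔 β))
  refine Eq.trans ?_ (hP.trans t₂)
  congr 1
  refine t₁.symm.trans (tsum_congr fun m => ?_)
  simp only [e₁, intCombEquiv_apply, map_sum, map_zsmul, fractionalIdealLatticeBasis_apply]
  rfl

section ProductMeasures

lemma lintegral_fin_prod {n : ℕ} {E : Type*} [MeasurableSpace E] (μ : Fin n → Measure E)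
    [∀ i, SigmaFinite (μ i)] (f : Fin n → E → ℝ≥0∞) (hf : ∀ i, Measurable (f i)) :
    ∫⁻ x, ∏ i, f i (x i) ∂(Measure.pi μ) = ∏ i, ∫⁻ x, f i x ∂(μ i) := by
  induction n with
  | zero => simp
  | succ n ih =>
    rw [← ((measurePreserving_piFinSuccAbove μ 0).symm).lintegral_comp_emb
      (MeasurableEquiv.measurableEmbedding _)]
    simp_rw [MeasurableEquiv.piFinSuccAbove_symm_apply, Fin.insertNthEquiv,
      Fin.prod_univ_succ, Fin.insertNth_zero, Equiv.coe_fn_mk, Fin.cons_succ,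
      Fin.zero_succAbove, Fin.cons_zero]
    rw [← ih (fun i => μ i.succ) (fun i => f i.succ) fun i => hf _]
    exact lintegral_prod_mul (hf 0).aemeasurable
      (measurable_prod _ fun (i : Fin n) _ => (hf i.succ).comp
        (measurable_pi_apply (X := fun _ : Fin n => E) i)).aemeasurable

lemma lintegral_pi_prod {ι : Type*} [Fintype ι] {E : Type*} [MeasurableSpace E]
    (μ : ι → Measure E) [∀ i, SigmaFinite (μ i)] (f : ι → E → ℝ≥0∞) (hf : ∀ i, Measurable (f i)) :
    ∫⁻ x, ∏ i, f i (x i) ∂(Measure.pi μ) = ∏ i, ∫⁻ x, f i x ∂(μ i) := by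
  let e := (Fintype.equivFin ι).symm
  rw [← (measurePreserving_piCongrLeft μ e).lintegral_comp_emb
    (MeasurableEquiv.measurableEmbedding _)]
  simp_rw [← e.prod_comp, MeasurableEquiv.coe_piCongrLeft, Equiv.piCongrLeft_apply_apply]
  exact lintegral_fin_prod (fun i => μ (e i)) (fun i => f (e i)) fun i => hf _

lemma pi_withDensity {ι : Type*} [Fintype ι] {E : Type*} [MeasurableSpace E]
    (μ : Measure E) [SigmaFinite μ] (f : E → ℝ≥0∞) (hf : Measurable f)
    [SigmaFinite (μ.withDensity f)] :
    Measure.pi (fun _ : ι => μ.withDensity f) =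
      (Measure.pi fun _ : ι => μ).withDensity fun x => ∏ i, f (x i) := by
  refine Measure.pi_eq (μ := fun _ : ι => μ.withDensity f) fun s hs => ?_
  rw [withDensity_apply _ (MeasurableSet.univ_pi hs), ← lintegral_indicator (MeasurableSet.univ_pi hs)]
  have : ∀ x : ι → E, (Set.univ.pi s).indicator (fun x => ∏ i, f (x i)) x =
      ∏ i, (s i).indicator f (x i) := by
    intro x
    by_cases hx : x ∈ Set.univ.pi s
    · rw [indicator_of_mem hx]
      exact prod_congr rfl fun i _ => (indicator_of_mem (hx i trivial) _).symm
    · rw [indicator_of_notMem hx]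
      simp only [Set.mem_pi, not_forall] at hx
      obtain ⟨i, -, hi⟩ := hx
      exact (prod_eq_zero (mem_univ i) (indicator_of_notMem hi _)).symm
  simp_rw [this]
  rw [lintegral_pi_prod (fun _ => μ) (fun i => (s i).indicator f) fun i => hf.indicator (hs i)]
  exact prod_congr rfl fun i _ => by
    rw [lintegral_indicator (hs i), withDensity_apply _ (hs i)]

/-- Change of variables for a measure with density `ω⁻¹`. -/
lemma measurePreserving_of_det {E : Type*} [NormedAddCommGroup E] [NormedSpace ℝ E]
    [FiniteDimensional ℝ E] [MeasurableSpace E] [BorelSpace E] (μ : Measure E) [μ.IsAddHaarMeasure]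
    (ω : E → ℝ≥0∞) (s : Set E) (hs : MeasurableSet s) (hsμ : μ sᶜ = 0)
    (f : E → E) (hf : Measurable f) (f' : E → E →L[ℝ] E) (hb : Set.BijOn f s s)
    (hd : ∀ x ∈ s, HasFDerivAt f (f' x) x)
    (hdet : ∀ x ∈ s, ofReal |(f' x).det| * ω (f x) = ω x) :
    MeasurePreserving f (μ.withDensity ω) (μ.withDensity ω) := by
  have key : ∀ g : E → ℝ≥0∞, ∫⁻ x, g x ∂μ = ∫⁻ x in s, g x ∂μ := by
    intro g
    rw [← lintegral_add_compl g hs, setLIntegral_measure_zero _ _ hsμ, add_zero]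
  refine ⟨hf, Measure.ext fun A hA => ?_⟩
  rw [Measure.map_apply hf hA, withDensity_apply _ (hf hA), withDensity_apply _ hA,
    ← lintegral_indicator (hf hA), ← lintegral_indicator hA, key, key (A.indicator _)]
  conv_rhs => rw [← hb.image_eq]
  rw [lintegral_image_eq_lintegral_abs_det_fderiv_mul μ hs
    (fun x hx => (hd x hx).hasFDerivWithinAt) hb.injOn]
  refine setLIntegral_congr_fun hs fun x hx => ?_
  by_cases h : f x ∈ A
  · rw [indicator_of_mem h, indicator_of_mem (by exact h)]
    exact (hdet x hx).symm
  · rw [indicator_of_notMem h, indicator_of_notMem (by exact h), mul_zero]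

/-- The multiplicative Haar measure on `ℝ` or `ℂ`. -/
def mulHaar1 (𝕜 : Type*) [RCLike 𝕜] [MeasureSpace 𝕜] (d : ℕ) : Measure 𝕜 :=
  (volume : Measure 𝕜).withDensity fun x => ofReal ((‖x‖ ^ d)⁻¹)

instance (𝕜 : Type*) [RCLike 𝕜] [MeasureSpace 𝕜] [BorelSpace 𝕜]
    [SigmaFinite (volume : Measure 𝕜)] (d : ℕ) : SigmaFinite (mulHaar1 𝕜 d) :=
  SigmaFinite.withDensity_ofReal _

section

variable (𝕜 : Type*) [RCLike 𝕜] [MeasureSpace 𝕜] [BorelSpace 𝕜]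
    [(volume : Measure 𝕜).IsAddHaarMeasure] (d : ℕ)

lemma measurePreserving_mul1 (hdet : ∀ a : 𝕜, |(mulLeft ℝ a).det| = ‖a‖ ^ d)
    (a : 𝕜) (ha : a ≠ 0) :
    MeasurePreserving (fun x => a * x) (mulHaar1 𝕜 d) (mulHaar1 𝕜 d) := by
  refine measurePreserving_of_det volume _ {0}ᶜ (measurableSet_singleton _).compl
    (by simp) _ (by fun_prop) (fun x => (ContinuousLinearMap.mul ℝ 𝕜 a)) ?_ ?_ ?_
  · refine ⟨fun x hx => by simpa [ha] using hx, mul_right_injective₀ ha |>.injOn, fun y hy => ?_⟩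
    exact ⟨a⁻¹ * y, by simpa [ha] using hy, by simp [ha]⟩
  · intro x _
    exact (ContinuousLinearMap.mul ℝ 𝕜 a).hasFDerivAt
  · intro x hx
    have : (ContinuousLinearMap.mul ℝ 𝕜 a).det = (mulLeft ℝ a).det := rfl
    rw [this, hdet, ← ENNReal.ofReal_mul (by positivity), norm_mul, mul_pow, mul_inv,
      mul_inv_cancel_left₀ (by simpa using fun h => absurd h ha)]

lemma measurePreserving_inv1 (hdet : ∀ a : 𝕜, |(mulLeft ℝ a).det| = ‖a‖ ^ d) :
    MeasurePreserving (fun x => x⁻¹) (mulHaar1 𝕜 d) (mulHaar1 𝕜 d) := by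
  refine measurePreserving_of_det volume _ {0}ᶜ (measurableSet_singleton _).compl
    (by simp) _ (by fun_prop) (fun x => (ContinuousLinearMap.mul ℝ 𝕜 (-(x ^ 2)⁻¹))) ?_ ?_ ?_
  · refine ⟨fun x hx => by simpa using hx, inv_injective.injOn, fun y hy => ?_⟩
    exact ⟨y⁻¹, by simpa using hy, by simp⟩
  · intro x hx
    have h := (hasDerivAt_inv (𝕜 := 𝕜) hx).hasFDerivAt.restrictScalars ℝ
    convert h using 1
    ext
    simp [mul_comm]
  · intro x hx
    have h1 : (ContinuousLinearMap.mul ℝ 𝕜 (-(x ^ 2)⁻¹)).det =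
      (mulLeft ℝ (-(x ^ 2)⁻¹)).det := rfl
    have h2 : (‖x‖ : ℝ) ≠ 0 := by simpa using hx
    rw [h1, hdet, ← ENNReal.ofReal_mul (by positivity)]
    congr 1
    simp only [norm_neg, norm_inv, norm_pow]
    rw [← inv_pow, ← inv_pow, inv_inv, ← mul_pow, ← inv_pow]
    congr 1
    field_simp

end

lemma det_mulLeft_real (a : ℝ) : |(mulLeft ℝ a).det| = ‖a‖ ^ 1 := by
  have : mulLeft ℝ a = a • LinearMap.id := by ext; simp
  simp [this]

lemma det_mulLeft_complex (a : ℂ) : |(mulLeft ℝ a).det| = ‖a‖ ^ 2 := by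
  have h := Algebra.norm_complex_apply a
  rw [Algebra.norm_apply] at h
  have h2 : (mulLeft ℝ a) = Algebra.lmul ℝ ℂ a := rfl
  rw [h2]
  change |LinearMap.det (Algebra.lmul ℝ ℂ a)| = _
  rw [h, normSq_eq_norm_sq, abs_of_nonneg (by positivity)]

end ProductMeasures

section MulHaar

lemma norm_eq_prod (v : 𝓜) :
    𝒩 v = (∏ w, ‖v.1 w‖ ^ 1) * ∏ w, ‖v.2 w‖ ^ 2 := by
  rw [mixedEmbedding.norm_apply, ← Fintype.prod_subtype_mul_prod_subtype
    (fun w : InfinitePlace K => w.IsReal)]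
  congr 1
  · refine prod_congr rfl fun w _ => ?_
    rw [normAtPlace_apply_of_isReal w.2, mult_isReal]
  · refine Fintype.prod_equiv (Equiv.subtypeEquivRight fun w => not_isReal_iff_isComplex) _ _
      fun w => ?_
    have hw : w.1.IsComplex := not_isReal_iff_isComplex.1 w.2
    rw [normAtPlace_apply_of_isComplex hw, mult, if_neg w.2]
    rfl

lemma norm_inv_mixed (v : 𝓜) :
    𝒩 (v⁻¹) = (𝒩 v)⁻¹ := by
  simp [norm_eq_prod, mul_comm]

/-- The multiplicative Haar measure on the mixed space. -/
def mulHaar (K : Type*) [Field K] [NumberField K] : Measure (mixedSpace K) :=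
  (volume : Measure (mixedSpace K)).withDensity
    fun v => ofReal (mixedEmbedding.norm v)⁻¹

lemma mulHaar_eq_prod : mulHaar K =
    (Measure.pi fun _ : {w : InfinitePlace K // IsReal w} => mulHaar1 ℝ 1).prod
      (Measure.pi fun _ : {w : InfinitePlace K // IsComplex w} => mulHaar1 ℂ 2) := by
  have i1 : SigmaFinite (volume.withDensity fun x : ℝ => ofReal ((‖x‖ ^ 1)⁻¹)) :=
    SigmaFinite.withDensity_ofReal _
  have i2 : SigmaFinite (volume.withDensity fun x : ℂ => ofReal ((‖x‖ ^ 2)⁻¹)) :=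
    SigmaFinite.withDensity_ofReal _
  simp only [mulHaar1]
  rw [pi_withDensity _ _ (by fun_prop), pi_withDensity _ _ (by fun_prop),
    prod_withDensity (measurable_prod _ fun i _ => by fun_prop)
      (measurable_prod _ fun i _ => by fun_prop)]
  simp only [mulHaar]
  congr 1
  ext v
  rw [norm_eq_prod, mul_inv, ENNReal.ofReal_mul (by positivity), ← Finset.prod_inv_distrib,
    ← Finset.prod_inv_distrib, ENNReal.ofReal_prod_of_nonneg (fun _ _ => by positivity),
    ENNReal.ofReal_prod_of_nonneg (fun _ _ => by positivity)]

lemma measurePreserving_mul_mixed (s : 𝓜) (hs : 𝒩 s ≠ 0) :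
    MeasurePreserving (fun v => s * v) (mulHaar K) (mulHaar K) := by
  rw [norm_eq_prod, mul_ne_zero_iff, prod_ne_zero_iff, prod_ne_zero_iff] at hs
  rw [mulHaar_eq_prod]
  exact (measurePreserving_pi _ _ fun w => measurePreserving_mul1 ℝ 1 det_mulLeft_real (s.1 w)
      (by simpa using hs.1 w)).prod (measurePreserving_pi _ _ fun w =>
        measurePreserving_mul1 ℂ 2 det_mulLeft_complex (s.2 w) (by simpa using hs.2 w))

lemma measurePreserving_inv_mixed :
    MeasurePreserving (fun v => v⁻¹) (mulHaar K) (mulHaar K) := by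
  rw [mulHaar_eq_prod]
  exact (measurePreserving_pi _ _ fun w => measurePreserving_inv1 ℝ 1 det_mulLeft_real).prod
    (measurePreserving_pi _ _ fun w => measurePreserving_inv1 ℂ 2 det_mulLeft_complex)

end MulHaar

lemma countable_field (K : Type*) [Field K] [NumberField K] : Countable K :=
  (Module.finBasis ℚ K).equivFun.toEquiv.injective.countable

instance countable_units : Countable (𝓞 K)ˣ := by
  have := countable_field K
  have h : Function.Injective fun u : (𝓞 K)ˣ => ((u : 𝓞 K) : K) := fun u v h =>
    Units.ext (RingOfIntegers.coe_injective h)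
  exact h.countable

lemma measurable_norm_mixed : Measurable (𝒩 : 𝓜 → ℝ) :=
  (mixedEmbedding.continuous_norm K).measurable

lemma measurePreserving_unit_smul (u : (𝓞 K)ˣ) :
    MeasurePreserving (fun v => u • v) (mulHaar K) (mulHaar K) := by
  simp_rw [unitSMul_smul]
  refine measurePreserving_mul_mixed _ ?_
  rw [norm_unit]
  exact one_ne_zero

lemma ae_norm_ne_zero : ∀ᵐ v ∂(mulHaar K), 𝒩 v ≠ 0 := by
  have hm : MeasurableSet {v : 𝓜 | 𝒩 v = 0} :=
    measurable_norm_mixed (measurableSet_singleton 0)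
  rw [ae_iff]
  simp only [not_not]
  rw [mulHaar, withDensity_apply _ hm, setLIntegral_congr_fun hm (g := fun _ => 0)]
  · simp
  · intro v hv
    rw [mem_ofPred_eq] at hv
    simp [hv]

lemma tsum_indicator_unit_smul {x : 𝓜} (hx : 𝒩 x ≠ 0) :
    ∑' u : (𝓞 K)ˣ, (fundamentalCone K).indicator (fun _ => (1 : ℝ≥0∞)) (u • x) =
      torsionOrder K := by
  obtain ⟨u₀, hu₀⟩ := fundamentalCone.exists_unit_smul_mem hx
  rw [← (Equiv.mulRight u₀).tsum_eq]
  have : ∀ u : (𝓞 K)ˣ, (fundamentalCone K).indicator (fun _ => (1 : ℝ≥0∞))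
      ((Equiv.mulRight u₀ u) • x) = (torsion K : Set (𝓞 K)ˣ).indicator (fun _ => 1) u := by
    intro u
    rw [Equiv.coe_mulRight, mul_smul]
    simp only [indicator, fundamentalCone.unit_smul_mem_iff_mem_torsion hu₀, SetLike.mem_coe]
  simp_rw [this]
  have : Finite (torsion K : Set (𝓞 K)ˣ) := inferInstanceAs (Finite (torsion K))
  have := ofFinite (torsion K : Set (𝓞 K)ˣ)
  rw [← tsum_subtype, tsum_fintype, sum_const, card_univ, nsmul_eq_mul, mul_one,
    torsionOrder, ← Nat.card_eq_fintype_card]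
  rfl

lemma tsum_indicator_inv_smul {x : 𝓜} (hx : 𝒩 x ≠ 0) :
    ∑' u : (𝓞 K)ˣ, (fundamentalCone K).indicator (fun _ => (1 : ℝ≥0∞)) (u⁻¹ • x) =
      torsionOrder K := by
  rw [← tsum_indicator_unit_smul hx, ← (Equiv.inv (𝓞 K)ˣ).tsum_eq]
  simp

lemma measurable_unit_smul (u : (𝓞 K)ˣ) : Measurable fun v : 𝓜 => u • v :=
  (measurePreserving_unit_smul u).measurable

lemma lintegral_unit_smul_cone (F : 𝓜 → ℝ≥0∞) (hF : Measurable F) (u : (𝓞 K)ˣ) :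
    ∫⁻ s in fundamentalCone K, F (u • s) ∂(mulHaar K) =
      ∫⁻ s, (fundamentalCone K).indicator (fun _ => (1 : ℝ≥0∞)) (u⁻¹ • s) * F s ∂(mulHaar K) := by
  have hC := measurableSet_fundamentalCone K
  have hm : Measurable fun s : 𝓜 =>
      (fundamentalCone K).indicator (fun _ => (1 : ℝ≥0∞)) (u⁻¹ • s) * F s :=
    ((measurable_const.indicator hC).comp (measurable_unit_smul _)).mul hF
  rw [← lintegral_indicator hC]
  refine Eq.trans (lintegral_congr fun s => ?_)
    ((measurePreserving_unit_smul u).lintegral_comp hm)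
  rw [inv_smul_smul]
  by_cases h : s ∈ fundamentalCone K
  · rw [indicator_of_mem h, indicator_of_mem h, one_mul]
  · rw [indicator_of_notMem h, indicator_of_notMem h, zero_mul]

theorem unfold_lintegral (F : 𝓜 → ℝ≥0∞) (hF : Measurable F) :
    ∑' u : (𝓞 K)ˣ, ∫⁻ s in fundamentalCone K, F (u • s) ∂(mulHaar K) =
      torsionOrder K * ∫⁻ s, F s ∂(mulHaar K) := by
  have hC := measurableSet_fundamentalCone K
  simp_rw [lintegral_unit_smul_cone F hF]
  have hm : ∀ u : (𝓞 K)ˣ, Measurable fun s : 𝓜 =>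
      (fundamentalCone K).indicator (fun _ => (1 : ℝ≥0∞)) (u⁻¹ • s) * F s := fun u =>
    ((measurable_const.indicator hC).comp (measurable_unit_smul _)).mul hF
  rw [← lintegral_tsum fun u => (hm u).aemeasurable, ← lintegral_const_mul _ hF]
  refine lintegral_congr_ae ?_
  filter_upwards [ae_norm_ne_zero (K := K)] with s hs
  rw [ENNReal.tsum_mul_right, tsum_indicator_inv_smul hs]

theorem unfold_integral (F : 𝓜 → ℂ) (hF : Measurable F)
    (hi : Integrable F (mulHaar K)) :
    ∑' u : (𝓞 K)ˣ, ∫ s in fundamentalCone K, F (u • s) ∂(mulHaar K) =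
      torsionOrder K * ∫ s, F s ∂(mulHaar K) := by
  have hC := measurableSet_fundamentalCone K
  have h1 : ∀ u : (𝓞 K)ˣ, ∫ s in fundamentalCone K, F (u • s) ∂(mulHaar K) =
      ∫ s, (fundamentalCone K).indicator (fun _ => (1 : ℂ)) (u⁻¹ • s) * F s ∂(mulHaar K) := by
    intro u
    have hm : AEStronglyMeasurable (fun s : 𝓜 =>
        (fundamentalCone K).indicator (fun _ => (1 : ℂ)) (u⁻¹ • s) * F s)
        (Measure.map (fun v => u • v) (mulHaar K)) :=
      (((measurable_const.indicator hC).comp (measurable_unit_smul _)).mul hF).aestronglyMeasurable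
    rw [← integral_indicator hC]
    have h2 := integral_map (measurable_unit_smul u).aemeasurable hm
    rw [(measurePreserving_unit_smul u).map_eq] at h2
    rw [h2]
    refine integral_congr_ae (.of_forall fun s => ?_)
    dsimp only
    rw [inv_smul_smul]
    by_cases h : s ∈ fundamentalCone K
    · rw [indicator_of_mem h, indicator_of_mem h, one_mul]
    · rw [indicator_of_notMem h, indicator_of_notMem h, zero_mul]
  have hn : ∀ (u : (𝓞 K)ˣ) (s : 𝓜),
      ‖(fundamentalCone K).indicator (fun _ => (1 : ℂ)) (u⁻¹ • s) * F s‖ₑ =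
        (fundamentalCone K).indicator (fun _ => (1 : ℝ≥0∞)) (u⁻¹ • s) * ‖F s‖ₑ := by
    intro u s
    by_cases h : u⁻¹ • s ∈ fundamentalCone K
    · rw [indicator_of_mem h, indicator_of_mem h, one_mul, one_mul]
    · rw [indicator_of_notMem h, indicator_of_notMem h, zero_mul, zero_mul, enorm_zero]
  have hm : ∀ u : (𝓞 K)ˣ, AEStronglyMeasurable (fun s : 𝓜 =>
        (fundamentalCone K).indicator (fun _ => (1 : ℂ)) (u⁻¹ • s) * F s) (mulHaar K) := fun u =>
    (((measurable_const.indicator hC).comp (measurable_unit_smul _)).mul hF).aestronglyMeasurable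
  simp_rw [h1]
  rw [← integral_tsum hm, ← integral_const_mul]
  · refine integral_congr_ae ?_
    filter_upwards [ae_norm_ne_zero (K := K)] with s hs
    rw [tsum_mul_right]
    congr 1
    have := congrArg ENNReal.toReal (tsum_indicator_inv_smul hs)
    rw [ENNReal.tsum_toReal_eq (f := fun u : (𝓞 K)ˣ => (fundamentalCone K).indicator
      (fun _ => (1 : ℝ≥0∞)) (u⁻¹ • s)) (fun u => by
        unfold indicator; split_ifs <;> simp)] at this
    have h2 := congrArg (fun r : ℝ => (r : ℂ)) this
    simp only [ofReal_tsum, ENNReal.toReal_natCast, ofReal_natCast] at h2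
    rw [← h2]
    refine tsum_congr fun u => ?_
    by_cases h : u⁻¹ • s ∈ fundamentalCone K
    · rw [indicator_of_mem h, indicator_of_mem h]; simp
    · rw [indicator_of_notMem h, indicator_of_notMem h]; simp
  · simp_rw [hn]
    have := unfold_lintegral (fun s => ‖F s‖ₑ) hF.enorm
    simp_rw [lintegral_unit_smul_cone _ hF.enorm] at this
    rw [this]
    exact ENNReal.mul_ne_top (by simp) hi.2.ne

/-- The integral ideals in the class of `A⁻¹`. -/
def classOf (A : ℱˣ) : Set ℐ :=
  {𝔫 | ∃ α : K, α ≠ 0 ∧ spanSingleton (𝓞 K)⁰ α = 𝔫 * A.1}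

/-- A generator of `𝔫 A`. -/
def gen (A : ℱˣ) (𝔫 : classOf A) : K := 𝔫.2.choose

lemma gen_ne_zero (A : ℱˣ) (𝔫 : classOf A) : gen A 𝔫 ≠ 0 :=
  𝔫.2.choose_spec.1

lemma span_gen (A : ℱˣ) (𝔫 : classOf A) :
    spanSingleton (𝓞 K)⁰ (gen A 𝔫) = 𝔫.1 * A.1 :=
  𝔫.2.choose_spec.2

lemma spanSingleton_unit_mul (u : (𝓞 K)ˣ) (α : K) :
    spanSingleton (𝓞 K)⁰ ((u : K) * α) =
      spanSingleton (𝓞 K)⁰ α := by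
  have h1 : spanSingleton (𝓞 K)⁰ (u : K) = 1 := by
    rw [← FractionalIdeal.spanSingleton_one]
    refine le_antisymm ?_ ?_ <;>
      rw [spanSingleton_le_iff_mem, mem_spanSingleton]
    · exact ⟨u, by simp [Algebra.smul_def]⟩
    · refine ⟨(u⁻¹ : (𝓞 K)ˣ), ?_⟩
      rw [Algebra.smul_def, ← map_mul]
      simp
  rw [← FractionalIdeal.spanSingleton_mul_spanSingleton, h1, one_mul]

lemma exists_unit_of_span_eq {α β : K} (hα : α ≠ 0) (h : spanSingleton (𝓞 K)⁰ α =
    spanSingleton (𝓞 K)⁰ β) : ∃ u : (𝓞 K)ˣ, (u : K) * β = α := by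
  obtain ⟨a, ha⟩ := (mem_spanSingleton (𝓞 K)⁰).1
    (h ▸ mem_spanSingleton_self (𝓞 K)⁰ α)
  obtain ⟨b, hb⟩ := (mem_spanSingleton (𝓞 K)⁰).1
    (h ▸ mem_spanSingleton_self (𝓞 K)⁰ β)
  have hab : a * b = 1 := by
    apply RingOfIntegers.coe_injective
    rw [Algebra.smul_def] at ha hb
    have : ((a * b : 𝓞 K) : K) * α = 1 * α := by
      rw [RingOfIntegers.coe_eq_algebraMap, map_mul, mul_assoc, hb, ha, one_mul]
    simpa using mul_right_cancel₀ hα this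
  exact ⟨Units.mkOfMulEqOne a b hab, by rw [← ha, Algebra.smul_def]; rfl⟩

/-- Nonzero elements of `A` correspond to integral ideals in the class together with a unit. -/
def orbitEquiv (A : ℱˣ) :
    (classOf A) × (𝓞 K)ˣ ≃ {α : K // α ∈ A.1 ∧ α ≠ 0} :=
  Equiv.ofBijective (fun p => ⟨(p.2 : K) * gen A p.1, by
    rw [← spanSingleton_le_iff_mem, spanSingleton_unit_mul, span_gen]
    conv_rhs => rw [← one_mul A.1]
    exact mul_le_mul_left FractionalIdeal.coeIdeal_le_one _, mul_ne_zero (by simp)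
      (gen_ne_zero _ _)⟩) <| by
    constructor
    · rintro ⟨𝔫, u⟩ ⟨𝔪, v⟩ h
      rw [Subtype.mk.injEq] at h
      have h1 := congrArg (spanSingleton (𝓞 K)⁰) h
      rw [spanSingleton_unit_mul, spanSingleton_unit_mul, span_gen, span_gen, A.mul_left_inj,
        coeIdeal_inj] at h1
      have h2 : 𝔫 = 𝔪 := Subtype.ext h1
      subst h2
      have h3 := mul_right_cancel₀ (gen_ne_zero _ _) h
      simpa using Units.ext (RingOfIntegers.coe_injective h3)
    · rintro ⟨α, hα, hα0⟩
      have h1 : spanSingleton (𝓞 K)⁰ α * (A⁻¹).1 ≤ 1 := by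
        rw [← A.mul_inv]
        exact mul_le_mul_left (spanSingleton_le_iff_mem.2 hα) _
      obtain ⟨𝔫, h𝔫⟩ := FractionalIdeal.le_one_iff_exists_coeIdeal.1 h1
      have h2 : spanSingleton (𝓞 K)⁰ α = 𝔫 * A.1 := by
        rw [h𝔫, mul_assoc, A.inv_mul, mul_one]
      let 𝔫' : classOf A := ⟨𝔫, α, hα0, h2⟩
      obtain ⟨u, hu⟩ := exists_unit_of_span_eq hα0 (h2.trans (span_gen A 𝔫').symm)
      exact ⟨(𝔫', u), Subtype.ext hu⟩

lemma totPos_iff (x : 𝓞 K) :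
    TotPos K x ↔ ∀ w : {w : InfinitePlace K // IsReal w}, 0 < (𝓔 x).1 w := by
  constructor
  · intro h w
    exact h (embedding_of_isReal w.2)
  · intro h φ
    have hφ : ComplexEmbedding.IsReal (ofRealHom.comp φ) := by
      ext y
      simp
    have h1 := h ⟨mk (ofRealHom.comp φ), isReal_iff.2 (by
      rw [embedding_mk_eq_of_isReal hφ]; exact hφ)⟩
    rw [mixedEmbedding_apply_isReal] at h1
    have h2 : (((embedding_of_isReal (isReal_iff.2 (by
        rw [embedding_mk_eq_of_isReal hφ]; exact hφ) :
          IsReal (mk (ofRealHom.comp φ)))) x : ℝ) : ℂ) = (φ x : ℝ) := by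
      rw [embedding_of_isReal_apply, embedding_mk_eq_of_isReal hφ]
      rfl
    rw [ofReal_inj.1 h2] at h1
    exact h1

/-- `x` has, at each real place, the sign of `s`. -/
def SameSign (s : 𝓜) (x : K) : Prop :=
  ∀ w : {w : InfinitePlace K // IsReal w}, 0 < (𝓔 x).1 w * s.1 w

lemma exists_sign (s : 𝓜) (hs : ∀ w, s.1 w ≠ 0) :
    ∃ x : 𝓞 K, x ≠ 0 ∧ SameSign s (x : K) := by
  by_cases hr : IsEmpty {w : InfinitePlace K // IsReal w}
  · exact ⟨1, one_ne_zero, fun w => hr.elim w⟩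
  rw [not_isEmpty_iff] at hr
  obtain ⟨w₀⟩ := hr
  let B := latticeBasis K
  obtain ⟨M, hM⟩ : ∃ M : ℝ, ∀ v, ‖fract B v‖ ≤ M := ⟨_, fun v => ZSpan.norm_fract_le B v⟩
  let v : 𝓜 := (fun w => (|M| + 1) * SignType.sign (s.1 w), 0)
  have hmem := (ZSpan.floor B v).2
  obtain ⟨x, hx⟩ := (mem_span_latticeBasis K).1 hmem
  have hx' : 𝓔 (x : K) = v - fract B v := by
    rw [fract, sub_sub_cancel]
    exact hx
  have key : SameSign s (x : K) := by
    intro w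
    rw [hx']
    have h1 : |(fract B v).1 w| ≤ |M| :=
      ((norm_le_pi_norm (fract B v).1 w).trans (norm_fst_le _)).trans
        ((hM v).trans (le_abs_self M))
    have h2 := abs_le.1 h1
    rcases (hs w).lt_or_gt with h | h
    · refine mul_pos_of_neg_of_neg ?_ h
      have : v.1 w = -(|M| + 1) := by simp [v, sign_neg h]
      change v.1 w - _ < 0
      linarith
    · refine mul_pos ?_ h
      have : v.1 w = |M| + 1 := by simp [v, sign_pos h]
      change 0 < v.1 w - _
      linarith
  refine ⟨x, ?_, key⟩
  rintro rfl
  simpa using key w₀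

lemma SameSign.add_nat_mul {s : 𝓜} {x : K} (hx : SameSign s x) (a : K) {m : ℕ}
    (hm : m ≠ 0) : ∀ᶠ k : ℕ in atTop, SameSign s (a + m * k * x) := by
  refine Filter.eventually_all.2 fun w => ?_
  have h0 := hx w
  have h1 : Tendsto (fun k : ℕ => (𝓔 a).1 w * s.1 w +
      (m * ((𝓔 x).1 w * s.1 w)) * (k : ℝ)) atTop atTop :=
    tendsto_atTop_add_const_left _ _ (tendsto_natCast_atTop_atTop.const_mul_atTop (by positivity))
  filter_upwards [h1.eventually_gt_atTop 0] with k hk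
  have h2 : (𝓔 (a + m * k * x)).1 w =
      (𝓔 a).1 w + m * k * (𝓔 x).1 w := by
    simp
  rw [h2]
  linarith

lemma exists_sameSign_sub_mem (s : 𝓜) (hs : ∀ w, s.1 w ≠ 0) {𝔞 : ℐ}
    (h𝔞 : 𝔞 ≠ ⊥) (a : 𝓞 K) : ∃ x : 𝓞 K, x - a ∈ 𝔞 ∧ x ≠ 0 ∧ SameSign s (x : K) := by
  obtain ⟨y, hy0, hy⟩ := exists_sign s hs
  have hm : absNorm 𝔞 ≠ 0 := by rwa [Ne, absNorm_eq_zero_iff]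
  have h2 : {k : ℕ | a + absNorm 𝔞 * k * y = 0}.Finite := by
    refine Set.Subsingleton.finite fun k hk l hl => ?_
    rw [mem_ofPred_eq] at hk hl
    have h3 := add_left_cancel (hk.trans hl.symm)
    have h4 := mul_left_cancel₀ (Nat.cast_ne_zero.2 hm) (mul_right_cancel₀ hy0 h3)
    exact_mod_cast h4
  have h3 : ∀ᶠ k : ℕ in atTop, a + absNorm 𝔞 * k * y ≠ 0 := by
    rw [← Nat.cofinite_eq_atTop]
    exact h2.eventually_cofinite_notMem
  obtain ⟨k, hk1, hk2⟩ := ((hy.add_nat_mul (a : K) hm).and h3).exists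
  refine ⟨a + absNorm 𝔞 * k * y, ?_, hk2, by simpa using hk1⟩
  rw [add_sub_cancel_left, mul_assoc]
  exact mul_mem_right _ _ (Ideal.absNorm_mem 𝔞)

lemma sameSign_one_iff (x : 𝓞 K) : SameSign 1 (x : K) ↔ TotPos K x := by
  rw [totPos_iff]
  simp [SameSign]

/-- A primitive narrow ray class character of conductor `𝔣`, as a function on nonzero ideals. -/
structure PChar (𝔣 : ℐ) where
  toFun : ℐ → ℂ
  map_mul_of_ne : ∀ 𝔞 𝔟, 𝔞 ≠ ⊥ → 𝔟 ≠ ⊥ → toFun (𝔞 * 𝔟) = toFun 𝔞 * toFun 𝔟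
  eq_zero : ∀ 𝔞, 𝔞 ≠ ⊥ → ¬ IsCoprime 𝔞 𝔣 → toFun 𝔞 = 0
  norm_one : ∀ 𝔞, 𝔞 ≠ ⊥ → IsCoprime 𝔞 𝔣 → ‖toFun 𝔞‖ = 1
  ray_one : ∀ α : 𝓞 K, α ≠ 0 → TotPos K α → α - 1 ∈ 𝔣 → toFun (span {α}) = 1
  prim : ∀ 𝔤, 𝔣 < 𝔤 → ∃ α : 𝓞 K, α ≠ 0 ∧ TotPos K α ∧ α - 1 ∈ 𝔤 ∧
    IsCoprime (span {α}) 𝔣 ∧ toFun (span {α}) ≠ 1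

namespace PChar

variable {𝔣 : Ideal (𝓞 K)} (χ : PChar 𝔣)

lemma norm_le_one {𝔞 : ℐ} (h : 𝔞 ≠ ⊥) : ‖χ.toFun 𝔞‖ ≤ 1 := by
  by_cases hc : IsCoprime 𝔞 𝔣
  · exact (χ.norm_one 𝔞 h hc).le
  · simp [χ.eq_zero 𝔞 h hc]

lemma sup_eq_sup {𝔟 𝔫 𝔫' : ℐ} (h𝔟 : 𝔟 ≠ ⊥) {α α' : 𝓞 K}
    (h : span {α} = 𝔫 * 𝔟) (h' : span {α'} = 𝔫' * 𝔟) (hd : α - α' ∈ 𝔟 * 𝔣) :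
    𝔫 ⊔ 𝔣 = 𝔫' ⊔ 𝔣 := by
  apply mul_left_cancel₀ (show 𝔟 ≠ 0 from h𝔟)
  rw [Ideal.mul_sup, Ideal.mul_sup, mul_comm 𝔟 𝔫, mul_comm 𝔟 𝔫', ← h, ← h']
  refine le_antisymm (sup_le ?_ le_sup_right) (sup_le ?_ le_sup_right) <;>
    rw [span_singleton_le_iff_mem]
  · rw [← add_sub_cancel α' α]
    exact add_mem (mem_sup_left (mem_span_singleton_self _)) (mem_sup_right hd)
  · rw [← sub_sub_cancel α α']
    exact sub_mem (mem_sup_left (mem_span_singleton_self _)) (mem_sup_right hd)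

lemma eq_of_sub_mem {𝔟 𝔫 𝔫' : ℐ} (h𝔟 : 𝔟 ≠ ⊥) (h𝔣 : 𝔣 ≠ ⊥) {α α' : 𝓞 K}
    (hα : α ≠ 0) (hα' : α' ≠ 0)
    (h : span {α} = 𝔫 * 𝔟) (h' : span {α'} = 𝔫' * 𝔟) (hd : α - α' ∈ 𝔟 * 𝔣)
    (hs : SameSign (𝓔 (α : K)) (α' : K)) : χ.toFun 𝔫 = χ.toFun 𝔫' := by
  have hn : 𝔫 ≠ ⊥ := by
    rintro rfl
    rw [Ideal.bot_mul, span_singleton_eq_bot] at h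
    exact hα h
  have hn' : 𝔫' ≠ ⊥ := by
    rintro rfl
    rw [Ideal.bot_mul, span_singleton_eq_bot] at h'
    exact hα' h'
  have hsup := sup_eq_sup h𝔟 h h' hd
  by_cases hc : IsCoprime 𝔫 𝔣
  swap
  · have hc' : ¬ IsCoprime 𝔫' 𝔣 := by rwa [isCoprime_iff_sup_eq, ← hsup,
      ← isCoprime_iff_sup_eq]
    rw [χ.eq_zero _ hn hc, χ.eq_zero _ hn' hc']
  obtain ⟨x₀, hx₀, y₀, hy₀, hxy⟩ := Submodule.mem_sup.1
    ((isCoprime_iff_sup_eq.1 hc) ▸ Submodule.mem_top : (1 : 𝓞 K) ∈ 𝔫 ⊔ 𝔣)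
  obtain ⟨x, hx1, hx2, hx3⟩ := exists_sameSign_sub_mem (1 : 𝓜) (by simp)
    (mul_ne_zero hn h𝔣 : 𝔫 * 𝔣 ≠ 0) x₀
  rw [sameSign_one_iff] at hx3
  have hxn : x ∈ 𝔫 := by
    rw [← sub_add_cancel x x₀]
    exact add_mem (mul_le_left hx1) hx₀
  have hxf : x - 1 ∈ 𝔣 := by
    have : x - 1 = (x - x₀) - y₀ := by rw [← hxy]; ring
    rw [this]
    exact sub_mem (mul_le_right hx1) hy₀
  obtain ⟨𝔪, h𝔪⟩ := dvd_iff_le.2 ((span_singleton_le_iff_mem 𝔫).2 hxn)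
  have hm : 𝔪 ≠ ⊥ := by
    rintro rfl
    rw [Ideal.mul_bot, span_singleton_eq_bot] at h𝔪
    exact hx2 h𝔪
  have h1 : span {x * α'} = span {α} * (𝔪 * 𝔫') := by
    rw [← span_singleton_mul_span_singleton, h𝔪, h', h]
    ring
  obtain ⟨x', hx'⟩ : α ∣ x * α' := by
    rw [← Ideal.span_singleton_le_span_singleton, h1]
    exact mul_le_left
  have h2 : span {x'} = 𝔪 * 𝔫' := by
    rw [hx', ← span_singleton_mul_span_singleton] at h1
    refine mul_left_cancel₀ (a := span {α}) ?_ h1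
    rwa [Ne, zero_eq_bot, span_singleton_eq_bot]
  have hx'0 : x' ≠ 0 := by
    rintro rfl
    rw [mul_zero] at hx'
    exact mul_ne_zero hx2 hα' hx'
  have h3 : x - x' ∈ 𝔣 := by
    have e : α * (x - x') = x * (α - α') := by rw [mul_sub, ← hx']; ring
    have h4 : α * (x - x') ∈ span {α} * (𝔪 * 𝔣) := by
      rw [e, h, show 𝔫 * 𝔟 * (𝔪 * 𝔣) = (𝔫 * 𝔪) * (𝔟 * 𝔣) by ring, ← h𝔪]
      exact Ideal.mul_mem_mul (mem_span_singleton_self _) hd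
    rw [Ideal.mem_span_singleton_mul] at h4
    obtain ⟨z, hz, hz'⟩ := h4
    rw [← mul_left_cancel₀ hα hz']
    exact mul_le_right hz
  have hx'p : TotPos K x' := by
    rw [totPos_iff] at hx3 ⊢
    intro w
    have e : (𝓔 (x : K)).1 w * (𝓔 (α' : K)).1 w =
        (𝓔 (α : K)).1 w * (𝓔 (x' : K)).1 w := by
      have := congrArg (fun z : 𝓞 K => (𝓔 (z : K)).1 w) hx'
      simpa using this
    have p1 := hs w
    have p2 := hx3 w
    have p3 : 0 < (𝓔 (x' : K)).1 w * (𝓔 (α : K)).1 w ^ 2 := by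
      have := mul_pos p1 p2
      linear_combination this + (𝓔 (α : K)).1 w * e
    exact pos_of_mul_pos_left p3 (sq_nonneg _)
  have e1 := χ.ray_one x hx2 hx3 hxf
  have e2 := χ.ray_one x' hx'0 hx'p (by
    rw [show x' - 1 = (x - 1) - (x - x') by ring]; exact sub_mem hxf h3)
  rw [h𝔪, χ.map_mul_of_ne _ _ hn hm] at e1
  rw [h2, χ.map_mul_of_ne _ _ hm hn', mul_comm] at e2
  exact mul_right_cancel₀ (right_ne_zero_of_mul_eq_one e1) (e1.trans e2.symm)

lemma exists_lift (h𝔣 : 𝔣 ≠ ⊥) (c : 𝓞 K ⧸ 𝔣) :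
    ∃ x : 𝓞 K, Ideal.Quotient.mk 𝔣 x = c ∧ x ≠ 0 ∧ TotPos K x := by
  obtain ⟨a, rfl⟩ := mk_surjective c
  obtain ⟨x, h1, h2, h3⟩ := exists_sameSign_sub_mem (1 : 𝓜) (by simp) h𝔣 a
  exact ⟨x, Ideal.Quotient.eq.2 h1, h2, (sameSign_one_iff x).1 h3⟩

/-- A totally positive lift. -/
def lift (h𝔣 : 𝔣 ≠ ⊥) (c : 𝓞 K ⧸ 𝔣) : 𝓞 K := (exists_lift h𝔣 c).choose

lemma mk_lift (h𝔣 : 𝔣 ≠ ⊥) (c : 𝓞 K ⧸ 𝔣) : Ideal.Quotient.mk 𝔣 (lift h𝔣 c) = c :=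
  (exists_lift h𝔣 c).choose_spec.1

lemma lift_ne_zero (h𝔣 : 𝔣 ≠ ⊥) (c : 𝓞 K ⧸ 𝔣) : lift h𝔣 c ≠ 0 :=
  (exists_lift h𝔣 c).choose_spec.2.1

lemma totPos_lift (h𝔣 : 𝔣 ≠ ⊥) (c : 𝓞 K ⧸ 𝔣) : TotPos K (lift h𝔣 c) :=
  (exists_lift h𝔣 c).choose_spec.2.2

lemma _root_.RTZ.TotPos.mul {x y : 𝓞 K} (hx : TotPos K x) (hy : TotPos K y) :
    TotPos K (x * y) := fun φ => by
  rw [map_mul, map_mul]; exact mul_pos (hx φ) (hy φ)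

lemma sameSign_of_totPos {x y : 𝓞 K} (hx : TotPos K x) (hy : TotPos K y) :
    SameSign (𝓔 (x : K)) (y : K) := fun w =>
  mul_pos ((totPos_iff y).1 hy w) ((totPos_iff x).1 hx w)

lemma span_eq_of_mk_eq (h𝔣 : 𝔣 ≠ ⊥) {x y : 𝓞 K} (hx : TotPos K x) (hy : TotPos K y) (hx0 : x ≠ 0)
    (hy0 : y ≠ 0) (h : Ideal.Quotient.mk 𝔣 x = Ideal.Quotient.mk 𝔣 y) :
    χ.toFun (span {x}) = χ.toFun (span {y}) := by
  refine χ.eq_of_sub_mem (𝔟 := ⊤) top_ne_bot h𝔣 hx0 hy0 (by simp) (by simp) ?_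
    (sameSign_of_totPos hx hy)
  rw [Ideal.top_mul]
  exact Ideal.Quotient.eq.1 h

lemma isCoprime_span_iff (x : 𝓞 K) :
    IsCoprime (span {x}) 𝔣 ↔ IsUnit (Ideal.Quotient.mk 𝔣 x) := by
  rw [Ideal.isCoprime_iff_exists]
  constructor
  · rintro ⟨i, hi, j, hj, hij⟩
    obtain ⟨z, rfl⟩ := Ideal.mem_span_singleton.1 hi
    refine IsUnit.of_mul_eq_one (Ideal.Quotient.mk 𝔣 z) ?_
    rw [← map_mul, ← map_one (Ideal.Quotient.mk 𝔣), Ideal.Quotient.eq, ← hij]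
    simpa using hj
  · rintro ⟨u, hu⟩
    obtain ⟨z, hz⟩ := mk_surjective (u⁻¹).1
    refine ⟨x * z, mul_mem_right _ _ (mem_span_singleton_self _), 1 - x * z, ?_,
      by ring⟩
    rw [← Ideal.Quotient.eq, map_one, map_mul, ← hu, hz, u.mul_inv]

/-- The residue character attached to `χ`. -/
def resChar (h𝔣 : 𝔣 ≠ ⊥) : MulChar (𝓞 K ⧸ 𝔣) ℂ where
  toFun c := χ.toFun (span {lift h𝔣 c})
  map_one' := by
    refine χ.ray_one _ (lift_ne_zero _ _) (totPos_lift _ _) ?_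
    rw [← Ideal.Quotient.eq, mk_lift, map_one]
  map_mul' c d := by
    have hne : ∀ c, span {lift h𝔣 c} ≠ ⊥ := fun c => by
      rw [Ne, span_singleton_eq_bot]; exact lift_ne_zero _ _
    rw [← χ.map_mul_of_ne _ _ (hne _) (hne _), span_singleton_mul_span_singleton]
    refine χ.span_eq_of_mk_eq h𝔣 (totPos_lift _ _) ((totPos_lift _ _).mul (totPos_lift _ _))
      (lift_ne_zero _ _) (mul_ne_zero (lift_ne_zero _ _) (lift_ne_zero _ _)) ?_
    rw [map_mul, mk_lift, mk_lift, mk_lift]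
  map_nonunit' c hc := by
    refine χ.eq_zero _ (by rw [Ne, span_singleton_eq_bot]; exact lift_ne_zero _ _) ?_
    rwa [isCoprime_span_iff, mk_lift]

lemma resChar_apply (h𝔣 : 𝔣 ≠ ⊥) {x : 𝓞 K} (hx : TotPos K x) (hx0 : x ≠ 0) :
    χ.resChar h𝔣 (Ideal.Quotient.mk 𝔣 x) = χ.toFun (span {x}) :=
  χ.span_eq_of_mk_eq h𝔣 (totPos_lift _ _) hx (lift_ne_zero _ _) hx0 (mk_lift _ _)

lemma norm_resChar (h𝔣 : 𝔣 ≠ ⊥) {c : 𝓞 K ⧸ 𝔣} (hc : IsUnit c) : ‖χ.resChar h𝔣 c‖ = 1 := by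
  refine χ.norm_one _ (by rw [Ne, span_singleton_eq_bot]; exact lift_ne_zero _ _) ?_
  rwa [isCoprime_span_iff, mk_lift]

/-- Evaluation of `χ` on `(α) 𝔟⁻¹` for `α ≡ c j (mod 𝔟 𝔣)`. -/
lemma toFun_eq_resChar (h𝔣 : 𝔣 ≠ ⊥) {𝔟 𝔧 𝔫 : ℐ} (h𝔟 : 𝔟 ≠ ⊥) {j α c : 𝓞 K}
    (hj : j ≠ 0) (hα : α ≠ 0) (hj𝔟 : span {j} = 𝔧 * 𝔟) (hα𝔟 : span {α} = 𝔫 * 𝔟)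
    (hs : SameSign (𝓔 (α : K)) (j : K)) (hd : α - c * j ∈ 𝔟 * 𝔣) :
    χ.toFun 𝔫 = χ.resChar h𝔣 (Ideal.Quotient.mk 𝔣 c) * χ.toFun 𝔧 := by
  set x := lift h𝔣 (Ideal.Quotient.mk 𝔣 c) with hx
  have hx0 : x ≠ 0 := lift_ne_zero _ _
  have hxp : TotPos K x := totPos_lift _ _
  have h𝔧 : 𝔧 ≠ ⊥ := by
    rintro rfl
    rw [Ideal.bot_mul, span_singleton_eq_bot] at hj𝔟
    exact hj hj𝔟
  have hxb : span {x} ≠ ⊥ := by rwa [Ne, span_singleton_eq_bot]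
  change _ = χ.toFun (span {x}) * _
  rw [← χ.map_mul_of_ne _ _ hxb h𝔧]
  refine χ.eq_of_sub_mem h𝔟 h𝔣 hα (mul_ne_zero hx0 hj) hα𝔟 (α' := x * j) ?_ ?_ ?_
  · rw [← span_singleton_mul_span_singleton, hj𝔟, mul_assoc]
  · have h1 : x - c ∈ 𝔣 := by rw [← Ideal.Quotient.eq, hx, mk_lift]
    rw [show α - x * j = (α - c * j) - j * (x - c) by ring]
    refine sub_mem hd (Ideal.mul_mem_mul ?_ h1)
    have : j ∈ span {j} := mem_span_singleton_self j
    rw [hj𝔟] at this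
    exact mul_le_right this
  · intro w
    have := mul_pos ((totPos_iff x).1 hxp w) (hs w)
    simpa [mul_assoc] using this

end PChar

namespace PChar

variable {𝔣 : Ideal (𝓞 K)} (χ : PChar 𝔣)

/-- The ideal of shifts trivialising an additive character. -/
def shiftKer {R : Type*} [CommRing R] (θ : AddChar R ℂ) : Ideal R where
  carrier := {r | ∀ x, θ (r * x) = 1}
  add_mem' {a b} ha hb x := by rw [add_mul, AddChar.map_add_eq_mul, ha, hb, one_mul]
  zero_mem' x := by rw [zero_mul, AddChar.map_zero_eq_one]
  smul_mem' c a ha x := by rw [smul_eq_mul, mul_comm c, mul_assoc]; exact ha _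

lemma gauss_eq_zero (h𝔣 : 𝔣 ≠ ⊥) [Fintype (𝓞 K ⧸ 𝔣)] (θ : AddChar (𝓞 K ⧸ 𝔣) ℂ)
    (hθ : ¬ θ.IsPrimitive) : ∑ c, χ.resChar h𝔣 c * θ c = 0 := by
  rw [AddChar.IsPrimitive] at hθ
  push Not at hθ
  obtain ⟨a, ha0, ha⟩ := hθ
  obtain ⟨a', rfl⟩ := mk_surjective a
  have hlt : 𝔣 < (shiftKer θ).comap (Ideal.Quotient.mk 𝔣) := by
    refine lt_of_le_of_ne (fun x hx => ?_) ?_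
    · rw [Ideal.mem_comap, eq_zero_iff_mem.2 hx]
      exact zero_mem _
    · intro he
      apply ha0
      rw [eq_zero_iff_mem, he, Ideal.mem_comap]
      intro x
      have := DFunLike.congr_fun ha x
      rwa [AddChar.mulShift_apply] at this
  obtain ⟨α, hα0, hαp, hα, hαc, hα1⟩ := χ.prim _ hlt
  rw [isCoprime_span_iff] at hαc
  rw [← χ.resChar_apply h𝔣 hαp hα0] at hα1
  set u := Ideal.Quotient.mk 𝔣 α with hu
  have h1 : ∑ c, χ.resChar h𝔣 c * θ c = χ.resChar h𝔣 u * ∑ c, χ.resChar h𝔣 c * θ c := by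
    conv_lhs => rw [← Equiv.sum_comp hαc.unit.mulLeft]
    rw [mul_sum]
    refine sum_congr rfl fun c _ => ?_
    have h2 : hαc.unit.mulLeft c = u * c := rfl
    have h3 : θ (u * c) = θ c := by
      have := hα c
      rw [map_sub, map_one, ← hu] at this
      rw [show u * c = (u - 1) * c + c by ring, AddChar.map_add_eq_mul, this, one_mul]
    rw [h2, h3, map_mul, mul_assoc]
  by_contra h0
  exact hα1 (mul_right_cancel₀ h0 (by rw [one_mul]; exact h1.symm))

lemma gauss_norm_le {R : Type*} [CommRing R] [Fintype R] (f : MulChar R ℂ)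
    (hf : ∀ c, IsUnit c → ‖f c‖ = 1) {θ : AddChar R ℂ} (hθ : θ.IsPrimitive) :
    ‖∑ c, f c * θ c‖ ≤ √(card R) := by
  let G : R → ℂ := fun r => ∑ c, f c * θ (r * c)
  have hG1 : ∑ c, f c * θ c = G 1 := by simp [G]
  have hnf : ∀ c, f c * conj (f c) = if IsUnit c then 1 else 0 := by
    intro c
    split_ifs with h
    · rw [Complex.mul_conj, normSq_eq_norm_sq, hf _ h]; simp
    · rw [MulChar.map_nonunit _ h, zero_mul]
  have hu : ∀ u : Rˣ, ‖G u‖ = ‖G 1‖ := by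
    intro u
    have h1 : f u * G u = G 1 := by
      simp only [G]
      rw [← Equiv.sum_comp u.mulLeft (fun c => f c * θ (1 * c)), mul_sum]
      refine sum_congr rfl fun c _ => ?_
      rw [← mul_assoc]
      simp only [Units.mulLeft_apply, map_mul, one_mul]
    rw [← h1, norm_mul, hf _ u.isUnit, one_mul]
  have hconj : ∀ x, conj (θ x) = θ (-x) := fun x => (AddChar.map_neg_eq_conj θ x).symm
  have hsum : ∑ r, ‖G r‖ ^ 2 = card R * card Rˣ := by
    have h1 : ∀ r, ((‖G r‖ ^ 2 : ℝ) : ℂ) =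
        ∑ c, ∑ d, f c * conj (f d) * θ (r * (c - d)) := by
      intro r
      rw [Complex.ofReal_pow, ← Complex.mul_conj']
      simp only [G, map_sum, map_mul, hconj]
      rw [sum_mul_sum]
      refine sum_congr rfl fun c _ => sum_congr rfl fun d _ => ?_
      rw [mul_sub, sub_eq_add_neg, AddChar.map_add_eq_mul]
      ring
    have h2 : (∑ r, ((‖G r‖ ^ 2 : ℝ) : ℂ)) = card R * card Rˣ := by
      simp_rw [h1]
      rw [sum_comm]
      have h3 : ∀ c, ∑ r, ∑ d, f c * conj (f d) * θ (r * (c - d)) =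
          if IsUnit c then (card R : ℂ) else 0 := by
        intro c
        rw [sum_comm]
        simp_rw [← mul_sum, AddChar.sum_mulShift _ hθ, sub_eq_zero]
        rw [Finset.sum_eq_single c (fun d _ hd => by rw [if_neg hd.symm]; simp) (by simp),
          hnf, if_pos rfl]
        split_ifs <;> simp
      simp_rw [h3]
      rw [← sum_filter, sum_const, nsmul_eq_mul, mul_comm]
      congr 2
      rw [← Fintype.card_subtype]
      exact Fintype.card_congr (Equiv.ofBijective (fun u : Rˣ => (⟨u, u.isUnit⟩ : {x : R // IsUnit x}))
        ⟨fun a b h => Units.ext (congrArg Subtype.val h), fun ⟨x, u, hx⟩ => ⟨u, Subtype.ext hx⟩⟩).symm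
    exact_mod_cast h2
  have hle : (card Rˣ : ℝ) * ‖G 1‖ ^ 2 ≤ card R * card Rˣ := by
    rw [← hsum]
    have h1 : (card Rˣ : ℝ) * ‖G 1‖ ^ 2 = ∑ u : Rˣ, ‖G u‖ ^ 2 := by
      simp_rw [hu]
      simp
    rw [h1]
    have h2 : ∑ u : Rˣ, ‖G u‖ ^ 2 = ∑ r ∈ Finset.univ.image (Units.val : Rˣ → R), ‖G r‖ ^ 2 := by
      rw [sum_image (fun a _ b _ h => Units.ext h)]
    rw [h2]
    exact Finset.sum_le_sum_of_subset_of_nonneg (Finset.subset_univ _) fun _ _ _ => sq_nonneg _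
  rw [hG1]
  apply Real.le_sqrt_of_sq_le
  have hpos : (0 : ℝ) < card Rˣ := by exact_mod_cast Fintype.card_pos
  nlinarith

lemma gauss_bound (h𝔣 : 𝔣 ≠ ⊥) [Fintype (𝓞 K ⧸ 𝔣)] (θ : AddChar (𝓞 K ⧸ 𝔣) ℂ) :
    ‖∑ c, χ.resChar h𝔣 c * θ c‖ ≤ √(card (𝓞 K ⧸ 𝔣)) := by
  by_cases hθ : θ.IsPrimitive
  · exact gauss_norm_le _ (fun c hc => χ.norm_resChar h𝔣 hc) hθ
  · rw [χ.gauss_eq_zero h𝔣 θ hθ, norm_zero]; positivity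

end PChar

lemma ae_norm_ne_zero_volume : ∀ᵐ v : 𝓜, 𝒩 v ≠ 0 := by
  have h1 : ∀ w : {w : InfinitePlace K // IsReal w}, ∀ᵐ v : 𝓜, v.1 w ≠ 0 := by
    intro w
    let f : 𝓜 →ₗ[ℝ] ℝ := ⟨⟨fun v => v.1 w, by simp⟩, by simp⟩
    rw [ae_iff]
    simp only [not_not]
    refine Measure.addHaar_submodule volume (LinearMap.ker f) ?_
    intro h
    have : (1 : 𝓜) ∈ LinearMap.ker f := h ▸ Submodule.mem_top
    exact one_ne_zero (α := ℝ) (LinearMap.mem_ker.1 this)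
  have h2 : ∀ w : {w : InfinitePlace K // IsComplex w}, ∀ᵐ v : 𝓜, v.2 w ≠ 0 := by
    intro w
    let f : 𝓜 →ₗ[ℝ] ℂ := ⟨⟨fun v => v.2 w, by simp⟩, by simp⟩
    rw [ae_iff]
    simp only [not_not]
    refine Measure.addHaar_submodule volume (LinearMap.ker f) ?_
    intro h
    have : (1 : 𝓜) ∈ LinearMap.ker f := h ▸ Submodule.mem_top
    exact one_ne_zero (α := ℂ) (LinearMap.mem_ker.1 this)
  filter_upwards [ae_all_iff.2 h1, ae_all_iff.2 h2] with v hv1 hv2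
  rw [norm_eq_prod]
  exact mul_ne_zero (prod_ne_zero_iff.2 fun w _ => by simpa using hv1 w)
    (prod_ne_zero_iff.2 fun w _ => by simpa using hv2 w)

lemma lintegral_norm_mul_mulHaar (F : 𝓜 → ℝ≥0∞) (hF : Measurable F) :
    ∫⁻ v, ofReal (𝒩 v) * F v ∂(mulHaar K) = ∫⁻ v, F v := by
  have hm : Measurable fun v : 𝓜 => ofReal (𝒩 v)⁻¹ :=
    measurable_norm_mixed.inv.ennreal_ofReal
  rw [mulHaar, lintegral_withDensity_eq_lintegral_mul _ hm
    (g := fun v => ofReal (𝒩 v) * F v)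
    (measurable_norm_mixed.ennreal_ofReal.mul hF)]
  refine lintegral_congr_ae ?_
  filter_upwards [ae_norm_ne_zero_volume (K := K)] with v hv
  have hpos : 0 < 𝒩 v := lt_of_le_of_ne (mixedEmbedding.norm_nonneg v) hv.symm
  rw [Pi.mul_apply, ← mul_assoc, ← ENNReal.ofReal_mul (by positivity), inv_mul_cancel₀ hv,
    ENNReal.ofReal_one, one_mul]

lemma integral_norm_mul_mulHaar (F : 𝓜 → ℂ) :
    ∫ v, (𝒩 v : ℂ) * F v ∂(mulHaar K) = ∫ v, F v := by
  have hm : Measurable fun v : 𝓜 => ofReal (𝒩 v)⁻¹ :=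
    measurable_norm_mixed.inv.ennreal_ofReal
  rw [mulHaar, integral_withDensity_eq_integral_toReal_smul hm (by simp)]
  refine integral_congr_ae ?_
  filter_upwards [ae_norm_ne_zero_volume (K := K)] with v hv
  rw [ENNReal.toReal_ofReal (inv_nonneg.2 (mixedEmbedding.norm_nonneg v)), real_smul,
    ← mul_assoc, ← Complex.ofReal_mul, inv_mul_cancel₀ hv, Complex.ofReal_one, one_mul]

lemma mul_inv_of_norm_ne_zero {s : 𝓜} (hs : 𝒩 s ≠ 0) :
    s * s⁻¹ = 1 := by
  rw [norm_eq_prod, mul_ne_zero_iff, prod_ne_zero_iff, prod_ne_zero_iff] at hs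
  ext w
  · exact mul_inv_cancel₀ (by simpa using hs.1 w (mem_univ _))
  · exact mul_inv_cancel₀ (by simpa using hs.2 w (mem_univ _))

/-- Multiplication by an element of nonzero norm. -/
def mulHomeo (s : 𝓜) (hs : 𝒩 s ≠ 0) : 𝓜 ≃ₜ 𝓜 :=
  Homeomorph.mk ⟨fun v => s * v, fun v => s⁻¹ * v,
    fun v => by
      change s⁻¹ * (s * v) = v
      rw [← mul_assoc, mul_comm s⁻¹, mul_inv_of_norm_ne_zero hs, one_mul],
    fun v => by
      change s * (s⁻¹ * v) = v
      rw [← mul_assoc, mul_inv_of_norm_ne_zero hs, one_mul]⟩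
      (by fun_prop) (by fun_prop)

lemma measurableEmbedding_mul {s : 𝓜} (hs : 𝒩 s ≠ 0) :
    MeasurableEmbedding fun v : 𝓜 => s * v :=
  (mulHomeo s hs).measurableEmbedding

lemma integral_comp_mul_mulHaar (F : 𝓜 → ℂ) {s : 𝓜}
    (hs : 𝒩 s ≠ 0) : ∫ v, F (s * v) ∂(mulHaar K) = ∫ v, F v ∂(mulHaar K) :=
  (measurePreserving_mul_mixed s hs).integral_comp (measurableEmbedding_mul hs) F

lemma integral_comp_mul_volume (F : 𝓜 → ℂ) {s : 𝓜}
    (hs : 𝒩 s ≠ 0) :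
    ∫ v, F (s * v) = (𝒩 s : ℂ)⁻¹ * ∫ v, F v := by
  rw [← integral_norm_mul_mulHaar, ← integral_norm_mul_mulHaar F,
    ← integral_comp_mul_mulHaar (fun v => (𝒩 v : ℂ) * F v) hs,
    ← integral_const_mul]
  congr 1 with v
  have := ofReal_ne_zero.2 hs
  rw [map_mul, Complex.ofReal_mul]
  field_simp

/-- The Fourier transform of a shifted and dilated function. -/
lemma FT_shift_mul (h : 𝓜 → ℂ) {s : 𝓜} (hs : 𝒩 s ≠ 0)
    (a ξ : 𝓜) :
    FT (fun v => h (s * (a + v))) ξ =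
      cexp (2 * π * I * (trV K (ξ * a) : ℂ)) * (𝒩 s : ℂ)⁻¹ *
        FT h (s⁻¹ * ξ) := by
  have hF := integral_comp_mul_volume
    (fun v => cexp (-(2 * π * I * (trV K (s⁻¹ * ξ * v) : ℂ))) * h v) hs
  rw [FT, FT, mul_assoc (cexp _), ← hF, ← integral_const_mul,
    ← integral_add_left_eq_self (fun v => cexp (2 * π * I * (trV K (ξ * a) : ℂ)) *
      (cexp (-(2 * π * I * (trV K (s⁻¹ * ξ * (s * v)) : ℂ))) * h (s * v))) a]
  congr 1 with v
  have h1 : s⁻¹ * ξ * (s * (a + v)) = ξ * a + ξ * v := by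
    rw [show s⁻¹ * ξ * (s * (a + v)) = (s * s⁻¹) * (ξ * (a + v)) by ring,
      mul_inv_of_norm_ne_zero hs, one_mul, mul_add]
  rw [h1, map_add, ← mul_assoc, ← exp_add]
  congr 2
  push_cast
  ring

/-- A nonzero integral ideal as an invertible fractional ideal. -/
def fU (𝔟 : ℐ) (h : 𝔟 ≠ ⊥) : ℱˣ :=
  Units.mk0 (𝔟 : ℱ) (coeIdeal_ne_zero.2 h)

lemma fU_val (𝔟 : ℐ) (h : 𝔟 ≠ ⊥) : (fU 𝔟 h).1 = (𝔟 : ℱ) := rfl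

lemma mem_fU {𝔟 : ℐ} {h : 𝔟 ≠ ⊥} {x : 𝓞 K} : (x : K) ∈ (fU 𝔟 h).1 ↔ x ∈ 𝔟 := by
  rw [fU_val, mem_coeIdeal]
  constructor
  · rintro ⟨y, hy, hyx⟩
    rwa [← RingOfIntegers.coe_injective hyx]
  · intro hx
    exact ⟨x, hx, rfl⟩

lemma exists_of_mem_fU {𝔟 : ℐ} {h : 𝔟 ≠ ⊥} {x : K} (hx : x ∈ (fU 𝔟 h).1) :
    ∃ a ∈ 𝔟, (a : K) = x := by
  rw [fU_val, mem_coeIdeal] at hx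
  exact hx

/-- `α ↦ χ((α) 𝔟⁻¹)`. -/
def tw {𝔣 : ℐ} (χ : PChar 𝔣) (𝔟 : ℐ) (α : K) : ℂ :=
  if h : α ≠ 0 ∧ ∃ 𝔫 : ℐ, spanSingleton (𝓞 K)⁰ α =
    𝔫 * (𝔟 : ℱ) then χ.toFun h.2.choose else 0

lemma tw_eq {𝔣 : ℐ} (χ : PChar 𝔣) {𝔟 : ℐ} (h𝔟 : 𝔟 ≠ ⊥) {α : K} (hα : α ≠ 0)
    {𝔫 : ℐ} (h : spanSingleton (𝓞 K)⁰ α =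
    𝔫 * (𝔟 : ℱ)) : tw χ 𝔟 α = χ.toFun 𝔫 := by
  have h' : α ≠ 0 ∧ ∃ 𝔫 : ℐ, spanSingleton (𝓞 K)⁰ α =
    𝔫 * (𝔟 : ℱ) := ⟨hα, 𝔫, h⟩
  rw [tw, dif_pos h']
  congr 1
  exact FractionalIdeal.coeIdeal_injective (mul_right_cancel₀
    (coeIdeal_ne_zero.2 h𝔟) (h'.2.choose_spec.symm.trans h))

lemma tw_eq' {𝔣 : ℐ} (χ : PChar 𝔣) {𝔟 : ℐ} (h𝔟 : 𝔟 ≠ ⊥) {α : 𝓞 K}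
    (hα : α ≠ 0) {𝔫 : ℐ} (h : span {α} = 𝔫 * 𝔟) : tw χ 𝔟 (α : K) = χ.toFun 𝔫 := by
  refine tw_eq χ h𝔟 (by simpa using hα) ?_
  rw [← coeIdeal_mul, ← h]
  exact (FractionalIdeal.coeIdeal_span_singleton α).symm

lemma tw_zero {𝔣 : ℐ} (χ : PChar 𝔣) {𝔟 : ℐ} : tw χ 𝔟 0 = 0 := by
  rw [tw, dif_neg (by simp)]

lemma exists_mul_of_mem {𝔟 : ℐ} {α : 𝓞 K} (h : α ∈ 𝔟) :
    ∃ 𝔫, span {α} = 𝔫 * 𝔟 := by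
  rw [← span_singleton_le_iff_mem, ← dvd_iff_le] at h
  obtain ⟨c, hc⟩ := h
  exact ⟨c, hc.trans (mul_comm _ _)⟩

lemma norm_tw_le {𝔣 : ℐ} (χ : PChar 𝔣) {𝔟 : ℐ} (h𝔟 : 𝔟 ≠ ⊥) (α : K) :
    ‖tw χ 𝔟 α‖ ≤ 1 := by
  by_cases h : α ≠ 0 ∧ ∃ 𝔫 : ℐ, spanSingleton (𝓞 K)⁰ α =
    𝔫 * (𝔟 : ℱ)
  · obtain ⟨h0, 𝔫, h⟩ := h
    rw [tw_eq χ h𝔟 h0 h]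
    refine χ.norm_le_one ?_
    rintro rfl
    rw [coeIdeal_bot, zero_mul, spanSingleton_eq_zero_iff] at h
    exact h0 h
  · rw [tw, dif_neg h]; simp

lemma finite_support_ideal (J : ℱˣ) {g : 𝓜 → ℂ}
    (hc : HasCompactSupport g) :
    (Function.support fun γ : {γ : K // γ ∈ J.1} => g (𝓔 γ)).Finite := by
  have h1 := ZSpan.setFinite_inter (fractionalIdealLatticeBasis K J) hc.isCompact.isBounded
  refine Set.Finite.of_finite_image (f := fun γ : {γ : K // γ ∈ J.1} => 𝓔 γ.1)
    (h1.subset ?_) fun x _ y _ h => Subtype.ext (mixedEmbedding_injective K h)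
  rintro _ ⟨γ, hγ, rfl⟩
  refine ⟨subset_tsupport _ hγ, ?_⟩
  rw [SetLike.mem_coe, mem_span_fractionalIdealLatticeBasis]
  exact ⟨γ.1, γ.2, rfl⟩

lemma mem_of_mul_mem {𝔣 𝔟 : ℐ} (h𝔟 : 𝔟 ≠ ⊥) {j x : 𝓞 K}
    (hj : 𝔟 * 𝔣 ⊔ span {j} = 𝔟) (h : x * j ∈ 𝔟 * 𝔣) : x ∈ 𝔣 := by
  have h1 : 𝔟 * span {x} ≤ 𝔟 * 𝔣 := by
    conv_lhs => rw [← hj]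
    rw [Ideal.sup_mul, span_singleton_mul_span_singleton, mul_comm j]
    refine sup_le mul_le_left ?_
    rwa [span_singleton_le_iff_mem]
  rw [← span_singleton_le_iff_mem, ← dvd_iff_le]
  rw [← dvd_iff_le] at h1
  exact (mul_dvd_mul_iff_left h𝔟).1 h1

/-- Decomposition of `𝔟` into classes modulo `𝔟 𝔣`. -/
def cosetEquiv {𝔣 𝔟 : ℐ} (h𝔣 : 𝔣 ≠ ⊥) (h𝔟 : 𝔟 ≠ ⊥) (j : 𝓞 K)
    (hj : 𝔟 * 𝔣 ⊔ span {j} = 𝔟) :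
    (𝓞 K ⧸ 𝔣) × {γ : K // γ ∈ (fU (𝔟 * 𝔣) (mul_ne_zero h𝔟 h𝔣)).1} ≃
      {α : K // α ∈ (fU 𝔟 h𝔟).1} :=
  Equiv.ofBijective (fun p => ⟨((j * p.1.out : 𝓞 K) : K) + p.2.1, by
    obtain ⟨a, ha, hap⟩ := exists_of_mem_fU p.2.2
    rw [← hap, ← map_add, mem_fU]
    refine add_mem (mul_mem_right _ _ ?_) (mul_le_left ha)
    rw [← hj]; exact mem_sup_right (mem_span_singleton_self _)⟩) <| by
    constructor
    · rintro ⟨c, γ⟩ ⟨c', γ'⟩ h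
      obtain ⟨a, ha, hap⟩ := exists_of_mem_fU γ.2
      obtain ⟨a', ha', hap'⟩ := exists_of_mem_fU γ'.2
      have h1 : ((j * c.out : 𝓞 K) : K) + γ.1 = ((j * c'.out : 𝓞 K) : K) + γ'.1 :=
        congrArg Subtype.val h
      rw [← hap, ← hap', ← map_add, ← map_add] at h1
      have h2 : j * c.out + a = j * c'.out + a' := RingOfIntegers.coe_injective h1
      have h3 : c = c' := by
        rw [← mk_out c, ← mk_out c', Ideal.Quotient.eq]
        refine mem_of_mul_mem h𝔟 hj ?_
        rw [show (c.out - c'.out) * j = a' - a by linear_combination h2]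
        exact sub_mem ha' ha
      subst h3
      have h4 : a = a' := by linear_combination h2
      subst h4
      exact Prod.ext rfl (Subtype.ext (hap.symm.trans hap'))
    · rintro ⟨α, hα⟩
      obtain ⟨a, ha, rfl⟩ := exists_of_mem_fU hα
      rw [← hj, Submodule.mem_sup] at ha
      obtain ⟨b, hb, d, hd, rfl⟩ := ha
      obtain ⟨x, rfl⟩ := Ideal.mem_span_singleton'.1 hd
      have h1 : j * (x - (Ideal.Quotient.mk 𝔣 x).out) ∈ 𝔟 * 𝔣 := by
        refine Ideal.mul_mem_mul ?_ ?_
        · rw [← hj]; exact mem_sup_right (mem_span_singleton_self _)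
        · rw [← Ideal.Quotient.eq, mk_out]
      refine ⟨(Ideal.Quotient.mk 𝔣 x, ⟨((j * (x - (Ideal.Quotient.mk 𝔣 x).out) + b : 𝓞 K) : K),
        mem_fU.2 (add_mem h1 hb)⟩), Subtype.ext ?_⟩
      change ((_ : 𝓞 K) : K) + ((_ : 𝓞 K) : K) = _
      rw [← map_add]
      congr 1
      ring

lemma exp_eq_one_of_range {q : ℚ} (hq : q ∈ (algebraMap ℤ ℚ).range) :
    cexp (2 * π * I * ((q : ℝ) : ℂ)) = 1 := by
  obtain ⟨m, rfl⟩ := hq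
  rw [exp_eq_one_iff]
  exact ⟨m, by simp; ring⟩

lemma exp_trace_eq_one {J : ℱˣ} {β γ : K}
    (hβ : β ∈ FractionalIdeal.dual ℤ ℚ J.1) (hγ : γ ∈ J.1) :
    cexp (2 * π * I * ((trV K (𝓔 (β * γ)) : ℝ) : ℂ)) = 1 := by
  rw [trV_mixedEmbedding]
  exact exp_eq_one_of_range ((mem_dual J.ne_zero).1 hβ γ hγ)

/-- The additive character `c ↦ e(tr(β j c))` of `𝓞 / 𝔣`, for `β` dual to `𝔟 𝔣` and `j ∈ 𝔟`. -/
def dualChar {𝔣 𝔟 : ℐ} (h : 𝔟 * 𝔣 ≠ ⊥) {j : 𝓞 K} (hj : j ∈ 𝔟) (β : K)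
    (hβ : β ∈ FractionalIdeal.dual ℤ ℚ (fU (𝔟 * 𝔣) h).1) : AddChar (𝓞 K ⧸ 𝔣) ℂ :=
  have key : ∀ x y z : 𝓞 K, x - (y + z) ∈ 𝔣 →
      cexp (2 * π * I * ((trV K (𝓔 (β * (j * x : 𝓞 K))) : ℝ) : ℂ)) =
      cexp (2 * π * I * ((trV K (𝓔 (β * (j * y : 𝓞 K))) : ℝ) : ℂ)) *
      cexp (2 * π * I * ((trV K (𝓔 (β * (j * z : 𝓞 K))) : ℝ) : ℂ)) := by
    intro x y z hxy
    have h1 := exp_trace_eq_one hβ (mem_fU.2 (Ideal.mul_mem_mul hj hxy))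
    have h2 : (β * (j * x : 𝓞 K) : K) = β * (j * y : 𝓞 K) + β * (j * z : 𝓞 K) +
        β * (j * (x - (y + z)) : 𝓞 K) := by
      push_cast; ring
    rw [h2, map_add, map_add, map_add, map_add, ofReal_add, ofReal_add, mul_add,
      mul_add, exp_add, exp_add, h1, mul_one]
  { toFun := fun c =>
      cexp (2 * π * I * ((trV K (𝓔 (β * (j * c.out : 𝓞 K))) : ℝ) : ℂ))
    map_zero_eq_one' := by
      have := key (0 : 𝓞 K ⧸ 𝔣).out 0 0 (by
        rw [add_zero, ← Ideal.Quotient.eq, mk_out, map_zero])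
      simpa using this
    map_add_eq_mul' := fun c d => key _ _ _ (by
      rw [← Ideal.Quotient.eq, map_add, mk_out, mk_out,
        mk_out]) }

lemma sameSign_of_sameSign {s : 𝓜} {x y : K} (hx : SameSign s x) (hy : SameSign s y) :
    SameSign (𝓔 x) y := fun w =>
  pos_of_mul_pos_left (b := s.1 w * s.1 w)
    (by have := mul_pos (hx w) (hy w); nlinarith) (mul_self_nonneg _)

lemma enorm_tsum_sub_le {ι : Type*} (a : ι) {p : ι → Prop} (hp : ∀ i, p i ↔ i ≠ a) (F : ι → ℂ)
    (hF : ∑' i : {i // p i}, ‖F i‖ₑ ≠ ⊤) :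
    Summable F ∧ ‖∑' i, F i - F a‖ₑ ≤ ∑' i : {i // p i}, ‖F i‖ₑ := by
  have h1 : Summable fun i : {i // p i} => F i := by
    refine Summable.of_norm ?_
    have := ENNReal.summable_toReal hF
    simpa using this
  have h2 : Summable F := by
    let e : {i // i ∉ ({a} : Finset ι)} ≃ {i // p i} :=
      Equiv.subtypeEquivRight fun i => by rw [hp, Finset.mem_singleton]
    exact (Finset.summable_compl_iff {a}).1 (e.summable_iff.2 h1)
  refine ⟨h2, ?_⟩
  have h3 : ∑' i, F i - F a = ∑' i : {i // p i}, F i := by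
    rw [sub_eq_iff_eq_add', h2.tsum_eq_add_tsum_ite a]
    congr 1
    rw [← Function.Injective.tsum_eq (g := ((↑) : {i // p i} → ι)) Subtype.val_injective]
    · refine tsum_congr fun i => ?_
      rw [if_neg ((hp _).1 i.2)]
    · intro i hi
      have : i ≠ a := fun h => hi (if_pos h)
      exact ⟨⟨i, (hp i).2 this⟩, rfl⟩
  rw [h3]
  exact enorm_tsum_le_tsum_enorm

/-- The value of `χ` on totally `s`-signed elements, for unramified `χ`. -/
def sgnVal {𝔣 : ℐ} (χ : PChar 𝔣) (𝔟 : ℐ) (s : 𝓜) : ℂ :=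
  if h : 𝔣 = ⊤ ∧ ∃ j : 𝓞 K, j ∈ 𝔟 ∧ j ≠ 0 ∧ SameSign s (j : K) then tw χ 𝔟 (h.2.choose : K) else 0

lemma sgnVal_eq {𝔣 : ℐ} (χ : PChar 𝔣) {𝔟 : ℐ} (h𝔟 : 𝔟 ≠ ⊥) {s : 𝓜}
    (h𝔣 : 𝔣 = ⊤) {j : 𝓞 K} (hj : j ∈ 𝔟) (hj0 : j ≠ 0) (hs : SameSign s (j : K)) :
    sgnVal χ 𝔟 s = tw χ 𝔟 (j : K) := by
  have hm : ∀ x ∈ 𝔟, x ∈ 𝔟 * 𝔣 := by rw [h𝔣, Ideal.mul_top]; exact fun x h => h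
  have h0 : 𝔣 ≠ ⊥ := by rw [h𝔣]; exact top_ne_bot
  have h : 𝔣 = ⊤ ∧ ∃ j : 𝓞 K, j ∈ 𝔟 ∧ j ≠ 0 ∧ SameSign s (j : K) := ⟨h𝔣, j, hj, hj0, hs⟩
  rw [sgnVal, dif_pos h]
  obtain ⟨h1, h2, h3⟩ := h.2.choose_spec
  obtain ⟨𝔫, hn⟩ := exists_mul_of_mem h1
  obtain ⟨𝔫', hn'⟩ := exists_mul_of_mem hj
  rw [tw_eq' χ h𝔟 h2 hn, tw_eq' χ h𝔟 hj0 hn']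
  exact χ.eq_of_sub_mem h𝔟 h0 h2 hj0 hn hn' (hm _ (sub_mem h1 hj))
    (sameSign_of_sameSign h3 hs)

lemma absNorm_fU {𝔟 : ℐ} (h : 𝔟 ≠ ⊥) :
    (FractionalIdeal.absNorm (fU 𝔟 h).1 : ℝ) = absNorm 𝔟 := by
  rw [fU_val, coeIdeal_absNorm]
  simp

theorem twisted_poisson {𝔣 𝔟 : ℐ} (χ : PChar 𝔣) (h𝔣 : 𝔣 ≠ ⊥) (h𝔟 : 𝔟 ≠ ⊥)
    {h : 𝓜 → ℂ} (hh : Continuous h) (hc : HasCompactSupport h)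
    (hp : ∀ v, h v ≠ 0 → 𝒩 v ≠ 0 ∧ ∀ w, 0 < v.1 w)
    {U : 𝓜 → ℝ≥0∞} (hU : ∀ ξ, ‖FT h ξ‖ₑ ≤ U ξ)
    {s : 𝓜} (hs : 𝒩 s ≠ 0) :
    ‖((cov K * absNorm (𝔟 * 𝔣) * 𝒩 s : ℝ) : ℂ) *
        ∑' α : {α : K // α ∈ (fU 𝔟 h𝔟).1}, tw χ 𝔟 α * h (s * 𝓔 α) -
        sgnVal χ 𝔟 s * FT h 0‖ₑ ≤
      ofReal √(absNorm 𝔣) *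
        ∑' β : {β : {β : K // β ∈ FractionalIdeal.dual ℤ ℚ (fU (𝔟 * 𝔣) (mul_ne_zero h𝔟 h𝔣)).1} //
          β.1 ≠ 0}, U (s⁻¹ * 𝓔 β.1.1) := by
  have hQf : Finite (𝓞 K ⧸ 𝔣) := Ideal.finiteQuotientOfFreeOfNeBot 𝔣 h𝔣
  let _ : Fintype (𝓞 K ⧸ 𝔣) := ofFinite _
  have hB : 𝔟 * 𝔣 ≠ ⊥ := mul_ne_zero h𝔟 h𝔣
  have hsw : ∀ w, s.1 w ≠ 0 := by
    intro w hw
    apply hs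
    rw [norm_eq_prod, prod_eq_zero (mem_univ w) (by simp [hw]), zero_mul]
  obtain ⟨j, hj, hj0, hjs⟩ : ∃ j : 𝓞 K, 𝔟 * 𝔣 ⊔ span {j} = 𝔟 ∧ j ≠ 0 ∧ SameSign s (j : K) := by
    obtain ⟨a, ha⟩ := IsDedekindDomain.exists_sup_span_eq (I := 𝔟 * 𝔣) (J := 𝔟) mul_le_left hB
    obtain ⟨j, hja, hj0, hjs⟩ := exists_sameSign_sub_mem s hsw hB a
    refine ⟨j, ?_, hj0, hjs⟩
    refine Eq.trans ?_ ha
    refine le_antisymm (sup_le le_sup_left ?_) (sup_le le_sup_left ?_) <;>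
      rw [span_singleton_le_iff_mem]
    · rw [← sub_add_cancel j a]
      exact add_mem (mem_sup_left hja)
        (mem_sup_right (mem_span_singleton_self _))
    · rw [← sub_sub_cancel j a]
      exact sub_mem (mem_sup_right (mem_span_singleton_self _))
        (mem_sup_left hja)
  have hj𝔟 : j ∈ 𝔟 := by
    rw [← hj]; exact mem_sup_right (mem_span_singleton_self _)
  obtain ⟨𝔧, h𝔧⟩ := exists_mul_of_mem hj𝔟
  have h𝔧0 : 𝔧 ≠ ⊥ := by
    rintro rfl
    rw [Ideal.bot_mul, span_singleton_eq_bot] at h𝔧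
    exact hj0 h𝔧
  let ψ : 𝓞 K ⧸ 𝔣 → ℂ := fun c => χ.resChar h𝔣 c * χ.toFun 𝔧
  let D := {β : K // β ∈ FractionalIdeal.dual ℤ ℚ (fU (𝔟 * 𝔣) hB).1}
  let θ : D → AddChar (𝓞 K ⧸ 𝔣) ℂ := fun β => dualChar hB hj𝔟 β.1 β.2
  let G : D → ℂ := fun β => ∑ c, ψ c * θ β c
  have hG : ∀ β, ‖G β‖ ≤ √(absNorm 𝔣) := by
    intro β
    have h1 : G β = (∑ c, χ.resChar h𝔣 c * θ β c) * χ.toFun 𝔧 := by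
      rw [sum_mul]
      exact sum_congr rfl fun c _ => by ring
    rw [h1, norm_mul]
    have h2 := χ.gauss_bound h𝔣 (θ β)
    rw [← Nat.card_eq_fintype_card] at h2
    calc _ ≤ √(Nat.card (𝓞 K ⧸ 𝔣) : ℝ) * 1 :=
          mul_le_mul h2 (χ.norm_le_one h𝔧0) (norm_nonneg _) (by positivity)
      _ = _ := by rw [mul_one]; rfl
  have hN0 : (0 : ℝ) < √(absNorm 𝔣) := by
    rw [Real.sqrt_pos]
    exact_mod_cast Nat.pos_of_ne_zero (by rwa [Ne, absNorm_eq_zero_iff])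
  let D' := {β : D // β.1 ≠ 0}
  by_cases htop : ∑' β : D', U (s⁻¹ * 𝓔 β.1.1) = ⊤
  · rw [htop, ENNReal.mul_top (by simpa using hN0)]
    exact le_top
  let F : D → ℂ := fun β => FT h (s⁻¹ * 𝓔 β.1)
  let z0 : D := ⟨0, FractionalIdeal.zero_mem _⟩
  have hz : ∀ β : D, β.1 ≠ 0 ↔ β ≠ z0 := fun β => by
    rw [Ne, Ne, Subtype.ext_iff]
  have hFfin : ∑' β : D', ‖F β.1‖ₑ ≠ ⊤ :=
    ne_top_of_le_ne_top htop (tsum_le_tsum fun β => hU _)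
  have hFs := (enorm_tsum_sub_le z0 hz F hFfin).1
  have hGF : ∑' β : D', ‖G β.1 * F β.1‖ₑ ≤
      ofReal √(absNorm 𝔣) * ∑' β : D', U (s⁻¹ * 𝓔 β.1.1) := by
    rw [← ENNReal.tsum_mul_left]
    refine tsum_le_tsum fun β => ?_
    rw [enorm_mul]
    gcongr
    · rw [← ofReal_norm]
      exact ENNReal.ofReal_le_ofReal (hG _)
    · exact hU _
  have hkey := (enorm_tsum_sub_le z0 hz (fun β => G β * F β)
    (ne_top_of_le_ne_top (ENNReal.mul_ne_top ENNReal.ofReal_ne_top htop) hGF)).2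
  refine le_trans (le_of_eq ?_) (hkey.trans hGF)
  congr 2
  · -- the Poisson identity
    let g : 𝓞 K ⧸ 𝔣 → 𝓜 → ℂ := fun c v =>
      h (s * (𝓔 (j * c.out : 𝓞 K) + v))
    have hgc : ∀ c, Continuous (g c) := fun c => by fun_prop
    have hgs : ∀ c, HasCompactSupport (g c) := fun c =>
      hc.comp_homeomorph ((Homeomorph.addLeft (𝓔 ((j * c.out : 𝓞 K) : K))).trans
        (mulHomeo s hs))
    have hFT : ∀ c (β : D), FT (g c) (𝓔 β.1) =
        θ β c * (𝒩 s : ℂ)⁻¹ * F β := by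
      intro c β
      rw [FT_shift_mul h hs, ← map_mul]
      rfl
    have hθs : ∀ c, Summable fun β : D => θ β c * F β := by
      intro c
      refine Summable.of_norm_bounded hFs.norm fun β => ?_
      rw [norm_mul]
      have : ‖θ β c‖ = 1 := by
        change ‖cexp _‖ = 1
        rw [norm_exp]
        simp
      rw [this, one_mul]
    have hP : ∀ c, ((cov K * absNorm (𝔟 * 𝔣) * 𝒩 s : ℝ) : ℂ) *
        ∑' γ : {γ : K // γ ∈ (fU (𝔟 * 𝔣) hB).1}, g c (𝓔 γ) =
        ∑' β : D, θ β c * F β := by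
      intro c
      have h1 := poisson_ideal (fU (𝔟 * 𝔣) hB) (g c) (hgc c) (hgs c) (by
        simp only [hFT]
        refine ((hθs c).mul_left (𝒩 s : ℂ)⁻¹).congr fun β => by ring)
      simp only [hFT] at h1
      rw [absNorm_fU] at h1
      have h2 : ∀ β : D, θ β c * (𝒩 s : ℂ)⁻¹ * F β =
        (𝒩 s : ℂ)⁻¹ * (θ β c * F β) := fun β => by ring
      have h3 : ∑' β : D, θ β c * (𝒩 s : ℂ)⁻¹ * F β =
        (𝒩 s : ℂ)⁻¹ * ∑' β : D, (θ β c * F β) := by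
        rw [← tsum_mul_left]
        exact tsum_congr h2
      have h4 := h1.trans h3
      have hsC : (𝒩 s : ℂ) ≠ 0 := ofReal_ne_zero.2 hs
      rw [← div_eq_inv_mul, eq_div_iff hsC] at h4
      rw [← h4]
      push_cast
      ring
    have hfin : (Function.support fun α : {α : K // α ∈ (fU 𝔟 h𝔟).1} =>
        tw χ 𝔟 α * h (s * 𝓔 α)).Finite :=
      (finite_support_ideal (fU 𝔟 h𝔟) (g := fun v => h (s * v))
        (hc.comp_homeomorph (mulHomeo s hs))).subset fun α hα => right_ne_zero_of_mul hα
    have hterm : ∀ c (γ : {γ : K // γ ∈ (fU (𝔟 * 𝔣) hB).1}),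
        tw χ 𝔟 (cosetEquiv h𝔣 h𝔟 j hj (c, γ)).1 *
          h (s * 𝓔 (cosetEquiv h𝔣 h𝔟 j hj (c, γ)).1) =
        ψ c * g c (𝓔 γ) := by
      intro c γ
      obtain ⟨b, hb, hbγ⟩ := exists_of_mem_fU γ.2
      have h1 : ((cosetEquiv h𝔣 h𝔟 j hj (c, γ)).1 : K) = ((j * c.out : 𝓞 K) : K) + γ.1 := rfl
      rw [h1]
      simp only [g]
      rw [← map_add]
      by_cases h0 : h (s * 𝓔 (((j * c.out : 𝓞 K) : K) + γ.1)) = 0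
      · rw [h0, mul_zero, mul_zero]
      congr 1
      rw [← hbγ, ← map_add] at h0 ⊢
      obtain ⟨hn, hpos⟩ := hp _ h0
      have ha0 : j * c.out + b ≠ 0 := by
        intro h
        apply hn
        rw [h]
        simp
      have hab : j * c.out + b ∈ 𝔟 := add_mem (mul_mem_right _ _ hj𝔟) (mul_le_left hb)
      obtain ⟨𝔫, h𝔫⟩ := exists_mul_of_mem hab
      rw [tw_eq' χ h𝔟 ha0 h𝔫, χ.toFun_eq_resChar h𝔣 h𝔟 (c := c.out) hj0 ha0 h𝔧 h𝔫,
        mk_out]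
      · refine sameSign_of_sameSign (s := s) (fun w => ?_) hjs
        have := hpos w
        rw [mul_comm]
        exact this
      · rwa [show j * c.out + b - c.out * j = b by ring]
    rw [← (cosetEquiv h𝔣 h𝔟 j hj).tsum_eq, Summable.tsum_prod, tsum_fintype, mul_sum]
    · simp only [hterm]
      have h1 : ∀ c, ((cov K * absNorm (𝔟 * 𝔣) * 𝒩 s : ℝ) : ℂ) *
        ∑' γ : {γ : K // γ ∈ (fU (𝔟 * 𝔣) hB).1}, ψ c * g c (𝓔 γ) =
        ∑' β : D, ψ c * (θ β c * F β) := by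
        intro c
        rw [tsum_mul_left, tsum_mul_left, ← hP]
        ring
      simp only [h1]
      rw [← Summable.tsum_finsetSum fun c _ => (hθs c).mul_left _]
      refine tsum_congr fun β => ?_
      simp only [G, sum_mul, mul_assoc]
    · exact (Equiv.summable_iff (cosetEquiv h𝔣 h𝔟 j hj)).2 (summable_of_hasFiniteSupport hfin)
  · have hF0 : F z0 = FT h 0 := by
      change FT h (s⁻¹ * 𝓔 (0 : K)) = _
      rw [map_zero, mul_zero]
    rw [hF0]
    congr 1
    have hθ0 : ∀ c, θ z0 c = 1 := by
      intro c
      change cexp (2 * π * I *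
        ((trV K (𝓔 ((0 : K) * (j * c.out : 𝓞 K))) : ℝ) : ℂ)) = 1
      simp
    by_cases ht : 𝔣 = ⊤
    · rw [sgnVal_eq χ h𝔟 ht hj𝔟 hj0 hjs, tw_eq' χ h𝔟 hj0 h𝔧]
      have : Subsingleton (𝓞 K ⧸ 𝔣) := Ideal.Quotient.subsingleton_iff.2 ht
      simp only [G, ψ]
      rw [Fintype.sum_subsingleton _ 1, map_one, hθ0, one_mul, mul_one]
    · rw [sgnVal, dif_neg fun h => ht h.1]
      have h1 : G z0 =
          (∑ c, χ.resChar h𝔣 c * θ z0 c) * χ.toFun 𝔧 := by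
        rw [sum_mul]
        exact sum_congr rfl fun c _ => by ring
      rw [h1, χ.gauss_eq_zero h𝔣 _ ?_, zero_mul]
      intro hprim
      have : Nontrivial (𝓞 K ⧸ 𝔣) := Ideal.Quotient.nontrivial_iff.2 ht
      refine hprim one_ne_zero ?_
      ext c
      rw [AddChar.mulShift_apply, hθ0, AddChar.one_apply]

/-- The invariant measure on the fundamental cone. -/
def coneHaar (K : Type*) [Field K] [NumberField K] : Measure (mixedSpace K) :=
  (mulHaar K).restrict (fundamentalCone K)

lemma measurePreserving_cone {s : 𝓜} (hs : 𝒩 s ≠ 0)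
    (h : ∀ v, s * v ∈ fundamentalCone K ↔ v ∈ fundamentalCone K) :
    MeasurePreserving (fun v => s * v) (coneHaar K) (coneHaar K) := by
  have h1 := (measurePreserving_mul_mixed s hs).restrict_preimage (measurableSet_fundamentalCone K)
  have h2 : (fun v => s * v) ⁻¹' (fundamentalCone K) = fundamentalCone K := by
    ext v; exact h v
  rw [h2] at h1
  exact h1

lemma measurePreserving_cone_smul {c : ℝ} (hc : c ≠ 0) :
    MeasurePreserving (fun v => c • v) (coneHaar K) (coneHaar K) := by
  have h1 : (fun v : 𝓜 => c • v) = fun v => (c • (1 : 𝓜)) * v := by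
    funext v; rw [smul_one_mul]
  rw [h1]
  refine measurePreserving_cone ?_ fun v => ?_
  · rw [mixedEmbedding.norm_smul, map_one, mul_one]
    exact pow_ne_zero _ (abs_ne_zero.2 hc)
  · rw [smul_one_mul]
    exact smul_mem_iff_mem hc

lemma measurePreserving_cone_sign {e : 𝓜} (he : ∀ w, normAtPlace w e = 1) :
    MeasurePreserving (fun v => e * v) (coneHaar K) (coneHaar K) := by
  have h1 : ∀ v w, normAtPlace w (e * v) = normAtPlace w v := fun v w => by
    rw [map_mul, he, one_mul]
  refine measurePreserving_cone ?_ fun v => ⟨fun h => mem_of_normAtPlace_eq h fun w => (h1 v w).symm,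
    fun h => mem_of_normAtPlace_eq h (h1 v)⟩
  rw [mixedEmbedding.norm_apply]
  simp [he]

lemma ae_cone_norm_pos : ∀ᵐ v ∂(coneHaar K), 0 < 𝒩 v :=
  (ae_restrict_iff' (measurableSet_fundamentalCone K)).2
    (.of_forall fun _ h => norm_pos_of_mem h)

lemma measurable_log_norm : Measurable fun v : 𝓜 => log (𝒩 v) :=
  Real.measurable_log.comp measurable_norm_mixed

/-- The image of the cone measure under `log ∘ norm`. -/
def logNormMeasure (K : Type*) [Field K] [NumberField K] : Measure ℝ :=
  (coneHaar K).map fun v => log (mixedEmbedding.norm v)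

lemma logNormMeasure_add (a : ℝ) : (logNormMeasure K).map (fun x => a + x) = logNormMeasure K := by
  have hn : (0 : ℝ) < finrank ℚ K := Nat.cast_pos.2 finrank_pos
  set c : ℝ := exp (a / finrank ℚ K) with hc
  have hc0 : c ≠ 0 := (exp_pos _).ne'
  have h2 := (measurePreserving_cone_smul (K := K) hc0).map_eq
  rw [logNormMeasure, Measure.map_map (measurable_const_add a) measurable_log_norm]
  conv_rhs => rw [← h2, Measure.map_map measurable_log_norm (measurePreserving_cone_smul hc0).measurable]
  refine Measure.map_congr ?_
  filter_upwards [ae_cone_norm_pos] with v hv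
  simp only [Function.comp_apply]
  rw [mixedEmbedding.norm_smul, Real.log_mul (pow_ne_zero _ (abs_ne_zero.2 hc0)) hv.ne',
    Real.log_pow, Real.log_abs, hc, Real.log_exp]
  congr 1
  field_simp

lemma logNormMeasure_Icc_lt_top (a : ℝ) : logNormMeasure K (Set.Icc (-a) 0) < ⊤ := by
  rw [logNormMeasure, Measure.map_apply measurable_log_norm measurableSet_Icc, coneHaar,
    Measure.restrict_apply (measurable_log_norm measurableSet_Icc), mulHaar,
    withDensity_apply _ ((measurable_log_norm measurableSet_Icc).inter
      (measurableSet_fundamentalCone K))]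
  have hv : volume (normLeOne K) < ⊤ := (isBounded_normLeOne K).measure_lt_top
  have hsub : ((fun v : 𝓜 => log (𝒩 v)) ⁻¹' Set.Icc (-a) 0) ∩
      fundamentalCone K ⊆ normLeOne K := by
    rintro v ⟨h1, h2⟩
    refine ⟨h2, ?_⟩
    have h3 := norm_pos_of_mem h2
    exact (Real.log_nonpos_iff h3.le).1 h1.2
  refine lt_of_le_of_lt (setLIntegral_mono' (g := fun _ => ofReal (exp a))
    ((measurable_log_norm measurableSet_Icc).inter (measurableSet_fundamentalCone K)) ?_) ?_
  · rintro v ⟨h1, h2⟩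
    have h3 := norm_pos_of_mem h2
    refine ENNReal.ofReal_le_ofReal ?_
    rw [inv_le_comm₀ h3 (exp_pos _), ← Real.exp_neg]
    exact (Real.le_log_iff_exp_le h3).1 h1.1
  · rw [setLIntegral_const]
    exact ENNReal.mul_lt_top ENNReal.ofReal_lt_top ((measure_mono hsub).trans_lt hv)

lemma exists_logNormMeasure : ∃ c : ℝ≥0, logNormMeasure K = c • (volume : Measure ℝ) := by
  have h1 : Measure.IsAddLeftInvariant (logNormMeasure K) := ⟨logNormMeasure_add⟩
  have h2 : IsFiniteMeasureOnCompacts (logNormMeasure K) := by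
    refine ⟨fun {s} hs => ?_⟩
    obtain ⟨R, hR⟩ := hs.isBounded.subset_closedBall 0
    rw [Real.closedBall_eq_Icc] at hR
    refine (measure_mono hR).trans_lt ?_
    have h3 : (fun x => -R + x) ⁻¹' Set.Icc (-(2 * R)) 0 = Set.Icc (0 - R) (0 + R) := by
      ext x
      simp only [Set.mem_preimage, mem_Icc]
      constructor <;> rintro ⟨h, h'⟩ <;> constructor <;> linarith
    rw [← h3, ← Measure.map_apply (measurable_const_add _) measurableSet_Icc, logNormMeasure_add]
    exact logNormMeasure_Icc_lt_top _
  exact ⟨_, Measure.isAddLeftInvariant_eq_smul _ _⟩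

/-- The constant in `∫_C F(log N v) dμ(v) = m ∫ F(x) dx`. -/
def coneConst (K : Type*) [Field K] [NumberField K] : ℝ≥0 := (exists_logNormMeasure (K := K)).choose

lemma logNormMeasure_eq : logNormMeasure K = coneConst K • (volume : Measure ℝ) :=
  (exists_logNormMeasure (K := K)).choose_spec

lemma integral_cone_log {F : ℝ → ℂ} (hF : Measurable F) :
    ∫ v, F (log (𝒩 v)) ∂(coneHaar K) = coneConst K * ∫ x, F x := by
  have h1 := integral_map (μ := coneHaar K) measurable_log_norm.aemeasurable (f := F)
    hF.aestronglyMeasurable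
  rw [← h1]
  change ∫ x, F x ∂(logNormMeasure K) = _
  rw [logNormMeasure_eq, integral_smul_nnreal_measure]
  exact NNReal.smul_def _ _

lemma lintegral_cone_log {F : ℝ → ℝ≥0∞} (hF : Measurable F) :
    ∫⁻ v, F (log (𝒩 v)) ∂(coneHaar K) = coneConst K * ∫⁻ x, F x := by
  have h1 := lintegral_map (μ := coneHaar K) hF measurable_log_norm
  rw [← h1]
  change ∫⁻ x, F x ∂(logNormMeasure K) = _
  rw [logNormMeasure_eq, lintegral_smul_measure]
  rfl

/-- Rescaling inside the cone by a real factor. -/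
lemma integral_cone_scale (F : ℝ → 𝓜 → ℂ) (hF : ∀ r (c : ℝ) v, 0 < c → F r (c • v) = F r v)
    {l : ℝ} (hl : 0 < l) :
    ∫ v, F (l * 𝒩 v) v ∂(coneHaar K) =
      ∫ v, F (𝒩 v) v ∂(coneHaar K) := by
  have hn : (finrank ℚ K : ℝ) ≠ 0 := (Nat.cast_pos.2 finrank_pos).ne'
  set c : ℝ := l ^ ((finrank ℚ K : ℝ)⁻¹) with hc
  have hc0 : 0 < c := Real.rpow_pos_of_pos hl _
  have h1 := measurePreserving_cone_smul (K := K) hc0.ne'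
  refine Eq.trans ?_ (h1.integral_comp' (f := (Homeomorph.smulOfNeZero c hc0.ne').toMeasurableEquiv)
    (fun v => F (𝒩 v) v))
  refine integral_congr_ae (.of_forall fun v => ?_)
  change _ = F (𝒩 (c • v)) (c • v)
  rw [hF _ _ _ hc0, mixedEmbedding.norm_smul, abs_of_pos hc0, hc, ← Real.rpow_mul_natCast hl.le,
    inv_mul_cancel₀ hn, Real.rpow_one]

/-- Test functions: continuous, compactly supported in the totally positive region. -/
structure Adm (h : 𝓜 → ℂ) : Prop where
  cont : Continuous h
  cpt : HasCompactSupport h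
  pos : ∀ v, h v ≠ 0 → 𝒩 v ≠ 0 ∧ ∀ w, 0 < v.1 w
  int : Integrable h (mulHaar K)

/-- Radial weights supported in `[a, b]` and bounded by the identity. -/
structure Wt (ω : ℝ → ℂ) (a b : ℝ) : Prop where
  meas : Measurable ω
  pos : 0 < a
  supp : ∀ r, ω r ≠ 0 → a ≤ r ∧ r ≤ b
  bound : ∀ r, 0 ≤ r → ‖ω r‖ ≤ r

lemma Wt.norm_le {ω : ℝ → ℂ} {a b : ℝ} (hω : Wt ω a b) (r : ℝ) : ‖ω r‖ ≤ |b| := by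
  by_cases h : ω r = 0
  · rw [h, norm_zero]; exact abs_nonneg _
  · have h1 := hω.supp r h
    exact (hω.bound r (hω.pos.le.trans h1.1)).trans (h1.2.trans (le_abs_self b))

lemma Adm.exists_norm_le {h : 𝓜 → ℂ} (hh : Adm h) :
    ∃ B : ℝ, ∀ v, h v ≠ 0 → 𝒩 v ≤ B := by
  have hcont : Continuous fun v : 𝓜 => 𝒩 v := by
    simp only [mixedEmbedding.norm_apply]
    exact continuous_finsetProd _ fun w _ => (continuous_normAtPlace w).pow _
  obtain ⟨B, hB⟩ := (hh.cpt.isCompact.image hcont).bddAbove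
  exact ⟨B, fun v hv => hB ⟨v, subset_tsupport _ hv, rfl⟩⟩

lemma absNorm_gen {𝔟 : ℐ} (h𝔟 : 𝔟 ≠ ⊥) (𝔫 : classOf (fU 𝔟 h𝔟)) :
    𝒩 (𝓔 (gen (fU 𝔟 h𝔟) 𝔫)) =
      absNorm 𝔫.1 * absNorm 𝔟 := by
  have h1 := congrArg FractionalIdeal.absNorm (span_gen (fU 𝔟 h𝔟) 𝔫)
  rw [absNorm_span_singleton, map_mul, fU_val, coeIdeal_absNorm,
    coeIdeal_absNorm] at h1
  rw [mixedEmbedding.norm_eq_norm, h1]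
  push_cast
  rfl

lemma ne_bot_of_classOf {A : ℱˣ} (𝔫 : classOf A) : 𝔫.1 ≠ ⊥ := by
  intro h
  have h1 := span_gen A 𝔫
  rw [h, coeIdeal_bot, zero_mul, spanSingleton_eq_zero_iff] at h1
  exact gen_ne_zero _ _ h1

lemma norm_emb_ne_zero {x : K} (hx : x ≠ 0) : 𝒩 (𝓔 x) ≠ 0 := by
  rw [mixedEmbedding.norm_eq_norm]
  simpa using hx

theorem primal_unfold {𝔣 𝔟 : ℐ} (χ : PChar 𝔣) (h𝔟 : 𝔟 ≠ ⊥) {h : 𝓜 → ℂ}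
    (hh : Adm h) {ω : ℝ → ℂ} {a b : ℝ} (hω : Wt ω a b) :
    Integrable (fun s => ω (absNorm 𝔟 * 𝒩 s) *
        ∑' α : {α : K // α ∈ (fU 𝔟 h𝔟).1}, tw χ 𝔟 α * h (s * 𝓔 α)) (coneHaar K) ∧
    (torsionOrder K : ℂ) * ∑' 𝔫 : classOf (fU 𝔟 h𝔟), χ.toFun 𝔫.1 *
        ∫ v, h v * ω (𝒩 v / absNorm 𝔫.1) ∂(mulHaar K) =
      ∫ s, ω (absNorm 𝔟 * 𝒩 s) *
        ∑' α : {α : K // α ∈ (fU 𝔟 h𝔟).1}, tw χ 𝔟 α * h (s * 𝓔 α) ∂(coneHaar K) := by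
  set A := fU 𝔟 h𝔟 with hA
  have hb0 : (0 : ℝ) < absNorm 𝔟 := by
    exact_mod_cast Nat.pos_of_ne_zero fun h => h𝔟 (absNorm_eq_zero_iff.1 h)
  let F : classOf A → 𝓜 → ℂ := fun 𝔫 s =>
    χ.toFun 𝔫.1 * (h (𝓔 (gen A 𝔫) * s) *
      ω (absNorm 𝔟 * 𝒩 s))
  let G : classOf A → 𝓜 → ℂ := fun 𝔫 v =>
    χ.toFun 𝔫.1 * (h v * ω (𝒩 v / absNorm 𝔫.1))
  have hn0 : ∀ 𝔫 : classOf A, (0 : ℝ) < absNorm 𝔫.1 := fun 𝔫 => by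
    exact_mod_cast Nat.pos_of_ne_zero fun h => ne_bot_of_classOf 𝔫 (absNorm_eq_zero_iff.1 h)
  have hg0 : ∀ 𝔫, 𝒩 (𝓔 (gen A 𝔫)) ≠ 0 := fun 𝔫 =>
    norm_emb_ne_zero (gen_ne_zero A 𝔫)
  have hFG : ∀ 𝔫 s, F 𝔫 s = G 𝔫 (𝓔 (gen A 𝔫) * s) := by
    intro 𝔫 s
    simp only [F, G]
    rw [map_mul, absNorm_gen h𝔟 𝔫, mul_assoc, mul_div_cancel_left₀ _ (hn0 𝔫).ne']
  have hGm : ∀ 𝔫, Measurable (G 𝔫) := fun 𝔫 =>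
    (hh.cont.measurable.mul (hω.meas.comp (measurable_norm_mixed.div_const _))).const_mul _
  have hGi : ∀ 𝔫, Integrable (G 𝔫) (mulHaar K) := fun 𝔫 =>
    (hh.int.mul_bdd (c := |b|) (hω.meas.comp (measurable_norm_mixed.div_const _)).aestronglyMeasurable
      (.of_forall fun v => hω.norm_le _)).const_mul _
  have hmp : ∀ 𝔫, MeasurePreserving (fun s => 𝓔 (gen A 𝔫) * s) (mulHaar K)
    (mulHaar K) := fun 𝔫 => measurePreserving_mul_mixed _ (hg0 𝔫)
  have hFe : ∀ 𝔫, F 𝔫 = G 𝔫 ∘ fun s => 𝓔 (gen A 𝔫) * s := fun 𝔫 =>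
    funext (hFG 𝔫)
  have hFm : ∀ 𝔫, Measurable (F 𝔫) := fun 𝔫 => by
    rw [hFe]; exact (hGm 𝔫).comp (hmp 𝔫).measurable
  have hFi : ∀ 𝔫, Integrable (F 𝔫) (mulHaar K) := fun 𝔫 => by
    rw [hFe]; exact (hmp 𝔫).integrable_comp_of_integrable (hGi 𝔫)
  have hint : ∀ 𝔫, ∫ v, F 𝔫 v ∂(mulHaar K) = ∫ v, G 𝔫 v ∂(mulHaar K) := fun 𝔫 => by
    simp only [hFG]
    exact integral_comp_mul_mulHaar (G 𝔫) (hg0 𝔫)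
  obtain ⟨B, hB⟩ := hh.exists_norm_le
  have hfin : {𝔫 : classOf A | F 𝔫 ≠ 0}.Finite := by
    refine Set.Finite.of_finite_image (f := fun 𝔫 : classOf A => 𝔫.1)
      ((finite_setOfPred_absNorm_le ⌊B / a⌋₊).subset ?_) Subtype.val_injective.injOn
    rintro _ ⟨𝔫, h𝔫, rfl⟩
    obtain ⟨s, hs⟩ := Function.ne_iff.1 h𝔫
    rw [hFG] at hs
    have h1 := left_ne_zero_of_mul (right_ne_zero_of_mul hs)
    have h2 := (hω.supp _ (right_ne_zero_of_mul (right_ne_zero_of_mul hs))).1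
    have h3 := hB _ h1
    refine le_floor ?_
    rw [le_div_iff₀ (hn0 𝔫)] at h2
    rw [le_div_iff₀ hω.pos, mul_comm]
    exact h2.trans h3
  have hsum : ∑' p : classOf A × (𝓞 K)ˣ, ∫⁻ s in fundamentalCone K, ‖F p.1 (p.2 • s)‖ₑ ∂(mulHaar K)
      ≠ ⊤ := by
    rw [ENNReal.tsum_prod']
    have h1 : ∀ 𝔫, ∑' u : (𝓞 K)ˣ, ∫⁻ s in fundamentalCone K, ‖F 𝔫 (u • s)‖ₑ ∂(mulHaar K) =
        torsionOrder K * ∫⁻ s, ‖F 𝔫 s‖ₑ ∂(mulHaar K) := fun 𝔫 =>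
      unfold_lintegral (fun s => ‖F 𝔫 s‖ₑ) (hFm 𝔫).enorm
    simp only [h1]
    rw [tsum_eq_sum (s := hfin.toFinset)]
    · exact ENNReal.sum_ne_top.2 fun 𝔫 _ => ENNReal.mul_ne_top (ENNReal.natCast_ne_top _)
        (hFi 𝔫).2.ne
    · intro 𝔫 h𝔫
      rw [hfin.mem_toFinset, mem_ofPred_eq, not_not] at h𝔫
      simp [h𝔫]
  have hms : ∀ p : classOf A × (𝓞 K)ˣ, AEStronglyMeasurable (fun s => F p.1 (p.2 • s))
      (coneHaar K) := fun p =>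
    ((hFm p.1).comp (measurable_unit_smul p.2)).aestronglyMeasurable
  have hcK : Countable K := countable_field K
  have hct : Countable (classOf A × (𝓞 K)ˣ) := (orbitEquiv A).injective.countable
  have hsw := integral_tsum hms hsum
  have hsummable : Summable fun p : classOf A × (𝓞 K)ˣ => ∫ s, F p.1 (p.2 • s) ∂(coneHaar K) := by
    refine Summable.of_norm_bounded (ENNReal.summable_toReal hsum) fun p => ?_
    rw [← toReal_enorm]
    refine ENNReal.toReal_mono ?_ (enorm_integral_le_lintegral_enorm _)
    exact ENNReal.ne_top_of_tsum_ne_top hsum p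
  rw [hsummable.tsum_prod] at hsw
  have hL : ∀ 𝔫, ∑' u : (𝓞 K)ˣ, ∫ s, F 𝔫 (u • s) ∂(coneHaar K) = torsionOrder K *
      (χ.toFun 𝔫.1 * ∫ v, h v * ω (𝒩 v / absNorm 𝔫.1) ∂(mulHaar K)) := by
    intro 𝔫
    refine (unfold_integral (F 𝔫) (hFm 𝔫) (hFi 𝔫)).trans ?_
    rw [hint, integral_const_mul]
  simp only [hL] at hsw
  rw [tsum_mul_left] at hsw
  have hIn : Integrable (fun s => ∑' p : classOf A × (𝓞 K)ˣ, F p.1 (p.2 • s)) (coneHaar K) := by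
    refine ⟨(Measurable.tsum fun p : classOf A × (𝓞 K)ˣ =>
      (hFm p.1).comp (measurable_unit_smul p.2)).aestronglyMeasurable, ?_⟩
    refine lt_of_le_of_lt (lintegral_mono fun s => enorm_tsum_le_tsum_enorm) ?_
    have h5 : ∫⁻ s, ∑' p : classOf A × (𝓞 K)ˣ, ‖F p.1 (p.2 • s)‖ₑ ∂(coneHaar K) = _ :=
      lintegral_tsum fun p : classOf A × (𝓞 K)ˣ =>
        (((hFm p.1).comp (measurable_unit_smul p.2)).enorm.aemeasurable :
          AEMeasurable (fun s => ‖F p.1 (p.2 • s)‖ₑ) (coneHaar K))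
    rw [h5]
    exact hsum.lt_top
  have key : (fun s => ω (absNorm 𝔟 * 𝒩 s) *
        ∑' α : {α : K // α ∈ A.1}, tw χ 𝔟 α * h (s * 𝓔 α)) =
      fun s => ∑' p : classOf A × (𝓞 K)ˣ, F p.1 (p.2 • s) := by
    funext s
    rw [← tsum_mul_left]
    symm
    let f : {α : K // α ∈ A.1} → ℂ := fun α =>
      ω (absNorm 𝔟 * 𝒩 s) * (tw χ 𝔟 α * h (s * 𝓔 α))
    let i : classOf A × (𝓞 K)ˣ → {α : K // α ∈ A.1} := fun p =>
      ⟨(orbitEquiv A p).1, (orbitEquiv A p).2.1⟩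
    have hi : Function.Injective i := fun p q hpq =>
      (orbitEquiv A).injective (Subtype.ext (by
        have h1 := congrArg Subtype.val hpq; exact h1))
    have hf : Function.support f ⊆ Set.range i := by
      intro α hα
      have hα0 : α.1 ≠ 0 := by
        intro h0
        apply hα
        simp only [f, h0, tw_zero, zero_mul, mul_zero]
      refine ⟨(orbitEquiv A).symm ⟨α.1, α.2, hα0⟩, Subtype.ext ?_⟩
      simp only [i, Equiv.apply_symm_apply]
    refine Eq.trans ?_ (hi.tsum_eq hf)
    refine tsum_congr fun p => ?_
    obtain ⟨𝔫, u⟩ := p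
    have h1 : (i (𝔫, u)).1 = u * gen A 𝔫 := rfl
    simp only [F, h1]
    have h2 : tw χ 𝔟 ((u : K) * gen A 𝔫) = χ.toFun 𝔫.1 := by
      refine tw_eq χ h𝔟 (mul_ne_zero (by simp) (gen_ne_zero A 𝔫)) ?_
      rw [spanSingleton_unit_mul]
      exact span_gen A 𝔫
    rw [h2, norm_unit_smul, map_mul, unitSMul_smul]
    have h3 : 𝓔 (gen A 𝔫) * (𝓔 (u : K) * s) =
      s * (𝓔 (u : K) * 𝓔 (gen A 𝔫)) := by ring
    rw [h3]
    ring
  rw [key]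
  refine ⟨hIn, ?_⟩
  rw [← hsw]

lemma mixed_unit_inv (u : (𝓞 K)ˣ) : (𝓔 ((u⁻¹ : (𝓞 K)ˣ) : K)) =
    (𝓔 (u : K))⁻¹ := by
  have h1 : ((u⁻¹ : (𝓞 K)ˣ) : K) = (u : K)⁻¹ := by simp
  rw [h1]
  ext w <;> simp

lemma norm_gen_abs (A : ℱˣ) (𝔫 : classOf A) :
    𝒩 (𝓔 (gen A 𝔫)) =
      absNorm 𝔫.1 * FractionalIdeal.absNorm A.1 := by
  have h1 := congrArg FractionalIdeal.absNorm (span_gen A 𝔫)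
  rw [absNorm_span_singleton, map_mul, coeIdeal_absNorm] at h1
  rw [mixedEmbedding.norm_eq_norm, h1]
  push_cast
  rfl

theorem dual_unfold (A : ℱˣ) {U : 𝓜 → ℝ≥0∞} (hU : Measurable U)
    {X η : ℝ} (hX : 0 < X) (hη : 0 < η) :
    ∫⁻ s, (if 𝒩 s ≤ X then 1 else 0) *
        ∑' β : {β : {β : K // β ∈ A.1} // β.1 ≠ 0}, U (s⁻¹ * 𝓔 β.1.1) ∂(coneHaar K) ≤
      torsionOrder K * ((∑' 𝔪 : classOf A,
        ofReal ((X / (absNorm 𝔪.1 * FractionalIdeal.absNorm A.1)) ^ (1 + η))) *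
        ∫⁻ ξ, ofReal (𝒩 ξ ^ η) * U ξ) := by
  have hcK : Countable K := countable_field K
  have hct : Countable (classOf A × (𝓞 K)ˣ) := (orbitEquiv A).injective.countable
  have hc2 : Countable (classOf A) := Function.Injective.countable (f := fun 𝔫 => (𝔫, (1 : (𝓞 K)ˣ)))
    fun x y h => (Prod.mk.inj h).1
  let e : classOf A × (𝓞 K)ˣ ≃ {β : {β : K // β ∈ A.1} // β.1 ≠ 0} :=
    (orbitEquiv A).trans (Equiv.subtypeSubtypeEquivSubtypeInter _ _).symm
  have he : ∀ 𝔫 u, (e (𝔫, u)).1.1 = u * gen A 𝔫 := fun _ _ => rfl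
  let F : classOf A → 𝓜 → ℝ≥0∞ := fun 𝔫 s =>
    (if 𝒩 s ≤ X then 1 else 0) * U (s⁻¹ * 𝓔 (gen A 𝔫))
  have hg0 : ∀ 𝔫, 𝒩 (𝓔 (gen A 𝔫)) ≠ 0 := fun 𝔫 =>
    norm_emb_ne_zero (gen_ne_zero A 𝔫)
  have hinv : Measurable fun s : 𝓜 => s⁻¹ := measurePreserving_inv_mixed.measurable
  have hmul : ∀ 𝔫, Measurable fun s => 𝓔 (gen A 𝔫) * s := fun 𝔫 =>
    (measurePreserving_mul_mixed _ (hg0 𝔫)).measurable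
  have hFm : ∀ 𝔫, Measurable (F 𝔫) := by
    intro 𝔫
    refine Measurable.mul (Measurable.ite (measurableSet_le measurable_norm_mixed measurable_const)
      measurable_const measurable_const) (hU.comp ?_)
    simp only [mul_comm _ (𝓔 (gen A 𝔫))]
    exact (hmul 𝔫).comp hinv
  have h1 : ∀ s : 𝓜, (if 𝒩 s ≤ X then (1 : ℝ≥0∞) else 0) *
      ∑' β : {β : {β : K // β ∈ A.1} // β.1 ≠ 0}, U (s⁻¹ * 𝓔 β.1.1) =
      ∑' p : classOf A × (𝓞 K)ˣ, F p.1 (p.2⁻¹ • s) := by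
    intro s
    rw [← ENNReal.tsum_mul_left, ← e.tsum_eq]
    refine tsum_congr fun ⟨𝔫, u⟩ => ?_
    simp only [F, he]
    rw [norm_unit_smul, unitSMul_smul, mixed_unit_inv, mul_inv, inv_inv, map_mul, mul_left_comm,
      mul_assoc]
  have h2 : ∀ p : classOf A × (𝓞 K)ˣ, Measurable fun s => F p.1 (p.2⁻¹ • s) := fun p =>
    (hFm p.1).comp (measurable_unit_smul _)
  have h3 : ∫⁻ s, ∑' p : classOf A × (𝓞 K)ˣ, F p.1 (p.2⁻¹ • s) ∂(coneHaar K) =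
      ∑' 𝔫, ∑' u : (𝓞 K)ˣ, ∫⁻ s, F 𝔫 (u⁻¹ • s) ∂(coneHaar K) :=
    (lintegral_tsum fun p => (h2 p).aemeasurable).trans
      (tsum_prod (f := fun 𝔫 u => ∫⁻ s, F 𝔫 (u⁻¹ • s) ∂(coneHaar K)))
  simp only [h1]
  rw [h3, ← ENNReal.tsum_mul_right, ← ENNReal.tsum_mul_left]
  refine tsum_le_tsum fun 𝔫 => ?_
  refine ((Equiv.inv (𝓞 K)ˣ).tsum_eq fun u => ∫⁻ s, F 𝔫 (u • s) ∂(coneHaar K)).le.trans ?_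
  refine (unfold_lintegral (F 𝔫) (hFm 𝔫)).le.trans (mul_le_mul_right ?_ _)
  rw [← norm_gen_abs]
  set g := 𝓔 (gen A 𝔫) with hg
  have hgp : 0 < 𝒩 g := lt_of_le_of_ne (mixedEmbedding.norm_nonneg _) (hg0 𝔫).symm
  let G : 𝓜 → ℝ≥0∞ := fun v =>
    (if 𝒩 g / 𝒩 v ≤ X then 1 else 0) * U v
  have hGm : Measurable G := Measurable.mul (Measurable.ite (measurableSet_le
    (measurable_const.div measurable_norm_mixed) measurable_const)
      measurable_const measurable_const) hU
  have h2 : ∫⁻ s, F 𝔫 s ∂(mulHaar K) = ∫⁻ v, G v ∂(mulHaar K) := by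
    refine Eq.trans ?_ ((measurePreserving_mul_mixed g (hg0 𝔫)).lintegral_comp hGm)
    refine Eq.trans (measurePreserving_inv_mixed.lintegral_comp (hFm 𝔫)).symm ?_
    refine lintegral_congr fun s => ?_
    simp only [F, G, inv_inv, norm_inv_mixed, map_mul]
    rw [← hg, mul_comm s g, div_mul_cancel_left₀ (hg0 𝔫)]
  rw [h2]
  have hr : Measurable fun ξ : 𝓜 => ofReal (𝒩 ξ ^ η) :=
    (measurable_norm_mixed.pow_const η).ennreal_ofReal
  rw [← lintegral_norm_mul_mulHaar (fun ξ => ofReal (𝒩 ξ ^ η) * U ξ)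
    (hr.mul hU), ← lintegral_const_mul]
  · refine lintegral_mono_ae ?_
    filter_upwards [ae_norm_ne_zero (K := K)] with v hv
    have hv0 : 0 < 𝒩 v := lt_of_le_of_ne (mixedEmbedding.norm_nonneg _) hv.symm
    simp only [G]
    split_ifs with h
    · rw [← mul_assoc, ← mul_assoc]
      refine mul_le_mul_left ?_ _
      rw [← ENNReal.ofReal_mul (by positivity), ← ENNReal.ofReal_mul (by positivity),
        ← ENNReal.ofReal_one]
      refine ENNReal.ofReal_le_ofReal ?_
      have h3 : (X / 𝒩 g) ^ (1 + η) * 𝒩 v *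
          𝒩 v ^ η = (X / 𝒩 g * 𝒩 v) ^ (1 + η) := by
        rw [Real.mul_rpow (by positivity) hv0.le, Real.rpow_add hv0, Real.rpow_one]
        ring
      rw [h3]
      refine Real.one_le_rpow ?_ (by positivity)
      rw [div_mul_eq_mul_div, one_le_div hgp]
      rwa [div_le_iff₀ hv0] at h
    · simp
  · exact measurable_norm_mixed.ennreal_ofReal.mul (hr.mul hU)

lemma norm_sgnVal_le {𝔣 : ℐ} (χ : PChar 𝔣) {𝔟 : ℐ} (h𝔟 : 𝔟 ≠ ⊥)
    (s : 𝓜) : ‖sgnVal χ 𝔟 s‖ ≤ 1 := by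
  rw [sgnVal]
  split_ifs
  · exact norm_tw_le χ h𝔟 _
  · simp

lemma sgnVal_congr {𝔣 : ℐ} (χ : PChar 𝔣) (𝔟 : ℐ) {s s' : 𝓜}
    (h : ∀ w (x : ℝ), 0 < x * s.1 w ↔ 0 < x * s'.1 w) : sgnVal χ 𝔟 s = sgnVal χ 𝔟 s' := by
  have h1 : SameSign s = SameSign s' := by
    funext x
    exact propext (forall_congr' fun w => h w _)
  simp only [sgnVal, h1]

lemma ne_zero_of_norm_ne_zero {s : 𝓜} (hs : 𝒩 s ≠ 0)
    (w : {w : InfinitePlace K // IsReal w}) : s.1 w ≠ 0 := by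
  intro h
  rw [Ne, mixedEmbedding.norm_eq_zero_iff] at hs
  apply hs
  refine ⟨w.1, ?_⟩
  rw [normAtPlace_apply_of_isReal w.2, h, norm_zero]

lemma aestronglyMeasurable_sgnVal {𝔣 : ℐ} (χ : PChar 𝔣) (𝔟 : ℐ) :
    AEStronglyMeasurable (sgnVal χ 𝔟) (coneHaar K) := by
  let g : ({w : InfinitePlace K // IsReal w} → Prop) → ℂ := fun p =>
    sgnVal χ 𝔟 (fun w => if p w then 1 else -1, 0)
  have hg : Measurable g := measurable_of_countable g
  have hp : Measurable fun (s : 𝓜) (w : {w : InfinitePlace K // IsReal w}) => 0 < s.1 w := by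
    refine measurable_pi_lambda _ fun w => ?_
    refine measurable_to_prop ?_
    have : (fun s : 𝓜 => 0 < s.1 w) ⁻¹' {True} = {s | 0 < s.1 w} := by
      ext s; simp
    rw [this]
    exact measurableSet_lt measurable_const ((measurable_pi_apply w).comp measurable_fst)
  refine ⟨fun s => g fun w => 0 < s.1 w, (hg.comp hp).stronglyMeasurable, ?_⟩
  filter_upwards [ae_cone_norm_pos] with s hs
  refine sgnVal_congr χ 𝔟 fun w x => ?_
  dsimp only
  rcases lt_or_gt_of_ne (ne_zero_of_norm_ne_zero hs.ne' w) with h | h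
  · rw [if_neg h.not_gt]
    constructor <;> intro <;> nlinarith
  · rw [if_pos h, mul_pos_iff_of_pos_right h, mul_one]

lemma pos_of_sign_rel {X Y J k e s : ℝ} (h2 : 0 < X * Y * e) (h3 : X * J = Y * k)
    (h1 : 0 < k * s) : 0 < J * (e * s) := by
  have hX : 0 < X ^ 2 := by
    have : X ≠ 0 := by rintro rfl; simp at h2
    positivity
  have h5 : X ^ 2 * (J * (e * s)) = (X * Y * e) * (k * s) := by
    linear_combination X * e * s * h3
  have h6 := mul_pos h2 h1
  rw [← h5] at h6
  exact (pos_iff_pos_of_mul_pos h6).1 hX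

lemma exists_sign_vector (z : 𝓜) (hz : ∀ w, z.1 w ≠ 0) :
    ∃ e : 𝓜, (∀ w, normAtPlace w e = 1) ∧ ∀ w, 0 < z.1 w * e.1 w := by
  let e : 𝓜 := (fun w => if 0 < z.1 w then 1 else -1, 1)
  have he1 : ∀ w, e.1 w = 1 ∨ e.1 w = -1 := fun w => by
    simp only [e]; split_ifs <;> simp
  have hze : ∀ w, 0 < z.1 w * e.1 w := fun w => by
    simp only [e]
    split_ifs with h
    · simpa using h
    · have := lt_of_le_of_ne (not_lt.1 h) (hz w)
      linarith
  have he : ∀ w, normAtPlace w e = 1 := by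
    intro w
    rcases isReal_or_isComplex w with hw | hw
    · rw [normAtPlace_apply_of_isReal hw]
      rcases he1 ⟨w, hw⟩ with h | h <;> rw [h] <;> simp
    · rw [normAtPlace_apply_of_isComplex hw]; simp [e]
  exact ⟨e, he, hze⟩

/-- The main-term integral attached to an ideal class. -/
def sgnInt {𝔣 : ℐ} (χ : PChar 𝔣) (φ : ℝ → ℂ) (𝔟 : ℐ) : ℂ :=
  ∫ s, φ (𝒩 s) * sgnVal χ 𝔟 s ∂(coneHaar K)

lemma sgnInt_scale {𝔣 : ℐ} (χ : PChar 𝔣) (φ : ℝ → ℂ) (𝔟 : ℐ) {l : ℝ} (hl : 0 < l) :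
    ∫ s, φ (l * 𝒩 s) * sgnVal χ 𝔟 s ∂(coneHaar K) = sgnInt χ φ 𝔟 := by
  refine integral_cone_scale (fun r v => φ r * sgnVal χ 𝔟 v) (fun r c v hc => ?_) hl
  congr 1
  refine sgnVal_congr χ 𝔟 fun w x => ?_
  rw [Prod.smul_fst, Pi.smul_apply, smul_eq_mul, mul_left_comm, mul_pos_iff_of_pos_left hc]

lemma sgnInt_eq_mul {𝔣 : ℐ} (χ : PChar 𝔣) (h𝔣 : 𝔣 = ⊤) (φ : ℝ → ℂ)
    {𝔟 𝔟' 𝔪 : ℐ} (h𝔟 : 𝔟 ≠ ⊥) (h𝔟' : 𝔟' ≠ ⊥) (h𝔪 : 𝔪 ≠ ⊥) {x y : 𝓞 K} (hx : x ≠ 0)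
    (hy : y ≠ 0) (h : span {x} * 𝔟 = span {y} * (𝔪 * 𝔟')) :
    sgnInt χ φ 𝔟' = χ.toFun 𝔪 * sgnInt χ φ 𝔟 := by
  have hxy : ((x : K) * (y : K)) ≠ 0 := by simpa using ⟨hx, hy⟩
  obtain ⟨z, hzdef⟩ : ∃ z, z = 𝓔 ((x : K) * (y : K)) := ⟨_, rfl⟩
  have hz : ∀ w, z.1 w ≠ 0 := by
    rw [hzdef]; exact ne_zero_of_norm_ne_zero (norm_emb_ne_zero hxy)
  obtain ⟨e, he, hze⟩ := exists_sign_vector z hz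
  have hne : 𝒩 e = 1 := by
    rw [mixedEmbedding.norm_apply]; simp [he]
  have hmp := measurePreserving_cone_sign (K := K) he
  have hem := measurableEmbedding_mul (s := e) (by rw [hne]; exact one_ne_zero)
  have hint := hmp.integral_comp hem (fun s => φ (𝒩 s) * sgnVal χ 𝔟 s)
  rw [sgnInt, sgnInt, ← hint, ← integral_const_mul]
  refine integral_congr_ae ?_
  filter_upwards [ae_cone_norm_pos] with s hs
  have hs' := ne_zero_of_norm_ne_zero hs.ne'
  rw [map_mul, hne, one_mul, mul_left_comm]
  congr 1
  have h𝔪𝔟 := mul_ne_zero h𝔪 h𝔟'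
  obtain ⟨k, hk, hk0, hks⟩ := exists_sameSign_sub_mem s hs' h𝔪𝔟 0
  rw [sub_zero] at hk
  have hyk : y * k ∈ span {x} * 𝔟 := by
    rw [h]; exact Ideal.mul_mem_mul (mem_span_singleton_self y) hk
  obtain ⟨j, hj, hxj⟩ := Ideal.mem_span_singleton_mul.1 hyk
  have hj0 : j ≠ 0 := by
    rintro rfl
    rw [mul_zero] at hxj
    exact mul_ne_zero hy hk0 hxj.symm
  have hjs : SameSign (e * s) (j : K) := by
    intro w
    have h1 := hks w
    have h2 := hze w
    have hK : (x : K) * (j : K) = (y : K) * (k : K) := by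
      exact_mod_cast congrArg (algebraMap (𝓞 K) K) hxj
    have h3 := congrArg (fun t => (𝓔 t).1 w) hK
    have h4 : z = 𝓔 (x : K) * 𝓔 (y : K) :=
      hzdef.trans (map_mul _ _ _)
    rw [h4] at h2
    simp only [map_mul, Prod.fst_mul, Pi.mul_apply] at h2 h3 ⊢
    exact pos_of_sign_rel h2 h3 h1
  obtain ⟨𝔫, hn⟩ := exists_mul_of_mem hj
  have hkn : span {k} = 𝔫 * 𝔪 * 𝔟' := by
    have h1 : span {y} * span {k} = span {y} * (𝔫 * 𝔪 * 𝔟') := by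
      rw [span_singleton_mul_span_singleton, ← hxj, ← span_singleton_mul_span_singleton,
        hn, mul_left_comm, h]
      ring
    have h0 : span {y} ≠ 0 := by simpa using hy
    exact mul_left_cancel₀ h0 h1
  have hk𝔟 : k ∈ 𝔟' := (mul_le_right : 𝔪 * 𝔟' ≤ 𝔟') hk
  have h𝔫 : 𝔫 ≠ ⊥ := by
    rintro rfl
    rw [← zero_eq_bot, zero_mul, zero_eq_bot, span_singleton_eq_bot] at hn
    exact hj0 hn
  rw [sgnVal_eq χ h𝔟' h𝔣 hk𝔟 hk0 hks, sgnVal_eq χ h𝔟 h𝔣 hj hj0 hjs, tw_eq' χ h𝔟' hk0 hkn,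
    tw_eq' χ h𝔟 hj0 hn, χ.map_mul_of_ne _ _ h𝔫 h𝔪]
  exact mul_comm _ _

/-- The trivial character. -/
def PChar.IsTriv {𝔣 : ℐ} (χ : PChar 𝔣) : Prop := ∀ 𝔫, 𝔫 ≠ ⊥ → χ.toFun 𝔫 = 1

lemma PChar.IsTriv.eq_top {𝔣 : ℐ} {χ : PChar 𝔣} (h : χ.IsTriv) (h𝔣 : 𝔣 ≠ ⊥) : 𝔣 = ⊤ := by
  by_contra hne
  have h1 := χ.eq_zero 𝔣 h𝔣 (by rwa [isCoprime_iff_sup_eq, sup_idem])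
  rw [h 𝔣 h𝔣] at h1
  exact one_ne_zero h1

/-- A nonzero integral ideal in a given class. -/
def rep (c : ClassGroup (𝓞 K)) : ℐ := (mk0_surjective c).choose.1

lemma rep_ne_bot (c : ClassGroup (𝓞 K)) : rep c ≠ ⊥ :=
  nonZeroDivisors.ne_zero (mk0_surjective c).choose.2

lemma mk0_rep (c : ClassGroup (𝓞 K)) :
    mk0 ⟨rep c, mem_nonZeroDivisors_of_ne_zero (rep_ne_bot c)⟩ = c :=
  (mk0_surjective c).choose_spec

lemma sgnVal_of_triv {𝔣 : ℐ} {χ : PChar 𝔣} (h𝔣 : 𝔣 = ⊤) (ht : χ.IsTriv)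
    {𝔟 : ℐ} (h𝔟 : 𝔟 ≠ ⊥) {s : 𝓜} (hs : 𝒩 s ≠ 0) :
    sgnVal χ 𝔟 s = 1 := by
  obtain ⟨k, hk, hk0, hks⟩ := exists_sameSign_sub_mem s (ne_zero_of_norm_ne_zero hs) h𝔟 0
  rw [sub_zero] at hk
  obtain ⟨𝔫, hn⟩ := exists_mul_of_mem hk
  rw [sgnVal_eq χ h𝔟 h𝔣 hk hk0 hks, tw_eq' χ h𝔟 hk0 hn]
  refine ht _ ?_
  rintro rfl
  rw [← zero_eq_bot, zero_mul, zero_eq_bot, span_singleton_eq_bot] at hn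
  exact hk0 hn

lemma sum_sgnInt {𝔣 : ℐ} (χ : PChar 𝔣) (h𝔣 : 𝔣 ≠ ⊥) {φ : ℝ → ℂ} (hφ : Measurable φ) :
    ∑ c : ClassGroup (𝓞 K), sgnInt χ φ (rep c) =
      if χ.IsTriv then card (ClassGroup (𝓞 K)) * (coneConst K * ∫ x, φ (exp x)) else 0 := by
  split_ifs with ht
  · have h1 : ∀ c, sgnInt χ φ (rep c) = coneConst K * ∫ x, φ (exp x) := by
      intro c
      refine Eq.trans ?_ (integral_cone_log (hφ.comp Real.measurable_exp))
      refine integral_congr_ae ?_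
      filter_upwards [ae_cone_norm_pos] with s hs
      rw [sgnVal_of_triv (ht.eq_top h𝔣) ht (rep_ne_bot c) hs.ne', mul_one]
      exact congrArg φ (Real.exp_log hs).symm
    simp [h1]
  · by_cases htop : 𝔣 = ⊤
    · rw [PChar.IsTriv] at ht
      push Not at ht
      obtain ⟨𝔪, hm, hχ⟩ := ht
      let m : ClassGroup (𝓞 K) := mk0 ⟨𝔪, mem_nonZeroDivisors_of_ne_zero hm⟩
      have h1 : ∀ c : ClassGroup (𝓞 K), sgnInt χ φ (rep (c * m⁻¹)) = χ.toFun 𝔪 * sgnInt χ φ (rep c) := by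
        intro c
        have h2 : mk0 ⟨rep c, mem_nonZeroDivisors_of_ne_zero (rep_ne_bot c)⟩ =
            mk0 (⟨𝔪, mem_nonZeroDivisors_of_ne_zero hm⟩ *
              ⟨rep (c * m⁻¹), mem_nonZeroDivisors_of_ne_zero (rep_ne_bot (c * m⁻¹))⟩) := by
          rw [map_mul, mk0_rep, mk0_rep]
          change c = m * (c * m⁻¹)
          rw [mul_comm, inv_mul_cancel_right]
        obtain ⟨x, y, hx, hy, h3⟩ := (ClassGroup.mk0_eq_mk0_iff).1 h2
        exact sgnInt_eq_mul χ htop φ (rep_ne_bot c) (rep_ne_bot _) hm hx hy h3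
      have h2 := Equiv.sum_comp (Equiv.mulRight m⁻¹) fun c => sgnInt χ φ (rep c)
      simp only [Equiv.coe_mulRight, h1] at h2
      rw [← mul_sum] at h2
      by_contra h0
      exact hχ (mul_right_cancel₀ h0 (h2.trans (one_mul _).symm))
    · refine sum_eq_zero fun c _ => ?_
      simp [sgnInt, sgnVal, htop]

lemma classOf_ne_bot {A : ℱˣ} {𝔫 : ℐ} (h : 𝔫 ∈ classOf A) :
    𝔫 ≠ ⊥ := ne_bot_of_classOf ⟨𝔫, h⟩

/-- A nonzero ideal as a non-zero-divisor. -/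
abbrev nzd (𝔫 : ℐ) (h : 𝔫 ≠ ⊥) : ℐ⁰ := ⟨𝔫, mem_nonZeroDivisors_of_ne_zero h⟩

lemma mem_classOf_fU {𝔫 𝔟 : ℐ} (hn : 𝔫 ≠ ⊥) (h𝔟 : 𝔟 ≠ ⊥) :
    𝔫 ∈ classOf (fU 𝔟 h𝔟) ↔ mk0 (nzd 𝔫 hn) * mk0 (nzd 𝔟 h𝔟) = 1 := by
  rw [← map_mul, ← map_one (mk0 (R := 𝓞 K)), eq_comm,
    ClassGroup.mk0_eq_mk0_iff_exists_fraction_ring (K := K)]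
  simp only [classOf, mem_ofPred_eq, fU_val, exists_prop]
  refine exists_congr fun x => and_congr_right fun _ => ?_
  simp

lemma mk0_of_mem_classOf_inv {𝔪 J : ℐ} (hJ : J ≠ ⊥) (h : 𝔪 ∈ classOf (fU J hJ)⁻¹) :
    mk0 (nzd J hJ) = mk0 (nzd 𝔪 (classOf_ne_bot h)) := by
  rw [ClassGroup.mk0_eq_mk0_iff_exists_fraction_ring (K := K)]
  have h0 := h
  obtain ⟨x, hx, h1⟩ := h0
  refine ⟨x, hx, ?_⟩
  have h2 := congrArg (fun t => t * (fU J hJ).1) h1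
  refine h2.trans ?_
  simp only
  rw [mul_assoc]
  change (𝔪 : ℱ) * ((fU J hJ)⁻¹.1 * (fU J hJ).1) = 𝔪
  rw [inv_mul, mul_one]

/-- Nonzero ideals, sorted by the class of a representative. -/
def classEquiv (K : Type*) [Field K] [NumberField K] :
    (Σ c : ClassGroup (𝓞 K), classOf (fU (rep c) (rep_ne_bot c))) ≃ {𝔫 : Ideal (𝓞 K) // 𝔫 ≠ ⊥} :=
  Equiv.ofBijective (fun p => ⟨p.2.1, classOf_ne_bot p.2.2⟩) (by
    constructor
    · rintro ⟨c, 𝔫, h⟩ ⟨c', 𝔫', h'⟩ heq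
      have h0 : 𝔫 = 𝔫' := congrArg Subtype.val heq
      subst h0
      have hn := classOf_ne_bot h
      have h1 := (mem_classOf_fU hn (rep_ne_bot c)).1 h
      have h2 := (mem_classOf_fU hn (rep_ne_bot c')).1 h'
      rw [mk0_rep] at h1 h2
      have h3 : c = c' := mul_left_cancel (h1.trans h2.symm)
      subst h3
      rfl
    · rintro ⟨𝔫, hn⟩
      refine ⟨⟨(mk0 (nzd 𝔫 hn))⁻¹, 𝔫, ?_⟩, rfl⟩
      rw [mem_classOf_fU hn, mk0_rep, mul_inv_cancel])

lemma tsum_ideals {f : ℐ → ℂ} {B : ℝ} (hf : ∀ 𝔫, 𝔫 ≠ ⊥ → f 𝔫 ≠ 0 → absNorm 𝔫 ≤ B) :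
    ∑' 𝔫 : ℐ₀, f 𝔫.1 =
      ∑ c : ClassGroup (𝓞 K), ∑' 𝔫 : classOf (fU (rep c) (rep_ne_bot c)), f 𝔫.1 := by
  have hfin : (Function.support fun 𝔫 : ℐ₀ => f 𝔫.1).Finite := by
    refine Set.Finite.of_finite_image (f := Subtype.val)
      ((finite_setOfPred_absNorm_le ⌊B⌋₊).subset ?_) Subtype.val_injective.injOn
    rintro _ ⟨𝔫, h𝔫, rfl⟩
    exact le_floor (hf _ 𝔫.2 h𝔫)
  have h1 : Summable fun 𝔫 : ℐ₀ => f 𝔫.1 :=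
    summable_of_hasFiniteSupport hfin
  have h2 := (classEquiv K).summable_iff.2 h1
  rw [← (classEquiv K).tsum_eq]
  refine (h2.tsum_sigma' fun c => h2.comp_injective sigma_mk_injective).trans ?_
  rw [tsum_fintype]
  rfl

lemma different_ne_bot : differentIdeal ℤ (𝓞 K) ≠ ⊥ := by
  intro h
  have h1 := NumberField.absNorm_differentIdeal K (𝓞 K)
  rw [h, Ideal.absNorm_bot, eq_comm, Int.natAbs_eq_zero] at h1
  exact NumberField.discr_ne_zero K h1

lemma dual_eq_inv {J : ℐ} (hJ : J ≠ ⊥) :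
    FractionalIdeal.dual ℤ ℚ (fU J hJ).1 =
      (fU (differentIdeal ℤ (𝓞 K) * J) (mul_ne_zero different_ne_bot hJ))⁻¹.1 := by
  have h := coeIdeal_differentIdeal ℤ ℚ K (𝓞 K)
  rw [FractionalIdeal.dual_eq_mul_inv, Units.val_inv_eq_inv_val, fU_val, fU_val,
    coeIdeal_mul, mul_inv, h, inv_inv]

lemma absNorm_dual {J : ℐ} (hJ : J ≠ ⊥) :
    ((FractionalIdeal.absNorm
      (fU (differentIdeal ℤ (𝓞 K) * J) (mul_ne_zero different_ne_bot hJ))⁻¹.1 : ℚ) : ℝ) =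
      (DK K * absNorm J : ℝ)⁻¹ := by
  rw [Units.val_inv_eq_inv_val, map_inv₀, Rat.cast_inv, absNorm_fU, map_mul,
    NumberField.absNorm_differentIdeal (K := K), DK]
  push_cast
  rfl

/-- The Dirichlet series of absolute values. -/
def zetaE (K : Type*) [Field K] [NumberField K] (σ : ℝ) : ℝ≥0∞ :=
  ∑' 𝔪 : {𝔪 : Ideal (𝓞 K) // 𝔪 ≠ ⊥}, ofReal ((absNorm 𝔪.1 : ℝ) ^ (-σ))

lemma sum_dual_le {𝔣 : ℐ} (h𝔣 : 𝔣 ≠ ⊥) (σ : ℝ) :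
    ∑ c : ClassGroup (𝓞 K), ∑' 𝔪 : classOf (fU (differentIdeal ℤ (𝓞 K) * (rep c * 𝔣))
        (mul_ne_zero different_ne_bot (mul_ne_zero (rep_ne_bot c) h𝔣)))⁻¹,
      ofReal ((absNorm 𝔪.1 : ℝ) ^ (-σ)) ≤ zetaE K σ := by
  let T : ClassGroup (𝓞 K) → Type _ := fun c =>
    classOf (fU (differentIdeal ℤ (𝓞 K) * (rep c * 𝔣))
        (mul_ne_zero different_ne_bot (mul_ne_zero (rep_ne_bot c) h𝔣)))⁻¹
  let i : (Σ c, T c) → ℐ₀ := fun p => ⟨p.2.1, classOf_ne_bot p.2.2⟩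
  have hi : Function.Injective i := by
    rintro ⟨c, 𝔫, h⟩ ⟨c', 𝔫', h'⟩ heq
    have h0 : 𝔫 = 𝔫' := congrArg Subtype.val heq
    subst h0
    have h1 := mk0_of_mem_classOf_inv _ h
    have h2 := mk0_of_mem_classOf_inv _ h'
    have h3 : ∀ c : ClassGroup (𝓞 K), mk0 (nzd (differentIdeal ℤ (𝓞 K) * (rep c * 𝔣))
        (mul_ne_zero different_ne_bot (mul_ne_zero (rep_ne_bot c) h𝔣))) =
        mk0 (nzd (differentIdeal ℤ (𝓞 K)) different_ne_bot) *
          (c * mk0 (nzd 𝔣 h𝔣)) := by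
      intro c
      rw [← mk0_rep c, ← map_mul, ← map_mul]
      congr 1
      simp only [mk0_rep]
      rfl
    rw [h3] at h1 h2
    have h4 : c = c' := mul_right_cancel (mul_left_cancel (h1.trans h2.symm))
    subst h4
    rfl
  have h1 := ENNReal.tsum_comp_le_tsum_of_injective hi
    fun 𝔪 => ofReal ((absNorm 𝔪.1 : ℝ) ^ (-σ))
  refine le_trans (le_of_eq ?_) h1
  rw [← tsum_fintype (L := SummationFilter.unconditional _)]
  exact (ENNReal.tsum_sigma' (fun p : (Σ c, T c) =>
    ofReal ((absNorm p.2.1 : ℝ) ^ (-σ)))).symm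

lemma cov_pos : 0 < cov K := by
  have h0 := volume_fundamentalDomain_latticeBasis K
  rw [cov, h0]
  refine ENNReal.toReal_pos (mul_ne_zero (pow_ne_zero _ (by simp)) ?_)
    (ENNReal.mul_ne_top (ENNReal.pow_ne_top (by simp)) ENNReal.coe_ne_top)
  rw [ENNReal.coe_ne_zero]
  have := NumberField.discr_ne_zero K
  simpa using this

lemma integrable_weight {ω : ℝ → ℂ} {a b : ℝ} (hω : Wt ω a b) {𝔣 : ℐ} (χ : PChar 𝔣)
    {𝔟 : ℐ} (h𝔟 : 𝔟 ≠ ⊥) {l : ℝ} (hl : 0 < l) :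
    Integrable (fun s => ω (l * 𝒩 s) / ((l * 𝒩 s : ℝ) : ℂ) *
      sgnVal χ 𝔟 s) (coneHaar K) := by
  refine Integrable.mul_bdd (c := 1) ?_ (aestronglyMeasurable_sgnVal χ 𝔟)
    (.of_forall fun s => norm_sgnVal_le χ h𝔟 s)
  have hm : Measurable fun s : 𝓜 =>
      ω (l * 𝒩 s) / ((l * 𝒩 s : ℝ) : ℂ) :=
    (hω.meas.comp (measurable_norm_mixed.const_mul l)).div
      (measurable_ofReal.comp (measurable_norm_mixed.const_mul l))
  refine ⟨hm.aestronglyMeasurable, ?_⟩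
  let F : ℝ → ℝ≥0∞ := indicator (Set.Icc (log (a / l)) (log (b / l))) 1
  have hF : Measurable F := measurable_one.indicator measurableSet_Icc
  have h1 := lintegral_cone_log (K := K) hF
  have h2 : coneConst K * ∫⁻ x, F x < ⊤ := by
    refine ENNReal.mul_lt_top ENNReal.coe_lt_top ?_
    rw [lintegral_indicator_one measurableSet_Icc, Real.volume_Icc]
    exact ENNReal.ofReal_lt_top
  rw [← h1] at h2
  refine lt_of_le_of_lt (lintegral_mono_ae ?_) h2
  filter_upwards [ae_cone_norm_pos] with s hs
  have hr : 0 < l * 𝒩 s := mul_pos hl hs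
  by_cases h0 : ω (l * 𝒩 s) = 0
  · rw [h0, zero_div, enorm_zero]; exact zero_le
  obtain ⟨h3, h4⟩ := hω.supp _ h0
  have hmem : log (𝒩 s) ∈ Set.Icc (log (a / l)) (log (b / l)) := by
    refine ⟨Real.log_le_log (div_pos hω.pos hl) ?_, Real.log_le_log hs ?_⟩
    · rw [div_le_iff₀ hl, mul_comm]; exact h3
    · rw [le_div_iff₀ hl, mul_comm]; exact h4
  simp only [F]
  rw [indicator_of_mem hmem, Pi.one_apply, ← ofReal_norm, norm_div, Complex.norm_real,
    norm_of_nonneg hr.le]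
  refine ENNReal.ofReal_le_one.2 ?_
  rw [div_le_one hr]
  exact hω.bound _ hr.le

lemma class_error {𝔣 𝔟 : ℐ} (χ : PChar 𝔣) (h𝔣 : 𝔣 ≠ ⊥) (h𝔟 : 𝔟 ≠ ⊥)
    {h : 𝓜 → ℂ} (hh : Adm h) {ω : ℝ → ℂ} {a b : ℝ} (hω : Wt ω a b) (hb : 0 < b)
    {U : 𝓜 → ℝ≥0∞} (hUm : Measurable U) (hU : ∀ ξ, ‖FT h ξ‖ₑ ≤ U ξ) {η : ℝ} (hη : 0 < η) :
    ‖(torsionOrder K : ℂ) * ∑' 𝔫 : classOf (fU 𝔟 h𝔟), χ.toFun 𝔫.1 *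
        ∫ v, h v * ω (𝒩 v / absNorm 𝔫.1) ∂(mulHaar K) -
      FT h 0 / ((cov K * absNorm 𝔣 : ℝ) : ℂ) * sgnInt χ (fun r => ω r / (r : ℂ)) 𝔟‖ₑ ≤
    torsionOrder K * (ofReal (1 / (cov K * √(absNorm 𝔣))) *
      ofReal ((b * DK K * absNorm 𝔣) ^ (1 + η)) *
      (∑' 𝔪 : classOf (fU (differentIdeal ℤ (𝓞 K) * (𝔟 * 𝔣))
        (mul_ne_zero different_ne_bot (mul_ne_zero h𝔟 h𝔣)))⁻¹,
        ofReal ((absNorm 𝔪.1 : ℝ) ^ (-(1 + η)))) *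
      ∫⁻ ξ, ofReal (𝒩 ξ ^ η) * U ξ) := by
  obtain ⟨hI, hE⟩ := primal_unfold χ h𝔟 hh hω
  have hb0 : (0 : ℝ) < absNorm 𝔟 := by
    exact_mod_cast Nat.pos_of_ne_zero fun h => h𝔟 (absNorm_eq_zero_iff.1 h)
  have hf0 : (0 : ℝ) < absNorm 𝔣 := by
    exact_mod_cast Nat.pos_of_ne_zero fun h => h𝔣 (absNorm_eq_zero_iff.1 h)
  have hD0 : (0 : ℝ) < DK K := by
    exact_mod_cast Int.natAbs_pos.2 (NumberField.discr_ne_zero K)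
  have hcov := cov_pos (K := K)
  set J := 𝔟 * 𝔣 with hJdef
  have hJ : J ≠ ⊥ := mul_ne_zero h𝔟 h𝔣
  set A' := (fU (differentIdeal ℤ (𝓞 K) * J) (mul_ne_zero different_ne_bot hJ))⁻¹ with hA'
  set φ : ℝ → ℂ := fun r => ω r / (r : ℂ) with hφ
  set C0 : ℂ := FT h 0 / ((cov K * absNorm 𝔣 : ℝ) : ℂ) with hC0
  have hgi : Integrable (fun s => C0 * (φ (absNorm 𝔟 * 𝒩 s) * sgnVal χ 𝔟 s))
    (coneHaar K) := (integrable_weight hω χ h𝔟 hb0).const_mul _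
  have hg : ∫ s, C0 * (φ (absNorm 𝔟 * 𝒩 s) * sgnVal χ 𝔟 s) ∂(coneHaar K) =
      C0 * sgnInt χ φ 𝔟 := by
    rw [integral_const_mul, sgnInt_scale χ φ 𝔟 hb0]
  rw [hE, ← hg, ← integral_sub hI hgi]
  refine (enorm_integral_le_lintegral_enorm _).trans ?_
  set E := ofReal (1 / (cov K * √(absNorm 𝔣))) with hEdef
  have hX : 0 < b / absNorm 𝔟 := div_pos hb hb0
  have hdu := dual_unfold A' hUm hX hη
  have hpt : ∀ᵐ s ∂(coneHaar K), ‖ω (absNorm 𝔟 * 𝒩 s) *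
        ∑' α : {α : K // α ∈ (fU 𝔟 h𝔟).1}, tw χ 𝔟 α * h (s * 𝓔 α) -
        C0 * (φ (absNorm 𝔟 * 𝒩 s) * sgnVal χ 𝔟 s)‖ₑ ≤
      E * ((if 𝒩 s ≤ b / absNorm 𝔟 then 1 else 0) *
        ∑' β : {β : {β : K // β ∈ A'.1} // β.1 ≠ 0}, U (s⁻¹ * 𝓔 β.1.1)) := by
    filter_upwards [ae_cone_norm_pos] with s hs
    have htp := twisted_poisson χ h𝔣 h𝔟 hh.cont hh.cpt hh.pos hU hs.ne'
    rw [dual_eq_inv hJ] at htp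
    have hr : 0 < absNorm 𝔟 * 𝒩 s := mul_pos hb0 hs
    by_cases h0 : ω (absNorm 𝔟 * 𝒩 s) = 0
    · simp only [hφ, h0, zero_mul, zero_div, mul_zero, sub_zero, enorm_zero]
      exact zero_le
    have h4 := (hω.supp _ h0).2
    rw [if_pos (by rw [le_div_iff₀ hb0, mul_comm]; exact h4), one_mul]
    set r := absNorm 𝔟 * 𝒩 s with hrdef
    set S := ∑' α : {α : K // α ∈ (fU 𝔟 h𝔟).1}, tw χ 𝔟 α * h (s * 𝓔 α)
    have hc0 : cov K * absNorm J * 𝒩 s = cov K * absNorm 𝔣 * r := by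
      rw [hJdef, map_mul, hrdef]; push_cast; ring
    rw [hc0] at htp
    have hc : (0 : ℝ) < cov K * absNorm 𝔣 := mul_pos hcov hf0
    have hfac : ω r * S - C0 * (φ r * sgnVal χ 𝔟 s) =
        ω r / ((cov K * absNorm 𝔣 * r : ℝ) : ℂ) *
          (((cov K * absNorm 𝔣 * r : ℝ) : ℂ) * S - sgnVal χ 𝔟 s * FT h 0) := by
      simp only [hφ, hC0]
      have h1 : ((cov K * absNorm 𝔣 : ℝ) : ℂ) ≠ 0 := by exact_mod_cast hc.ne'
      have h2 : (r : ℂ) ≠ 0 := by exact_mod_cast hr.ne'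
      rw [Complex.ofReal_mul (cov K * absNorm 𝔣) r]
      field_simp
    rw [hfac, enorm_mul]
    have h5 : ‖ω r / ((cov K * absNorm 𝔣 * r : ℝ) : ℂ)‖ₑ ≤
        ofReal (1 / (cov K * absNorm 𝔣)) := by
      rw [← ofReal_norm, norm_div, Complex.norm_real, norm_of_nonneg (mul_pos hc hr).le]
      refine ENNReal.ofReal_le_ofReal ?_
      rw [div_le_div_iff₀ (mul_pos hc hr) hc, one_mul, mul_comm]
      exact mul_le_mul_of_nonneg_left (hω.bound _ hr.le) hc.le
    refine (mul_le_mul' h5 htp).trans (le_of_eq ?_)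
    rw [← mul_assoc, ← ENNReal.ofReal_mul (by positivity), hEdef]
    congr 2
    have h6 : (0 : ℝ) < √(absNorm 𝔣) := Real.sqrt_pos.2 hf0
    have h7 := Real.mul_self_sqrt hf0.le
    rw [one_div, one_div, mul_inv, mul_inv, mul_assoc]
    congr 1
    refine eq_inv_of_mul_eq_one_left ?_
    rw [mul_assoc, h7, inv_mul_cancel₀ hf0.ne']
  refine (lintegral_mono_ae hpt).trans ?_
  rw [lintegral_const_mul' _ _ ENNReal.ofReal_ne_top]
  refine (mul_le_mul_right hdu E).trans (le_of_eq ?_)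
  have h8 : ∀ 𝔪 : classOf A', ofReal ((b / absNorm 𝔟 /
      (absNorm 𝔪.1 * FractionalIdeal.absNorm A'.1)) ^ (1 + η)) =
      ofReal ((b * DK K * absNorm 𝔣) ^ (1 + η)) *
        ofReal ((absNorm 𝔪.1 : ℝ) ^ (-(1 + η))) := by
    intro 𝔪
    have hm0 : (0 : ℝ) < absNorm 𝔪.1 := by
      exact_mod_cast Nat.pos_of_ne_zero fun h => ne_bot_of_classOf 𝔪 (absNorm_eq_zero_iff.1 h)
    rw [← ENNReal.ofReal_mul (by positivity), Real.rpow_neg hm0.le, ← Real.inv_rpow hm0.le,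
      ← Real.mul_rpow (by positivity) (by positivity), absNorm_dual hJ, hJdef, map_mul]
    congr 2
    push_cast
    field_simp
  simp only [h8]
  rw [ENNReal.tsum_mul_left]
  ring

/-- The residue constant. -/
def kap (K : Type*) [Field K] [NumberField K] : ℝ :=
  card (ClassGroup (𝓞 K)) * coneConst K / (torsionOrder K * cov K)

/-- Smoothed sums of a primitive character. -/
theorem smooth_sum {𝔣 : ℐ} (χ : PChar 𝔣) (h𝔣 : 𝔣 ≠ ⊥)
    {h : 𝓜 → ℂ} (hh : Adm h) {ω : ℝ → ℂ} {a b : ℝ} (hω : Wt ω a b) (hb : 0 < b)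
    {U : 𝓜 → ℝ≥0∞} (hUm : Measurable U) (hU : ∀ ξ, ‖FT h ξ‖ₑ ≤ U ξ) {η : ℝ} (hη : 0 < η) :
    ‖∑' 𝔫 : ℐ₀, χ.toFun 𝔫.1 *
        ∫ v, h v * ω (𝒩 v / absNorm 𝔫.1) ∂(mulHaar K) -
      (if χ.IsTriv then (kap K : ℂ) * FT h 0 * ∫ x : ℝ, ω (exp x) / (exp x : ℂ) else 0)‖ₑ ≤
    ofReal (1 / (cov K * √(absNorm 𝔣))) *
      ofReal ((b * DK K * absNorm 𝔣) ^ (1 + η)) * zetaE K (1 + η) *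
      ∫⁻ ξ, ofReal (𝒩 ξ ^ η) * U ξ := by
  set w : ℂ := ((torsionOrder K : ℕ) : ℂ) with hw
  have hw0 : w ≠ 0 := by
    rw [hw]; exact_mod_cast (torsionOrder_pos K).ne'
  have hf0 : (0 : ℝ) < absNorm 𝔣 := by
    exact_mod_cast Nat.pos_of_ne_zero fun h => h𝔣 (absNorm_eq_zero_iff.1 h)
  set φ : ℝ → ℂ := fun r => ω r / (r : ℂ) with hφ
  have hφm : Measurable φ := hω.meas.div measurable_ofReal
  set C0 : ℂ := FT h 0 / ((cov K * absNorm 𝔣 : ℝ) : ℂ) with hC0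
  let f : ℐ → ℂ := fun 𝔫 => χ.toFun 𝔫 *
        ∫ v, h v * ω (𝒩 v / absNorm 𝔫) ∂(mulHaar K)
  obtain ⟨B, hB⟩ := hh.exists_norm_le
  have hf : ∀ 𝔫, 𝔫 ≠ ⊥ → f 𝔫 ≠ 0 → absNorm 𝔫 ≤ B / a := by
    intro 𝔫 hn h0
    have hn0 : (0 : ℝ) < absNorm 𝔫 := by
      exact_mod_cast Nat.pos_of_ne_zero fun h => hn (absNorm_eq_zero_iff.1 h)
    by_contra hlt
    apply right_ne_zero_of_mul h0
    refine integral_eq_zero_of_ae (.of_forall fun v => ?_)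
    by_contra h1
    have h2 := hB v (left_ne_zero_of_mul h1)
    have h3 := (hω.supp _ (right_ne_zero_of_mul h1)).1
    rw [le_div_iff₀ hn0] at h3
    apply hlt
    rw [le_div_iff₀ hω.pos, mul_comm]
    exact h3.trans h2
  have hmain : (if χ.IsTriv then (kap K : ℂ) * FT h 0 * ∫ x : ℝ, ω (exp x) / (exp x : ℂ)
      else 0) = w⁻¹ * ∑ c : ClassGroup (𝓞 K), C0 * sgnInt χ φ (rep c) := by
    rw [← mul_sum, sum_sgnInt χ h𝔣 hφm]
    split_ifs with ht
    · have h1 : absNorm 𝔣 = 1 := by rw [ht.eq_top h𝔣]; exact absNorm_top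
      have hcov : (cov K : ℂ) ≠ 0 := by exact_mod_cast (cov_pos (K := K)).ne'
      rw [hC0, h1, hφ, kap, hw]
      push_cast
      field_simp
    · rw [mul_zero, mul_zero]
  have hsplit : ∑' 𝔫 : ℐ₀, f 𝔫.1 = _ := tsum_ideals hf
  change ‖∑' 𝔫 : ℐ₀, f 𝔫.1 - _‖ₑ ≤ _
  have hwn : ‖w‖ₑ = torsionOrder K := by
    rw [hw, ← ofReal_norm, Complex.norm_natCast, ENNReal.ofReal_natCast]
  have hwn0 : ‖w‖ₑ ≠ 0 := by rwa [Ne, enorm_eq_zero]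
  rw [hmain, hsplit, ← ENNReal.mul_le_mul_iff_right hwn0 enorm_ne_top, ← enorm_mul, mul_sub,
    mul_inv_cancel_left₀ hw0, mul_sum, ← sum_sub_distrib]
  refine (enorm_sum_le _ _).trans ?_
  refine (sum_le_sum fun c _ =>
    class_error χ h𝔣 (rep_ne_bot c) hh hω hb hUm hU hη).trans ?_
  rw [← mul_sum, hwn, ← sum_mul, ← mul_sum]
  gcongr
  exact sum_dual_le h𝔣 (1 + η)

/-- A fixed smooth bump supported in `[-1/4, 1/4]`. -/
def bump : ContDiffBump (0 : ℝ) := ⟨1 / 8, 1 / 4, by norm_num, by norm_num⟩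

lemma bump_eq_zero {x : ℝ} (hx : 1 / 4 ≤ |x|) : bump x = 0 :=
  bump.zero_of_le_dist (by simpa [bump, Real.dist_eq] using hx)

lemma bump_bounds : ∃ (M : ℝ) (φ₁ φ₂ φ₃ : ℝ → ℝ), 1 ≤ M ∧ (∀ x, HasDerivAt bump (φ₁ x) x) ∧
    (∀ x, HasDerivAt φ₁ (φ₂ x) x) ∧ (∀ x, HasDerivAt φ₂ (φ₃ x) x) ∧
    (∀ x, |bump x| ≤ M) ∧ (∀ x, |φ₁ x| ≤ M) ∧ (∀ x, |φ₂ x| ≤ M) ∧ ∀ x, |φ₃ x| ≤ M := by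
  have hc : ContDiff ℝ (⊤ : ℕ∞) (bump : ℝ → ℝ) := bump.contDiff
  have h1 : ContDiff ℝ (⊤ : ℕ∞) (deriv (bump : ℝ → ℝ)) := ContDiff.iterate_deriv 1 hc
  have h2 : ContDiff ℝ (⊤ : ℕ∞) (deriv (deriv (bump : ℝ → ℝ))) := ContDiff.iterate_deriv 2 hc
  have h3 : ContDiff ℝ (⊤ : ℕ∞) (deriv (deriv (deriv (bump : ℝ → ℝ)))) :=
    ContDiff.iterate_deriv 3 hc
  have hs0 : HasCompactSupport (bump : ℝ → ℝ) := bump.hasCompactSupport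
  have key : ∀ f : ℝ → ℝ, Continuous f → HasCompactSupport f → ∃ M, ∀ x, |f x| ≤ M := by
    intro f hf hs
    obtain ⟨M, hM⟩ := hf.bounded_above_of_compact_support hs
    exact ⟨M, hM⟩
  obtain ⟨M0, hM0⟩ := key _ hc.continuous hs0
  obtain ⟨M1, hM1⟩ := key _ h1.continuous hs0.deriv
  obtain ⟨M2, hM2⟩ := key _ h2.continuous hs0.deriv.deriv
  obtain ⟨M3, hM3⟩ := key _ h3.continuous hs0.deriv.deriv.deriv
  have p0 := (abs_nonneg _).trans (hM0 0)
  have p1 := (abs_nonneg _).trans (hM1 0)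
  have p2 := (abs_nonneg _).trans (hM2 0)
  have p3 := (abs_nonneg _).trans (hM3 0)
  refine ⟨1 + M0 + M1 + M2 + M3, _, _, _, by linarith,
    fun x => (hc.differentiable (by simp) x).hasDerivAt,
    fun x => (h1.differentiable (by simp) x).hasDerivAt,
    fun x => (h2.differentiable (by simp) x).hasDerivAt,
    fun x => (hM0 x).trans (by linarith), fun x => (hM1 x).trans (by linarith),
    fun x => (hM2 x).trans (by linarith), fun x => (hM3 x).trans (by linarith)⟩

/-- Functions on `(-1/2, 1/2)` with three controlled logarithmic derivatives. -/
def Osc (A : ℝ) (E : ℝ → ℂ) : Prop :=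
  ∃ R R₁ R₂ : ℝ → ℂ, ∀ s, |s| < 1 / 2 → HasDerivAt E (R s * E s) s ∧ HasDerivAt R (R₁ s) s ∧
    HasDerivAt R₁ (R₂ s) s ∧ ‖E s‖ ≤ A ∧ ‖R s‖ ≤ A ∧ ‖R₁ s‖ ≤ A ∧ ‖R₂ s‖ ≤ A

lemma deriv_chain {f f' : ℝ → ℂ} {C : ℝ} (hf : ∀ x, 1 / 4 < |x| → f x = 0)
    (h : ∀ x, |x| < 1 / 2 → HasDerivAt f (f' x) x) (hb : ∀ x, |x| < 1 / 2 → ‖f' x‖ ≤ C) :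
    (∀ x, 1 / 4 < |x| → deriv f x = 0) ∧ (∀ x, |x| < 1 / 2 → deriv f x = f' x) ∧
    Differentiable ℝ f ∧ Integrable f ∧ Integrable (deriv f) ∧
    ∫ x, ‖deriv f x‖ ≤ C := by
  have hz : ∀ x, 1 / 4 < |x| → HasDerivAt f 0 x := fun x hx => by
    have : f =ᶠ[𝓝 x] fun _ => 0 := by
      filter_upwards [continuous_abs.continuousAt.eventually (lt_mem_nhds hx)] with y hy
      exact hf y hy
    exact (hasDerivAt_const x (0 : ℂ)).congr_of_eventuallyEq this
  have h0 : ∀ x, 1 / 4 < |x| → deriv f x = 0 := fun x hx => (hz x hx).deriv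
  have h1 : ∀ x, |x| < 1 / 2 → deriv f x = f' x := fun x hx => (h x hx).deriv
  have hd : Differentiable ℝ f := by
    intro x
    rcases lt_or_ge (|x|) (1 / 2) with hx | hx
    · exact (h x hx).differentiableAt
    · exact (hz x (by linarith)).differentiableAt
  have hC : 0 ≤ C := (norm_nonneg _).trans (hb 0 (by norm_num))
  have hle : ∀ x, ‖deriv f x‖ ≤ (Set.Ioo (-(1 / 2) : ℝ) (1 / 2)).indicator (fun _ => C) x := by
    intro x
    by_cases hx : |x| < 1 / 2
    · rw [indicator_of_mem (show x ∈ Set.Ioo _ _ from abs_lt.1 hx), h1 x hx]; exact hb x hx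
    · rw [h0 x (by linarith), norm_zero]
      exact indicator_nonneg (fun _ _ => hC) x
  have hi : Integrable ((Set.Ioo (-(1 / 2) : ℝ) (1 / 2)).indicator (fun _ => C)) :=
    (integrableOn_const (by simp)).integrable_indicator measurableSet_Ioo
  refine ⟨h0, h1, hd, ?_, ?_, ?_⟩
  · refine hd.continuous.integrable_of_hasCompactSupport ?_
    refine HasCompactSupport.intro (K := Set.Icc (-(1 / 4) : ℝ) (1 / 4)) isCompact_Icc fun x hx => ?_
    refine hf x ?_
    by_contra hlt
    exact hx (abs_le.1 (not_lt.1 hlt))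
  · exact hi.mono' (measurable_deriv f).aestronglyMeasurable (.of_forall hle)
  · refine (integral_mono_of_nonneg (.of_forall fun _ => norm_nonneg _) hi
      (.of_forall hle)).trans ?_
    rw [integral_indicator measurableSet_Ioo]
    simp
    norm_num

theorem osc_bound (A : ℝ) : ∃ C : ℝ, 0 < C ∧ ∀ E, Osc A E → ∀ ζ : ℝ,
    ‖∫ s : ℝ, cexp (-(2 * π * I * ((ζ * s : ℝ) : ℂ))) * ((bump s : ℂ) * E s)‖ ≤
      C / (1 + |ζ|) ^ 3 := by
  obtain ⟨M, φ₁, φ₂, φ₃, hM, d0, d1, d2, b0, b1, b2, b3⟩ := bump_bounds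
  set C3 := (M + 3 * M * A + 3 * M * (A + A ^ 2) + M * (A + 3 * A * A + A ^ 3)) * A with hC3
  refine ⟨8 * (|M * A| + |C3| + 1), by positivity, ?_⟩
  rintro E ⟨R, R₁, R₂, h⟩ ζ
  have hA : 0 ≤ A := (norm_nonneg _).trans (h 0 (by norm_num)).2.2.2.1
  have hM0 : 0 ≤ M := by linarith
  have e0 : ∀ x, HasDerivAt (fun x => (bump x : ℂ)) (φ₁ x) x := fun x => (d0 x).ofReal_comp
  have e1 : ∀ x, HasDerivAt (fun x => (φ₁ x : ℂ)) (φ₂ x) x := fun x => (d1 x).ofReal_comp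
  have e2 : ∀ x, HasDerivAt (fun x => (φ₂ x : ℂ)) (φ₃ x) x := fun x => (d2 x).ofReal_comp
  have n0 : ∀ x, ‖(bump x : ℂ)‖ ≤ M := fun x => by rw [Complex.norm_real]; exact b0 x
  have n1 : ∀ x, ‖(φ₁ x : ℂ)‖ ≤ M := fun x => by rw [Complex.norm_real]; exact b1 x
  have n2 : ∀ x, ‖(φ₂ x : ℂ)‖ ≤ M := fun x => by rw [Complex.norm_real]; exact b2 x
  have n3 : ∀ x, ‖(φ₃ x : ℂ)‖ ≤ M := fun x => by rw [Complex.norm_real]; exact b3 x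
  set f : ℝ → ℂ := fun x => (bump x : ℂ) * E x with hf
  have f0 : ∀ x, 1 / 4 < |x| → f x = 0 := fun x hx => by simp [hf, bump_eq_zero hx.le]
  have g1 : ∀ x, |x| < 1 / 2 → HasDerivAt f (((φ₁ x : ℂ) + bump x * R x) * E x) x := fun x hx => by
    exact ((e0 x).mul (h x hx).1).congr_deriv (by ring)
  have bd : ∀ x, |x| < 1 / 2 → ∀ (P : ℂ) (c : ℝ), ‖P‖ ≤ c → ‖P * E x‖ ≤ c * A :=
    fun x hx P c hP => by
      rw [norm_mul]
      exact mul_le_mul hP (h x hx).2.2.2.1 (norm_nonneg _) ((norm_nonneg _).trans hP)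
  have bm : ∀ (u v : ℂ) (c d : ℝ), ‖u‖ ≤ c → ‖v‖ ≤ d → ‖u * v‖ ≤ c * d := fun u v c d hu hv => by
    rw [norm_mul]
    exact mul_le_mul hu hv (norm_nonneg _) ((norm_nonneg _).trans hu)
  have ba : ∀ (u v : ℂ) (c d : ℝ), ‖u‖ ≤ c → ‖v‖ ≤ d → ‖u + v‖ ≤ c + d := fun u v c d hu hv =>
    (norm_add_le _ _).trans (add_le_add hu hv)
  have b3' : ‖(3 : ℂ)‖ ≤ 3 := by simp
  have b2' : ‖(2 : ℂ)‖ ≤ 2 := by simp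
  obtain ⟨z1, q1, D1, I1, J1, -⟩ := deriv_chain (C := (M + M * A) * A) f0 g1 fun x hx =>
    bd x hx _ _ (ba _ _ _ _ (n1 x) (bm _ _ _ _ (n0 x) (h x hx).2.2.2.2.1))
  have nh : ∀ x : ℝ, |x| < 1 / 2 → ∀ᶠ y in 𝓝 x, |y| < 1 / 2 := fun x hx =>
    continuous_abs.continuousAt.eventually (gt_mem_nhds hx)
  have g2 : ∀ x, |x| < 1 / 2 → HasDerivAt (deriv f)
      (((φ₂ x : ℂ) + 2 * (φ₁ x * R x) + bump x * (R₁ x + R x * R x)) * E x) x := fun x hx => by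
    have := (((e1 x).add ((e0 x).mul (h x hx).2.1)).mul (h x hx).1)
    refine HasDerivAt.congr_of_eventuallyEq (f := fun x => ((φ₁ x : ℂ) + bump x * R x) * E x) ?_ ?_
    · exact this.congr_deriv (by simp only [Pi.add_apply, Pi.mul_apply]; ring)
    · filter_upwards [nh x hx] with y hy using q1 y hy
  obtain ⟨z2, q2, D2, I2, J2, -⟩ := deriv_chain
    (C := (M + 2 * (M * A) + M * (A + A * A)) * A) z1 g2 fun x hx => by
      obtain ⟨-, -, -, hE, hR, hR1, hR2⟩ := h x hx
      exact bd x hx _ _ (ba _ _ _ _ (ba _ _ _ _ (n2 x) (bm _ _ _ _ b2' (bm _ _ _ _ (n1 x) hR)))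
        (bm _ _ _ _ (n0 x) (ba _ _ _ _ hR1 (bm _ _ _ _ hR hR))))
  have g3 : ∀ x, |x| < 1 / 2 → HasDerivAt (deriv (deriv f))
      (((φ₃ x : ℂ) + 3 * (φ₂ x * R x) + 3 * (φ₁ x * (R₁ x + R x * R x)) +
        bump x * (R₂ x + 3 * (R x * R₁ x) + R x * (R x * R x))) * E x) x := fun x hx => by
    have := ((((e2 x).add (((e1 x).mul (h x hx).2.1).const_mul 2)).add
      ((e0 x).mul ((h x hx).2.2.1.add ((h x hx).2.1.mul (h x hx).2.1)))).mul (h x hx).1)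
    refine HasDerivAt.congr_of_eventuallyEq (f := fun x =>
      ((φ₂ x : ℂ) + 2 * (φ₁ x * R x) + bump x * (R₁ x + R x * R x)) * E x) ?_ ?_
    · exact this.congr_deriv (by simp only [Pi.add_apply, Pi.mul_apply]; ring)
    · filter_upwards [nh x hx] with y hy using q2 y hy
  obtain ⟨z3, q3, D3, I3, J3, B3⟩ := deriv_chain (C := C3) z2 g3 fun x hx => by
      obtain ⟨-, -, -, hE, hR, hR1, hR2⟩ := h x hx
      refine (bd x hx _ _ (ba _ _ _ _ (ba _ _ _ _ (ba _ _ _ _ (n3 x)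
        (bm _ _ _ _ b3' (bm _ _ _ _ (n2 x) hR)))
        (bm _ _ _ _ b3' (bm _ _ _ _ (n1 x) (ba _ _ _ _ hR1 (bm _ _ _ _ hR hR)))))
        (bm _ _ _ _ (n0 x) (ba _ _ _ _ (ba _ _ _ _ hR2 (bm _ _ _ _ b3' (bm _ _ _ _ hR hR1)))
          (bm _ _ _ _ hR (bm _ _ _ _ hR hR)))))).trans (le_of_eq ?_)
      rw [hC3]; ring
  have F1 := Real.fourier_deriv I1 D1 J1
  have F2 := Real.fourier_deriv J1 D2 J2
  have F3 := Real.fourier_deriv J2 D3 J3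
  have hF : ∫ s : ℝ, cexp (-(2 * π * I * ((ζ * s : ℝ) : ℂ))) * f s =
      FourierTransform.fourier f ζ := by
    rw [fourier_eq']
    refine integral_congr_ae (.of_forall fun s => ?_)
    simp only [smul_eq_mul, RCLike.inner_apply]
    congr 2
    simp
    ring
  have hFb : ‖FourierTransform.fourier f ζ‖ ≤ M * A := by
    rw [← hF]
    refine (norm_integral_le_integral_norm _).trans ?_
    have hle : ∀ x, ‖cexp (-(2 * π * I * ((ζ * x : ℝ) : ℂ))) * f x‖ ≤
        (Set.Ioo (-(1 / 2) : ℝ) (1 / 2)).indicator (fun _ => M * A) x := by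
      intro x
      have : ‖cexp (-(2 * π * I * ((ζ * x : ℝ) : ℂ)))‖ = 1 := by
        rw [norm_exp]; simp
      rw [norm_mul, this, one_mul]
      by_cases hx : |x| < 1 / 2
      · rw [indicator_of_mem (show x ∈ Set.Ioo _ _ from abs_lt.1 hx)]; exact bd x hx _ _ (n0 x)
      · rw [f0 x (by linarith), norm_zero]
        exact indicator_nonneg (fun _ _ => by positivity) x
    have hi : Integrable ((Set.Ioo (-(1 / 2) : ℝ) (1 / 2)).indicator (fun _ => M * A)) :=
      (integrableOn_const (by simp)).integrable_indicator measurableSet_Ioo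
    refine (integral_mono_of_nonneg (.of_forall fun _ => norm_nonneg _) hi
      (.of_forall hle)).trans ?_
    rw [integral_indicator measurableSet_Ioo]
    simp
    norm_num
  have hF3 : ‖FourierTransform.fourier (deriv (deriv (deriv f))) ζ‖ ≤ C3 := by
    refine le_trans ?_ B3
    rw [fourier_eq']
    refine (norm_integral_le_integral_norm _).trans (le_of_eq ?_)
    refine integral_congr_ae (.of_forall fun s => ?_)
    simp only [_root_.norm_smul]
    rw [norm_exp]; simp
  rw [F3, F2, F1] at hF3
  simp only [smul_smul, _root_.norm_smul, norm_mul, Complex.norm_real, norm_I, mul_one,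
    norm_eq_abs, norm_ofNat, abs_of_pos Real.pi_pos] at hF3
  rw [hF, le_div_iff₀ (by positivity)]
  set X := ‖FourierTransform.fourier f ζ‖ with hX
  have hX0 : 0 ≤ X := norm_nonneg _
  have hpi := pi_gt_three
  have l1 := le_abs_self (M * A)
  have l2 := le_abs_self C3
  rcases le_total (|ζ|) 1 with h1 | h1
  · have : (1 + |ζ|) ^ 3 ≤ 8 := by
      calc (1 + |ζ|) ^ 3 ≤ (1 + 1) ^ 3 := by gcongr
        _ = 8 := by norm_num
    calc X * (1 + |ζ|) ^ 3 ≤ X * 8 := by gcongr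
      _ ≤ _ := by nlinarith [abs_nonneg C3]
  · have h2 : (1 + |ζ|) ^ 3 ≤ 8 * |ζ| ^ 3 := by
      calc (1 + |ζ|) ^ 3 ≤ (|ζ| + |ζ|) ^ 3 := by gcongr
        _ = _ := by ring
    have h3 : X * |ζ| ^ 3 ≤ C3 := by
      refine le_trans ?_ hF3
      have : (1 : ℝ) ≤ (2 * π) ^ 3 := one_le_pow₀ (by linarith)
      calc X * |ζ| ^ 3 ≤ (2 * π) ^ 3 * (X * |ζ| ^ 3) :=
            le_mul_of_one_le_left (by positivity) this
        _ = _ := by ring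
    calc X * (1 + |ζ|) ^ 3 ≤ X * (8 * |ζ| ^ 3) := by gcongr
      _ ≤ _ := by nlinarith [abs_nonneg (M * A)]

lemma norm_one_add_mul_I_le (t : ℝ) {b : ℝ} (hb : 0 < b) (hb1 : b ≤ 1) (ht : |t| * b ^ 2 ≤ 1) :
    ‖(1 + t * I : ℂ)‖ * b ^ 2 ≤ 2 := by
  have : ‖(1 + t * I : ℂ)‖ ≤ 1 + |t| := by
    refine (norm_add_le _ _).trans ?_
    simp
  nlinarith [sq_nonneg b]

lemma osc_real {t b : ℝ} (hb : 0 < b) (hb1 : b ≤ 1) (ht : |t| * b ^ 2 ≤ 1) :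
    Osc 32 fun s => cexp (-(1 + t * I) * (log (1 + b * s) : ℂ) + I * t * b * s) := by
  refine ⟨fun s => -(1 + t * I) * (b * ((1 + b * s : ℝ) : ℂ)⁻¹) + I * t * b,
    fun s => (1 + t * I) * (b ^ 2 * (((1 + b * s : ℝ) : ℂ)⁻¹) ^ 2),
    fun s => -(1 + t * I) * (2 * b ^ 3 * (((1 + b * s : ℝ) : ℂ)⁻¹) ^ 3), fun s hs => ?_⟩
  obtain ⟨hs1, hs2⟩ := abs_lt.1 hs
  have hp : 1 / 2 ≤ 1 + b * s := by nlinarith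
  have hp0 : 0 < 1 + b * s := by linarith
  have hz : ((1 + b * s : ℝ) : ℂ) ≠ 0 := by exact_mod_cast hp0.ne'
  have hN := norm_one_add_mul_I_le t hb hb1 ht
  have hN0 := norm_nonneg (1 + t * I : ℂ)
  have hinv : ‖(((1 + b * s : ℝ) : ℂ)⁻¹)‖ ≤ 2 := by
    rw [norm_inv, Complex.norm_real, norm_of_nonneg hp0.le]
    exact inv_le_of_inv_le₀ (by norm_num) (by linarith)
  have hi0 := norm_nonneg (((1 + b * s : ℝ) : ℂ)⁻¹)
  have dl : HasDerivAt (fun s : ℝ => ((1 + b * s : ℝ) : ℂ)) (b : ℂ) s := by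
    have : HasDerivAt (fun s : ℝ => 1 + b * s) b s := by
      simpa using ((hasDerivAt_id s).const_mul b).const_add 1
    exact this.ofReal_comp
  have di : HasDerivAt (fun s : ℝ => (((1 + b * s : ℝ) : ℂ))⁻¹)
      (-(b * (((1 + b * s : ℝ) : ℂ)⁻¹) ^ 2)) s := by
    refine (dl.inv hz).congr_deriv ?_
    field_simp
  have dlog : HasDerivAt (fun s : ℝ => (log (1 + b * s) : ℂ))
      (b * ((1 + b * s : ℝ) : ℂ)⁻¹) s := by
    have : HasDerivAt (fun s : ℝ => 1 + b * s) b s := by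
      simpa using ((hasDerivAt_id s).const_mul b).const_add 1
    refine (this.log hp0.ne').ofReal_comp.congr_deriv ?_
    push_cast; rw [div_eq_mul_inv]
  refine ⟨?_, ?_, ?_, ?_, ?_, ?_, ?_⟩ <;> beta_reduce
  · refine (((dlog.const_mul (-(1 + t * I))).add
      ((hasDerivAt_id s).ofReal_comp.const_mul (I * t * b))).cexp).congr_deriv ?_
    simp; ring
  · refine ((((di.const_mul (b : ℂ)).const_mul (-(1 + t * I))).add_const _)).congr_deriv ?_
    ring
  · refine ((((di.pow 2).const_mul ((b : ℂ) ^ 2)).const_mul (1 + t * I))).congr_deriv ?_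
    simp only [Nat.cast_ofNat]
    ring
  · rw [norm_exp]
    have : (-(1 + t * I) * (log (1 + b * s) : ℂ) + I * t * b * s).re =
        -log (1 + b * s) := by simp
    rw [this, Real.exp_neg, Real.exp_log hp0]
    exact (inv_le_of_inv_le₀ (by norm_num) (by linarith : (2 : ℝ)⁻¹ ≤ _)).trans (by norm_num)
  · have : -(1 + t * I) * (b * ((1 + b * s : ℝ) : ℂ)⁻¹) + I * t * b =
        (-(b : ℂ) + ((t * b ^ 2 * s : ℝ) : ℂ) * I) * ((1 + b * s : ℝ) : ℂ)⁻¹ := by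
      field_simp
      push_cast
      ring
    rw [this, norm_mul]
    have h1 : ‖(-(b : ℂ) + ((t * b ^ 2 * s : ℝ) : ℂ) * I)‖ ≤ 2 := by
      refine (norm_add_le _ _).trans ?_
      rw [norm_neg, norm_mul, norm_I, Complex.norm_real, Complex.norm_real, mul_one,
        norm_of_nonneg hb.le, norm_eq_abs, abs_mul, abs_mul, abs_of_nonneg (sq_nonneg b)]
      nlinarith [abs_nonneg t, abs_nonneg s, mul_nonneg (abs_nonneg t) (sq_nonneg b)]
    calc _ ≤ (2 : ℝ) * 2 := mul_le_mul h1 hinv hi0 (by norm_num)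
      _ ≤ _ := by norm_num
  · rw [norm_mul, norm_mul, norm_pow, norm_pow, Complex.norm_real, norm_of_nonneg hb.le,
      ← mul_assoc]
    calc _ ≤ (2 : ℝ) * 2 ^ 2 := by gcongr
      _ ≤ _ := by norm_num
  · rw [norm_mul, norm_mul, norm_mul, norm_pow, norm_pow, Complex.norm_real, norm_neg,
      norm_of_nonneg hb.le]
    have : ‖(1 + t * I : ℂ)‖ * (‖(2 : ℂ)‖ * b ^ 3) ≤ 4 := by
      rw [norm_ofNat]
      nlinarith [mul_nonneg hN0 (sq_nonneg b)]
    rw [← mul_assoc]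
    calc _ ≤ (4 : ℝ) * 2 ^ 3 := by gcongr
      _ ≤ _ := by norm_num

lemma complex_aux {b x y : ℝ} (hb : 0 < b) (hb1 : b ≤ 1) (hx : |x| < 1 / 2) (σ : ℂ)
    (hσ : σ = I ∨ σ = -I) :
    ((1 + b * x + b * y * σ : ℂ)) ≠ 0 ∧ ‖((1 + b * x + b * y * σ : ℂ))⁻¹‖ ≤ 2 := by
  obtain ⟨hs1, hs2⟩ := abs_lt.1 hx
  have hp : 1 / 2 ≤ 1 + b * x := by nlinarith
  have hre : (1 + b * x + b * y * σ : ℂ).re = 1 + b * x := by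
    rcases hσ with rfl | rfl <;> simp
  have hn : 1 / 2 ≤ ‖(1 + b * x + b * y * σ : ℂ)‖ := by
    refine hp.trans ?_
    rw [← hre]
    exact (le_abs_self _).trans (abs_re_le_norm _)
  refine ⟨fun h => ?_, ?_⟩
  · rw [h, norm_zero] at hn; linarith
  · rw [norm_inv]
    exact inv_le_of_inv_le₀ (by norm_num) (by linarith)

lemma complex_inv (b x y : ℝ) :
    (((1 + b * x) ^ 2 + (b * y) ^ 2 : ℝ) : ℂ) =
      (1 + b * x + b * y * I) * (1 + b * x + b * y * (-I)) := by
  push_cast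
  ring_nf
  simp [Complex.I_sq]

lemma osc_complex_x {t b y : ℝ} (hb : 0 < b) (hb1 : b ≤ 1) (ht : |t| * b ^ 2 ≤ 1)
    (hy : |y| < 1 / 2) :
    Osc 64 fun s => cexp (-(1 + t * I) * (log ((1 + b * s) ^ 2 + (b * y) ^ 2) : ℂ) +
      2 * I * t * b * s) := by
  refine ⟨fun s => -(1 + t * I) * (b * ((1 + b * s + b * y * I : ℂ)⁻¹ +
      (1 + b * s + b * y * (-I) : ℂ)⁻¹)) + 2 * I * t * b,
    fun s => (1 + t * I) * (b ^ 2 * ((1 + b * s + b * y * I : ℂ)⁻¹ ^ 2 +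
      (1 + b * s + b * y * (-I) : ℂ)⁻¹ ^ 2)),
    fun s => -(1 + t * I) * (2 * b ^ 3 * ((1 + b * s + b * y * I : ℂ)⁻¹ ^ 3 +
      (1 + b * s + b * y * (-I) : ℂ)⁻¹ ^ 3)), fun s hs => ?_⟩
  obtain ⟨hs1, hs2⟩ := abs_lt.1 hs
  have hp : 1 / 2 ≤ 1 + b * s := by nlinarith
  have hN := norm_one_add_mul_I_le t hb hb1 ht
  have hN0 := norm_nonneg (1 + t * I : ℂ)
  have hm : 1 / 4 ≤ (1 + b * s) ^ 2 + (b * y) ^ 2 := by nlinarith [sq_nonneg (b * y)]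
  have hm0 : 0 < (1 + b * s) ^ 2 + (b * y) ^ 2 := by linarith
  have hmul := complex_inv b s y
  obtain ⟨z1, i1⟩ := complex_aux (y := y) hb hb1 hs I (Or.inl rfl)
  obtain ⟨z2, i2⟩ := complex_aux (y := y) hb hb1 hs (-I) (Or.inr rfl)
  have m1 := mul_inv_cancel₀ z1
  have m2 := mul_inv_cancel₀ z2
  have dw : ∀ σ : ℂ, HasDerivAt (fun s : ℝ => (1 + b * s + b * y * σ : ℂ)) (b : ℂ) s := fun σ => by
    refine ((((hasDerivAt_id s).ofReal_comp.const_mul (b : ℂ)).const_add 1).add_const _).congr_deriv ?_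
    simp
  have di : ∀ σ : ℂ, (1 + b * s + b * y * σ : ℂ) ≠ 0 →
      HasDerivAt (fun s : ℝ => (1 + b * s + b * y * σ : ℂ)⁻¹)
      (-(b * (1 + b * s + b * y * σ : ℂ)⁻¹ ^ 2)) s := fun σ hσ => by
    refine ((dw σ).inv hσ).congr_deriv ?_
    field_simp
  have d1 := di I z1
  have d2 := di (-I) z2
  have dlog : HasDerivAt (fun s : ℝ => (log ((1 + b * s) ^ 2 + (b * y) ^ 2) : ℂ))
      (b * ((1 + b * s + b * y * I : ℂ)⁻¹ + (1 + b * s + b * y * (-I) : ℂ)⁻¹)) s := by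
    have h1 : HasDerivAt (fun s : ℝ => 1 + b * s) b s := by
      simpa using ((hasDerivAt_id s).const_mul b).const_add 1
    have h2 := ((h1.pow 2).add_const ((b * y) ^ 2)).log (by simpa using hm0.ne')
    refine h2.ofReal_comp.congr_deriv ?_
    rw [ofReal_div]
    simp only [Pi.pow_apply]
    rw [hmul, div_eq_iff (mul_ne_zero z1 z2)]
    push_cast
    linear_combination -(b * (1 + b * s + b * y * (-I) : ℂ)) * m1 - b * (1 + b * s + b * y * I : ℂ) * m2
  refine ⟨?_, ?_, ?_, ?_, ?_, ?_, ?_⟩ <;> beta_reduce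
  · refine (((dlog.const_mul (-(1 + t * I))).add
      ((hasDerivAt_id s).ofReal_comp.const_mul (2 * I * t * b))).cexp).congr_deriv ?_
    simp; ring
  · refine (((((d1.add d2).const_mul (b : ℂ)).const_mul (-(1 + t * I))).add_const _)).congr_deriv ?_
    ring
  · refine (((((d1.pow 2).add (d2.pow 2)).const_mul ((b : ℂ) ^ 2)).const_mul
      (1 + t * I))).congr_deriv ?_
    simp only [Nat.cast_ofNat]
    ring
  · rw [norm_exp]
    have : (-(1 + t * I) * (log ((1 + b * s) ^ 2 + (b * y) ^ 2) : ℂ) + 2 * I * t * b * s).re =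
        -log ((1 + b * s) ^ 2 + (b * y) ^ 2) := by simp
    rw [this, Real.exp_neg, Real.exp_log hm0]
    exact (inv_le_of_inv_le₀ (by norm_num) (by linarith : (4 : ℝ)⁻¹ ≤ _)).trans (by norm_num)
  · have : -(1 + t * I) * (b * ((1 + b * s + b * y * I : ℂ)⁻¹ +
        (1 + b * s + b * y * (-I) : ℂ)⁻¹)) + 2 * I * t * b =
        (-(b : ℂ) + ((t * b ^ 2 : ℝ) : ℂ) * I * (s + y * I)) * (1 + b * s + b * y * I : ℂ)⁻¹ +
        (-(b : ℂ) + ((t * b ^ 2 : ℝ) : ℂ) * I * (s + y * (-I))) *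
          (1 + b * s + b * y * (-I) : ℂ)⁻¹ := by
      push_cast
      linear_combination -(t * b * I) * m1 - (t * b * I) * m2
    rw [this]
    have h1 : ∀ σ : ℂ, ‖σ‖ = 1 → ‖(-(b : ℂ) + ((t * b ^ 2 : ℝ) : ℂ) * I * (s + y * σ))‖ ≤ 2 := by
      intro σ hσ
      have h2 : ‖(s + y * σ : ℂ)‖ ≤ 1 := by
        refine (norm_add_le _ _).trans ?_
        rw [norm_mul, hσ, Complex.norm_real, Complex.norm_real, norm_eq_abs, norm_eq_abs]
        linarith
      refine (norm_add_le _ _).trans ?_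
      rw [norm_neg, norm_mul, norm_mul, norm_I, Complex.norm_real, Complex.norm_real,
        mul_one, norm_of_nonneg hb.le, norm_eq_abs, abs_mul, abs_of_nonneg (sq_nonneg b)]
      have h3 := norm_nonneg (s + y * σ : ℂ)
      nlinarith [mul_nonneg (abs_nonneg t) (sq_nonneg b)]
    refine (norm_add_le _ _).trans ?_
    rw [norm_mul, norm_mul]
    calc _ ≤ (2 : ℝ) * 2 + 2 * 2 := add_le_add
          (mul_le_mul (h1 _ (by simp)) i1 (norm_nonneg _) (by norm_num))
          (mul_le_mul (h1 _ (by simp)) i2 (norm_nonneg _) (by norm_num))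
      _ ≤ _ := by norm_num
  · rw [norm_mul, norm_mul, norm_pow, Complex.norm_real, norm_of_nonneg hb.le,
      ← mul_assoc]
    calc _ ≤ (2 : ℝ) * (2 ^ 2 + 2 ^ 2) := by
          refine mul_le_mul hN ((norm_add_le _ _).trans ?_) (norm_nonneg _) (by norm_num)
          rw [norm_pow, norm_pow]; gcongr
      _ ≤ _ := by norm_num
  · rw [norm_mul, norm_mul, norm_mul, norm_pow, Complex.norm_real, norm_neg,
      norm_of_nonneg hb.le]
    have : ‖(1 + t * I : ℂ)‖ * (‖(2 : ℂ)‖ * b ^ 3) ≤ 4 := by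
      rw [norm_ofNat]
      nlinarith [mul_nonneg hN0 (sq_nonneg b)]
    rw [← mul_assoc]
    calc _ ≤ (4 : ℝ) * (2 ^ 3 + 2 ^ 3) := by
          refine mul_le_mul this ((norm_add_le _ _).trans ?_) (norm_nonneg _) (by norm_num)
          rw [norm_pow, norm_pow]; gcongr
      _ ≤ _ := by norm_num

lemma osc_complex_y {t b x : ℝ} (hb : 0 < b) (hb1 : b ≤ 1) (ht : |t| * b ^ 2 ≤ 1)
    (hx : |x| < 1 / 2) :
    Osc 64 fun s => cexp (-(1 + t * I) * (log ((1 + b * x) ^ 2 + (b * s) ^ 2) : ℂ)) := by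
  refine ⟨fun s => -(1 + t * I) * (b * I * ((1 + b * x + b * s * I : ℂ)⁻¹ -
      (1 + b * x + b * s * (-I) : ℂ)⁻¹)),
    fun s => -(1 + t * I) * (b ^ 2 * ((1 + b * x + b * s * I : ℂ)⁻¹ ^ 2 +
      (1 + b * x + b * s * (-I) : ℂ)⁻¹ ^ 2)),
    fun s => (1 + t * I) * (2 * b ^ 3 * I * ((1 + b * x + b * s * I : ℂ)⁻¹ ^ 3 -
      (1 + b * x + b * s * (-I) : ℂ)⁻¹ ^ 3)), fun s hs => ?_⟩
  obtain ⟨hs1, hs2⟩ := abs_lt.1 hx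
  have hp : 1 / 2 ≤ 1 + b * x := by nlinarith
  have hN := norm_one_add_mul_I_le t hb hb1 ht
  have hN0 := norm_nonneg (1 + t * I : ℂ)
  have hm : 1 / 4 ≤ (1 + b * x) ^ 2 + (b * s) ^ 2 := by nlinarith [sq_nonneg (b * s)]
  have hm0 : 0 < (1 + b * x) ^ 2 + (b * s) ^ 2 := by linarith
  have hmul := complex_inv b x s
  obtain ⟨z1, i1⟩ := complex_aux (y := s) hb hb1 hx I (Or.inl rfl)
  obtain ⟨z2, i2⟩ := complex_aux (y := s) hb hb1 hx (-I) (Or.inr rfl)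
  have m1 := mul_inv_cancel₀ z1
  have m2 := mul_inv_cancel₀ z2
  have hI2 := Complex.I_sq
  have dw : ∀ σ : ℂ, HasDerivAt (fun s : ℝ => (1 + b * x + b * s * σ : ℂ)) (b * σ : ℂ) s :=
    fun σ => by
    refine ((((hasDerivAt_id s).ofReal_comp.const_mul (b : ℂ)).mul_const σ).const_add _).congr_deriv ?_
    simp
  have di : ∀ σ : ℂ, (1 + b * x + b * s * σ : ℂ) ≠ 0 →
      HasDerivAt (fun s : ℝ => (1 + b * x + b * s * σ : ℂ)⁻¹)
      (-(b * σ * (1 + b * x + b * s * σ : ℂ)⁻¹ ^ 2)) s := fun σ hσ => by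
    refine ((dw σ).inv hσ).congr_deriv ?_
    field_simp
  have d1 := di I z1
  have d2 := di (-I) z2
  have dlog : HasDerivAt (fun s : ℝ => (log ((1 + b * x) ^ 2 + (b * s) ^ 2) : ℂ))
      (b * I * ((1 + b * x + b * s * I : ℂ)⁻¹ - (1 + b * x + b * s * (-I) : ℂ)⁻¹)) s := by
    have h1 : HasDerivAt (fun s : ℝ => b * s) b s := by
      simpa using (hasDerivAt_id s).const_mul b
    have h2 := ((h1.pow 2).const_add ((1 + b * x) ^ 2)).log (by simpa using hm0.ne')
    refine h2.ofReal_comp.congr_deriv ?_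
    rw [ofReal_div]
    simp only [Pi.pow_apply]
    rw [hmul, div_eq_iff (mul_ne_zero z1 z2)]
    push_cast
    linear_combination -(b * I * (1 + b * x + b * s * (-I) : ℂ)) * m1 +
      b * I * (1 + b * x + b * s * I : ℂ) * m2 + 2 * b ^ 2 * s * hI2
  refine ⟨?_, ?_, ?_, ?_, ?_, ?_, ?_⟩ <;> beta_reduce
  · refine ((dlog.const_mul (-(1 + t * I))).cexp).congr_deriv ?_
    ring
  · refine ((((d1.sub d2).const_mul (b * I : ℂ)).const_mul (-(1 + t * I)))).congr_deriv ?_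
    linear_combination (1 + t * I) * b ^ 2 * ((1 + b * x + b * s * I : ℂ)⁻¹ ^ 2 +
      (1 + b * x + b * s * (-I) : ℂ)⁻¹ ^ 2) * hI2
  · refine (((((d1.pow 2).add (d2.pow 2)).const_mul ((b : ℂ) ^ 2)).const_mul
      (-(1 + t * I)))).congr_deriv ?_
    simp only [Nat.cast_ofNat]
    ring
  · rw [norm_exp]
    have : (-(1 + t * I) * (log ((1 + b * x) ^ 2 + (b * s) ^ 2) : ℂ)).re =
        -log ((1 + b * x) ^ 2 + (b * s) ^ 2) := by simp
    rw [this, Real.exp_neg, Real.exp_log hm0]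
    exact (inv_le_of_inv_le₀ (by norm_num) (by linarith : (4 : ℝ)⁻¹ ≤ _)).trans (by norm_num)
  · have : -(1 + t * I) * (b * I * ((1 + b * x + b * s * I : ℂ)⁻¹ -
        (1 + b * x + b * s * (-I) : ℂ)⁻¹)) =
        -((1 + t * I) * (b ^ 2 * (2 * s * ((1 + b * x + b * s * I : ℂ)⁻¹ *
          (1 + b * x + b * s * (-I) : ℂ)⁻¹)))) := by
      linear_combination ((1 + t * I) * b * I * (1 + b * x + b * s * I : ℂ)⁻¹) * m2 -
        ((1 + t * I) * b * I * (1 + b * x + b * s * (-I) : ℂ)⁻¹) * m1 +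
        2 * (1 + t * I) * b ^ 2 * s * (1 + b * x + b * s * I : ℂ)⁻¹ *
          (1 + b * x + b * s * (-I) : ℂ)⁻¹ * hI2
    rw [this, norm_neg, norm_mul, norm_mul, norm_pow, Complex.norm_real, norm_of_nonneg hb.le,
      ← mul_assoc, norm_mul, norm_mul, norm_mul, Complex.norm_real, norm_ofNat,
      norm_eq_abs]
    calc _ ≤ (2 : ℝ) * (2 * (1 / 2) * (2 * 2)) := by gcongr
      _ ≤ _ := by norm_num
  · rw [norm_mul, norm_mul, norm_pow, Complex.norm_real, norm_of_nonneg hb.le,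
      ← mul_assoc, norm_neg]
    calc _ ≤ (2 : ℝ) * (2 ^ 2 + 2 ^ 2) := by
          refine mul_le_mul hN ((norm_add_le _ _).trans ?_) (norm_nonneg _) (by norm_num)
          rw [norm_pow, norm_pow]; gcongr
      _ ≤ _ := by norm_num
  · rw [norm_mul, norm_mul, norm_mul, norm_mul, norm_pow, Complex.norm_real, norm_I,
      norm_of_nonneg hb.le, mul_one]
    have : ‖(1 + t * I : ℂ)‖ * (‖(2 : ℂ)‖ * b ^ 3) ≤ 4 := by
      rw [norm_ofNat]
      nlinarith [mul_nonneg hN0 (sq_nonneg b)]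
    rw [← mul_assoc]
    calc _ ≤ (4 : ℝ) * (2 ^ 3 + 2 ^ 3) := by
          refine mul_le_mul this ((norm_sub_le _ _).trans ?_) (norm_nonneg _) (by norm_num)
          rw [norm_pow, norm_pow]; gcongr
      _ ≤ _ := by norm_num

/-- The real packet. -/
def pR (B x : ℝ) : ℝ := bump (B * (x - 1))

/-- The complex packet. -/
def pC (B : ℝ) (z : ℂ) : ℝ := bump (B * (z.re - 1)) * bump (B * z.im)

/-- The twisted real packet. -/
def fR (B t x : ℝ) : ℂ := (pR B x : ℂ) * ((|x| : ℝ) : ℂ) ^ (-(1 + t * I))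

/-- The twisted complex packet. -/
def fC (B t : ℝ) (z : ℂ) : ℂ := (pC B z : ℂ) * ((‖z‖ ^ 2 : ℝ) : ℂ) ^ (-(1 + t * I))

lemma cpow_eq_exp {r : ℝ} (hr : 0 < r) (s : ℂ) : (r : ℂ) ^ s = cexp (s * (log r : ℂ)) := by
  rw [cpow_def_of_ne_zero (by exact_mod_cast hr.ne'), ofReal_log hr.le, mul_comm]

lemma integral_affine (F : ℝ → ℂ) (c : ℝ) {b : ℝ} (hb : 0 < b) :
    ∫ x, F x = b * ∫ s, F (c + b * s) := by
  rw [Measure.integral_comp_mul_left (fun x => F (c + x)) b, integral_add_left_eq_self F c,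
    abs_of_pos (inv_pos.2 hb), real_smul, ← mul_assoc]
  rw [← Complex.ofReal_mul, mul_inv_cancel₀ hb.ne', Complex.ofReal_one, one_mul]

lemma abs_lt_of_bump_ne {B x : ℝ} (hB : 1 ≤ B) (h : bump (B * x) ≠ 0) : |x| < B⁻¹ / 4 := by
  have h0 : |B * x| < 1 / 4 := by
    by_contra hlt
    exact h (bump_eq_zero (not_lt.1 hlt))
  rw [abs_mul, abs_of_pos (by linarith)] at h0
  rw [lt_div_iff₀ (by norm_num), inv_eq_one_div, lt_div_iff₀ (by linarith)]
  nlinarith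

theorem FR_bound : ∃ C : ℝ, 0 < C ∧ ∀ B : ℝ, 1 ≤ B → ∀ t : ℝ, |t| ≤ B ^ 2 → ∀ ξ : ℝ,
    ‖∫ x : ℝ, cexp (-(2 * π * I * ((ξ * x : ℝ) : ℂ))) * fR B t x‖ ≤
      C * B⁻¹ / (1 + |B⁻¹ * (ξ + t / (2 * π))|) ^ 3 := by
  obtain ⟨C, hC, h⟩ := osc_bound 32
  refine ⟨C, hC, fun B hB t ht ξ => ?_⟩
  have hB0 : 0 < B := by linarith
  set b := B⁻¹ with hb
  have hb0 : 0 < b := inv_pos.2 hB0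
  have hb1 : b ≤ 1 := inv_le_one_of_one_le₀ hB
  have hbB : B * b = 1 := mul_inv_cancel₀ hB0.ne'
  have htb : |t| * b ^ 2 ≤ 1 := by
    rw [hb, inv_pow, ← div_eq_mul_inv, div_le_one (by positivity)]; exact ht
  have key := h _ (osc_real hb0 hb1 htb) (b * (ξ + t / (2 * π)))
  rw [integral_affine _ 1 hb0]
  have : ∀ s : ℝ, cexp (-(2 * π * I * ((ξ * (1 + b * s) : ℝ) : ℂ))) * fR B t (1 + b * s) =
      cexp (-(2 * π * I * ξ)) *
      (cexp (-(2 * π * I * ((b * (ξ + t / (2 * π)) * s : ℝ) : ℂ))) *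
        ((bump s : ℂ) * cexp (-(1 + t * I) * (log (1 + b * s) : ℂ) + I * t * b * s))) := by
    intro s
    have e1 : pR B (1 + b * s) = bump s := by
      rw [pR]; congr 1; linear_combination s * hbB
    by_cases hs : 1 / 4 ≤ |s|
    · rw [fR, e1, bump_eq_zero hs]; simp
    have hs' := abs_lt.1 (not_le.1 hs)
    have hp : 0 < 1 + b * s := by nlinarith
    rw [fR, e1, abs_of_pos hp, cpow_eq_exp hp]
    have hpi : (π : ℂ) ≠ 0 := by exact_mod_cast Real.pi_ne_zero
    have : ∀ a b c d e x : ℂ, cexp a * (x * cexp b) = cexp c * (cexp d * (x * cexp e)) ↔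
        x * cexp (a + b) = x * cexp (c + d + e) := fun a b c d e x => by
      simp only [exp_add]
      constructor <;> intro h <;> linear_combination h
    rw [this]
    congr 2
    push_cast
    field_simp
    ring
  simp only [this]
  rw [integral_const_mul, norm_mul, norm_mul, Complex.norm_real, norm_of_nonneg hb0.le]
  have hone : ‖cexp (-(2 * π * I * ξ))‖ = 1 := by
    rw [norm_exp]; simp
  rw [hone, one_mul, mul_comm C, mul_div_assoc]
  exact mul_le_mul_of_nonneg_left key hb0.le

lemma abs_pR_le (B x : ℝ) : 0 ≤ pR B x ∧ pR B x ≤ 1 := ⟨bump.nonneg, bump.le_one⟩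

lemma abs_pC_le (B : ℝ) (z : ℂ) : 0 ≤ pC B z ∧ pC B z ≤ 1 :=
  ⟨mul_nonneg bump.nonneg bump.nonneg, mul_le_one₀ bump.le_one bump.nonneg bump.le_one⟩

lemma pR_ne {B x : ℝ} (hB : 1 ≤ B) (h : pR B x ≠ 0) : |x - 1| < 1 / 4 := by
  refine (abs_lt_of_bump_ne hB h).trans_le ?_
  have := inv_le_one_of_one_le₀ hB
  linarith

lemma pC_ne {B : ℝ} {z : ℂ} (hB : 1 ≤ B) (h : pC B z ≠ 0) : |z.re - 1| < 1 / 4 ∧ |z.im| < 1 / 4 := by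
  have := inv_le_one_of_one_le₀ hB
  exact ⟨(abs_lt_of_bump_ne hB (left_ne_zero_of_mul h)).trans_le (by linarith),
    (abs_lt_of_bump_ne hB (right_ne_zero_of_mul h)).trans_le (by linarith)⟩

lemma continuous_pR (B : ℝ) : Continuous (pR B) := by
  unfold pR
  exact bump.continuous.comp (by fun_prop)

lemma continuous_pC (B : ℝ) : Continuous (pC B) := by
  unfold pC
  exact (bump.continuous.comp (by fun_prop)).mul (bump.continuous.comp (by fun_prop))

lemma fR_eq {B : ℝ} (hB : 1 ≤ B) (t x : ℝ) :
    fR B t x = (pR B x : ℂ) * cexp (-(1 + t * I) * (log (max (|x|) (1 / 2)) : ℂ)) := by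
  by_cases h : pR B x = 0
  · simp [fR, h]
  have h1 := abs_lt.1 (pR_ne hB h)
  have h2 : 1 / 2 ≤ |x| := le_trans (by linarith) (le_abs_self x)
  rw [fR, cpow_eq_exp (by linarith), max_eq_left h2]

lemma fC_eq {B : ℝ} (hB : 1 ≤ B) (t : ℝ) (z : ℂ) :
    fC B t z = (pC B z : ℂ) * cexp (-(1 + t * I) * (log (max (‖z‖ ^ 2) (1 / 4)) : ℂ)) := by
  by_cases h : pC B z = 0
  · simp [fC, h]
  have h1 := abs_lt.1 (pC_ne hB h).1
  have h2 : 1 / 2 ≤ ‖z‖ :=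
    le_trans (by linarith) ((le_abs_self z.re).trans (abs_re_le_norm z))
  have h3 : 1 / 4 ≤ ‖z‖ ^ 2 := by nlinarith
  rw [fC, cpow_eq_exp (by linarith), max_eq_left h3]

lemma continuous_fR {B : ℝ} (hB : 1 ≤ B) (t : ℝ) : Continuous (fR B t) := by
  have : fR B t = _ := funext (fR_eq hB t)
  rw [this]
  refine (continuous_ofReal.comp (continuous_pR B)).mul (continuous_exp.comp
    (continuous_const.mul (continuous_ofReal.comp (Continuous.log (by fun_prop) fun x => ?_))))
  have := le_max_right (|x|) (1 / 2 : ℝ)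
  linarith

lemma continuous_fC {B : ℝ} (hB : 1 ≤ B) (t : ℝ) : Continuous (fC B t) := by
  have : fC B t = _ := funext (fC_eq hB t)
  rw [this]
  refine (continuous_ofReal.comp (continuous_pC B)).mul (continuous_exp.comp
    (continuous_const.mul (continuous_ofReal.comp (Continuous.log (by fun_prop) fun x => ?_))))
  have := le_max_right (‖x‖ ^ 2) (1 / 4 : ℝ)
  linarith

lemma fR_ne {B t x : ℝ} (h : fR B t x ≠ 0) : pR B x ≠ 0 := fun h0 => h (by simp [fR, h0])
lemma fC_ne {B t : ℝ} {z : ℂ} (h : fC B t z ≠ 0) : pC B z ≠ 0 := fun h0 => h (by simp [fC, h0])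

lemma hasCompactSupport_fC {B : ℝ} (hB : 1 ≤ B) (t : ℝ) : HasCompactSupport (fC B t) := by
  refine HasCompactSupport.intro (isCompact_closedBall (1 : ℂ) 1) fun x hx => ?_
  by_contra h
  obtain ⟨h1, h2⟩ := pC_ne hB (fC_ne h)
  refine hx ?_
  rw [mem_closedBall, Complex.dist_eq]
  refine (norm_le_abs_re_add_abs_im _).trans ?_
  simp
  linarith

/-- Bounding an integral over `ℂ` by bounding the integrals over lines. -/
lemma norm_integral_complex_le {G : ℂ → ℂ} (hG : Integrable G) {b M : ℝ} (hM : 0 ≤ M) (c : ℝ)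
    (hb : 0 ≤ b) :
    ((∀ y : ℝ, b / 4 ≤ |y - c| → ∀ x : ℝ, G (x + y * I) = 0) → (∀ y : ℝ, ‖∫ x : ℝ, G (x + y * I)‖ ≤ M) →
      ‖∫ z, G z‖ ≤ M * b) ∧
    ((∀ x : ℝ, b / 4 ≤ |x - c| → ∀ y : ℝ, G (x + y * I) = 0) → (∀ x : ℝ, ‖∫ y : ℝ, G (x + y * I)‖ ≤ M) →
      ‖∫ z, G z‖ ≤ M * b) := by
  have hmp := volume_preserving_equiv_real_prod.symm
  have hsy : ∀ p : ℝ × ℝ, measurableEquivRealProd.symm p = p.1 + p.2 * I := fun p => by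
    apply Complex.ext <;> simp [measurableEquivRealProd]
  have hI : ∫ z, G z = ∫ p : ℝ × ℝ, G (p.1 + p.2 * I) := by
    rw [← hmp.integral_comp measurableEquivRealProd.symm.measurableEmbedding G]
    refine integral_congr_ae (.of_forall fun p => ?_)
    exact congrArg G (hsy p)
  have hi : Integrable (fun p : ℝ × ℝ => G (p.1 + p.2 * I)) (volume.prod volume) := by
    refine ((hmp.integrable_comp_emb
      measurableEquivRealProd.symm.measurableEmbedding).2 hG).congr
      (.of_forall fun p => ?_)
    exact congrArg G (hsy p)
  have one : ∀ F : ℝ → ℂ, (∀ y, b / 4 ≤ |y - c| → F y = 0) → (∀ y, ‖F y‖ ≤ M) →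
      ‖∫ y, F y‖ ≤ M * b := by
    intro F h0 hF
    refine (norm_integral_le_integral_norm _).trans ?_
    have hle : ∀ x, ‖F x‖ ≤ (Set.Icc (c - b / 4) (c + b / 4)).indicator (fun _ => M) x := by
      intro x
      by_cases hx : b / 4 ≤ |x - c|
      · rw [h0 x hx, norm_zero]; exact indicator_nonneg (fun _ _ => hM) x
      · have := abs_lt.1 (not_le.1 hx)
        rw [indicator_of_mem (show x ∈ Set.Icc _ _ from ⟨by linarith, by linarith⟩)]
        exact hF x
    refine (integral_mono_of_nonneg (.of_forall fun _ => norm_nonneg _)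
      ((integrableOn_const (by simp)).integrable_indicator measurableSet_Icc)
      (.of_forall hle)).trans ?_
    rw [integral_indicator measurableSet_Icc]
    simp
    rw [max_eq_left (by linarith)]
    nlinarith
  rw [hI]
  constructor
  · intro h0 hle
    rw [Measure.volume_eq_prod, integral_prod_symm _ hi]
    refine one _ (fun y hy => ?_) hle
    simp [h0 y hy]
  · intro h0 hle
    rw [Measure.volume_eq_prod, integral_prod _ hi]
    refine one _ (fun y hy => ?_) hle
    simp [h0 y hy]

theorem FC_bound : ∃ C : ℝ, 0 < C ∧ ∀ B : ℝ, 1 ≤ B → ∀ t : ℝ, |t| ≤ B ^ 2 → ∀ ξ : ℂ,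
    ‖∫ z : ℂ, cexp (-(2 * π * I * ((2 * (ξ * z).re : ℝ) : ℂ))) * fC B t z‖ ≤
      C * B⁻¹ ^ 2 / (1 + ‖(B⁻¹ : ℂ) * (2 * ξ + t / π)‖) ^ 3 := by
  obtain ⟨C, hC, h⟩ := osc_bound 64
  refine ⟨8 * C, by positivity, fun B hB t ht ξ => ?_⟩
  have hB0 : 0 < B := by linarith
  have hcb : (B⁻¹ : ℂ) = ((B⁻¹ : ℝ) : ℂ) := by push_cast; rfl
  rw [hcb]
  set b := B⁻¹ with hb
  have hb0 : 0 < b := inv_pos.2 hB0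
  have hb1 : b ≤ 1 := inv_le_one_of_one_le₀ hB
  have hbB : B * b = 1 := mul_inv_cancel₀ hB0.ne'
  have htb : |t| * b ^ 2 ≤ 1 := by
    rw [hb, inv_pow, ← div_eq_mul_inv, div_le_one (by positivity)]; exact ht
  have hpi : (π : ℂ) ≠ 0 := by exact_mod_cast Real.pi_ne_zero
  set G : ℂ → ℂ := fun z => cexp (-(2 * π * I * ((2 * (ξ * z).re : ℝ) : ℂ))) * fC B t z
    with hGdef
  have hGi : Integrable G := by
    refine Continuous.integrable_of_hasCompactSupport ?_ (hasCompactSupport_fC hB t).mul_left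
    exact (continuous_exp.comp (by fun_prop)).mul (continuous_fC hB t)
  have hone : ∀ r : ℝ, ‖cexp (-(2 * π * I * r))‖ = 1 := fun r => by
    rw [norm_exp]; simp
  have hfC : ∀ x y : ℝ, 0 < 1 + b * x → fC B t (((1 + b * x : ℝ) : ℂ) + ((b * y : ℝ) : ℂ) * I) =
      (bump x : ℂ) * (bump y : ℂ) *
        cexp (-(1 + t * I) * (log ((1 + b * x) ^ 2 + (b * y) ^ 2) : ℂ)) := by
    intro x y hx
    have hn : ‖((1 + b * x : ℝ) : ℂ) + ((b * y : ℝ) : ℂ) * I‖ ^ 2 =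
        (1 + b * x) ^ 2 + (b * y) ^ 2 := by
      rw [sq_norm, normSq_add_mul_I]
    have hp : 0 < (1 + b * x) ^ 2 + (b * y) ^ 2 := by positivity
    rw [fC, hn, cpow_eq_exp hp]
    congr 1
    rw [pC, ← Complex.ofReal_mul]
    congr 3
    · simp
      linear_combination x * hbB
    · simp
      linear_combination y * hbB
  have hfC0 : ∀ x y : ℝ, 1 / 4 ≤ |x| ∨ 1 / 4 ≤ |y| →
      fC B t (((1 + b * x : ℝ) : ℂ) + ((b * y : ℝ) : ℂ) * I) = 0 := by
    intro x y hxy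
    by_contra h0
    have h1 := fC_ne h0
    have h2 : pC B (((1 + b * x : ℝ) : ℂ) + ((b * y : ℝ) : ℂ) * I) = bump x * bump y := by
      rw [pC]
      congr 2
      · simp
        linear_combination x * hbB
      · simp
        linear_combination y * hbB
    rw [h2] at h1
    rcases hxy with hx | hy
    · exact h1 (by rw [bump_eq_zero hx, zero_mul])
    · exact h1 (by rw [bump_eq_zero hy, mul_zero])
  have hz : ∀ x y : ℝ, ∃ s : ℝ, x = 1 + b * s := fun x y => ⟨B * (x - 1), by
    linear_combination (1 - x) * hbB⟩
  have hw : ∀ y : ℝ, ∃ s : ℝ, y = b * s := fun y => ⟨B * y, by linear_combination -y * hbB⟩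
  have hre : ∀ x y : ℝ, (ξ * ((x : ℂ) + (y : ℂ) * I)).re = ξ.re * x - ξ.im * y := by
    intro x y; simp
  have hxy1 : ‖∫ z, G z‖ ≤ (b * (C / (1 + |b * (2 * ξ.re + t / π)|) ^ 3)) * b := by
    refine (norm_integral_complex_le hGi (by positivity) 0 hb0.le).1 (fun y hy x => ?_) fun y => ?_
    · obtain ⟨s, rfl⟩ := hz x y
      obtain ⟨u, rfl⟩ := hw y
      have : 1 / 4 ≤ |u| := by
        rw [sub_zero, abs_mul, abs_of_pos hb0] at hy
        by_contra hlt
        nlinarith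
      rw [hGdef]
      beta_reduce
      rw [hfC0 s u (Or.inr this), mul_zero]
    · obtain ⟨u, rfl⟩ := hw y
      by_cases hu : 1 / 4 ≤ |u|
      · have : ∀ x : ℝ, G (x + ((b * u : ℝ) : ℂ) * I) = 0 := by
          intro x
          obtain ⟨s, rfl⟩ := hz x x
          rw [hGdef]
          beta_reduce
          rw [hfC0 s u (Or.inr hu), mul_zero]
        simp only [this, integral_zero, norm_zero]
        positivity
      have key := h _ (osc_complex_x hb0 hb1 htb (y := u) (by linarith [not_le.1 hu]))
        (b * (2 * ξ.re + t / π))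
      rw [integral_affine _ 1 hb0]
      have : ∀ s : ℝ, G (((1 + b * s : ℝ) : ℂ) + ((b * u : ℝ) : ℂ) * I) =
          (cexp (-(2 * π * I * ((2 * (ξ.re - ξ.im * (b * u)) : ℝ) : ℂ))) * (bump u : ℂ)) *
          (cexp (-(2 * π * I * ((b * (2 * ξ.re + t / π) * s : ℝ) : ℂ))) *
            ((bump s : ℂ) * cexp (-(1 + t * I) * (log ((1 + b * s) ^ 2 + (b * u) ^ 2) : ℂ)
              + 2 * I * t * b * s))) := by
        intro s
        rw [hGdef]
        beta_reduce
        by_cases hs : 1 / 4 ≤ |s|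
        · rw [hfC0 s u (Or.inl hs), bump_eq_zero hs]; simp
        have hs' := abs_lt.1 (not_le.1 hs)
        rw [hfC s u (by nlinarith), hre]
        have : ∀ a b c d e x y : ℂ, cexp a * (x * y * cexp b) =
            (cexp c * y) * (cexp d * (x * cexp e)) ↔
            x * y * cexp (a + b) = x * y * cexp (c + d + e) := fun a b c d e x y => by
          simp only [exp_add]
          constructor <;> intro h <;> linear_combination h
        rw [this]
        congr 2
        push_cast
        field_simp
        ring
      simp only [this]
      rw [integral_const_mul, norm_mul, norm_mul, norm_mul, Complex.norm_real,
        norm_of_nonneg hb0.le, hone, one_mul, Complex.norm_real, norm_of_nonneg bump.nonneg]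
      refine mul_le_mul_of_nonneg_left ?_ hb0.le
      exact (mul_le_of_le_one_left (norm_nonneg _) bump.le_one).trans key
  have hxy2 : ‖∫ z, G z‖ ≤ (b * (C / (1 + |b * (2 * ξ.im)|) ^ 3)) * b := by
    refine (norm_integral_complex_le hGi (by positivity) 1 hb0.le).2 (fun x hx y => ?_) fun x => ?_
    · obtain ⟨s, rfl⟩ := hz x y
      obtain ⟨u, rfl⟩ := hw y
      have : 1 / 4 ≤ |s| := by
        rw [add_sub_cancel_left, abs_mul, abs_of_pos hb0] at hx
        by_contra hlt
        nlinarith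
      rw [hGdef]
      beta_reduce
      rw [hfC0 s u (Or.inl this), mul_zero]
    · obtain ⟨s, rfl⟩ := hz x x
      by_cases hs : 1 / 4 ≤ |s|
      · have : ∀ y : ℝ, G (((1 + b * s : ℝ) : ℂ) + (y : ℂ) * I) = 0 := by
          intro y
          obtain ⟨u, rfl⟩ := hw y
          rw [hGdef]
          beta_reduce
          rw [hfC0 s u (Or.inl hs), mul_zero]
        simp only [this, integral_zero, norm_zero]
        positivity
      have hs' := abs_lt.1 (not_le.1 hs)
      have key := h _ (osc_complex_y hb0 hb1 htb (x := s) (by linarith [not_le.1 hs]))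
        (b * (2 * (-ξ.im)))
      rw [integral_affine _ 0 hb0]
      have : ∀ u : ℝ, G (((1 + b * s : ℝ) : ℂ) + ((0 + b * u : ℝ) : ℂ) * I) =
          (cexp (-(2 * π * I * ((2 * (ξ.re * (1 + b * s)) : ℝ) : ℂ))) * (bump s : ℂ)) *
          (cexp (-(2 * π * I * ((b * (2 * (-ξ.im)) * u : ℝ) : ℂ))) *
            ((bump u : ℂ) * cexp (-(1 + t * I) * (log ((1 + b * s) ^ 2 + (b * u) ^ 2) : ℂ)))) := by
        intro u
        rw [zero_add, hGdef]
        beta_reduce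
        rw [hfC s u (by nlinarith), hre]
        have : ∀ a b c d e x y : ℂ, cexp a * (x * y * cexp b) =
            (cexp c * x) * (cexp d * (y * cexp e)) ↔
            x * y * cexp (a + b) = x * y * cexp (c + d + e) := fun a b c d e x y => by
          simp only [exp_add]
          constructor <;> intro h <;> linear_combination h
        rw [this]
        congr 2
        push_cast
        ring
      simp only [this]
      rw [integral_const_mul, norm_mul, norm_mul, norm_mul, Complex.norm_real,
        norm_of_nonneg hb0.le, hone, one_mul, Complex.norm_real, norm_of_nonneg bump.nonneg]
      refine mul_le_mul_of_nonneg_left ?_ hb0.le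
      rw [mul_neg, mul_neg, abs_neg] at key
      refine (mul_le_of_le_one_left (norm_nonneg _) bump.le_one).trans (le_trans (le_of_eq ?_) key)
      simp only [mul_neg]
  have hnorm : ‖((b : ℝ) : ℂ) * (2 * ξ + t / π)‖ ≤
      |b * (2 * ξ.re + t / π)| + |b * (2 * ξ.im)| := by
    refine (norm_le_abs_re_add_abs_im _).trans (le_of_eq ?_)
    have e : ((b : ℝ) : ℂ) * (2 * ξ + t / π) =
        ((b * (2 * ξ.re + t / π) : ℝ) : ℂ) + ((b * (2 * ξ.im) : ℝ) : ℂ) * I := by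
      conv_lhs => rw [← re_add_im ξ]
      push_cast
      ring
    rw [e]
    simp
  have fin : ∀ r : ℝ, 0 ≤ r → ‖((b : ℝ) : ℂ) * (2 * ξ + t / π)‖ ≤ 2 * r →
      (b * (C / (1 + r) ^ 3)) * b ≤
      8 * C * b ^ 2 / (1 + ‖((b : ℝ) : ℂ) * (2 * ξ + t / π)‖) ^ 3 := by
    intro r hr hle
    rw [le_div_iff₀ (by positivity)]
    have e1 : (1 + ‖((b : ℝ) : ℂ) * (2 * ξ + t / π)‖) ^ 3 ≤ 8 * (1 + r) ^ 3 := by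
      have : (8 : ℝ) * (1 + r) ^ 3 = (2 * (1 + r)) ^ 3 := by ring
      rw [this]
      exact pow_le_pow_left₀ (by positivity) (by linarith) 3
    calc _ ≤ (b * (C / (1 + r) ^ 3)) * b * (8 * (1 + r) ^ 3) := by gcongr
      _ = _ := by field_simp
  rcases le_total (|b * (2 * ξ.re + t / π)|) (|b * (2 * ξ.im)|) with hle | hle
  · exact hxy2.trans (fin _ (abs_nonneg _) (by linarith))
  · exact hxy1.trans (fin _ (abs_nonneg _) (by linarith))

theorem lintegral_weight_le (E : Type*) [NormedAddCommGroup E] [NormedSpace ℝ E]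
    [FiniteDimensional ℝ E] [MeasureSpace E] [BorelSpace E]
    [(volume : Measure E).IsAddHaarMeasure] (hd : finrank ℝ E ≤ 2) :
    ∃ C : ℝ, 0 ≤ C ∧ ∀ B : ℝ, 1 ≤ B → ∀ τ : E, ‖τ‖ ≤ B ^ 2 → ∀ s : ℝ, 0 ≤ s → s ≤ 1 / 4 →
      ∫⁻ ξ : E, ofReal (‖ξ‖ ^ s *
        (B⁻¹ ^ finrank ℝ E / (1 + ‖B⁻¹ • (ξ + τ)‖) ^ 3)) ≤ ofReal (C * (B ^ 2) ^ s) := by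
  set d := finrank ℝ E
  set F : E → ℝ≥0∞ := fun x => ofReal ((1 + ‖x‖) ^ (-(11 / 4 : ℝ))) with hF
  have hfin : ∫⁻ x, F x < ∞ := by
    refine finite_integral_one_add_norm ?_
    have : (d : ℝ) ≤ 2 := by exact_mod_cast hd
    linarith
  have hFm : Measurable F := by
    refine ENNReal.measurable_ofReal.comp (Continuous.measurable ?_)
    exact Continuous.rpow_const (by fun_prop) fun x => Or.inl (by positivity)
  refine ⟨(∫⁻ x, F x).toReal, ENNReal.toReal_nonneg, fun B hB τ hτ s hs hs' => ?_⟩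
  have hB0 : 0 < B := by linarith
  set b := B⁻¹ with hb
  have hb0 : 0 < b := inv_pos.2 hB0
  have hpt : ∀ ξ : E, ofReal (‖ξ‖ ^ s * (b ^ d / (1 + ‖b • (ξ + τ)‖) ^ 3)) ≤
      ofReal ((B ^ 2) ^ s * b ^ d) * F (b • (ξ + τ)) := by
    intro ξ
    rw [hF, ← ENNReal.ofReal_mul (by positivity)]
    refine ENNReal.ofReal_le_ofReal ?_
    set r := ‖b • (ξ + τ)‖ with hr
    have hr0 : 0 ≤ r := norm_nonneg _
    have h1 : ‖ξ‖ ≤ B ^ 2 * (1 + r) := by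
      have e1 : ‖ξ‖ ≤ ‖ξ + τ‖ + ‖τ‖ := by
        simpa using norm_sub_le (ξ + τ) τ
      have e2 : r = b * ‖ξ + τ‖ := by rw [hr, _root_.norm_smul, norm_of_nonneg hb0.le]
      have e3 : ‖ξ + τ‖ = B * r := by
        rw [e2, ← mul_assoc, hb, mul_inv_cancel₀ hB0.ne', one_mul]
      nlinarith [mul_nonneg (mul_nonneg hB0.le (sub_nonneg.2 hB)) hr0]
    have h2 : ‖ξ‖ ^ s ≤ (B ^ 2) ^ s * (1 + r) ^ (1 / 4 : ℝ) := by
      refine (Real.rpow_le_rpow (norm_nonneg _) h1 hs).trans ?_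
      rw [Real.mul_rpow (by positivity) (by positivity)]
      gcongr
      linarith
    have h3 : (1 + r) ^ (-(11 / 4 : ℝ)) = (1 + r) ^ (1 / 4 : ℝ) / (1 + r) ^ 3 := by
      rw [← Real.rpow_natCast, ← Real.rpow_sub (by positivity)]
      norm_num
    rw [h3]
    calc _ ≤ ((B ^ 2) ^ s * (1 + r) ^ (1 / 4 : ℝ)) * (b ^ d / (1 + r) ^ 3) := by gcongr
      _ = _ := by ring
  refine (lintegral_mono hpt).trans ?_
  have hFm' : Measurable fun ξ => F (b • (ξ + τ)) := hFm.comp (by fun_prop)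
  rw [lintegral_const_mul _ hFm',
    lintegral_add_right_eq_self (fun x => F (b • x)) τ]
  have hmap : ∫⁻ x, F (b • x) = ofReal ((b ^ d)⁻¹) * ∫⁻ x, F x := by
    rw [← lintegral_map hFm (measurable_const_smul b), Measure.map_addHaar_smul _ hb0.ne',
      lintegral_smul_measure, abs_of_pos (by positivity), smul_eq_mul]
  rw [hmap, ← mul_assoc, ← ENNReal.ofReal_mul (by positivity),
    mul_assoc, mul_inv_cancel₀ (by positivity), mul_one, mul_comm,
    ENNReal.ofReal_mul ENNReal.toReal_nonneg, ENNReal.ofReal_toReal hfin.ne]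

/-- The product packet. -/
def pk (B : ℝ) (v : 𝓜) : ℝ := (∏ w, pR B (v.1 w)) * ∏ w, pC B (v.2 w)

/-- The twisted product packet. -/
def hk (B t : ℝ) (v : 𝓜) : ℂ := (∏ w, fR B t (v.1 w)) * ∏ w, fC B t (v.2 w)

lemma pk_nonneg (B : ℝ) (v : 𝓜) : 0 ≤ pk B v :=
  mul_nonneg (prod_nonneg fun _ _ => (abs_pR_le _ _).1)
    (prod_nonneg fun _ _ => (abs_pC_le _ _).1)

lemma continuous_pk (B : ℝ) : Continuous (pk B : 𝓜 → ℝ) := by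
  unfold pk
  exact (continuous_finsetProd _ fun w _ => (continuous_pR B).comp (by fun_prop)).mul
    (continuous_finsetProd _ fun w _ => (continuous_pC B).comp (by fun_prop))

lemma pk_ne {B : ℝ} (hB : 1 ≤ B) {v : 𝓜} (h : pk B v ≠ 0) :
    (∀ w, |v.1 w - 1| < 1 / 4) ∧ ∀ w, |(v.2 w).re - 1| < 1 / 4 ∧ |(v.2 w).im| < 1 / 4 := by
  rw [pk, mul_ne_zero_iff, prod_ne_zero_iff, prod_ne_zero_iff] at h
  exact ⟨fun w => pR_ne hB (h.1 w (mem_univ w)),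
    fun w => pC_ne hB (h.2 w (mem_univ w))⟩

lemma norm_pos_of_pk_ne {B : ℝ} (hB : 1 ≤ B) {v : 𝓜} (h : pk B v ≠ 0) :
    exp (-(2 * nK K)) ≤ 𝒩 v ∧
      𝒩 v ≤ exp (2 * nK K) := by
  obtain ⟨h1, h2⟩ := pk_ne hB h
  have he : (2.7 : ℝ) ≤ exp 1 := by linarith [Real.exp_one_gt_d9]
  have he2 : (7 : ℝ) ≤ exp 2 := by
    have : exp 2 = exp 1 * exp 1 := by rw [← Real.exp_add]; norm_num
    nlinarith
  have hem : exp (-2) ≤ 1 / 7 := by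
    rw [Real.exp_neg, inv_eq_one_div]
    exact one_div_le_one_div_of_le (by norm_num) he2
  have a1 : ∀ w, exp (-2) ≤ ‖v.1 w‖ ^ 1 ∧ ‖v.1 w‖ ^ 1 ≤ exp 2 := by
    intro w
    have := abs_lt.1 (h1 w)
    rw [pow_one, norm_of_nonneg (by linarith)]
    constructor <;> linarith
  have a2 : ∀ w, exp (-4) ≤ ‖v.2 w‖ ^ 2 ∧ ‖v.2 w‖ ^ 2 ≤ exp 4 := by
    intro w
    obtain ⟨b1, b2⟩ := h2 w
    rw [abs_lt] at b1 b2
    have e4 : exp 2 ≤ exp 4 := exp_le_exp.2 (by norm_num)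
    have e4' : exp (-4) ≤ exp (-2) := exp_le_exp.2 (by norm_num)
    rw [sq_norm, normSq_apply]
    constructor <;> nlinarith
  have hc : nK K = card {w : InfinitePlace K // IsReal w} +
      2 * card {w : InfinitePlace K // IsComplex w} := by
    have := card_add_two_mul_card_eq_rank K
    rw [nK, ← this]
  rw [norm_eq_prod]
  have e1 : exp (-(2 * nK K)) = (∏ _w : {w : InfinitePlace K // IsReal w}, exp (-2)) *
      ∏ _w : {w : InfinitePlace K // IsComplex w}, exp (-4) := by
    rw [prod_const, prod_const, ← Real.exp_nat_mul, ← Real.exp_nat_mul,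
      ← Real.exp_add, card_univ, card_univ, hc]
    congr 1; push_cast; ring
  have e2 : exp (2 * nK K) = (∏ _w : {w : InfinitePlace K // IsReal w}, exp 2) *
      ∏ _w : {w : InfinitePlace K // IsComplex w}, exp 4 := by
    rw [prod_const, prod_const, ← Real.exp_nat_mul, ← Real.exp_nat_mul,
      ← Real.exp_add, card_univ, card_univ, hc]
    congr 1; push_cast; ring
  rw [e1, e2]
  constructor
  · gcongr with w _ w _
    · exact (a1 w).1
    · exact (a2 w).1
  · gcongr with w _ w _
    · exact (a1 w).2
    · exact (a2 w).2

lemma prod_ofReal_cpow {ι : Type*} (s : Finset ι) (f : ι → ℝ) (hf : ∀ i ∈ s, 0 ≤ f i) (z : ℂ) :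
    ((∏ i ∈ s, f i : ℝ) : ℂ) ^ z = ∏ i ∈ s, ((f i : ℝ) : ℂ) ^ z := by
  classical
  induction s using induction_on with
  | empty => simp
  | insert a s ha ih =>
    rw [prod_insert ha, prod_insert ha, ← ih fun i hi => hf i (by simp [hi]),
      Complex.ofReal_mul, mul_cpow_ofReal_nonneg (hf a (by simp))
        (prod_nonneg fun i hi => hf i (by simp [hi]))]

lemma hk_eq (B t : ℝ) (v : 𝓜) :
    hk B t v = (pk B v : ℂ) * ((𝒩 v : ℝ) : ℂ) ^ (-(1 + t * I)) := by
  rw [norm_eq_prod, Complex.ofReal_mul, mul_cpow_ofReal_nonneg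
    (prod_nonneg fun _ _ => by positivity) (prod_nonneg fun _ _ => by positivity),
    prod_ofReal_cpow _ _ (fun _ _ => by positivity), prod_ofReal_cpow _ _ (fun _ _ => by positivity),
    hk, pk]
  simp only [fR, fC, prod_mul_distrib, pow_one, norm_eq_abs]
  push_cast
  ring

lemma hasCompactSupport_pk {B : ℝ} (hB : 1 ≤ B) :
    HasCompactSupport (pk B : 𝓜 → ℝ) := by
  refine HasCompactSupport.intro (isCompact_closedBall (1 : 𝓜) 1) fun v hv => ?_
  by_contra h
  obtain ⟨h1, h2⟩ := pk_ne hB h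
  refine hv ?_
  rw [mem_closedBall, dist_eq_norm, Prod.norm_def, max_le_iff,
    pi_norm_le_iff_of_nonneg zero_le_one, pi_norm_le_iff_of_nonneg zero_le_one]
  refine ⟨fun w => ?_, fun w => ?_⟩
  · have := h1 w
    simp only [Prod.fst_sub, Prod.fst_one, Pi.sub_apply, Pi.one_apply, norm_eq_abs]
    linarith
  · obtain ⟨b1, b2⟩ := h2 w
    refine (norm_le_abs_re_add_abs_im _).trans ?_
    simp
    linarith

lemma integrable_pk {B : ℝ} (hB : 1 ≤ B) : Integrable (pk B : 𝓜 → ℝ) (mulHaar K) := by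
  have hm : Measurable fun v : 𝓜 => ofReal (𝒩 v)⁻¹ :=
    measurable_norm_mixed.inv.ennreal_ofReal
  refine (integrable_withDensity_iff_integrable_smul' hm (by simp)).2 ?_
  refine ((continuous_pk B).integrable_of_hasCompactSupport (hasCompactSupport_pk hB)).const_mul
    (exp (2 * nK K)) |>.mono' ?_ (.of_forall fun v => ?_)
  · refine Measurable.aestronglyMeasurable ?_
    exact Measurable.smul hm.ennreal_toReal (continuous_pk B).measurable
  · by_cases hv : pk B v = 0
    · simp [hv]
    have hn := (norm_pos_of_pk_ne hB hv).1
    have hn0 := (exp_pos _).trans_le hn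
    rw [smul_eq_mul, norm_mul, norm_of_nonneg (pk_nonneg _ _), norm_of_nonneg (by simp),
      ENNReal.toReal_ofReal (by positivity)]
    refine mul_le_mul_of_nonneg_right ?_ (pk_nonneg _ _)
    rw [← inv_inv (exp (2 * nK K)), ← Real.exp_neg]
    exact inv_anti₀ (exp_pos _) hn

lemma continuous_hk {B : ℝ} (hB : 1 ≤ B) (t : ℝ) : Continuous (hk B t : 𝓜 → ℂ) := by
  unfold hk
  exact (continuous_finsetProd _ fun w _ => (continuous_fR hB t).comp (by fun_prop)).mul
    (continuous_finsetProd _ fun w _ => (continuous_fC hB t).comp (by fun_prop))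

lemma pk_ne_of_hk {B t : ℝ} {v : 𝓜} (h : hk B t v ≠ 0) : pk B v ≠ 0 := by
  intro h0
  rw [hk_eq, h0] at h
  simp at h

lemma adm_hk {B : ℝ} (hB : 1 ≤ B) (t : ℝ) : Adm (hk B t : 𝓜 → ℂ) where
  cont := continuous_hk hB t
  cpt := (hasCompactSupport_pk hB).mono fun v hv => pk_ne_of_hk hv
  pos v hv := by
    refine ⟨((exp_pos _).trans_le (norm_pos_of_pk_ne hB (pk_ne_of_hk hv)).1).ne', fun w => ?_⟩
    have := abs_lt.1 ((pk_ne hB (pk_ne_of_hk hv)).1 w)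
    linarith
  int := by
    refine ((integrable_pk hB).const_mul (exp (2 * nK K))).mono'
      (continuous_hk hB t).aestronglyMeasurable (.of_forall fun v => ?_)
    by_cases hv : pk B v = 0
    · rw [hk_eq, hv]; simp
    have hn := (norm_pos_of_pk_ne hB hv).1
    have hn0 := (exp_pos _).trans_le hn
    rw [hk_eq, norm_mul, Complex.norm_real, norm_of_nonneg (pk_nonneg _ _),
      norm_cpow_eq_rpow_re_of_pos hn0, mul_comm]
    refine mul_le_mul_of_nonneg_right ?_ (pk_nonneg _ _)
    simp only [neg_re, add_re, one_re, mul_re, ofReal_re, I_re, mul_zero, ofReal_im, I_im, mul_one,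
      sub_self, add_zero]
    rw [Real.rpow_neg_one, ← inv_inv (exp (2 * nK K)), ← Real.exp_neg]
    exact inv_anti₀ (exp_pos _) hn

lemma nK_eq_card : nK K = card {w : InfinitePlace K // IsReal w} +
    2 * card {w : InfinitePlace K // IsComplex w} := by
  have := card_add_two_mul_card_eq_rank K
  rw [nK, ← this]

lemma FT_hk (B t : ℝ) (ξ : 𝓜) : FT (hk B t) ξ =
    (∏ w, ∫ x : ℝ, cexp (-(2 * π * I * ((ξ.1 w * x : ℝ) : ℂ))) * fR B t x) *
    ∏ w, ∫ z : ℂ, cexp (-(2 * π * I * ((2 * (ξ.2 w * z).re : ℝ) : ℂ))) * fC B t z := by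
  have h : ∀ v : 𝓜, cexp (-(2 * π * I * (trV K (ξ * v) : ℂ))) * hk B t v =
      (∏ w, cexp (-(2 * π * I * ((ξ.1 w * v.1 w : ℝ) : ℂ))) * fR B t (v.1 w)) *
      ∏ w, cexp (-(2 * π * I * ((2 * (ξ.2 w * v.2 w).re : ℝ) : ℂ))) * fC B t (v.2 w) := by
    intro v
    rw [prod_mul_distrib, prod_mul_distrib, ← Complex.exp_sum, ← Complex.exp_sum,
      hk, trV_apply]
    have : -(2 * π * I * ((∑ w, (ξ * v).1 w + 2 * ∑ w, ((ξ * v).2 w).re : ℝ) : ℂ)) =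
        (∑ w, -(2 * π * I * ((ξ.1 w * v.1 w : ℝ) : ℂ))) +
        ∑ w, -(2 * π * I * ((2 * (ξ.2 w * v.2 w).re : ℝ) : ℂ)) := by
      simp only [← mul_neg, ← mul_sum, Finset.sum_neg_distrib, ← ofReal_sum]
      rw [← mul_add, ← neg_add, ← ofReal_add]
      rfl
    rw [this, exp_add]
    ring
  rw [FT]
  simp only [h]
  rw [Measure.volume_eq_prod]
  rw [integral_prod_mul (fun a : {w : InfinitePlace K // IsReal w} → ℝ =>
    ∏ w, cexp (-(2 * π * I * ((ξ.1 w * a w : ℝ) : ℂ))) * fR B t (a w))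
    (fun a : {w : InfinitePlace K // IsComplex w} → ℂ =>
    ∏ w, cexp (-(2 * π * I * ((2 * (ξ.2 w * a w).re : ℝ) : ℂ))) * fC B t (a w))]
  congr 1
  · exact integral_fintype_prod_volume_eq_prod
      (fun w x => cexp (-(2 * π * I * ((ξ.1 w * x : ℝ) : ℂ))) * fR B t x)
  · exact integral_fintype_prod_volume_eq_prod
      (fun w z => cexp (-(2 * π * I * ((2 * (ξ.2 w * z).re : ℝ) : ℂ))) * fC B t z)

lemma lintegral_mixed_prod (f : {w : InfinitePlace K // IsReal w} → ℝ → ℝ≥0∞)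
    (g : {w : InfinitePlace K // IsComplex w} → ℂ → ℝ≥0∞)
    (hf : ∀ w, Measurable (f w)) (hg : ∀ w, Measurable (g w)) (μ : Measure ℝ) (ν : Measure ℂ)
    [SigmaFinite μ] [SigmaFinite ν] :
    ∫⁻ v : 𝓜, (∏ w, f w (v.1 w)) * ∏ w, g w (v.2 w)
      ∂((Measure.pi fun _ => μ).prod (Measure.pi fun _ => ν)) =
      (∏ w, ∫⁻ x, f w x ∂μ) * ∏ w, ∫⁻ z, g w z ∂ν := by
  rw [lintegral_prod_mul (f := fun a : {w : InfinitePlace K // IsReal w} → ℝ => ∏ w, f w (a w))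
    (g := fun a : {w : InfinitePlace K // IsComplex w} → ℂ => ∏ w, g w (a w))
    (measurable_prod _ fun w _ => (hf w).comp (measurable_pi_apply w)).aemeasurable
    (measurable_prod _ fun w _ => (hg w).comp (measurable_pi_apply w)).aemeasurable,
    lintegral_pi_prod _ _ hf, lintegral_pi_prod _ _ hg]

theorem exists_FT_majorant : ∃ C : ℝ, 1 ≤ C ∧ ∀ (K : Type) [Field K] [NumberField K] (B t η : ℝ),
    1 ≤ B → |t| ≤ B ^ 2 → 0 ≤ η → η ≤ 1 / 8 → ∃ U : mixedSpace K → ℝ≥0∞, Measurable U ∧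
      (∀ ξ, ‖FT (hk B t) ξ‖ₑ ≤ U ξ) ∧
      ∫⁻ ξ, ofReal (mixedEmbedding.norm ξ ^ η) * U ξ ≤
        ofReal (C ^ nK K * (B ^ 2) ^ (nK K * η)) := by
  obtain ⟨C1, hC1, h1⟩ := FR_bound
  obtain ⟨C2, hC2, h2⟩ := FC_bound
  obtain ⟨C3, hC3, h3⟩ := lintegral_weight_le ℝ (by simp)
  obtain ⟨C4, hC4, h4⟩ := lintegral_weight_le ℂ (by simp)
  refine ⟨1 + C1 * C3 + C2 * C4, by nlinarith [mul_nonneg hC1.le hC3, mul_nonneg hC2.le hC4],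
    fun K _ _ B t η hB ht hη hη' => ?_⟩
  have hB0 : 0 < B := by linarith
  set b := B⁻¹ with hb
  have hb0 : 0 < b := inv_pos.2 hB0
  set τ : ℝ := t / (2 * π) with hτ
  have hτB : |τ| ≤ B ^ 2 := by
    rw [hτ, abs_div, abs_of_pos (by positivity : 0 < 2 * π)]
    exact (div_le_self (abs_nonneg _) (by linarith [pi_gt_three])).trans ht
  set gR : ℝ → ℝ := fun x => b / (1 + ‖b • (x + τ)‖) ^ 3
  set gC : ℂ → ℝ := fun z => b ^ 2 / (1 + ‖b • (z + (τ : ℂ))‖) ^ 3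
  have gRm : Measurable gR := by fun_prop
  have gCm : Measurable gC := by fun_prop
  have gR0 : ∀ x, 0 ≤ gR x := fun x => by positivity
  have gC0 : ∀ x, 0 ≤ gC x := fun x => by positivity
  have b1 : ∀ ξ : ℝ, ‖∫ x : ℝ, cexp (-(2 * π * I * ((ξ * x : ℝ) : ℂ))) * fR B t x‖ ≤
      C1 * gR ξ := by
    intro ξ
    refine (h1 B hB t ht ξ).trans (le_of_eq ?_)
    rw [mul_div_assoc]
    rfl
  have b2 : ∀ ξ : ℂ, ‖∫ z : ℂ, cexp (-(2 * π * I * ((2 * (ξ * z).re : ℝ) : ℂ))) * fC B t z‖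
      ≤ C2 * gC ξ := by
    intro ξ
    refine (h2 B hB t ht ξ).trans ?_
    rw [mul_div_assoc]
    refine mul_le_mul_of_nonneg_left ?_ hC2.le
    refine div_le_div_of_nonneg_left (by positivity) (by positivity) ?_
    gcongr
    have e : (B⁻¹ : ℂ) * (2 * ξ + t / π) = 2 * (b • (ξ + (τ : ℂ))) := by
      rw [real_smul, hb, hτ]
      have hpi : (π : ℂ) ≠ 0 := by exact_mod_cast Real.pi_ne_zero
      push_cast
      field_simp
    rw [e, norm_mul]
    simp only [norm_ofNat]
    linarith [norm_nonneg (b • (ξ + (τ : ℂ)))]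
  refine ⟨fun ξ => (∏ w, ofReal (C1 * gR (ξ.1 w))) * ∏ w, ofReal (C2 * gC (ξ.2 w)),
    ?_, fun ξ => ?_, ?_⟩
  · refine Measurable.mul ?_ ?_
    · exact measurable_prod _ fun w _ => ENNReal.measurable_ofReal.comp
        ((gRm.const_mul _).comp ((measurable_pi_apply w).comp measurable_fst))
    · exact measurable_prod _ fun w _ => ENNReal.measurable_ofReal.comp
        ((gCm.const_mul _).comp ((measurable_pi_apply w).comp measurable_snd))
  · rw [FT_hk, ← ofReal_norm, norm_mul, norm_prod, norm_prod, ENNReal.ofReal_mul (by positivity),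
      ENNReal.ofReal_prod_of_nonneg (fun _ _ => by positivity),
      ENNReal.ofReal_prod_of_nonneg (fun _ _ => by positivity)]
    exact mul_le_mul' (prod_le_prod' fun w _ => ENNReal.ofReal_le_ofReal (b1 _))
      (prod_le_prod' fun w _ => ENNReal.ofReal_le_ofReal (b2 _))
  · have e : ∀ ξ : mixedSpace K, ofReal (mixedEmbedding.norm ξ ^ η) *
        ((∏ w, ofReal (C1 * gR (ξ.1 w))) * ∏ w, ofReal (C2 * gC (ξ.2 w))) =
        (∏ w, ofReal C1 * ofReal (‖ξ.1 w‖ ^ η * gR (ξ.1 w))) *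
        ∏ w, ofReal C2 * ofReal (‖ξ.2 w‖ ^ (2 * η) * gC (ξ.2 w)) := by
      intro ξ
      rw [norm_eq_prod, Real.mul_rpow (prod_nonneg fun _ _ => by positivity)
        (prod_nonneg fun _ _ => by positivity),
        ← Real.finsetProd_rpow _ _ (fun _ _ => by positivity),
        ← Real.finsetProd_rpow _ _ (fun _ _ => by positivity),
        ENNReal.ofReal_mul (prod_nonneg fun _ _ => by positivity),
        ENNReal.ofReal_prod_of_nonneg (fun _ _ => by positivity),
        ENNReal.ofReal_prod_of_nonneg (fun _ _ => by positivity)]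
      simp only [pow_one, ENNReal.ofReal_mul hC1.le, ENNReal.ofReal_mul hC2.le,
        ENNReal.ofReal_mul (Real.rpow_nonneg (norm_nonneg _) _), prod_mul_distrib]
      have e2 : ∀ w, (‖ξ.2 w‖ ^ 2) ^ η = ‖ξ.2 w‖ ^ (2 * η) := fun w => by
        rw [Real.rpow_mul (norm_nonneg _)]; norm_cast
      simp only [e2]
      ring
    have m1 : Measurable fun x : ℝ => ofReal (‖x‖ ^ η * gR x) :=
      ENNReal.measurable_ofReal.comp ((measurable_norm.pow_const _).mul gRm)
    have m2 : Measurable fun x : ℂ => ofReal (‖x‖ ^ (2 * η) * gC x) :=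
      ENNReal.measurable_ofReal.comp ((measurable_norm.pow_const _).mul gCm)
    simp only [e]
    refine (lintegral_mixed_prod
      (fun _ x => ofReal C1 * ofReal (‖x‖ ^ η * gR x))
      (fun _ z => ofReal C2 * ofReal (‖z‖ ^ (2 * η) * gC z))
      (fun _ => m1.const_mul _) (fun _ => m2.const_mul _) volume volume).le.trans ?_
    rw [prod_const, prod_const, lintegral_const_mul _ m1, lintegral_const_mul _ m2]
    have k1 := h3 B hB τ hτB η hη (by linarith)
    have k2 := h4 B hB (τ : ℂ) (by rwa [Complex.norm_real]) (2 * η) (by linarith) (by linarith)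
    simp only [Module.finrank_self, pow_one, finrank_real_complex] at k1 k2
    set D := 1 + C1 * C3 + C2 * C4
    have hD1 : C1 * C3 ≤ D := by nlinarith [mul_nonneg hC2.le hC4]
    have hD2 : C2 * C4 ≤ D ^ 2 := by
      have : C2 * C4 ≤ D := by nlinarith [mul_nonneg hC1.le hC3]
      have h1 : 1 ≤ D := by nlinarith [mul_nonneg hC2.le hC4, mul_nonneg hC1.le hC3]
      nlinarith
    have hD0 : 0 ≤ D := le_trans (by positivity) hD1
    have l1 : ofReal C1 * ∫⁻ x : ℝ, ofReal (‖x‖ ^ η * gR x) ≤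
        ofReal (D * (B ^ 2) ^ η) := by
      refine (mul_le_mul_right k1 _).trans ?_
      rw [← ENNReal.ofReal_mul hC1.le, ← mul_assoc]
      exact ENNReal.ofReal_le_ofReal (by gcongr)
    have l2 : ofReal C2 * ∫⁻ x : ℂ, ofReal (‖x‖ ^ (2 * η) * gC x) ≤
        ofReal ((D * (B ^ 2) ^ η) ^ 2) := by
      refine (mul_le_mul_right k2 _).trans ?_
      rw [← ENNReal.ofReal_mul hC2.le, ← mul_assoc, mul_pow, ← Real.rpow_mul_natCast (by positivity)]
      rw [mul_comm 2 η]
      push_cast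
      exact ENNReal.ofReal_le_ofReal (by gcongr)
    refine (mul_le_mul' (pow_le_pow_left' l1 _) (pow_le_pow_left' l2 _)).trans (le_of_eq ?_)
    rw [← ENNReal.ofReal_pow (by positivity), ← ENNReal.ofReal_pow (by positivity),
      ← ENNReal.ofReal_mul (by positivity)]
    congr 1
    rw [← pow_mul, ← pow_add, card_univ, card_univ, ← nK_eq_card, mul_pow,
      ← Real.rpow_mul_natCast (by positivity), mul_comm η]

/-- The total mass of the packet. -/
def Mk (K : Type*) [Field K] [NumberField K] (B : ℝ) : ℝ := ∫ v : mixedSpace K, pk B v ∂mulHaar K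

lemma Mk_lower {B : ℝ} (hB : 1 ≤ B) : (B⁻¹ / 8) ^ nK K ≤ Mk K B := by
  have hB0 : 0 < B := by linarith
  have hbB : B * B⁻¹ = 1 := mul_inv_cancel₀ hB0.ne'
  have hb1 : B⁻¹ ≤ 1 := inv_le_one_of_one_le₀ hB
  set b := B⁻¹ with hb
  have hb0 : 0 < b := inv_pos.2 hB0
  have hone : ∀ x : ℝ, |x| ≤ b / 8 → bump (B * x) = 1 := by
    intro x hx
    refine bump.one_of_mem_closedBall ?_
    rw [mem_closedBall_zero_iff, norm_eq_abs, abs_mul, abs_of_pos hB0]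
    show B * |x| ≤ 1 / 8
    nlinarith
  have mR : Measurable fun x : ℝ => ofReal (pR B x) := (continuous_pR B).measurable.ennreal_ofReal
  have mC : Measurable fun x : ℂ => ofReal (pC B x) := (continuous_pC B).measurable.ennreal_ofReal
  have l1 : ofReal (b / 8) ≤ ∫⁻ x, ofReal (pR B x) ∂(mulHaar1 ℝ 1) := by
    rw [mulHaar1, lintegral_withDensity_eq_lintegral_mul _ (by fun_prop) mR]
    calc ofReal (b / 8) = ∫⁻ x in closedBall (1 : ℝ) (b / 8), ofReal (1 / 2) := by
          rw [setLIntegral_const, Real.volume_closedBall, ← ENNReal.ofReal_mul (by norm_num)]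
          congr 1; ring
      _ ≤ ∫⁻ x in closedBall (1 : ℝ) (b / 8),
          ofReal ((‖x‖ ^ 1)⁻¹) * ofReal (pR B x) := by
        refine setLIntegral_mono' measurableSet_closedBall fun x hx => ?_
        rw [mem_closedBall, Real.dist_eq] at hx
        have hx' := abs_le.1 hx
        rw [pR, hone _ hx, ENNReal.ofReal_one, mul_one, pow_one,
          norm_of_nonneg (by linarith), inv_eq_one_div]
        exact ENNReal.ofReal_le_ofReal (one_div_le_one_div_of_le (by linarith) (by linarith))
      _ ≤ _ := setLIntegral_le_lintegral _ _
  have l2 : ofReal ((b / 8) ^ 2) ≤ ∫⁻ x, ofReal (pC B x) ∂(mulHaar1 ℂ 2) := by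
    rw [mulHaar1, lintegral_withDensity_eq_lintegral_mul _ (by fun_prop) mC]
    calc ofReal ((b / 8) ^ 2) ≤
          ∫⁻ x in closedBall (1 : ℂ) (b / 8), ofReal (1 / 2) := by
          rw [setLIntegral_const, volume_closedBall, ← ENNReal.ofReal_coe_nnreal,
            ← ENNReal.ofReal_pow (by positivity), ← ENNReal.ofReal_mul (by positivity),
            ← ENNReal.ofReal_mul (by norm_num)]
          refine ENNReal.ofReal_le_ofReal ?_
          rw [NNReal.coe_real_pi]
          nlinarith [pi_gt_three, sq_nonneg (b / 8)]
      _ ≤ ∫⁻ x in closedBall (1 : ℂ) (b / 8),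
          ofReal ((‖x‖ ^ 2)⁻¹) * ofReal (pC B x) := by
        refine setLIntegral_mono' measurableSet_closedBall fun x hx => ?_
        rw [mem_closedBall, Complex.dist_eq] at hx
        have h1 : |x.re - 1| ≤ b / 8 := by
          simpa using (abs_re_le_norm (x - 1)).trans hx
        have h2 : |x.im| ≤ b / 8 := by
          simpa using (abs_im_le_norm (x - 1)).trans hx
        rw [pC, hone _ h1, hone _ h2, mul_one, ENNReal.ofReal_one, mul_one,
          inv_eq_one_div, sq_norm, normSq_apply]
        rw [abs_le] at h1 h2
        exact ENNReal.ofReal_le_ofReal (one_div_le_one_div_of_le (by nlinarith) (by nlinarith))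
      _ ≤ _ := setLIntegral_le_lintegral _ _
  have key : ∫⁻ v : 𝓜, ofReal (pk B v) ∂mulHaar K =
      (∏ w : {w : InfinitePlace K // IsReal w}, ∫⁻ x, ofReal (pR B x) ∂(mulHaar1 ℝ 1)) *
      ∏ w : {w : InfinitePlace K // IsComplex w}, ∫⁻ x, ofReal (pC B x) ∂(mulHaar1 ℂ 2) := by
    rw [← lintegral_mixed_prod (fun _ x => ofReal (pR B x))
      (fun _ x => ofReal (pC B x)) (fun _ => mR) (fun _ => mC), mulHaar_eq_prod]
    refine lintegral_congr fun v => ?_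
    rw [pk, ENNReal.ofReal_mul (prod_nonneg fun _ _ => (abs_pR_le _ _).1),
      ENNReal.ofReal_prod_of_nonneg (fun _ _ => (abs_pR_le _ _).1),
      ENNReal.ofReal_prod_of_nonneg (fun _ _ => (abs_pC_le _ _).1)]
  rw [Mk, ← ENNReal.ofReal_le_ofReal_iff (integral_nonneg fun v => pk_nonneg B v),
    ofReal_integral_eq_lintegral_ofReal (integrable_pk hB)
      (.of_forall fun v => pk_nonneg B v), key, prod_const, prod_const,
    card_univ, card_univ]
  refine le_trans (le_of_eq ?_) (mul_le_mul' (pow_le_pow_left' l1 _) (pow_le_pow_left' l2 _))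
  rw [← ENNReal.ofReal_pow (by positivity), ← ENNReal.ofReal_pow (by positivity),
    ← ENNReal.ofReal_mul (by positivity), nK_eq_card, pow_add, pow_mul]

lemma Mk_pos {B : ℝ} (hB : 1 ≤ B) : 0 < Mk K B := by
  have : 0 < B⁻¹ := inv_pos.2 (by linarith)
  exact lt_of_lt_of_le (by positivity) (Mk_lower hB)

/-- The weight `N𝔪^{-σ}`. -/
def nw (σ : ℝ) (𝔪 : ℐ) : ℝ≥0∞ := ofReal ((absNorm 𝔪 : ℝ) ^ (-σ))

lemma nw_mul (σ : ℝ) (𝔞 𝔟 : ℐ) : nw σ (𝔞 * 𝔟) = nw σ 𝔞 * nw σ 𝔟 := by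
  rw [nw, nw, nw, map_mul, cast_mul, Real.mul_rpow (by positivity) (by positivity),
    ENNReal.ofReal_mul (by positivity)]

lemma nw_top (σ : ℝ) : nw σ (⊤ : ℐ) = 1 := by simp [nw]

lemma nw_pow (σ : ℝ) (𝔞 : ℐ) (k : ℕ) : nw σ (𝔞 ^ k) = nw σ 𝔞 ^ k := by
  induction k with
  | zero => simpa using nw_top (K := K) σ
  | succ k ih => rw [pow_succ, nw_mul, ih, pow_succ]

/-- Nonzero ideals all of whose prime divisors belong to `s`. -/
abbrev Smooth (s : Set ℐ) : Type _ :=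
  {𝔪 : ℐ // 𝔪 ≠ ⊥ ∧ ∀ P : ℐ, P.IsPrime → 𝔪 ≤ P → P ∈ s}

lemma exists_pow_mul {p 𝔪 : ℐ} (hp : p.IsPrime) (hp0 : p ≠ ⊥) (h𝔪 : 𝔪 ≠ ⊥) :
    ∃ (k : ℕ) (𝔟 : ℐ), 𝔪 = p ^ k * 𝔟 ∧ ¬ 𝔟 ≤ p := by
  obtain ⟨c, hc, hc'⟩ := (FiniteMultiplicity.of_prime_left
    (Ideal.prime_of_isPrime hp0 hp) h𝔪).exists_eq_pow_mul_and_not_dvd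
  exact ⟨_, c, hc, fun h => hc' (dvd_iff_le.2 h)⟩

lemma tsum_smooth_insert (σ : ℝ) {p : ℐ} (hp : p.IsPrime) (hp0 : p ≠ ⊥)
    (s : Set ℐ) :
    ∑' 𝔪 : Smooth (insert p s), nw σ 𝔪.1 ≤ (1 - nw σ p)⁻¹ * ∑' 𝔪 : Smooth s, nw σ 𝔪.1 := by
  have key : ∀ 𝔪 : Smooth (insert p s), ∃ q : ℕ × Smooth s, 𝔪.1 = p ^ q.1 * q.2.1 := by
    rintro ⟨𝔪, h0, h⟩
    obtain ⟨k, 𝔟, rfl, hb⟩ := exists_pow_mul hp hp0 h0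
    refine ⟨⟨k, 𝔟, ?_, fun P hP hle => ?_⟩, rfl⟩
    · rintro rfl; simp at h0
    · rcases h P hP (mul_le_right.trans hle) with rfl | h
      · exact absurd hle hb
      · exact h
  choose g hg using key
  have inj : Function.Injective g := fun a b hab => Subtype.ext (by rw [hg a, hg b, hab])
  calc ∑' 𝔪 : Smooth (insert p s), nw σ 𝔪.1
      = ∑' 𝔪 : Smooth (insert p s), (fun q : ℕ × Smooth s => nw σ p ^ q.1 * nw σ q.2.1) (g 𝔪) := by
        refine tsum_congr fun 𝔪 => ?_
        rw [hg 𝔪, nw_mul, nw_pow]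
    _ ≤ ∑' q : ℕ × Smooth s, nw σ p ^ q.1 * nw σ q.2.1 :=
        ENNReal.tsum_comp_le_tsum_of_injective inj _
    _ = _ := by
        rw [tsum_prod (f := fun (k : ℕ) (𝔪 : Smooth s) => nw σ p ^ k * nw σ 𝔪.1)]
        simp_rw [ENNReal.tsum_mul_left]
        rw [ENNReal.tsum_mul_right, ENNReal.tsum_geometric]

lemma tsum_smooth_empty (σ : ℝ) : ∑' 𝔪 : Smooth (∅ : Set ℐ), nw σ 𝔪.1 ≤ 1 := by
  have h : ∀ 𝔪 : Smooth (∅ : Set ℐ), 𝔪.1 = ⊤ := by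
    rintro ⟨𝔪, h0, h⟩
    by_contra h1
    obtain ⟨P, hP, hle⟩ := Ideal.exists_le_maximal 𝔪 h1
    exact h P hP.isPrime hle
  have : Subsingleton (Smooth (∅ : Set ℐ)) :=
    ⟨fun a b => Subtype.ext ((h a).trans (h b).symm)⟩
  rcases isEmpty_or_nonempty (Smooth (∅ : Set ℐ)) with hE | ⟨⟨a⟩⟩
  · simp
  · rw [tsum_eq_single a (fun b hb => absurd (Subsingleton.elim b a) hb), h a, nw_top]

lemma two_le_absNorm {p : ℐ} (hp : p.IsPrime) (hp0 : p ≠ ⊥) :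
    2 ≤ absNorm p := by
  have h0 : absNorm p ≠ 0 := by rwa [Ne, absNorm_eq_zero_iff]
  have h1 : absNorm p ≠ 1 := by rw [Ne, Ideal.absNorm_eq_one_iff]; exact hp.ne_top
  omega

lemma inv_one_sub_nw_le {σ : ℝ} (hσ : 1 ≤ σ) {p : ℐ} (hp : p.IsPrime) (hp0 : p ≠ ⊥) :
    (1 - nw σ p)⁻¹ ≤ ofReal (exp (2 * (absNorm p : ℝ) ^ (-σ))) := by
  set x := (absNorm p : ℝ) ^ (-σ) with hx
  have h2 : (2 : ℝ) ≤ absNorm p := by exact_mod_cast two_le_absNorm hp hp0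
  have hx0 : 0 ≤ x := by positivity
  have hx1 : x ≤ 1 / 2 := by
    calc x ≤ (absNorm p : ℝ) ^ (-1 : ℝ) :=
          Real.rpow_le_rpow_of_exponent_le (by linarith) (by linarith)
      _ = (absNorm p : ℝ)⁻¹ := Real.rpow_neg_one _
      _ ≤ 1 / 2 := by rw [one_div]; exact inv_anti₀ (by norm_num) h2
  have : (1 : ℝ≥0∞) - nw σ p = ofReal (1 - x) := by
    rw [ENNReal.ofReal_sub _ hx0, ENNReal.ofReal_one]; rfl
  rw [this, ← ENNReal.ofReal_inv_of_pos (by linarith)]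
  refine ENNReal.ofReal_le_ofReal ?_
  rw [inv_le_comm₀ (by linarith) (by positivity), ← Real.exp_neg]
  have h4 : exp (2 * x) * (1 - x) ≥ 1 := by
    have := Real.quadratic_le_exp_of_nonneg (x := 2 * x) (by linarith)
    nlinarith
  rw [Real.exp_neg, inv_le_comm₀ (by positivity) (by linarith), inv_le_iff_one_le_mul₀ (by linarith)]
  linarith

lemma tsum_smooth_le {σ : ℝ} (hσ : 1 ≤ σ) (s : Finset ℐ)
    (hs : ∀ p ∈ s, p.IsPrime ∧ p ≠ ⊥) :
    ∑' 𝔪 : Smooth (s : Set ℐ), nw σ 𝔪.1 ≤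
      ofReal (exp (2 * ∑ p ∈ s, (absNorm p : ℝ) ^ (-σ))) := by
  classical
  induction s using induction_on with
  | empty =>
    rw [coe_empty]
    simpa using tsum_smooth_empty (K := K) σ
  | insert p s hps ih =>
    have hp := hs p (Finset.mem_insert_self _ _)
    rw [coe_insert]
    refine (tsum_smooth_insert σ hp.1 hp.2 _).trans ?_
    refine (mul_le_mul' (inv_one_sub_nw_le hσ hp.1 hp.2)
      (ih fun q hq => hs q (Finset.mem_insert_of_mem hq))).trans ?_
    rw [← ENNReal.ofReal_mul (by positivity), ← Real.exp_add, Finset.sum_insert hps, mul_add]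

lemma card_primes_over_le {m : ℕ} (hm : m.Prime) (s : Finset ℐ)
    (hs : ∀ P ∈ s, P.IsPrime ∧ P ≠ ⊥ ∧ absNorm (Ideal.under ℤ P) = m) :
    s.card ≤ nK K := by
  classical
  have hdvd : ∏ P ∈ s, P ∣ span {(m : 𝓞 K)} := by
    refine Finset.prod_dvd_of_coprime (fun P hP Q hQ hne => ?_) fun P hP => ?_
    · have hPm := (hs P hP).1.isMaximal (hs P hP).2.1
      have hQm := (hs Q hQ).1.isMaximal (hs Q hQ).2.1
      exact isCoprime_iff_sup_eq.2 (hPm.coprime_of_ne hQm hne)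
    · rw [dvd_iff_le, span_singleton_le_iff_mem]
      have := Int.absNorm_under_mem P
      rw [(hs P hP).2.2] at this
      exact_mod_cast this
  have hn : absNorm (span {(m : 𝓞 K)}) = m ^ nK K := by
    rw [Ideal.absNorm_span_singleton]
    have : (m : 𝓞 K) = algebraMap ℤ (𝓞 K) m := by simp
    rw [this, Algebra.norm_algebraMap, Int.natAbs_pow, Int.natAbs_natCast, nK,
      RingOfIntegers.rank]
  have h1 : ∏ P ∈ s, absNorm P ≤ m ^ nK K := by
    rw [← hn, ← map_prod]
    exact le_of_dvd (by rw [hn]; exact pow_pos hm.pos _) (map_dvd absNorm hdvd)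
  have h2 : m ^ s.card ≤ ∏ P ∈ s, absNorm P := by
    rw [← prod_const]
    refine prod_le_prod' fun P hP => ?_
    have h3 := Int.absNorm_under_dvd_absNorm P
    rw [(hs P hP).2.2] at h3
    exact le_of_dvd (Nat.pos_of_ne_zero (by
      rw [Ne, absNorm_eq_zero_iff]; exact (hs P hP).2.1)) h3
  exact (Nat.pow_le_pow_iff_right hm.one_lt).1 (h2.trans h1)

lemma sum_primes_le {σ : ℝ} (hσ : 1 < σ) (s : Finset ℐ)
    (hs : ∀ p ∈ s, p.IsPrime ∧ p ≠ ⊥) :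
    ∑ p ∈ s, (absNorm p : ℝ) ^ (-σ) ≤ nK K * ∑' m : ℕ, (m : ℝ) ^ (-σ) := by
  classical
  have hsum : Summable fun m : ℕ => (m : ℝ) ^ (-σ) := Real.summable_nat_rpow.2 (by linarith)
  set u : ℐ → ℕ := fun P => absNorm (Ideal.under ℤ P)
  have hu : ∀ p ∈ s, (u p).Prime := fun p hp => by
    have := (hs p hp).1
    have : NeZero p := ⟨(hs p hp).2⟩
    exact Nat.absNorm_under_prime p
  calc ∑ p ∈ s, (absNorm p : ℝ) ^ (-σ) ≤ ∑ p ∈ s, (u p : ℝ) ^ (-σ) := by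
        refine sum_le_sum fun p hp => ?_
        refine Real.rpow_le_rpow_of_nonpos (by exact_mod_cast (hu p hp).pos) ?_ (by linarith)
        exact_mod_cast le_of_dvd (Nat.pos_of_ne_zero (by
          rw [Ne, absNorm_eq_zero_iff]; exact (hs p hp).2)) (Int.absNorm_under_dvd_absNorm p)
    _ = ∑ m ∈ s.image u, ∑ p ∈ s with u p = m, (u p : ℝ) ^ (-σ) :=
        (Finset.sum_fiberwise_of_maps_to (fun p hp => Finset.mem_image_of_mem u hp) _).symm
    _ ≤ ∑ m ∈ s.image u, nK K * (m : ℝ) ^ (-σ) := by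
        refine sum_le_sum fun m hm => ?_
        obtain ⟨q, hq, rfl⟩ := mem_image.1 hm
        rw [sum_congr rfl (fun p hp => by rw [(mem_filter.1 hp).2]),
          sum_const, nsmul_eq_mul]
        refine mul_le_mul_of_nonneg_right ?_ (by positivity)
        exact_mod_cast card_primes_over_le (hu q hq) _ fun P hP =>
          ⟨(hs P (mem_filter.1 hP).1).1, (hs P (mem_filter.1 hP).1).2,
            (mem_filter.1 hP).2⟩
    _ = nK K * ∑ m ∈ s.image u, (m : ℝ) ^ (-σ) := by rw [mul_sum]
    _ ≤ _ := by
        refine mul_le_mul_of_nonneg_left (hsum.sum_le_tsum _ fun m _ => by positivity) (by positivity)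

lemma finite_primes_above {𝔪 : ℐ} (h : 𝔪 ≠ ⊥) :
    {P : ℐ | P.IsPrime ∧ 𝔪 ≤ P}.Finite := by
  refine (finite_setOfPred_absNorm_le (S := 𝓞 K) (absNorm 𝔪)).subset fun P hP => ?_
  exact le_of_dvd (Nat.pos_of_ne_zero (by rwa [Ne, absNorm_eq_zero_iff]))
    (map_dvd absNorm (dvd_iff_le.2 hP.2))

theorem zetaE_le {σ : ℝ} (hσ : 1 < σ) :
    zetaE K σ ≤ ofReal (exp (2 * ∑' m : ℕ, (m : ℝ) ^ (-σ)) ^ nK K) := by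
  classical
  rw [zetaE, ENNReal.tsum_eq_iSup_sum]
  refine iSup_le fun F => ?_
  choose! fin hfin using fun (𝔪 : ℐ₀) => (finite_primes_above 𝔪.2).exists_finset
  set s := F.biUnion fin
  have hs : ∀ p ∈ s, p.IsPrime ∧ p ≠ ⊥ := fun p hp => by
    obtain ⟨𝔪, _, h⟩ := mem_biUnion.1 hp
    have := (hfin 𝔪 p).1 h
    exact ⟨this.1, fun h0 => 𝔪.2 (le_bot_iff.1 (h0 ▸ this.2))⟩
  have h1 : ∑ 𝔪 ∈ F, nw σ 𝔪.1 ≤ ∑' 𝔪 : Smooth (s : Set ℐ), nw σ 𝔪.1 := by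
    have hF : ∀ 𝔪 ∈ F, 𝔪.1 ≠ ⊥ ∧ ∀ P : ℐ, P.IsPrime → 𝔪.1 ≤ P →
        P ∈ (s : Set ℐ) := fun 𝔪 h𝔪 =>
      ⟨𝔪.2, fun P hP hle => mem_biUnion.2 ⟨𝔪, h𝔪, (hfin 𝔪 P).2 ⟨hP, hle⟩⟩⟩
    rw [← sum_attach]
    refine (tsum_fintype (L := SummationFilter.unconditional _)
      (fun 𝔪 : F => nw σ 𝔪.1.1)).symm.trans_le ?_
    exact ENNReal.tsum_comp_le_tsum_of_injective (f := fun 𝔪 : F =>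
      (⟨𝔪.1.1, hF 𝔪.1 𝔪.2⟩ : Smooth (s : Set ℐ)))
      (fun a b h => Subtype.ext (Subtype.ext (by simpa using h))) (fun 𝔪 => nw σ 𝔪.1)
  refine h1.trans ((tsum_smooth_le hσ.le s hs).trans (ENNReal.ofReal_le_ofReal ?_))
  rw [← Real.exp_nat_mul]
  refine exp_le_exp.2 ?_
  have := sum_primes_le hσ s hs
  linarith

/-- The mass of the packet in the norm shell `[a u, b u]`. -/
def shell (K : Type*) [Field K] [NumberField K] (B a b u : ℝ) : ℝ :=
  ∫ v : mixedSpace K, pk B v * (Set.Icc a b).indicator 1 (mixedEmbedding.norm v / u) ∂mulHaar K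

/-- The main term for the trivial character. -/
def mainT (K : Type*) [Field K] [NumberField K] (B t a b : ℝ) : ℂ :=
  kap K * (∫ v : mixedSpace K, (pk B v : ℂ) *
    cexp (-(t * log (mixedEmbedding.norm v) * I)) ∂mulHaar K) *
    ∫ X : ℝ in Set.Icc (log a) (log b), cexp (t * X * I)

/-- The radial weight `r^{1+it}` on `[a, b]`. -/
def rw_ (t a b r : ℝ) : ℂ := (Set.Icc a b).indicator (fun r : ℝ => (r : ℂ) ^ (1 + t * I)) r

lemma wt_rw {t a b : ℝ} (ha : 0 < a) : Wt (rw_ t a b) a b where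
  meas := by
    refine Measurable.indicator ?_ measurableSet_Icc
    exact measurable_ofReal.pow_const _
  pos := ha
  supp r h := by
    by_contra h1
    rw [← mem_Icc] at h1
    exact h (indicator_of_notMem h1 _)
  bound r hr := by
    by_cases h1 : r ∈ Set.Icc a b
    · rw [rw_, indicator_of_mem h1, norm_cpow_eq_rpow_re_of_pos (ha.trans_le h1.1)]
      simp
    · rw [rw_, indicator_of_notMem h1, norm_zero]; exact hr

lemma hk_mul_rw {B : ℝ} (hB : 1 ≤ B) (t a b : ℝ) (v : 𝓜) {u : ℝ} (hu : 0 < u) :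
    hk B t v * rw_ t a b (𝒩 v / u) =
      (u : ℂ) ^ (-(1 + t * I)) *
        ((pk B v * (Set.Icc a b).indicator 1 (𝒩 v / u) : ℝ) : ℂ) := by
  by_cases h0 : pk B v = 0
  · rw [hk_eq, h0]; simp
  by_cases h1 : 𝒩 v / u ∈ Set.Icc a b
  · have hn : 0 < 𝒩 v := (exp_pos _).trans_le (norm_pos_of_pk_ne hB h0).1
    rw [rw_, indicator_of_mem h1, indicator_of_mem h1, hk_eq, Pi.one_apply, mul_one,
      ofReal_div, div_eq_mul_inv, ← Complex.ofReal_inv,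
      mul_cpow_ofReal_nonneg hn.le (inv_nonneg.2 hu.le), Complex.ofReal_inv,
      inv_cpow _ _ (by rw [arg_ofReal_of_nonneg hu.le]; exact Real.pi_pos.ne),
      ← cpow_neg (u : ℂ)]
    have h2 : ((𝒩 v : ℝ) : ℂ) ^ (-(1 + t * I)) *
        ((𝒩 v : ℝ) : ℂ) ^ (1 + t * I) = 1 := by
      rw [← cpow_add _ _ (by exact_mod_cast hn.ne'), neg_add_cancel, cpow_zero]
    linear_combination ((pk B v : ℝ) : ℂ) * (u : ℂ) ^ (-(1 + t * I)) * h2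
  · rw [rw_, indicator_of_notMem h1, indicator_of_notMem h1]; simp

lemma integral_hk_mul_rw {B : ℝ} (hB : 1 ≤ B) (t a b : ℝ) {u : ℝ} (hu : 0 < u) :
    ∫ v, hk B t v * rw_ t a b (𝒩 v / u) ∂mulHaar K =
      (u : ℂ) ^ (-(1 + t * I)) * (shell K B a b u : ℂ) := by
  rw [shell, ← integral_complex_ofReal, ← integral_const_mul]
  exact integral_congr_ae (.of_forall fun v => hk_mul_rw hB t a b v hu)

lemma FT_hk_zero {B : ℝ} (hB : 1 ≤ B) (t : ℝ) : FT (hk B t : 𝓜 → ℂ) 0 =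
    ∫ v : 𝓜, (pk B v : ℂ) *
      cexp (-(t * log (𝒩 v) * I)) ∂mulHaar K := by
  rw [FT]
  simp only [zero_mul, map_zero, ofReal_zero, mul_zero, neg_zero, exp_zero, one_mul]
  rw [← integral_norm_mul_mulHaar]
  refine integral_congr_ae (.of_forall fun v => ?_)
  beta_reduce
  by_cases h0 : pk B v = 0
  · rw [hk_eq, h0]; simp
  have hn : 0 < 𝒩 v := (exp_pos _).trans_le (norm_pos_of_pk_ne hB h0).1
  have h1 : ((𝒩 v : ℝ) : ℂ) ^ (-(1 + t * I)) =
      ((𝒩 v : ℝ) : ℂ)⁻¹ * cexp (-(t * log (𝒩 v) * I)) := by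
    rw [neg_add, cpow_add _ _ (by exact_mod_cast hn.ne'), cpow_neg_one,
      cpow_eq_exp hn]
    congr 2; ring
  have h2 : ((𝒩 v : ℝ) : ℂ) * ((𝒩 v : ℝ) : ℂ)⁻¹ = 1 :=
    mul_inv_cancel₀ (by exact_mod_cast hn.ne')
  rw [hk_eq, h1]
  linear_combination ((pk B v : ℝ) : ℂ) * cexp (-(t * log (𝒩 v) * I)) * h2

lemma integral_rw (t : ℝ) {a b : ℝ} (ha : 0 < a) (hb : 0 < b) :
    ∫ x : ℝ, rw_ t a b (exp x) / (exp x : ℂ) =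
      ∫ X : ℝ in Set.Icc (log a) (log b), cexp (t * X * I) := by
  rw [← integral_indicator measurableSet_Icc]
  refine integral_congr_ae (.of_forall fun x => ?_)
  beta_reduce
  have hx : exp x ∈ Set.Icc a b ↔ x ∈ Set.Icc (log a) (log b) := by
    rw [mem_Icc, mem_Icc, Real.log_le_iff_le_exp ha, Real.le_log_iff_exp_le hb]
  by_cases h : x ∈ Set.Icc (log a) (log b)
  · rw [rw_, indicator_of_mem (hx.2 h), indicator_of_mem h, cpow_eq_exp (exp_pos x),
      Real.log_exp, ofReal_exp, ← exp_sub]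
    congr 1; ring
  · rw [rw_, indicator_of_notMem (fun h1 => h (hx.1 h1)), indicator_of_notMem h, zero_div]

lemma inv_cov_le : 1 / cov K ≤ 2 ^ nK K / √(DK K) := by
  have hD : (0 : ℝ) < DK K := by
    exact_mod_cast Int.natAbs_pos.2 (NumberField.discr_ne_zero K)
  have h1 : cov K = (2⁻¹ : ℝ) ^ nrComplexPlaces K * √(DK K) := by
    rw [cov, volume_fundamentalDomain_latticeBasis, ENNReal.toReal_mul, ENNReal.toReal_pow,
      ENNReal.toReal_inv]
    congr 1
    rw [DK, Nat.cast_natAbs, Int.cast_abs, ← Int.norm_eq_abs]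
    simp
  have h2 : nrComplexPlaces K ≤ nK K := by
    rw [nK, ← card_add_two_mul_card_eq_rank K]; omega
  rw [h1, one_div, mul_inv, inv_pow, inv_inv, div_eq_mul_inv]
  exact mul_le_mul_of_nonneg_right (pow_le_pow_right₀ (by norm_num) h2) (by positivity)

theorem smooth_packet {η : ℝ} (hη : 0 < η) (hη' : η ≤ 1 / 8) : ∃ C : ℝ, 1 ≤ C ∧
    ∀ (K : Type) [Field K] [NumberField K] (𝔣 : Ideal (𝓞 K)) (χ : PChar 𝔣) (B t a b : ℝ),
    𝔣 ≠ ⊥ → 1 ≤ B → |t| ≤ B ^ 2 → 0 < a → 0 < b →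
    ‖∑' 𝔫 : {𝔫 : Ideal (𝓞 K) // 𝔫 ≠ ⊥}, χ.toFun 𝔫.1 *
        ((absNorm 𝔫.1 : ℂ) ^ (-(1 + t * I)) * (shell K B a b (absNorm 𝔫.1) : ℂ)) -
      (if χ.IsTriv then mainT K B t a b else 0)‖ ≤
    C ^ nK K * (DK K * absNorm 𝔣) ^ (1 / 2 + η) * b ^ (1 + η) * (B ^ 2) ^ (nK K * η) := by
  obtain ⟨C, hC, hU⟩ := exists_FT_majorant
  set Z := exp (2 * ∑' m : ℕ, (m : ℝ) ^ (-(1 + η))) with hZ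
  have hZ1 : 1 ≤ Z := Real.one_le_exp (by
    refine mul_nonneg (by norm_num) (tsum_nonneg fun m => by positivity))
  refine ⟨2 * Z * C, by nlinarith, fun K _ _ 𝔣 χ B t a b h𝔣 hB ht ha hb => ?_⟩
  obtain ⟨U, hUm, hU1, hU2⟩ := hU K B t η hB ht hη.le hη'
  have hD : (0 : ℝ) < DK K := by
    exact_mod_cast Int.natAbs_pos.2 (NumberField.discr_ne_zero K)
  have hf0 : (0 : ℝ) < absNorm 𝔣 := by
    exact_mod_cast Nat.pos_of_ne_zero fun h => h𝔣 (absNorm_eq_zero_iff.1 h)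
  have key := smooth_sum χ h𝔣 (adm_hk hB t) (wt_rw (t := t) (b := b) ha) hb hUm hU1 hη
  rw [FT_hk_zero hB, integral_rw t ha hb] at key
  have h1 : ∀ 𝔫 : {𝔫 : Ideal (𝓞 K) // 𝔫 ≠ ⊥}, χ.toFun 𝔫.1 *
      ∫ v, hk B t v * rw_ t a b (mixedEmbedding.norm v / absNorm 𝔫.1) ∂(mulHaar K) =
      χ.toFun 𝔫.1 * ((absNorm 𝔫.1 : ℂ) ^ (-(1 + t * I)) *
        (shell K B a b (absNorm 𝔫.1) : ℂ)) := fun 𝔫 => by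
    rw [integral_hk_mul_rw hB t a b (by
      exact_mod_cast Nat.pos_of_ne_zero fun h => 𝔫.2 (absNorm_eq_zero_iff.1 h)),
      ofReal_natCast]
  rw [tsum_congr h1] at key
  rw [← ENNReal.ofReal_le_ofReal_iff (by positivity), ofReal_norm]
  refine key.trans ?_
  refine (mul_le_mul' (mul_le_mul' le_rfl (zetaE_le (by linarith : (1 : ℝ) < 1 + η))) hU2).trans ?_
  have hcov := cov_pos (K := K)
  rw [← ENNReal.ofReal_mul (by positivity), ← ENNReal.ofReal_mul (by positivity),
    ← ENNReal.ofReal_mul (by positivity)]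
  refine ENNReal.ofReal_le_ofReal ?_
  rw [← hZ]
  have h2 : 1 / (cov K * √(absNorm 𝔣)) ≤ 2 ^ nK K * (DK K * absNorm 𝔣 : ℝ) ^ (-(1 / 2 : ℝ)) := by
    rw [← div_div, div_le_iff₀ (by positivity)]
    refine inv_cov_le.trans (le_of_eq ?_)
    rw [Real.rpow_neg (by positivity), ← Real.sqrt_eq_rpow, Real.sqrt_mul hD.le]
    have := (Real.sqrt_pos.2 hf0).ne'
    field_simp
  have h3 : (b * DK K * absNorm 𝔣) ^ (1 + η) =
      b ^ (1 + η) * (DK K * absNorm 𝔣 : ℝ) ^ (1 + η) := by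
    rw [mul_assoc, Real.mul_rpow hb.le (by positivity)]
  have h4 : (DK K * absNorm 𝔣 : ℝ) ^ (1 / 2 + η) =
      (DK K * absNorm 𝔣 : ℝ) ^ (-(1 / 2 : ℝ)) * (DK K * absNorm 𝔣 : ℝ) ^ (1 + η) := by
    rw [← Real.rpow_add (by positivity)]; congr 1; ring
  rw [h3, h4, mul_pow, mul_pow]
  calc _ ≤ 2 ^ nK K * (DK K * absNorm 𝔣 : ℝ) ^ (-(1 / 2 : ℝ)) *
        (b ^ (1 + η) * (DK K * absNorm 𝔣 : ℝ) ^ (1 + η)) * Z ^ nK K *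
        (C ^ nK K * (B ^ 2) ^ (nK K * η)) := by gcongr
    _ = _ := by ring

section selberg

variable {ι : Type*} [DecidableEq ι]

lemma sum_interval_sign (P u v : Finset ι) (hu : u ⊆ P) (hv : v ⊆ P) :
    ∑ s ∈ P.powerset, (if u ⊆ s ∧ s ⊆ v then (-1 : ℝ) ^ s.card else 0) =
      if u = v then (-1) ^ u.card else 0 := by
  have h1 := Finset.prod_add (fun p => if p ∈ v then (-1 : ℝ) else 0)
    (fun p => if p ∈ u then (0 : ℝ) else 1) P
  have h2 : ∀ s ∈ P.powerset, (∏ p ∈ s, if p ∈ v then (-1 : ℝ) else 0) *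
      (∏ p ∈ P \ s, if p ∈ u then (0 : ℝ) else 1) =
      if u ⊆ s ∧ s ⊆ v then (-1 : ℝ) ^ s.card else 0 := by
    intro s hs
    split_ifs with h
    · rw [prod_congr rfl (fun p hp => if_pos (h.2 hp)), prod_const,
        prod_congr rfl (fun p hp => if_neg fun hpu => (Finset.mem_sdiff.1 hp).2 (h.1 hpu)),
        Finset.prod_const_one, mul_one]
    · rw [not_and_or] at h
      rcases h with h | h
      · obtain ⟨p, hp, hps⟩ := not_subset.1 h
        exact mul_eq_zero_of_right _ (prod_eq_zero (Finset.mem_sdiff.2 ⟨hu hp, hps⟩) (if_pos hp))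
      · obtain ⟨p, hp, hpv⟩ := not_subset.1 h
        exact mul_eq_zero_of_left (prod_eq_zero hp (if_neg hpv)) _
  rw [← sum_congr rfl h2, ← h1]
  split_ifs with h
  · subst h
    have : ∀ p ∈ P, ((if p ∈ u then (-1 : ℝ) else 0) + if p ∈ u then (0 : ℝ) else 1) =
        if p ∈ u then (-1 : ℝ) else 1 := fun p _ => by split_ifs <;> norm_num
    rw [prod_congr rfl this, Finset.prod_ite, prod_const, Finset.prod_const_one,
      mul_one, Finset.filter_mem_eq_inter, Finset.inter_eq_right.2 hu]
  · obtain ⟨p, hp⟩ : ∃ p, ¬ (p ∈ u ↔ p ∈ v) := by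
      by_contra hc; push Not at hc; exact h (Finset.ext hc)
    by_cases hpu : p ∈ u
    · have hpv : p ∉ v := fun hpv => hp ⟨fun _ => hpv, fun _ => hpu⟩
      exact prod_eq_zero (hu hpu) (by rw [if_pos hpu, if_neg hpv, add_zero])
    · have hpv : p ∈ v := by by_contra hpv; exact hp ⟨fun h => absurd h hpu, fun h => absurd h hpv⟩
      exact prod_eq_zero (hv hpv) (by rw [if_neg hpu, if_pos hpv]; norm_num)

lemma prod_mono_of_one_lt {N : ι → ℝ} {s t : Finset ι} (hN : ∀ p ∈ t, 1 < N p) (h : s ⊆ t) :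
    ∏ p ∈ s, N p ≤ ∏ p ∈ t, N p := by
  rw [← prod_sdiff h]
  refine le_mul_of_one_le_left (prod_nonneg fun p hp => by linarith [hN p (h hp)]) ?_
  exact one_le_prod fun p hp => (hN p (Finset.mem_sdiff.1 hp).1).le

/-- The Selberg sum `∑ 1/φ(s)` over square-free products of norm at most `z`. -/
def selJ (P : Finset ι) (N : ι → ℝ) (z : ℝ) : ℝ :=
  ∑ s ∈ P.powerset with ∏ p ∈ s, N p ≤ z, (∏ p ∈ s, (N p - 1))⁻¹

theorem selberg_weights (P : Finset ι) (N : ι → ℝ) (hN : ∀ p ∈ P, 1 < N p) {z : ℝ} (hz : 1 ≤ z) :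
    1 ≤ selJ P N z ∧ ∃ lam : Finset ι → ℝ, lam ∅ = 1 ∧ (∀ s ∈ P.powerset, |lam s| ≤ 1) ∧
      (∀ s ∈ P.powerset, ¬ ∏ p ∈ s, N p ≤ z → lam s = 0) ∧
      ∑ s ∈ P.powerset, ∑ t ∈ P.powerset, lam s * lam t * (∏ p ∈ s ∪ t, N p)⁻¹ =
        (selJ P N z)⁻¹ := by
  set J := selJ P N z with hJ
  set n : Finset ι → ℝ := fun s => ∏ p ∈ s, N p with hn
  set φ : Finset ι → ℝ := fun s => ∏ p ∈ s, (N p - 1) with hφ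
  set D := P.powerset.filter fun s => n s ≤ z with hD
  have hDP : ∀ {s}, s ∈ D → s ⊆ P := fun h => mem_powerset.1 (mem_filter.1 h).1
  have hn0 : ∀ {s}, s ⊆ P → 0 < n s := fun h =>
    prod_pos fun p hp => by linarith [hN p (h hp)]
  have hφ0 : ∀ {s}, s ⊆ P → 0 < φ s := fun h =>
    prod_pos fun p hp => by linarith [hN p (h hp)]
  have hJ' : J = ∑ s ∈ D, (φ s)⁻¹ := rfl
  have hemp : (∅ : Finset ι) ∈ D := by simp [hD, hn, hz]
  have hJ1 : 1 ≤ J := by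
    have := Finset.single_le_sum (f := fun s => (φ s)⁻¹)
      (fun s hs => (inv_pos.2 (hφ0 (hDP hs))).le) hemp
    simpa [hJ', hφ] using this
  have hJ0 : 0 < J := by linarith
  refine ⟨hJ1, fun s => (-1) ^ s.card * n s * J⁻¹ * ∑ v ∈ D, if s ⊆ v then (φ v)⁻¹ else 0,
    ?_, ?_, ?_, ?_⟩
  · simp only [Finset.card_empty, pow_zero, Finset.empty_subset, if_true, ← hJ']
    simp [hn, hJ0.ne']
  · intro s hs
    have hs := mem_powerset.1 hs
    have hS0 : 0 ≤ ∑ v ∈ D, if s ⊆ v then (φ v)⁻¹ else 0 := sum_nonneg fun v hv => by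
      split_ifs
      exacts [(inv_pos.2 (hφ0 (hDP hv))).le, le_rfl]
    have key : n s * ∑ v ∈ D, (if s ⊆ v then (φ v)⁻¹ else 0) ≤ J := by
      have h1 : n s = ∑ l ∈ s.powerset, φ s * (φ l)⁻¹ := by
        have : ∀ l ∈ s.powerset, φ s * (φ l)⁻¹ = φ (s \ l) := fun l hl => by
          have hl' := mem_powerset.1 hl
          rw [mul_inv_eq_iff_eq_mul₀ (hφ0 (hl'.trans hs)).ne', hφ]
          exact (prod_sdiff hl').symm
        rw [sum_congr rfl this]
        have h2 := Finset.prod_one_add (f := fun p => N p - 1) s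
        have h3 : n s = ∏ p ∈ s, (1 + (N p - 1)) := prod_congr rfl fun p _ => by ring
        rw [h3, h2]
        refine (Finset.sum_nbij' (fun l => s \ l) (fun l => s \ l) ?_ ?_ ?_ ?_ ?_).symm
        · intro l _; exact mem_powerset.2 sdiff_subset
        · intro l _; exact mem_powerset.2 sdiff_subset
        · intro l hl; exact Finset.sdiff_sdiff_eq_self (mem_powerset.1 hl)
        · intro l hl; exact Finset.sdiff_sdiff_eq_self (mem_powerset.1 hl)
        · intro l _; rfl
      rw [h1, ← sum_filter, sum_mul_sum, ← Finset.sum_product']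
      have hmem : ∀ q ∈ s.powerset ×ˢ D.filter (s ⊆ ·), q.1 ⊆ s ∧ q.2 ∈ D ∧ s ⊆ q.2 := by
        intro q hq
        rw [Finset.mem_product, mem_powerset, mem_filter] at hq
        exact ⟨hq.1, hq.2.1, hq.2.2⟩
      have hsub : ∀ q : Finset ι × Finset ι, q.1 ⊆ s ∧ q.2 ∈ D ∧ s ⊆ q.2 →
          q.1 ∪ q.2 \ s ⊆ q.2 := fun q hq =>
        Finset.union_subset (hq.1.trans hq.2.2) sdiff_subset
      have hinj : Set.InjOn (fun q : Finset ι × Finset ι => q.1 ∪ q.2 \ s)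
          (s.powerset ×ˢ D.filter (s ⊆ ·) : Finset _) := by
        intro q hq r hr hqr
        have hq := hmem q hq
        have hr := hmem r hr
        have hx : ∀ p, p ∈ q.1 ∪ q.2 \ s ↔ p ∈ r.1 ∪ r.2 \ s := fun p => by
          have : q.1 ∪ q.2 \ s = r.1 ∪ r.2 \ s := hqr
          rw [this]
        simp only [mem_union, Finset.mem_sdiff] at hx
        refine Prod.ext (Finset.ext fun p => ?_) (Finset.ext fun p => ?_)
        · have := hx p
          have := @hq.1 p
          have := @hr.1 p
          tauto
        · have := hx p
          have := @hq.1 p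
          have := @hr.1 p
          have := @hq.2.2 p
          have := @hr.2.2 p
          tauto
      calc ∑ q ∈ s.powerset ×ˢ D.filter (s ⊆ ·), φ s * (φ q.1)⁻¹ * (φ q.2)⁻¹
          = ∑ q ∈ s.powerset ×ˢ D.filter (s ⊆ ·), (φ (q.1 ∪ q.2 \ s))⁻¹ := by
            refine sum_congr rfl fun q hq => ?_
            have hq := hmem q hq
            have e1 : φ (q.1 ∪ q.2 \ s) = φ q.1 * φ (q.2 \ s) :=
              Finset.prod_union (Finset.disjoint_of_subset_left hq.1 Finset.disjoint_sdiff)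
            have e2 : φ (q.2 \ s) * φ s = φ q.2 := prod_sdiff hq.2.2
            have p1 := (hφ0 hs).ne'
            have p2 := (hφ0 (hq.1.trans hs)).ne'
            have p3 := (hφ0 (sdiff_subset.trans (hDP hq.2.1) : q.2 \ s ⊆ P)).ne'
            rw [e1, ← e2]
            field_simp
        _ = ∑ w ∈ (s.powerset ×ˢ D.filter (s ⊆ ·)).image fun q => q.1 ∪ q.2 \ s, (φ w)⁻¹ :=
            (sum_image (f := fun w => (φ w)⁻¹) hinj).symm
        _ ≤ ∑ w ∈ D, (φ w)⁻¹ := by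
            refine Finset.sum_le_sum_of_subset_of_nonneg ?_ fun w hw _ =>
              (inv_pos.2 (hφ0 (hDP hw))).le
            intro w hw
            obtain ⟨q, hq, rfl⟩ := mem_image.1 hw
            have hq := hmem q hq
            have hq2 := hDP hq.2.1
            refine mem_filter.2 ⟨mem_powerset.2 ((hsub q hq).trans hq2), ?_⟩
            refine le_trans ?_ (mem_filter.1 hq.2.1).2
            exact prod_mono_of_one_lt (fun p hp => hN p (hq2 hp)) (hsub q hq)
    beta_reduce
    rw [abs_mul, abs_mul, abs_mul, abs_pow, abs_neg, abs_one, one_pow, one_mul,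
      abs_of_pos (hn0 hs), abs_of_pos (inv_pos.2 hJ0), abs_of_nonneg hS0]
    calc _ = (n s * ∑ v ∈ D, (if s ⊆ v then (φ v)⁻¹ else 0)) * J⁻¹ := by ring
      _ ≤ J * J⁻¹ := mul_le_mul_of_nonneg_right key (inv_pos.2 hJ0).le
      _ = 1 := mul_inv_cancel₀ hJ0.ne'
  · intro s hs hsz
    have : ∀ v ∈ D, (if s ⊆ v then (φ v)⁻¹ else 0) = 0 := fun v hv => by
      refine if_neg fun hsv => hsz (le_trans ?_ (mem_filter.1 hv).2)
      exact prod_mono_of_one_lt (fun p hp => hN p (hDP hv hp)) hsv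
    beta_reduce
    rw [sum_eq_zero this, mul_zero]
  · set L : Finset ι → ℝ := fun s => (-1) ^ s.card * n s * J⁻¹ *
      ∑ v ∈ D, if s ⊆ v then (φ v)⁻¹ else 0 with hL
    have hy : ∀ u ∈ P.powerset, ∑ s ∈ P.powerset, (if u ⊆ s then L s * (n s)⁻¹ else 0) =
        if u ∈ D then J⁻¹ * ((-1) ^ u.card * (φ u)⁻¹) else 0 := by
      intro u hu
      have h1 : ∀ s ∈ P.powerset, (if u ⊆ s then L s * (n s)⁻¹ else 0) =
          ∑ v ∈ D, J⁻¹ * (φ v)⁻¹ * (if u ⊆ s ∧ s ⊆ v then (-1 : ℝ) ^ s.card else 0) := by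
        intro s hs
        have hs0 := (hn0 (mem_powerset.1 hs)).ne'
        by_cases hus : u ⊆ s
        · rw [if_pos hus]
          have : L s * (n s)⁻¹ = (-1) ^ s.card * J⁻¹ * ∑ v ∈ D, if s ⊆ v then (φ v)⁻¹ else 0 := by
            rw [hL]; field_simp
          rw [this, mul_sum]
          refine sum_congr rfl fun v _ => ?_
          by_cases hsv : s ⊆ v
          · rw [if_pos hsv, if_pos ⟨hus, hsv⟩]; ring
          · rw [if_neg hsv, if_neg (fun h => hsv h.2)]; ring
        · rw [if_neg hus]
          exact (sum_eq_zero fun v _ => by rw [if_neg (fun h => hus h.1), mul_zero]).symm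
      rw [sum_congr rfl h1, sum_comm]
      simp_rw [← mul_sum]
      rw [sum_congr rfl fun v hv => by
        rw [sum_interval_sign P u v (mem_powerset.1 hu) (hDP hv)]]
      simp only [mul_ite, mul_zero, Finset.sum_ite_eq]
      split_ifs <;> ring
    have hq : ∀ s ∈ P.powerset, ∀ t ∈ P.powerset, L s * L t * (n (s ∪ t))⁻¹ =
        ∑ u ∈ P.powerset, φ u * ((if u ⊆ s then L s * (n s)⁻¹ else 0) *
          (if u ⊆ t then L t * (n t)⁻¹ else 0)) := by
      intro s hs t ht
      have hs' := mem_powerset.1 hs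
      have ht' := mem_powerset.1 ht
      have h1 : n (s ∪ t) * n (s ∩ t) = n s * n t := Finset.prod_union_inter
      have h2 : n (s ∩ t) = ∑ u ∈ (s ∩ t).powerset, φ u := by
        have h2 := Finset.prod_one_add (f := fun p => N p - 1) (s ∩ t)
        have h3 : n (s ∩ t) = ∏ p ∈ s ∩ t, (1 + (N p - 1)) :=
          prod_congr rfl fun p _ => by ring
        rw [h3, h2]
      have h4 : (s ∩ t).powerset = P.powerset.filter (fun u => u ⊆ s ∧ u ⊆ t) := by
        ext u
        simp only [mem_powerset, mem_filter, Finset.subset_inter_iff]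
        exact ⟨fun h => ⟨h.1.trans hs', h⟩, fun h => h.2⟩
      have h5 : (n (s ∪ t))⁻¹ = (n s)⁻¹ * (n t)⁻¹ * n (s ∩ t) := by
        have e1 := (hn0 (Finset.union_subset hs' ht')).ne'
        have e2 := (hn0 hs').ne'
        have e3 := (hn0 ht').ne'
        field_simp
        linarith
      rw [h5, h2, h4, sum_filter, ← mul_assoc, mul_sum]
      refine sum_congr rfl fun u _ => ?_
      by_cases h6 : u ⊆ s <;> by_cases h7 : u ⊆ t <;> simp [h6, h7]
      ring
    rw [sum_congr rfl fun s hs => sum_congr rfl fun t ht => hq s hs t ht]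
    have h8 : ∀ s ∈ P.powerset, ∑ t ∈ P.powerset, ∑ u ∈ P.powerset,
        φ u * ((if u ⊆ s then L s * (n s)⁻¹ else 0) * (if u ⊆ t then L t * (n t)⁻¹ else 0)) =
        ∑ u ∈ P.powerset, φ u * ((if u ⊆ s then L s * (n s)⁻¹ else 0) *
          (if u ∈ D then J⁻¹ * ((-1) ^ u.card * (φ u)⁻¹) else 0)) := by
      intro s hs
      rw [sum_comm]
      refine sum_congr rfl fun u hu => ?_
      rw [← mul_sum, ← mul_sum, hy u hu]
    rw [sum_congr rfl h8, sum_comm]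
    have h9 : ∀ u ∈ P.powerset, ∑ s ∈ P.powerset, φ u * ((if u ⊆ s then L s * (n s)⁻¹ else 0) *
          (if u ∈ D then J⁻¹ * ((-1) ^ u.card * (φ u)⁻¹) else 0)) =
        if n u ≤ z then J⁻¹ * J⁻¹ * (φ u)⁻¹ else 0 := by
      intro u hu
      have hu0 := (hφ0 (mem_powerset.1 hu)).ne'
      rw [← mul_sum, ← sum_mul, hy u hu]
      have hDu : u ∈ D ↔ n u ≤ z := ⟨fun h => (mem_filter.1 h).2,
        fun h => mem_filter.2 ⟨hu, h⟩⟩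
      simp only [hDu]
      split_ifs with h
      · have hsq : ((-1 : ℝ) ^ u.card) * (-1) ^ u.card = 1 := by
          rw [← mul_pow]; norm_num
        have hi : φ u * (φ u)⁻¹ = 1 := mul_inv_cancel₀ hu0
        linear_combination (J⁻¹ * J⁻¹ * (φ u)⁻¹ * (φ u * (φ u)⁻¹)) * hsq + (J⁻¹ * J⁻¹ * (φ u)⁻¹) * hi
      · ring
    rw [sum_congr rfl h9, ← sum_filter, ← mul_sum, ← hJ']
    field_simp

end selberg

/-- Nonzero ideals whose set of prime divisors is exactly `s`. -/
abbrev ExactSupp (s : Set ℐ) : Type _ :=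
  {𝔪 : ℐ // 𝔪 ≠ ⊥ ∧ ∀ P : ℐ, P.IsPrime → (𝔪 ≤ P ↔ P ∈ s)}

lemma le_pow_mul_iff {p P 𝔟 : ℐ} (hp : p.IsPrime) (hp0 : p ≠ ⊥) (hP : P.IsPrime) (k : ℕ) :
    p ^ (k + 1) * 𝔟 ≤ P ↔ P = p ∨ 𝔟 ≤ P := by
  rw [hP.mul_le, Ideal.IsPrime.pow_le_iff (hn := k.succ_ne_zero)]
  refine or_congr ⟨fun h => ?_, fun h => h.ge⟩ Iff.rfl
  exact ((hp.isMaximal hp0).eq_of_le hP.ne_top h).symm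

lemma tsum_exact_insert {p : ℐ} (hp : p.IsPrime) (hp0 : p ≠ ⊥)
    (s : Set ℐ) (hps : p ∉ s) :
    ∑' 𝔪 : ExactSupp (insert p s), nw 1 𝔪.1 ≤
      ofReal ((absNorm p : ℝ) - 1)⁻¹ * ∑' 𝔪 : ExactSupp s, nw 1 𝔪.1 := by
  have key : ∀ 𝔪 : ExactSupp (insert p s), ∃ q : ℕ × ExactSupp s, 𝔪.1 = p ^ (q.1 + 1) * q.2.1 := by
    rintro ⟨𝔪, h0, h⟩
    obtain ⟨k, 𝔟, rfl, hb⟩ := exists_pow_mul hp hp0 h0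
    obtain _ | k := k
    · have := (h p hp).2 (Set.mem_insert _ _)
      rw [pow_zero, one_mul] at this
      exact absurd this hb
    refine ⟨⟨k, 𝔟, ?_, fun P hP => ?_⟩, rfl⟩
    · rintro rfl; simp at h0
    · have h1 := h P hP
      rw [le_pow_mul_iff hp hp0 hP, Set.mem_insert_iff] at h1
      constructor
      · intro hle
        rcases h1.1 (Or.inr hle) with rfl | h2
        exacts [absurd hle hb, h2]
      · intro hs
        rcases h1.2 (Or.inr hs) with rfl | h2
        exacts [absurd hs hps, h2]
  choose g hg using key
  have inj : Function.Injective g := fun a b hab => Subtype.ext (by rw [hg a, hg b, hab])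
  have h2 : (2 : ℝ) ≤ absNorm p := by exact_mod_cast two_le_absNorm hp hp0
  calc ∑' 𝔪 : ExactSupp (insert p s), nw 1 𝔪.1
      = ∑' 𝔪 : ExactSupp (insert p s),
        (fun q : ℕ × ExactSupp s => nw 1 p ^ (q.1 + 1) * nw 1 q.2.1) (g 𝔪) := by
        refine tsum_congr fun 𝔪 => ?_
        rw [hg 𝔪, nw_mul, nw_pow]
    _ ≤ ∑' q : ℕ × ExactSupp s, nw 1 p ^ (q.1 + 1) * nw 1 q.2.1 :=
        ENNReal.tsum_comp_le_tsum_of_injective inj _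
    _ = (∑' k : ℕ, nw 1 p ^ (k + 1)) * ∑' 𝔪 : ExactSupp s, nw 1 𝔪.1 := by
        rw [tsum_prod (f := fun (k : ℕ) (𝔪 : ExactSupp s) => nw 1 p ^ (k + 1) * nw 1 𝔪.1)]
        simp_rw [ENNReal.tsum_mul_left]
        rw [ENNReal.tsum_mul_right]
    _ = _ := by
        congr 1
        simp_rw [pow_succ]
        rw [ENNReal.tsum_mul_right, ENNReal.tsum_geometric]
        set x := (absNorm p : ℝ) with hx
        have hn : nw 1 p = ofReal x⁻¹ := by rw [nw, Real.rpow_neg_one]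
        have hx1 : x⁻¹ < 1 := inv_lt_one_of_one_lt₀ (by linarith)
        rw [hn, ← ENNReal.ofReal_one, ← ENNReal.ofReal_sub _ (by positivity),
          ← ENNReal.ofReal_inv_of_pos (by linarith), ← ENNReal.ofReal_mul (by
            exact inv_nonneg.2 (by linarith))]
        congr 1
        have h3 : x - 1 ≠ 0 := by linarith
        have h4 : 1 - x⁻¹ ≠ 0 := by linarith
        have h5 : x ≠ 0 := by linarith
        field_simp

lemma tsum_exact_le (s : Finset ℐ) (hs : ∀ p ∈ s, p.IsPrime ∧ p ≠ ⊥) :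
    ∑' 𝔪 : ExactSupp (s : Set ℐ), nw 1 𝔪.1 ≤
      ofReal (∏ p ∈ s, ((absNorm p : ℝ) - 1))⁻¹ := by
  induction s using induction_on with
  | empty =>
    rw [prod_empty, inv_one, ENNReal.ofReal_one, coe_empty]
    refine le_trans ?_ (tsum_smooth_empty (K := K) 1)
    exact ENNReal.tsum_comp_le_tsum_of_injective (f := fun 𝔪 : ExactSupp (∅ : Set ℐ) =>
      (⟨𝔪.1, 𝔪.2.1, fun P hP h => (𝔪.2.2 P hP).1 h⟩ : Smooth (∅ : Set ℐ)))
      (fun a b h => Subtype.ext (by simpa using h)) (fun 𝔪 => nw 1 𝔪.1)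
  | insert p s hps ih =>
    have hp := hs p (Finset.mem_insert_self _ _)
    have h2 : (2 : ℝ) ≤ absNorm p := by exact_mod_cast two_le_absNorm hp.1 hp.2
    rw [coe_insert]
    refine (tsum_exact_insert hp.1 hp.2 _ (by simpa using hps)).trans ?_
    refine (mul_le_mul' le_rfl
      (ih fun q hq => hs q (Finset.mem_insert_of_mem hq))).trans ?_
    rw [← ENNReal.ofReal_mul (inv_nonneg.2 (by linarith)), prod_insert hps, mul_inv]

lemma finite_primes_le (K : Type*) [Field K] [NumberField K] (z : ℝ) :
    {P : Ideal (𝓞 K) | P.IsPrime ∧ P ≠ ⊥ ∧ (absNorm P : ℝ) ≤ z}.Finite :=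
  (finite_setOfPred_absNorm_le (S := 𝓞 K) ⌊z⌋₊).subset fun _ hP => le_floor hP.2.2

/-- The nonzero prime ideals of norm at most `z`. -/
def primesLE (K : Type*) [Field K] [NumberField K] (z : ℝ) : Finset (Ideal (𝓞 K)) :=
  (finite_primes_le K z).toFinset

lemma mem_primesLE {z : ℝ} {P : ℐ} :
    P ∈ primesLE K z ↔ P.IsPrime ∧ P ≠ ⊥ ∧ (absNorm P : ℝ) ≤ z := by
  simp [primesLE]

lemma prod_dvd_iff {s : Finset ℐ} (hs : ∀ p ∈ s, p.IsPrime ∧ p ≠ ⊥) (𝔫 : ℐ) :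
    ∏ p ∈ s, p ∣ 𝔫 ↔ ∀ p ∈ s, p ∣ 𝔫 := by
  refine ⟨fun h p hp => dvd_trans (dvd_prod_of_mem (fun q : ℐ => q) hp) h, fun h =>
    Finset.prod_dvd_of_coprime (fun P hP Q hQ hne => ?_) h⟩
  have hPm := (hs P hP).1.isMaximal (hs P hP).2
  have hQm := (hs Q hQ).1.isMaximal (hs Q hQ).2
  exact isCoprime_iff_sup_eq.2 (hPm.coprime_of_ne hQm hne)

lemma prod_primes_ne_bot {s : Finset ℐ} (hs : ∀ p ∈ s, p.IsPrime ∧ p ≠ ⊥) :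
    ∏ p ∈ s, p ≠ ⊥ := by
  rw [← zero_eq_bot, prod_ne_zero_iff]
  exact fun p hp => (hs p hp).2

lemma prod_primes_inj {s t : Finset ℐ} (hs : ∀ p ∈ s, p.IsPrime ∧ p ≠ ⊥)
    (ht : ∀ p ∈ t, p.IsPrime ∧ p ≠ ⊥) (h : ∏ p ∈ s, p = ∏ p ∈ t, p) : s = t := by
  have aux : ∀ {s t : Finset ℐ}, (∀ p ∈ s, p.IsPrime ∧ p ≠ ⊥) →
      (∀ p ∈ t, p.IsPrime ∧ p ≠ ⊥) → ∏ p ∈ s, p = ∏ p ∈ t, p → s ⊆ t := by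
    intro s t hs ht h p hp
    have h1 : p ∣ ∏ q ∈ t, q := h ▸ dvd_prod_of_mem (fun q : ℐ => q) hp
    obtain ⟨q, hq, hpq⟩ := (Prime.dvd_finsetProd_iff (Ideal.prime_of_isPrime (hs p hp).2 (hs p hp).1)
      _).1 h1
    have : q = p := (((ht q hq).1.isMaximal (ht q hq).2).eq_of_le (hs p hp).1.ne_top
      (dvd_iff_le.1 hpq))
    exact this ▸ hq
  exact (aux hs ht h).antisymm (aux ht hs h.symm)

theorem sum_inv_le_selJ {z : ℝ} (F : Finset ℐ)
    (hF : ∀ 𝔫 ∈ F, 𝔫 ≠ ⊥ ∧ (absNorm 𝔫 : ℝ) ≤ z) :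
    ∑ 𝔫 ∈ F, (absNorm 𝔫 : ℝ)⁻¹ ≤ selJ (primesLE K z) (fun p => (absNorm p : ℝ)) z := by
  have hfin : ∀ 𝔫 : ℐ, ∃ s : Finset ℐ, 𝔫 ≠ ⊥ →
      ∀ P, P ∈ s ↔ P.IsPrime ∧ 𝔫 ≤ P := fun 𝔫 => by
    by_cases h : 𝔫 = ⊥
    · exact ⟨∅, fun h' => absurd h h'⟩
    · obtain ⟨s, hs⟩ := (finite_primes_above h).exists_finset
      exact ⟨s, fun _ P => hs P⟩
  choose g hg using hfin
  have hpr : ∀ 𝔫, 𝔫 ≠ ⊥ → ∀ p ∈ g 𝔫, p.IsPrime ∧ p ≠ ⊥ := fun 𝔫 h0 p hp => by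
    have := (hg 𝔫 h0 p).1 hp
    exact ⟨this.1, fun h => h0 (le_bot_iff.1 (h ▸ this.2))⟩
  have hone : ∀ p ∈ primesLE K z, (1 : ℝ) < absNorm p := fun p hp => by
    have := mem_primesLE.1 hp
    have h2 : (2 : ℝ) ≤ absNorm p := by exact_mod_cast two_le_absNorm this.1 this.2.1
    linarith
  set D := (primesLE K z).powerset.filter fun s => ∏ p ∈ s, (absNorm p : ℝ) ≤ z with hD
  have hmem : ∀ 𝔫 ∈ F, g 𝔫 ∈ D := by
    intro 𝔫 hn
    obtain ⟨h0, hz⟩ := hF 𝔫 hn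
    have hpos : 0 < absNorm 𝔫 := Nat.pos_of_ne_zero (by rwa [Ne, absNorm_eq_zero_iff])
    refine mem_filter.2 ⟨mem_powerset.2 fun p hp => ?_, ?_⟩
    · have h1 := (hg 𝔫 h0 p).1 hp
      refine mem_primesLE.2 ⟨h1.1, (hpr 𝔫 h0 p hp).2, le_trans ?_ hz⟩
      exact_mod_cast le_of_dvd hpos (map_dvd absNorm (dvd_iff_le.2 h1.2))
    · refine le_trans ?_ hz
      have h1 : ∏ p ∈ g 𝔫, p ∣ 𝔫 := (prod_dvd_iff (hpr 𝔫 h0) 𝔫).2 fun p hp =>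
        dvd_iff_le.2 ((hg 𝔫 h0 p).1 hp).2
      have h2 := le_of_dvd hpos (map_dvd absNorm h1)
      rw [map_prod] at h2
      exact_mod_cast h2
  rw [← Finset.sum_fiberwise_of_maps_to hmem, selJ]
  refine sum_le_sum fun s hs => ?_
  have hsP : ∀ p ∈ s, p.IsPrime ∧ p ≠ ⊥ := fun p hp => by
    have := mem_primesLE.1 (mem_powerset.1 (mem_filter.1 hs).1 hp)
    exact ⟨this.1, this.2.1⟩
  have hφ : 0 ≤ (∏ p ∈ s, ((absNorm p : ℝ) - 1))⁻¹ := inv_nonneg.2 (prod_nonneg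
    fun p hp => by linarith [hone p (mem_powerset.1 (mem_filter.1 hs).1 hp)])
  rw [← ENNReal.ofReal_le_ofReal_iff hφ]
  refine le_trans ?_ (tsum_exact_le s hsP)
  rw [ENNReal.ofReal_sum_of_nonneg (fun _ _ => by positivity), ← sum_attach]
  have hE : ∀ 𝔫 : {𝔫 // 𝔫 ∈ F.filter fun 𝔫 => g 𝔫 = s}, 𝔫.1 ≠ ⊥ ∧ ∀ P : ℐ, P.IsPrime →
      (𝔫.1 ≤ P ↔ P ∈ (s : Set ℐ)) := by
    rintro ⟨𝔫, hn⟩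
    obtain ⟨hn, hgs⟩ := mem_filter.1 hn
    have h0 := (hF 𝔫 hn).1
    refine ⟨h0, fun P hP => ?_⟩
    have := hg 𝔫 h0 P
    rw [hgs] at this
    exact ⟨fun h => this.2 ⟨hP, h⟩, fun h => (this.1 h).2⟩
  have h3 : ∀ 𝔫 : ℐ, ofReal (absNorm 𝔫 : ℝ)⁻¹ = nw 1 𝔫 := fun 𝔫 => by
    rw [nw, Real.rpow_neg_one]
  simp_rw [h3]
  refine (tsum_fintype (L := SummationFilter.unconditional _)
    (fun 𝔫 : {𝔫 // 𝔫 ∈ F.filter fun 𝔫 => g 𝔫 = s} => nw 1 𝔫.1)).symm.trans_le ?_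
  exact ENNReal.tsum_comp_le_tsum_of_injective
    (f := fun 𝔫 : {𝔫 // 𝔫 ∈ F.filter fun 𝔫 => g 𝔫 = s} =>
      (⟨𝔫.1, hE 𝔫⟩ : ExactSupp (s : Set ℐ)))
    (fun a b h => Subtype.ext (by simpa using h)) (fun 𝔪 => nw 1 𝔪.1)

theorem card_squarefree_le {η : ℝ} (hη : 0 < η) {z : ℝ} (hz : 0 < z) :
    ((((primesLE K z).powerset.filter
      fun s => ∏ p ∈ s, (absNorm p : ℝ) ≤ z).card : ℕ) : ℝ) ≤
    z ^ (1 + η) * exp (2 * ∑' m : ℕ, (m : ℝ) ^ (-(1 + η))) ^ nK K := by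
  set D := (primesLE K z).powerset.filter fun s => ∏ p ∈ s, (absNorm p : ℝ) ≤ z with hD
  have hsP : ∀ s ∈ D, ∀ p ∈ s, p.IsPrime ∧ p ≠ ⊥ := fun s hs p hp => by
    have := mem_primesLE.1 (mem_powerset.1 (mem_filter.1 hs).1 hp)
    exact ⟨this.1, this.2.1⟩
  rw [← ENNReal.ofReal_le_ofReal_iff (by positivity), ENNReal.ofReal_mul (by positivity)]
  refine le_trans ?_ (mul_le_mul' le_rfl (zetaE_le (K := K) (by linarith : (1 : ℝ) < 1 + η)))
  rw [zetaE, ← ENNReal.tsum_mul_left]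
  have h1 : ofReal (D.card : ℝ) = ∑' _ : {s // s ∈ D}, (1 : ℝ≥0∞) := by
    rw [tsum_fintype]; simp
  rw [h1]
  refine le_trans ?_ (ENNReal.tsum_comp_le_tsum_of_injective
    (f := fun s : {s // s ∈ D} => (⟨∏ p ∈ s.1, p, prod_primes_ne_bot (hsP s.1 s.2)⟩ :
      ℐ₀)) (fun a b h => Subtype.ext
        (prod_primes_inj (hsP a.1 a.2) (hsP b.1 b.2) (by simpa using h))) _)
  refine tsum_le_tsum fun s => ?_
  rw [← ENNReal.ofReal_mul (by positivity), ← ENNReal.ofReal_one]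
  refine ENNReal.ofReal_le_ofReal ?_
  have hn : (absNorm (∏ p ∈ s.1, p) : ℝ) ≤ z := by
    have := (mem_filter.1 s.2).2
    rw [map_prod]; exact_mod_cast this
  have hn0 : (0 : ℝ) < absNorm (∏ p ∈ s.1, p) := by
    exact_mod_cast Nat.pos_of_ne_zero fun h => prod_primes_ne_bot (hsP s.1 s.2)
      (absNorm_eq_zero_iff.1 h)
  rw [Real.rpow_neg hn0.le, ← div_eq_mul_inv, one_le_div (by positivity)]
  exact Real.rpow_le_rpow hn0.le hn (by linarith)

section characters

variable {𝔮 : Ideal (𝓞 K)}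

lemma exists_totPos_sub_mem {𝔞 : ℐ} (h𝔞 : 𝔞 ≠ ⊥) (a : 𝓞 K) :
    ∃ x : 𝓞 K, x - a ∈ 𝔞 ∧ x ≠ 0 ∧ TotPos K x := by
  obtain ⟨x, h1, h2, h3⟩ := exists_sameSign_sub_mem (1 : 𝓜) (by simp) h𝔞 a
  exact ⟨x, h1, h2, (sameSign_one_iff x).1 h3⟩

lemma exists_coprime_sub_mem (h𝔮 : 𝔮 ≠ ⊥) {𝔟 : ℐ} {x : 𝓞 K}
    (hx : IsCoprime (span {x}) 𝔟) :
    ∃ γ : 𝓞 K, γ - x ∈ 𝔟 ∧ IsCoprime (span {γ}) 𝔮 := by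
  set F := (finite_primes_above h𝔮).toFinset with hF
  set S := F.filter fun P => x ∈ P
  set R := F.filter fun P => x ∉ P
  have hcop : IsCoprime (∏ P ∈ S, P) (𝔟 * ∏ P ∈ R, P) := by
    refine IsCoprime.prod_left fun P hP => ?_
    obtain ⟨hPF, hxP⟩ := mem_filter.1 hP
    obtain ⟨hPp, hqP⟩ := (finite_primes_above h𝔮).mem_toFinset.1 hPF
    have hP0 : P ≠ ⊥ := fun h => h𝔮 (le_bot_iff.1 (h ▸ hqP))
    have hPm := hPp.isMaximal hP0
    refine IsCoprime.mul_right ?_ (IsCoprime.prod_right fun Q hQ => ?_)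
    · rw [isCoprime_iff_sup_eq] at hx ⊢
      exact top_le_iff.1 (hx ▸ sup_le_sup_right ((span_singleton_le_iff_mem _).2 hxP) _)
    · obtain ⟨hQF, hxQ⟩ := mem_filter.1 hQ
      obtain ⟨hQp, hqQ⟩ := (finite_primes_above h𝔮).mem_toFinset.1 hQF
      have hQm := hQp.isMaximal fun h => h𝔮 (le_bot_iff.1 (h ▸ hqQ))
      exact isCoprime_iff_sup_eq.2 (hPm.coprime_of_ne hQm fun h => hxQ (h ▸ hxP))
  obtain ⟨s, hs, d, hd, hsd⟩ := Ideal.isCoprime_iff_exists.1 hcop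
  refine ⟨x + d, by simpa using mul_le_left hd, ?_⟩
  rw [isCoprime_iff_sup_eq]
  by_contra hne
  obtain ⟨P, hPm, hP⟩ := Ideal.exists_le_maximal _ hne
  have hqP : 𝔮 ≤ P := le_sup_right.trans hP
  have hxd : x + d ∈ P := hP (mem_sup_left (mem_span_singleton_self _))
  have hPF : P ∈ F := (finite_primes_above h𝔮).mem_toFinset.2 ⟨hPm.isPrime, hqP⟩
  by_cases hxP : x ∈ P
  · have hPS : P ∈ S := mem_filter.2 ⟨hPF, hxP⟩
    have h1 : s ∈ P := dvd_iff_le.1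
      (dvd_prod_of_mem (fun Q : ℐ => Q) hPS) hs
    have h2 : d ∈ P := by simpa using sub_mem hxd hxP
    exact hPm.ne_top ((Ideal.eq_top_iff_one _).2 (hsd ▸ add_mem h1 h2))
  · have hPR : P ∈ R := mem_filter.2 ⟨hPF, hxP⟩
    have h1 : d ∈ P := dvd_iff_le.1
      (dvd_prod_of_mem (fun Q : ℐ => Q) hPR) (mul_le_right hd)
    exact hxP (by simpa using sub_mem hxd h1)

lemma isCoprime_span_congr {𝔟 : ℐ} {x y : 𝓞 K} (h : x - y ∈ 𝔟)
    (hx : IsCoprime (span {x}) 𝔟) : IsCoprime (span {y}) 𝔟 := by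
  rw [PChar.isCoprime_span_iff] at hx ⊢
  rwa [← Ideal.Quotient.eq.2 h]

lemma _root_.IsCoprime.of_le_right {𝔞 𝔟 𝔠 : ℐ} (h : IsCoprime 𝔞 𝔟) (hbc : 𝔟 ≤ 𝔠) :
    IsCoprime 𝔞 𝔠 := by
  rw [isCoprime_iff_sup_eq] at h ⊢
  exact top_le_iff.1 (h ▸ sup_le_sup_left hbc _)

lemma isCoprime_top (𝔣 : ℐ) : IsCoprime (⊤ : ℐ) 𝔣 :=
  isCoprime_iff_sup_eq.2 (top_sup_eq _)

lemma isCoprime_span_of_sub_one {𝔣 : ℐ} {α : 𝓞 K} (h : α - 1 ∈ 𝔣) :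
    IsCoprime (span {α}) 𝔣 := by
  rw [PChar.isCoprime_span_iff, Ideal.Quotient.eq.2 h, map_one]
  exact isUnit_one

/-- `𝔞 𝔠 = (α)` with `α ≡ 1 (mod 𝔣)` totally positive and `𝔠` coprime to `𝔮`. -/
structure RayInv (𝔮 𝔣 𝔞 𝔠 : ℐ) (α : 𝓞 K) : Prop where
  eq : 𝔞 * 𝔠 = span {α}
  ne : α ≠ 0
  pos : TotPos K α
  one : α - 1 ∈ 𝔣
  cop : IsCoprime 𝔠 𝔮

lemma exists_rayInv (h𝔮 : 𝔮 ≠ ⊥) {𝔣 𝔞 : ℐ} (hqf : 𝔮 ≤ 𝔣) (h𝔞 : 𝔞 ≠ ⊥)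
    (hc : IsCoprime 𝔞 𝔣) : ∃ 𝔠 α, RayInv 𝔮 𝔣 𝔞 𝔠 α := by
  obtain ⟨a, ha⟩ := IsDedekindDomain.exists_sup_span_eq (mul_le_left : 𝔞 * 𝔮 ≤ 𝔞)
    (mul_ne_zero h𝔞 h𝔮)
  have haa : a ∈ 𝔞 := ha ▸ mem_sup_right (mem_span_singleton_self _)
  obtain ⟨𝔠₀, h𝔠₀⟩ := dvd_iff_le.2 ((span_singleton_le_iff_mem 𝔞).2 haa)
  have hc0 : IsCoprime 𝔠₀ 𝔮 := by
    rw [isCoprime_iff_sup_eq, sup_comm]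
    apply mul_left_cancel₀ (show 𝔞 ≠ 0 from h𝔞)
    rw [Ideal.mul_sup, ← h𝔠₀, ha, Ideal.mul_top]
  have hac : IsCoprime (span {a}) 𝔣 := h𝔠₀ ▸ hc.mul_left (hc0.of_le_right hqf)
  obtain ⟨u, hu⟩ := (PChar.isCoprime_span_iff a).1 hac
  obtain ⟨g, hg⟩ := mk_surjective (↑u⁻¹ : 𝓞 K ⧸ 𝔣)
  have hgc : IsCoprime (span {g}) 𝔣 := (PChar.isCoprime_span_iff g).2 (hg ▸ (u⁻¹).isUnit)
  obtain ⟨γ, hγ, hγc⟩ := exists_coprime_sub_mem h𝔮 hgc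
  have hγa : γ * a - 1 ∈ 𝔣 := by
    rw [← Ideal.Quotient.eq, map_mul, Ideal.Quotient.eq.2 hγ, hg, ← hu, inv_mul, map_one]
  obtain ⟨α, h1, h2, h3⟩ := exists_totPos_sub_mem (mul_ne_zero h𝔞 h𝔮 : 𝔞 * 𝔮 ≠ 0) (γ * a)
  have hα : α ∈ 𝔞 := by
    simpa using add_mem (mul_le_left h1) (Ideal.mul_mem_left _ γ haa)
  obtain ⟨𝔠, h𝔠⟩ := dvd_iff_le.2 ((span_singleton_le_iff_mem 𝔞).2 hα)
  refine ⟨𝔠, α, h𝔠.symm, h2, h3, ?_, ?_⟩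
  · simpa using add_mem (hqf (mul_le_right h1)) hγa
  · have h4 : span {γ * a} = (span {γ} * 𝔠₀) * 𝔞 := by
      rw [← span_singleton_mul_span_singleton, h𝔠₀]; ring
    rw [isCoprime_iff_sup_eq, PChar.sup_eq_sup h𝔞 (h𝔠.trans (mul_comm _ _)) h4 h1,
      ← isCoprime_iff_sup_eq]
    exact hγc.mul_left hc0

/-- `χ` is trivial on the totally positive `α ≡ 1 (mod 𝔣)` coprime to `𝔮`. -/
def TrivOn (χ : HeckeChar K 𝔮) (𝔣 : ℐ) : Prop :=
  ∀ α : 𝓞 K, α ≠ 0 → TotPos K α → α - 1 ∈ 𝔣 → IsCoprime (span {α}) 𝔮 →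
    χ.toFun (span {α}) = 1

lemma TrivOn.sup {χ : HeckeChar K 𝔮} (h𝔮 : 𝔮 ≠ ⊥) {𝔣 𝔤 : ℐ} (hf : TrivOn χ 𝔣)
    (hg : TrivOn χ 𝔤) (hqf : 𝔮 ≤ 𝔣) (hqg : 𝔮 ≤ 𝔤) : TrivOn χ (𝔣 ⊔ 𝔤) := by
  intro α hα0 hα hα1 hαc
  obtain ⟨f, hfm, g, hgm, hfg⟩ := Submodule.mem_sup.1 hα1
  have h1 : IsCoprime (span {1 + f}) (𝔣 ⊓ 𝔤) := by
    refine (IsCoprime.mul_right ?_ ?_).of_le_right Ideal.mul_le_inf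
    · exact isCoprime_span_of_sub_one (by simpa using hfm)
    · refine isCoprime_span_congr (x := α) ?_ (hαc.of_le_right hqg)
      rw [← sub_sub, ← hfg]; simpa using hgm
  obtain ⟨γ₀, h2, h3⟩ := exists_coprime_sub_mem h𝔮 h1
  obtain ⟨γ, h4, hγ0, hγ⟩ := exists_totPos_sub_mem h𝔮 γ₀
  have hγc : IsCoprime (span {γ}) 𝔮 :=
    isCoprime_span_congr (by simpa using neg_mem h4) h3
  obtain ⟨u, hu⟩ := (PChar.isCoprime_span_iff γ).1 hγc
  obtain ⟨δ₀, hδ₀⟩ := mk_surjective (↑u⁻¹ : 𝓞 K ⧸ 𝔮)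
  obtain ⟨δ, h5, hδ0, hδ⟩ := exists_totPos_sub_mem h𝔮 δ₀
  have hmk : Ideal.Quotient.mk 𝔮 δ = ↑u⁻¹ := by rw [← hδ₀]; exact Ideal.Quotient.eq.2 h5
  have hδc : IsCoprime (span {δ}) 𝔮 :=
    (PChar.isCoprime_span_iff δ).2 (hmk ▸ (u⁻¹).isUnit)
  have hγδ : γ * δ - 1 ∈ 𝔮 := by
    rw [← Ideal.Quotient.eq, map_mul, hmk, ← hu, Units.mul_inv, map_one]
  have hγf : γ - 1 ∈ 𝔣 := by
    have : γ - 1 = (γ - γ₀) + (γ₀ - (1 + f)) + f := by ring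
    rw [this]
    exact add_mem (add_mem (hqf h4) h2.1) hfm
  have hγg : γ - α ∈ 𝔤 := by
    have : γ - α = (γ - γ₀) + (γ₀ - (1 + f)) - g := by linear_combination hfg
    rw [this]
    exact sub_mem (add_mem (hqg h4) h2.2) hgm
  have e1 := hf γ hγ0 hγ hγf hγc
  have e2 := χ.ray_one' (γ * δ) (hγ.mul hδ) hγδ
  have e3 := hg (α * δ) (mul_ne_zero hα0 hδ0) (hα.mul hδ) (by
    have : α * δ - 1 = (γ * δ - 1) - (γ - α) * δ := by ring
    rw [this]
    exact sub_mem (hqg hγδ) (mul_mem_right _ _ hγg)) (by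
    rw [← span_singleton_mul_span_singleton]; exact hαc.mul_left hδc)
  rw [← span_singleton_mul_span_singleton, χ.map_mul'] at e2 e3
  rw [e1, one_mul] at e2
  rwa [e2, mul_one] at e3

lemma HeckeChar.map_top (χ : HeckeChar K 𝔮) : χ.toFun ⊤ = 1 := by
  have := χ.ray_one' 1 (fun φ => by simp) (by simp)
  rwa [Ideal.span_singleton_one] at this

lemma TrivOn.eq_of_rayInv {χ : HeckeChar K 𝔮} (h𝔮 : 𝔮 ≠ ⊥) {𝔣 𝔞 𝔠 𝔠' : ℐ} {α α' : 𝓞 K}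
    (hqf : 𝔮 ≤ 𝔣) (hf : TrivOn χ 𝔣) (h : RayInv 𝔮 𝔣 𝔞 𝔠 α) (h' : RayInv 𝔮 𝔣 𝔞 𝔠' α') :
    χ.toFun 𝔠 = χ.toFun 𝔠' := by
  have hne : 𝔠 ≠ ⊥ := by
    rintro rfl
    have := h.eq
    rw [Ideal.mul_bot, eq_comm, span_singleton_eq_bot] at this
    exact h.ne this
  have hne' : 𝔞 ≠ ⊥ := by
    rintro rfl
    have := h.eq
    rw [Ideal.bot_mul, eq_comm, span_singleton_eq_bot] at this
    exact h.ne this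
  obtain ⟨𝔡, β, hd⟩ := exists_rayInv h𝔮 le_rfl hne h.cop
  have e1 := χ.ray_one' β hd.pos hd.one
  rw [← hd.eq, χ.map_mul'] at e1
  have h1 : span {α} * (𝔠' * 𝔡) = span {α' * β} := by
    rw [← span_singleton_mul_span_singleton, ← h.eq, ← h'.eq, ← hd.eq]; ring
  obtain ⟨δ, hδ⟩ := Ideal.span_singleton_le_span_singleton.1
    (h1 ▸ mul_le_left : span {α' * β} ≤ span {α})
  have hδ0 : δ ≠ 0 := by
    rintro rfl
    exact mul_ne_zero h'.ne hd.ne (by simpa using hδ)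
  have h2 : 𝔠' * 𝔡 = span {δ} := by
    refine mul_left_cancel₀ (show span {α} ≠ 0 from ?_)
      (h1.trans (by rw [hδ, span_singleton_mul_span_singleton]))
    rw [zero_eq_bot, Ne, span_singleton_eq_bot]; exact h.ne
  have hδp : TotPos K δ := fun φ => by
    have h3 := (h'.pos.mul hd.pos) φ
    rw [hδ, map_mul, map_mul] at h3
    exact (pos_iff_pos_of_mul_pos h3).1 (h.pos φ)
  have hδ1 : δ - 1 ∈ 𝔣 := by
    have : δ - 1 = α' * (β - 1) + (α' - 1) - (α - 1) * δ := by linear_combination -hδ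
    rw [this]
    exact sub_mem (add_mem (Ideal.mul_mem_left _ _ (hqf hd.one)) h'.one)
      (mul_mem_right _ _ h.one)
  have e2 := hf δ hδ0 hδp hδ1 (h2 ▸ h'.cop.mul_left hd.cop)
  rw [← h2, χ.map_mul'] at e2
  have h4 : χ.toFun 𝔡 ≠ 0 := fun h0 => by simp [h0] at e1
  exact mul_right_cancel₀ h4 (e1.trans e2.symm)

/-- The greatest modulus of definition of `χ` exists. -/
lemma exists_greatest_trivOn (h𝔮 : 𝔮 ≠ ⊥) (χ : HeckeChar K 𝔮) : ∃ 𝔣, 𝔮 ≤ 𝔣 ∧ TrivOn χ 𝔣 ∧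
    ∀ 𝔤, 𝔮 ≤ 𝔤 → TrivOn χ 𝔤 → 𝔤 ≤ 𝔣 := by
  obtain ⟨𝔣, ⟨h1, h2⟩, h3⟩ := set_has_maximal_iff_noetherian.2 (inferInstance :
    IsNoetherian (𝓞 K) (𝓞 K)) {𝔣 : ℐ | 𝔮 ≤ 𝔣 ∧ TrivOn χ 𝔣}
    ⟨𝔮, le_rfl, fun α _ h h1 _ => χ.ray_one' α h h1⟩
  refine ⟨𝔣, h1, h2, fun 𝔤 hq hg => ?_⟩
  by_contra hle
  exact h3 (𝔣 ⊔ 𝔤) ⟨h1.trans le_sup_left, h2.sup h𝔮 hg h1 hq⟩ (left_lt_sup.2 hle)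

/-- The primitive character inducing a Hecke character. -/
theorem exists_pchar (h𝔮 : 𝔮 ≠ ⊥) (χ : HeckeChar K 𝔮) : ∃ (𝔣 : ℐ) (χ' : PChar 𝔣),
    𝔮 ≤ 𝔣 ∧ TrivOn χ 𝔣 ∧ (∀ 𝔤, 𝔮 ≤ 𝔤 → TrivOn χ 𝔤 → 𝔤 ≤ 𝔣) ∧
    (∀ 𝔞, 𝔞 ≠ ⊥ → IsCoprime 𝔞 𝔮 → χ'.toFun 𝔞 = χ.toFun 𝔞) ∧
    ∀ 𝔞 𝔠 α, IsCoprime 𝔞 𝔣 → RayInv 𝔮 𝔣 𝔞 𝔠 α → χ'.toFun 𝔞 * χ.toFun 𝔠 = 1 := by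
  obtain ⟨𝔣, hqf, hf, hmax⟩ := exists_greatest_trivOn h𝔮 χ
  have hval : ∀ 𝔞 : ℐ, ∃ z : ℂ, (𝔞 ≠ ⊥ → ¬ IsCoprime 𝔞 𝔣 → z = 0) ∧
      ∀ 𝔠 α, IsCoprime 𝔞 𝔣 → RayInv 𝔮 𝔣 𝔞 𝔠 α → z * χ.toFun 𝔠 = 1 := fun 𝔞 => by
    by_cases hc : 𝔞 ≠ ⊥ ∧ IsCoprime 𝔞 𝔣
    · obtain ⟨𝔠, α, h⟩ := exists_rayInv h𝔮 hqf hc.1 hc.2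
      refine ⟨(χ.toFun 𝔠)⁻¹, fun _ h2 => absurd hc.2 h2, fun 𝔠' α' _ h' => ?_⟩
      rw [← hf.eq_of_rayInv h𝔮 hqf h h']
      exact inv_mul_cancel₀ (norm_pos_iff.1 (by rw [χ.norm_one' _ h.cop]; exact one_pos))
    · refine ⟨0, fun _ _ => rfl, fun 𝔠 α h h' => absurd ⟨?_, h⟩ hc⟩
      rintro rfl
      have := h'.eq
      rw [Ideal.bot_mul, eq_comm, span_singleton_eq_bot] at this
      exact h'.ne this
  choose f hf0 hf1 using hval
  have hagree : ∀ 𝔞, 𝔞 ≠ ⊥ → IsCoprime 𝔞 𝔮 → f 𝔞 = χ.toFun 𝔞 := fun 𝔞 h0 hc => by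
    obtain ⟨𝔠, α, h⟩ := exists_rayInv h𝔮 hqf h0 (hc.of_le_right hqf)
    have h1 := hf1 𝔞 𝔠 α (hc.of_le_right hqf) h
    have h2 := hf α h.ne h.pos h.one (h.eq ▸ hc.mul_left h.cop)
    rw [← h.eq, χ.map_mul', ← h1] at h2
    refine (mul_right_cancel₀ (fun h3 => ?_) h2).symm
    simp [h3] at h1
  refine ⟨𝔣, ⟨f, fun 𝔞 𝔟 ha hb => ?_, hf0, fun 𝔞 h0 hc => ?_, fun α h0 hp h1 => ?_,
    fun 𝔤 hg => ?_⟩, hqf, hf, hmax, hagree, hf1⟩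
  · by_cases hc : IsCoprime 𝔞 𝔣 ∧ IsCoprime 𝔟 𝔣
    · obtain ⟨𝔠, α, h⟩ := exists_rayInv h𝔮 hqf ha hc.1
      obtain ⟨𝔡, β, h'⟩ := exists_rayInv h𝔮 hqf hb hc.2
      have e1 := hf1 _ _ _ hc.1 h
      have e2 := hf1 _ _ _ hc.2 h'
      have e3 := hf1 (𝔞 * 𝔟) (𝔠 * 𝔡) (α * β) (hc.1.mul_left hc.2) ⟨by
        rw [← span_singleton_mul_span_singleton, ← h.eq, ← h'.eq]; ring,
        mul_ne_zero h.ne h'.ne, h.pos.mul h'.pos, by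
          have : α * β - 1 = (α - 1) * β + (β - 1) := by ring
          rw [this]
          exact add_mem (mul_mem_right _ _ h.one) h'.one, h.cop.mul_left h'.cop⟩
      rw [χ.map_mul'] at e3
      linear_combination (-f (𝔞 * 𝔟)) * (e1 * f 𝔟 * χ.toFun 𝔡 + e2) + f 𝔞 * f 𝔟 * e3
    · rw [hf0 _ (mul_ne_zero ha hb) fun h => hc ⟨h.of_mul_left_left, h.of_mul_left_right⟩]
      rw [not_and_or] at hc
      rcases hc with hc | hc
      · rw [hf0 _ ha hc, zero_mul]
      · rw [hf0 _ hb hc, mul_zero]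
  · obtain ⟨𝔠, α, h⟩ := exists_rayInv h𝔮 hqf h0 hc
    have := congrArg norm (hf1 _ _ _ hc h)
    rwa [norm_mul, χ.norm_one' _ h.cop, mul_one, norm_one] at this
  · have := hf1 (span {α}) ⊤ α (isCoprime_span_of_sub_one h1)
      ⟨Ideal.mul_top _, h0, hp, h1, isCoprime_top 𝔮⟩
    rwa [χ.map_top, mul_one] at this
  · have h1 : ¬ TrivOn χ 𝔤 := fun h => (hmax 𝔤 (hqf.trans hg.le) h).not_gt hg
    rw [TrivOn] at h1
    push Not at h1
    obtain ⟨α, h2, h3, h4, h5, h6⟩ := h1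
    refine ⟨α, h2, h3, h4, h5.of_le_right hqf, ?_⟩
    rwa [hagree _ (by rwa [Ne, span_singleton_eq_bot]) h5]

end characters

section family

variable {𝔮 : Ideal (𝓞 K)}

/-- The trivial character. -/
def oneChar (𝔮 : ℐ) : HeckeChar K 𝔮 where
  toFun 𝔞 := if IsCoprime 𝔞 𝔮 then 1 else 0
  map_mul' 𝔞 𝔟 := by
    simp only [IsCoprime.mul_left_iff, ite_and, ite_mul, one_mul, zero_mul]
  eq_zero' 𝔞 h := if_neg h
  norm_one' 𝔞 h := by rw [if_pos h, norm_one]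
  ray_one' α _ h := if_pos (isCoprime_span_of_sub_one h)

/-- The product of two characters. -/
def HeckeChar.mul (χ ψ : HeckeChar K 𝔮) : HeckeChar K 𝔮 where
  toFun 𝔞 := χ.toFun 𝔞 * ψ.toFun 𝔞
  map_mul' 𝔞 𝔟 := by rw [χ.map_mul', ψ.map_mul']; ring
  eq_zero' 𝔞 h := by rw [χ.eq_zero' 𝔞 h, zero_mul]
  norm_one' 𝔞 h := by rw [norm_mul, χ.norm_one' 𝔞 h, ψ.norm_one' 𝔞 h, one_mul]
  ray_one' α h h1 := by rw [χ.ray_one' α h h1, ψ.ray_one' α h h1, one_mul]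

lemma HeckeChar.ext_coprime {χ ψ : HeckeChar K 𝔮}
    (h : ∀ 𝔞, IsCoprime 𝔞 𝔮 → χ.toFun 𝔞 = ψ.toFun 𝔞) : χ = ψ := by
  have : χ.toFun = ψ.toFun := funext fun 𝔞 => by
    by_cases hc : IsCoprime 𝔞 𝔮
    · exact h 𝔞 hc
    · rw [χ.eq_zero' _ hc, ψ.eq_zero' _ hc]
  cases χ; cases ψ; congr

lemma induces_oneChar (𝔮 : ℐ) : Induces (oneChar ⊤) (oneChar 𝔮) :=
  ⟨le_top, fun 𝔞 h => by
    simp only [oneChar]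
    rw [if_pos h, if_pos (h.of_le_right le_top)]⟩

lemma ne_bot_of_primitive {H : CongClassGroup K 𝔮} (h : IsPrimitiveCCG H) : 𝔮 ≠ ⊥ := by
  rintro rfl
  have h1 : ∀ χ : HeckeChar K (⊥ : ℐ), Induces (oneChar ⊤) χ := fun χ => by
    have : χ = oneChar ⊥ := HeckeChar.ext_coprime fun 𝔞 ha => by
      rw [isCoprime_iff_sup_eq, sup_bot_eq] at ha
      rw [ha, χ.map_top, HeckeChar.map_top]
    exact this ▸ induces_oneChar ⊥
  have h2 : (⊤ : ℐ) ≤ fH H := le_sInf fun 𝔣 ⟨χ, _, hc⟩ => hc.2 ⊤ ⟨_, h1 χ⟩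
  rw [← h] at h2
  exact bot_ne_top (top_le_iff.1 h2)

/-- The conductor (greatest modulus of definition). -/
def HeckeChar.cd (h𝔮 : 𝔮 ≠ ⊥) (χ : HeckeChar K 𝔮) : ℐ := (exists_pchar h𝔮 χ).choose

/-- The primitive character inducing `χ`. -/
def HeckeChar.pc (h𝔮 : 𝔮 ≠ ⊥) (χ : HeckeChar K 𝔮) : PChar (χ.cd h𝔮) :=
  (exists_pchar h𝔮 χ).choose_spec.choose

lemma HeckeChar.pc_spec (h𝔮 : 𝔮 ≠ ⊥) (χ : HeckeChar K 𝔮) :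
    𝔮 ≤ χ.cd h𝔮 ∧ TrivOn χ (χ.cd h𝔮) ∧ (∀ 𝔤, 𝔮 ≤ 𝔤 → TrivOn χ 𝔤 → 𝔤 ≤ χ.cd h𝔮) ∧
    (∀ 𝔞, 𝔞 ≠ ⊥ → IsCoprime 𝔞 𝔮 → (χ.pc h𝔮).toFun 𝔞 = χ.toFun 𝔞) ∧
    ∀ 𝔞 𝔠 α, IsCoprime 𝔞 (χ.cd h𝔮) → RayInv 𝔮 (χ.cd h𝔮) 𝔞 𝔠 α →
      (χ.pc h𝔮).toFun 𝔞 * χ.toFun 𝔠 = 1 :=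
  (exists_pchar h𝔮 χ).choose_spec.choose_spec

lemma le_QH (h𝔮 : 𝔮 ≠ ⊥) {H : CongClassGroup K 𝔮} {χ : HeckeChar K 𝔮} {𝔣 : ℐ}
    (hχ : CharTrivOn χ H) (h : IsConductor χ 𝔣) : absNorm 𝔣 ≤ QH H := by
  refine le_csSup ⟨absNorm 𝔮, ?_⟩ ⟨χ, 𝔣, hχ, h, rfl⟩
  rintro n ⟨χ, 𝔣, -, h, rfl⟩
  exact le_of_dvd (Nat.pos_of_ne_zero (by rwa [Ne, absNorm_eq_zero_iff]))
    (Ideal.absNorm_dvd_absNorm_of_le h.1.choose_spec.1)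

lemma one_le_QH (h𝔮 : 𝔮 ≠ ⊥) (H : CongClassGroup K 𝔮) : 1 ≤ QH H := by
  have := le_QH (𝔣 := ⊤) h𝔮 (χ := oneChar 𝔮) (H := H) (fun 𝔞 h => if_pos (H.coprime' 𝔞 h))
    ⟨⟨_, induces_oneChar 𝔮⟩, fun _ _ => le_top⟩
  rwa [absNorm_top] at this

lemma absNorm_cd_le (h𝔮 : 𝔮 ≠ ⊥) {H : CongClassGroup K 𝔮} {χ : HeckeChar K 𝔮}
    (hχ : CharTrivOn χ H) : absNorm (χ.cd h𝔮) ≤ QH H := by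
  obtain ⟨h1, -, h3, h4, -⟩ := χ.pc_spec h𝔮
  by_cases ht : χ.cd h𝔮 = ⊤
  · rw [ht, absNorm_top]; exact one_le_QH h𝔮 H
  have hb : ∀ 𝔞 : ℐ, IsCoprime 𝔞 (χ.cd h𝔮) → 𝔞 ≠ ⊥ := by
    rintro _ hc rfl
    rw [isCoprime_iff_sup_eq, bot_sup_eq] at hc
    exact ht hc
  refine le_QH h𝔮 hχ ⟨⟨⟨fun 𝔞 => if 𝔞 = ⊥ then 0 else (χ.pc h𝔮).toFun 𝔞, fun 𝔞 𝔟 => ?_,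
    fun 𝔞 hc => ?_, fun 𝔞 hc => ?_, fun α hp ha => ?_⟩, h1, fun 𝔞 hc => ?_⟩, ?_⟩
  · by_cases ha : 𝔞 = ⊥
    · simp [ha]
    by_cases hb : 𝔟 = ⊥
    · simp [hb]
    rw [if_neg (show 𝔞 * 𝔟 ≠ ⊥ from mul_ne_zero ha hb), if_neg ha, if_neg hb, (χ.pc h𝔮).map_mul_of_ne _ _ ha hb]
  · split_ifs with ha
    · rfl
    · exact (χ.pc h𝔮).eq_zero _ ha hc
  · rw [if_neg (hb 𝔞 hc)]
    exact (χ.pc h𝔮).norm_one _ (hb 𝔞 hc) hc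
  · have hne := hb _ (isCoprime_span_of_sub_one ha)
    rw [if_neg hne]
    exact (χ.pc h𝔮).ray_one α (by rwa [Ne, span_singleton_eq_bot] at hne) hp ha
  · have hne := hb _ (hc.of_le_right h1)
    exact (h4 𝔞 hne hc).symm.trans (if_neg hne).symm
  · rintro 𝔤 ⟨χ', hle, hχ'⟩
    exact h3 𝔤 hle fun α _ hp h1 hc => by rw [hχ' _ hc, χ'.ray_one' α hp h1]

lemma coset_eq {H : CongClassGroup K 𝔮} {𝔞 𝔟 : ℐ} (h : rayEquiv 𝔮 𝔞 𝔟) :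
    coset H 𝔞 = coset H 𝔟 := by
  have aux : ∀ {𝔞 𝔟 : ℐ}, rayEquiv 𝔮 𝔞 𝔟 → coset H 𝔟 ⊆ coset H 𝔞 := by
    rintro 𝔞 𝔟 ⟨α, β, hα, hβ, hα1, hβ1, he⟩ 𝔵 ⟨𝔥, hh, γ, δ, hγ, hδ, hγ1, hδ1, he'⟩
    have hm : ∀ {x y : 𝓞 K}, x - 1 ∈ 𝔮 → y - 1 ∈ 𝔮 → x * y - 1 ∈ 𝔮 := fun {x y} hx hy => by
      have : x * y - 1 = (x - 1) * y + (y - 1) := by ring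
      rw [this]
      exact add_mem (mul_mem_right _ _ hx) hy
    refine ⟨𝔥, hh, α * γ, β * δ, hα.mul hγ, hβ.mul hδ, hm hα1 hγ1, hm hβ1 hδ1, ?_⟩
    rw [← span_singleton_mul_span_singleton, ← span_singleton_mul_span_singleton]
    calc _ = span {γ} * 𝔥 * (span {α} * 𝔞) := by ring
      _ = span {β} * (span {γ} * (𝔟 * 𝔥)) := by rw [he]; ring
      _ = _ := by rw [he']; ring
  obtain ⟨α, β, hα, hβ, hα1, hβ1, he⟩ := id h
  exact (aux ⟨β, α, hβ, hα, hβ1, hα1, he.symm⟩).antisymm (aux h)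

lemma exists_span_data (h𝔮 : 𝔮 ≠ ⊥) : ∃ 𝔠 : ClassGroup (𝓞 K) → ℐ, ∀ 𝔞 (h : 𝔞 ≠ ⊥),
    IsCoprime 𝔞 𝔮 → ∃ a : 𝓞 K, a ≠ 0 ∧ IsCoprime (span {a}) 𝔮 ∧
      𝔞 * 𝔠 (mk0 ⟨𝔞, mem_nonZeroDivisors_of_ne_zero h⟩) = span {a} := by
  have : ∀ c : ClassGroup (𝓞 K), ∃ 𝔠 α, RayInv 𝔮 ⊤ (rep c) 𝔠 α := fun c =>
    exists_rayInv h𝔮 le_top (rep_ne_bot c) ((isCoprime_top _).symm)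
  choose 𝔠 α h using this
  refine ⟨𝔠, fun 𝔞 h0 hc => ?_⟩
  set c := mk0 ⟨𝔞, mem_nonZeroDivisors_of_ne_zero h0⟩ with hcdef
  have hc0 : 𝔠 c ≠ ⊥ := fun hb => by
    have := (h c).eq
    rw [hb, Ideal.mul_bot, eq_comm, span_singleton_eq_bot] at this
    exact (h c).ne this
  have h1 : mk0 (⟨𝔞, mem_nonZeroDivisors_of_ne_zero h0⟩ *
      ⟨𝔠 c, mem_nonZeroDivisors_of_ne_zero hc0⟩) = 1 := by
    rw [map_mul, ← hcdef]
    refine (congrArg (· * _) (mk0_rep c).symm).trans ?_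
    rw [← map_mul]
    refine (mk0_eq_one_iff _).2 ?_
    exact ⟨α c, (h c).eq⟩
  rw [mk0_eq_one_iff] at h1
  obtain ⟨a, ha⟩ := h1
  have ha' : 𝔞 * 𝔠 c = span {a} := ha
  refine ⟨a, ?_, ha' ▸ hc.mul_left (h c).cop, ha'⟩
  rintro rfl
  rw [Ideal.span_singleton_zero] at ha'
  exact mul_ne_zero h0 hc0 ha'

lemma finite_cosets (h𝔮 : 𝔮 ≠ ⊥) (H : CongClassGroup K 𝔮) :
    Finite {C : Set ℐ // ∃ 𝔞₀, IsCoprime 𝔞₀ 𝔮 ∧ C = coset H 𝔞₀} := by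
  have : Finite (𝓞 K ⧸ 𝔮) := Ideal.finiteQuotientOfFreeOfNeBot 𝔮 h𝔮
  obtain ⟨𝔠, h𝔠⟩ := exists_span_data h𝔮
  choose a ha0 hac ha using h𝔠
  choose r hrc hr using fun C : {C : Set ℐ // ∃ 𝔞₀, IsCoprime 𝔞₀ 𝔮 ∧ C = coset H 𝔞₀} =>
    C.2
  refine Finite.of_injective (β := Option (ClassGroup (𝓞 K) × (𝓞 K ⧸ 𝔮) ×
      Set {w : InfinitePlace K // w.IsReal}))
    (fun C => if h : r C = ⊥ then none else some
      (mk0 ⟨r C, mem_nonZeroDivisors_of_ne_zero h⟩,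
        Ideal.Quotient.mk 𝔮 (a _ h (hrc C)),
        {w | 0 < (𝓔 (a _ h (hrc C) : K)).1 w})) fun C D hCD => ?_
  refine Subtype.ext ((hr C).trans (Eq.trans ?_ (hr D).symm))
  by_cases hC : r C = ⊥
  · by_cases hD : r D = ⊥
    · rw [hC, hD]
    · simp [hC, hD] at hCD
  by_cases hD : r D = ⊥
  · simp [hC, hD] at hCD
  simp only [hC, hD, dite_false, Option.some.injEq, Prod.mk.injEq] at hCD
  obtain ⟨h1, h2, h3⟩ := hCD
  have e1 := ha _ hC (hrc C)
  have e2 := ha _ hD (hrc D)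
  rw [← h1] at e2
  have n1 := ha0 _ hC (hrc C)
  have n2 := ha0 _ hD (hrc D)
  have c1 := hac _ hC (hrc C)
  generalize a _ hC (hrc C) = x at *
  generalize a _ hD (hrc D) = y at *
  obtain ⟨u, hu⟩ := (PChar.isCoprime_span_iff x).1 c1
  obtain ⟨g, hg⟩ := mk_surjective (↑u⁻¹ : 𝓞 K ⧸ 𝔮)
  have hne : ∀ {x : 𝓞 K}, x ≠ 0 → ∀ w, (𝓔 (x : K)).1 w ≠ 0 := fun {x} hx w => by
    rw [mixedEmbedding_apply_isReal, map_ne_zero]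
    exact_mod_cast hx
  obtain ⟨z, hz1, hz0, hz⟩ := exists_sameSign_sub_mem _ (hne n1) h𝔮 g
  have hzu : Ideal.Quotient.mk 𝔮 z = ↑u⁻¹ := by rw [← hg]; exact Ideal.Quotient.eq.2 hz1
  have hmul : ∀ {x y : 𝓞 K} (w), (𝓔 ((x * y : 𝓞 K) : K)).1 w =
      (𝓔 (x : K)).1 w * (𝓔 (y : K)).1 w := fun {x y} w => by
    simp
  refine coset_eq ⟨z * y, z * x, (totPos_iff _).2 fun w => ?_, (totPos_iff _).2 fun w => ?_, ?_, ?_, ?_⟩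
  · have h4 := hz w
    have h5 : 0 < (𝓔 (x : K)).1 w ↔ 0 < (𝓔 (y : K)).1 w := by
      have := Set.ext_iff.1 h3 w
      simpa using this
    rw [hmul]
    rcases lt_or_gt_of_ne (hne n1 w) with h6 | h6
    · have h7 : (𝓔 (y : K)).1 w < 0 :=
        lt_of_le_of_ne (not_lt.1 fun h => h6.not_gt (h5.2 h)) (hne n2 w)
      exact mul_pos_of_neg_of_neg ((neg_iff_neg_of_mul_pos h4).2 h6) h7
    · exact mul_pos ((pos_iff_pos_of_mul_pos h4).2 h6) (h5.1 h6)
  · rw [hmul]; exact hz w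
  · rw [← Ideal.Quotient.eq, map_mul, ← h2, hzu, ← hu, inv_mul, map_one]
  · rw [← Ideal.Quotient.eq, map_mul, hzu, ← hu, inv_mul, map_one]
  · generalize 𝔠 (mk0 ⟨r C, _⟩) = 𝔡 at e1 e2
    refine mul_right_cancel₀ (b := 𝔡) (fun h0 => n1 ?_) ?_
    · rw [h0, mul_zero, eq_comm] at e1
      exact span_singleton_eq_bot.1 e1
    · rw [mul_assoc, e1, mul_assoc, e2, span_singleton_mul_span_singleton,
        span_singleton_mul_span_singleton]
      congr 2; ring

lemma eq_of_coset_eq {H : CongClassGroup K 𝔮} {χ : HeckeChar K 𝔮} (hχ : CharTrivOn χ H)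
    {𝔞 𝔟 : ℐ} (h : coset H 𝔞 = coset H 𝔟) : χ.toFun 𝔞 = χ.toFun 𝔟 := by
  have h1 : 𝔟 ∈ coset H 𝔟 := by
    refine ⟨span {1}, H.princ_mem' 1 (fun φ => by simp) (by simp), 1, 1, fun φ => by simp,
      fun φ => by simp, by simp, by simp, ?_⟩
    rw [Ideal.span_singleton_one, Ideal.mul_top]
  rw [← h] at h1
  obtain ⟨𝔥, hh, α, β, hα, hβ, hα1, hβ1, he⟩ := h1
  have := congrArg χ.toFun he
  rw [χ.map_mul', χ.map_mul', χ.map_mul', χ.ray_one' α hα hα1, χ.ray_one' β hβ hβ1, hχ 𝔥 hh] at this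
  simpa using this

/-- The characters trivial on `H` form a finite set of at most `h_H` elements. -/
theorem exists_family (h𝔮 : 𝔮 ≠ ⊥) (H : CongClassGroup K 𝔮) :
    ∃ G : Finset (HeckeChar K 𝔮), (∀ χ, χ ∈ G ↔ CharTrivOn χ H) ∧ G.card ≤ hH H := by
  have hfin := finite_cosets h𝔮 H
  set Cs := {C : Set ℐ // ∃ 𝔞₀, IsCoprime 𝔞₀ 𝔮 ∧ C = coset H 𝔞₀} with hCs
  let M : Submonoid ℐ :=
    { carrier := {𝔞 | IsCoprime 𝔞 𝔮}, mul_mem' := fun h h' => h.mul_left h'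
      one_mem' := by
        show IsCoprime (1 : ℐ) 𝔮
        rw [Ideal.one_eq_top]; exact isCoprime_top 𝔮 }
  let cs : M → Cs := fun 𝔞 => ⟨coset H 𝔞.1, 𝔞.1, 𝔞.2, rfl⟩
  let X := {χ : HeckeChar K 𝔮 // CharTrivOn χ H}
  let F : X → (M →* ℂ) := fun χ =>
    { toFun := fun 𝔞 => χ.1.toFun 𝔞.1, map_one' := (congrArg χ.1.toFun Ideal.one_eq_top).trans χ.1.map_top
      map_mul' := fun 𝔞 𝔟 => χ.1.map_mul' _ _ }
  have hF : Function.Injective F := fun χ ψ h =>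
    Subtype.ext (HeckeChar.ext_coprime fun 𝔞 ha => DFunLike.congr_fun h (⟨𝔞, ha⟩ : M))
  choose r hrc hr using fun C : Cs => C.2
  let g : X → Cs → ℂ := fun χ C => χ.1.toFun (r C)
  have hli : LinearIndependent ℂ g := by
    refine LinearIndependent.of_comp (funLeft ℂ ℂ cs) ?_
    have h1 : (funLeft ℂ ℂ cs : (Cs → ℂ) → (M → ℂ)) ∘ g = fun χ => (F χ : M → ℂ) := by
      funext χ 𝔞
      exact eq_of_coset_eq χ.2 (hr (cs 𝔞)).symm
    rw [h1]
    exact (linearIndependent_monoidHom M ℂ).comp F hF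
  have := ofFinite Cs
  have hX : Finite X := hli.finite
  have := ofFinite X
  refine ⟨Finset.univ.map (Function.Embedding.subtype _ : X ↪ HeckeChar K 𝔮), fun χ => ?_, ?_⟩
  · simp [X]
  · rw [card_map, card_univ, hH, ← hCs, Nat.card_eq_fintype_card]
    exact hli.fintype_card_le_finrank.trans_eq (Module.finrank_fintype_fun_eq_card ℂ)

lemma CharTrivOn.mul {H : CongClassGroup K 𝔮} {χ ψ : HeckeChar K 𝔮} (hχ : CharTrivOn χ H)
    (hψ : CharTrivOn ψ H) : CharTrivOn (χ.mul ψ) H := fun 𝔞 h => by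
  simp [HeckeChar.mul, hχ 𝔞 h, hψ 𝔞 h]

lemma HeckeChar.mul_left_injective (ψ : HeckeChar K 𝔮) :
    Function.Injective fun χ : HeckeChar K 𝔮 => χ.mul ψ := fun χ χ' h =>
  HeckeChar.ext_coprime fun 𝔞 ha => by
    have h1 : χ.toFun 𝔞 * ψ.toFun 𝔞 = χ'.toFun 𝔞 * ψ.toFun 𝔞 :=
      congrFun (congrArg HeckeChar.toFun h) 𝔞
    refine mul_right_cancel₀ (fun h0 => ?_) h1
    have := ψ.norm_one' 𝔞 ha
    simp [h0] at this

lemma sum_zero_or_card {G : Finset (HeckeChar K 𝔮)} (hG : ∀ χ ∈ G, ∀ ψ ∈ G, χ.mul ψ ∈ G)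
    (f : HeckeChar K 𝔮 → ℂ) (hf : ∀ χ ∈ G, ∀ ψ ∈ G, f (χ.mul ψ) = f χ * f ψ) :
    ∑ χ ∈ G, f χ = 0 ∨ ∑ χ ∈ G, f χ = G.card := by
  by_cases h : ∀ χ ∈ G, f χ = 1
  · right; rw [sum_congr rfl h]; simp
  left
  push Not at h
  obtain ⟨ψ, hψ, hψ1⟩ := h
  have h1 : G.image (fun χ => χ.mul ψ) = G := Finset.eq_of_subset_of_card_le
    (Finset.image_subset_iff.2 fun χ hχ => hG χ hχ ψ hψ)
    (Finset.card_image_of_injective _ ψ.mul_left_injective).ge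
  have h2 : ∑ χ ∈ G, f χ = (∑ χ ∈ G, f χ) * f ψ := by
    conv_lhs => rw [← h1]
    rw [sum_image fun _ _ _ _ h => ψ.mul_left_injective h, sum_mul]
    exact sum_congr rfl fun χ hχ => hf χ hχ ψ hψ
  have h3 : (∑ χ ∈ G, f χ) * (f ψ - 1) = 0 := by linear_combination -h2
  exact (mul_eq_zero.1 h3).resolve_right (sub_ne_zero.2 hψ1)

/-- Positivity of the twisted sums over the family. -/
theorem sum_pc_nonneg (h𝔮 : 𝔮 ≠ ⊥) {H : CongClassGroup K 𝔮} {G : Finset (HeckeChar K 𝔮)}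
    (hG : ∀ χ, χ ∈ G ↔ CharTrivOn χ H) (𝔭 : ℐ) {𝔫 : ℐ}
    (h𝔫 : 𝔫 ≠ ⊥) : ∃ r : ℝ, 0 ≤ r ∧
      ∑ χ ∈ G, (starRingEnd ℂ) (χ.toFun 𝔭) * (χ.pc h𝔮).toFun 𝔫 = r := by
  set G' := G.filter fun χ => IsCoprime 𝔫 (χ.cd h𝔮) with hG'
  have h1 : ∑ χ ∈ G, (starRingEnd ℂ) (χ.toFun 𝔭) * (χ.pc h𝔮).toFun 𝔫 =
      ∑ χ ∈ G', (starRingEnd ℂ) (χ.toFun 𝔭) * (χ.pc h𝔮).toFun 𝔫 := by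
    rw [hG', sum_filter]
    refine sum_congr rfl fun χ _ => ?_
    split_ifs with h
    · rfl
    · rw [(χ.pc h𝔮).eq_zero 𝔫 h𝔫 h, mul_zero]
  have hinf : ∀ χ ∈ G', ∀ ψ ∈ G', IsCoprime 𝔫 (χ.cd h𝔮 ⊓ ψ.cd h𝔮) := fun χ hχ ψ hψ =>
    ((mem_filter.1 hχ).2.mul_right (mem_filter.1 hψ).2).of_le_right Ideal.mul_le_inf
  have hle : ∀ χ ψ : HeckeChar K 𝔮, 𝔮 ≤ χ.cd h𝔮 ⊓ ψ.cd h𝔮 := fun χ ψ =>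
    le_inf (χ.pc_spec h𝔮).1 (ψ.pc_spec h𝔮).1
  have hcd : ∀ χ ψ : HeckeChar K 𝔮, χ.cd h𝔮 ⊓ ψ.cd h𝔮 ≤ (χ.mul ψ).cd h𝔮 := fun χ ψ =>
    ((χ.mul ψ).pc_spec h𝔮).2.2.1 _ (hle χ ψ) fun α h0 hp hα hc => by
      simp only [HeckeChar.mul]
      rw [(χ.pc_spec h𝔮).2.1 α h0 hp hα.1 hc, (ψ.pc_spec h𝔮).2.1 α h0 hp hα.2 hc, one_mul]
  have key := sum_zero_or_card (G := G') (fun χ hχ ψ hψ => mem_filter.2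
    ⟨(hG _).2 (((hG χ).1 (mem_filter.1 hχ).1).mul ((hG ψ).1 (mem_filter.1 hψ).1)),
      (hinf χ hχ ψ hψ).of_le_right (hcd χ ψ)⟩)
    (fun χ => (starRingEnd ℂ) (χ.toFun 𝔭) * (χ.pc h𝔮).toFun 𝔫) fun χ hχ ψ hψ => by
      obtain ⟨𝔠, α, h⟩ := exists_rayInv h𝔮 (hle χ ψ) h𝔫 (hinf χ hχ ψ hψ)
      have e1 := (χ.pc_spec h𝔮).2.2.2.2 𝔫 𝔠 α (mem_filter.1 hχ).2
        ⟨h.eq, h.ne, h.pos, h.one.1, h.cop⟩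
      have e2 := (ψ.pc_spec h𝔮).2.2.2.2 𝔫 𝔠 α (mem_filter.1 hψ).2
        ⟨h.eq, h.ne, h.pos, h.one.2, h.cop⟩
      have e3 := ((χ.mul ψ).pc_spec h𝔮).2.2.2.2 𝔫 𝔠 α ((hinf χ hχ ψ hψ).of_le_right (hcd χ ψ))
        ⟨h.eq, h.ne, h.pos, hcd χ ψ h.one, h.cop⟩
      have h4 : ((χ.mul ψ).pc h𝔮).toFun 𝔫 = (χ.pc h𝔮).toFun 𝔫 * (ψ.pc h𝔮).toFun 𝔫 := by
        replace e3 : ((χ.mul ψ).pc h𝔮).toFun 𝔫 * (χ.toFun 𝔠 * ψ.toFun 𝔠) = 1 := e3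
        generalize ((χ.mul ψ).pc h𝔮).toFun 𝔫 = X at *
        generalize (χ.pc h𝔮).toFun 𝔫 = Y at *
        generalize (ψ.pc h𝔮).toFun 𝔫 = Z at *
        linear_combination (-X) * (e1 * Z * ψ.toFun 𝔠 + e2) + Y * Z * e3
      beta_reduce
      rw [h4]
      simp only [HeckeChar.mul, map_mul]
      ring
  rw [h1]
  rcases key with h | h
  · exact ⟨0, le_rfl, by rw [h]; simp⟩
  · exact ⟨G'.card, by positivity, by rw [h]; simp⟩

/-- At most one character of the family is induced by the trivial one. -/
lemma pc_isTriv_unique (h𝔮 : 𝔮 ≠ ⊥) {χ ψ : HeckeChar K 𝔮} (hχ : (χ.pc h𝔮).IsTriv)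
    (hψ : (ψ.pc h𝔮).IsTriv) : χ = ψ := by
  refine HeckeChar.ext_coprime fun 𝔞 ha => ?_
  by_cases h0 : 𝔞 = ⊥
  · have ht : 𝔮 = ⊤ := by
      rwa [h0, isCoprime_iff_sup_eq, bot_sup_eq] at ha
    subst ht
    have h1 : ∀ χ : HeckeChar K (⊤ : ℐ), χ.toFun ⊥ = 1 := fun χ => by
      have h2 := χ.map_mul' ⊥ ⊥
      have h3 := χ.norm_one' ⊥ (isCoprime_top _).symm
      rw [Ideal.bot_mul] at h2
      refine (mul_right_cancel₀ (b := χ.toFun ⊥) (fun h => ?_) ((one_mul _).trans h2)).symm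
      simp [h] at h3
    rw [h0, h1, h1]
  · rw [← (χ.pc_spec h𝔮).2.2.2.1 𝔞 h0 ha, ← (ψ.pc_spec h𝔮).2.2.2.1 𝔞 h0 ha, hχ 𝔞 h0, hψ 𝔞 h0]

end family

/-- The triangle function. -/
def tri (u : ℝ) : ℝ := max 0 (1 - |u|)

/-- The Fejér kernel, the Fourier transform of `tri`. -/
def fej (s : ℝ) : ℝ := if s = 0 then 1 else 2 * (1 - Real.cos s) / s ^ 2

lemma continuous_tri : Continuous tri := by unfold tri; fun_prop

lemma tri_nonneg (u : ℝ) : 0 ≤ tri u := le_max_left _ _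

lemma tri_le_one (u : ℝ) : tri u ≤ 1 := max_le zero_le_one (by linarith [abs_nonneg u])

lemma tri_eq_zero {u : ℝ} (h : 1 ≤ |u|) : tri u = 0 := max_eq_left (by linarith)

lemma integrable_tri : Integrable tri :=
  continuous_tri.integrable_of_hasCompactSupport <| HasCompactSupport.intro
    (isCompact_Icc (a := (-1 : ℝ)) (b := 1)) fun u hu => tri_eq_zero <| by
      by_contra h
      exact hu (abs_le.1 (not_le.1 h).le)

lemma integral_tri_aux {s : ℝ} (hs : s ≠ 0) : ∫ u in (0 : ℝ)..1, (tri u : ℂ) * cexp (s * u * I) =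
    (cexp (s * I) - 1) / (s * I) ^ 2 - 1 / (s * I) := by
  have hsI : (s : ℂ) * I ≠ 0 := mul_ne_zero (by exact_mod_cast hs) I_ne_zero
  have h1 : ∀ u ∈ Set.uIcc (0 : ℝ) 1, HasDerivAt (fun u : ℝ => (1 - (u : ℂ)) * cexp (s * u * I) / (s * I) +
      cexp (s * u * I) / (s * I) ^ 2) ((tri u : ℂ) * cexp (s * u * I)) u := fun u hu => by
    rw [Set.uIcc_of_le zero_le_one] at hu
    have h2 : HasDerivAt (fun u : ℝ => cexp (s * u * I)) (cexp (s * u * I) * (s * 1 * I)) u :=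
      (((HasDerivAt.ofReal_comp (hasDerivAt_id u)).const_mul (s : ℂ)).mul_const I).cexp
    have h3 : HasDerivAt (fun u : ℝ => 1 - (u : ℂ)) (-1) u := by
      simpa using (HasDerivAt.ofReal_comp (hasDerivAt_id u)).const_sub 1
    refine (((h3.mul h2).div_const _).add (h2.div_const _)).congr_deriv ?_
    rw [tri, abs_of_nonneg hu.1, max_eq_right (by linarith [hu.2])]
    have hs' : (s : ℂ) ≠ 0 := by exact_mod_cast hs
    push_cast
    field_simp
    ring
  rw [intervalIntegral.integral_eq_sub_of_hasDerivAt h1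
    (Continuous.intervalIntegrable (by have := continuous_tri; fun_prop) _ _)]
  simp
  ring

lemma integral_tri (s : ℝ) : ∫ u : ℝ, (tri u : ℂ) * cexp (s * u * I) = fej s := by
  have hc : Continuous fun u : ℝ => (tri u : ℂ) * cexp (s * u * I) := by
    have := continuous_tri; fun_prop
  have h0 : ∫ u : ℝ, (tri u : ℂ) * cexp (s * u * I) =
      ∫ u in (-1 : ℝ)..1, (tri u : ℂ) * cexp (s * u * I) := by
    rw [intervalIntegral.integral_of_le (by norm_num), ← integral_Icc_eq_integral_Ioc]
    refine (setIntegral_eq_integral_of_forall_compl_eq_zero fun u hu => ?_).symm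
    rw [tri_eq_zero, ofReal_zero, zero_mul]
    by_contra h
    exact hu (abs_le.1 (not_le.1 h).le)
  have h1 : ∫ u in (-1 : ℝ)..0, (tri u : ℂ) * cexp (s * u * I) =
      ∫ u in (0 : ℝ)..1, (tri u : ℂ) * cexp ((-s : ℝ) * u * I) := by
    have := intervalIntegral.integral_comp_neg (a := 0) (b := 1)
      (fun u : ℝ => (tri u : ℂ) * cexp (s * u * I))
    rw [neg_zero] at this
    rw [← this]
    simp [tri]
  rw [h0, ← intervalIntegral.integral_add_adjacent_intervals (hc.intervalIntegrable _ 0)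
    (hc.intervalIntegrable _ _), h1]
  rcases eq_or_ne s 0 with rfl | hs
  · have h2 : ∫ u in (0 : ℝ)..1, (tri u : ℂ) = 1 / 2 := by
      have : ∫ u in (0 : ℝ)..1, tri u = ∫ u in (0 : ℝ)..1, (1 - u) := by
        refine intervalIntegral.integral_congr fun u hu => ?_
        rw [Set.uIcc_of_le zero_le_one] at hu
        simp only [tri]
        rw [abs_of_nonneg hu.1, max_eq_right (by linarith [hu.2])]
      rw [intervalIntegral.integral_ofReal, this,
        intervalIntegral.integral_comp_sub_left (fun u : ℝ => u)]
      norm_num [integral_id]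
    simp [h2, fej]; norm_num
  · rw [integral_tri_aux hs, integral_tri_aux (neg_ne_zero.2 hs), fej, if_neg hs]
    have hs' : (s : ℂ) ≠ 0 := by exact_mod_cast hs
    push_cast
    rw [Complex.cos, mul_pow, mul_pow, I_sq]
    field_simp
    ring

lemma fej_nonneg (s : ℝ) : 0 ≤ fej s := by
  unfold fej
  split_ifs
  · exact zero_le_one
  · have := Real.cos_le_one s
    positivity [sub_nonneg.2 this]

lemma fej_le (s : ℝ) : fej s ≤ 5 * (1 + s ^ 2)⁻¹ := by
  unfold fej
  split_ifs with h
  · norm_num [h]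
  · have h1 : 0 < s ^ 2 := by positivity
    rw [← div_eq_mul_inv, div_le_div_iff₀ h1 (by positivity)]
    have h2 := Real.one_sub_sq_div_two_le_cos (x := s)
    have h3 := Real.neg_one_le_cos s
    nlinarith

lemma half_le_fej {s : ℝ} (hs : |s| ≤ 1) : 1 / 2 ≤ fej s := by
  unfold fej
  split_ifs with h
  · norm_num
  · have h1 : 0 < s ^ 2 := by positivity
    have h2 := (abs_le.1 (Real.cos_bound hs)).2
    have h3 : s ^ 2 ≤ 1 := (sq_le_one_iff_abs_le_one s).2 hs
    have h4 : |s| ^ 4 = s ^ 2 * s ^ 2 := by rw [← sq_abs s]; ring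
    rw [h4] at h2
    rw [div_le_div_iff₀ two_pos h1]
    nlinarith

lemma measurable_fej : Measurable fej :=
  Measurable.ite (measurableSet_singleton _) measurable_const (by fun_prop)

lemma integrable_fej : Integrable fej :=
  (integrable_inv_one_add_sq.const_mul 5).mono' measurable_fej.aestronglyMeasurable
    (.of_forall fun s => by rw [norm_of_nonneg (fej_nonneg s)]; exact fej_le s)

lemma integral_fej_le : ∫ s, fej s ≤ 5 * π := by
  rw [← integral_univ_inv_one_add_sq, ← integral_const_mul]
  exact integral_mono integrable_fej (integrable_inv_one_add_sq.const_mul 5) fej_le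

/-- Fourier inversion for the triangle function. -/
lemma integral_fej_mul (l : ℝ) : ∫ s, (fej s : ℂ) * cexp (l * s * I) = 2 * π * tri l := by
  have h1 : FourierTransform.fourier (fun u : ℝ => (tri u : ℂ)) = fun x => (fej (-(2 * π * x)) : ℂ) := by
    funext x
    rw [fourier_eq', ← integral_tri]
    refine integral_congr_ae (.of_forall fun u => ?_)
    simp only [smul_eq_mul]
    rw [mul_comm]
    congr 2
    simp [RCLike.inner_apply]
    ring
  have hi : Integrable fun x : ℝ => (fej (-(2 * π * x)) : ℂ) :=
    have h : Integrable fun x : ℝ => fej (-(2 * π * x)) := by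
      simpa only [neg_mul] using integrable_fej.comp_mul_left' (R := -(2 * π)) (by simp [Real.pi_ne_zero])
    h.ofReal
  have h2 := congrFun (Continuous.fourierInv_fourier_eq (f := fun u : ℝ => (tri u : ℂ))
    (by have := continuous_tri; fun_prop) integrable_tri.ofReal (h1 ▸ hi)) (-l)
  rw [h1, Real.fourierInv_eq'] at h2
  have h3 := Measure.integral_comp_mul_left (fun s : ℝ => (fej s : ℂ) * cexp (l * s * I)) (-(2 * π))
  have h4 : tri (-l) = tri l := by simp [tri]
  have h5 : ∫ x : ℝ, (fej (-(2 * π) * x) : ℂ) * cexp (l * (-(2 * π) * x : ℝ) * I) = tri l := by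
    rw [← h4, ← h2]
    refine integral_congr_ae (.of_forall fun x => ?_)
    simp only [smul_eq_mul]
    rw [mul_comm]
    congr 2
    · simp [RCLike.inner_apply]
      ring
    · ring_nf
  rw [h5] at h3
  generalize ∫ y : ℝ, (fej y : ℂ) * cexp (l * y * I) = J at h3 ⊢
  rw [h3, abs_inv, abs_neg, abs_of_pos (by positivity), real_smul]
  push_cast
  field_simp

section shellFacts

variable {B : ℝ}

instance : SFinite (mulHaar K) := by unfold mulHaar; infer_instance

lemma kap_nonneg : 0 ≤ kap K := by
  have := cov_pos (K := K)
  unfold kap; positivity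

lemma shell_nonneg (a b u : ℝ) : 0 ≤ shell K B a b u :=
  integral_nonneg fun v => mul_nonneg (pk_nonneg B v) (indicator_nonneg (fun _ _ => zero_le_one) _)

/-- Only points of the packet, with `|log |Nv|| ≤ 2n`, matter for the shell. -/
lemma shell_eq_of (hB : 1 ≤ B) {a b u c : ℝ} (h : ∀ r : ℝ, exp (-(2 * nK K)) ≤ r →
    r ≤ exp (2 * nK K) → (Set.Icc a b).indicator (1 : ℝ → ℝ) (r / u) = c) :
    shell K B a b u = Mk K B * c := by
  rw [shell, Mk, ← integral_mul_const]
  refine integral_congr_ae (.of_forall fun v => ?_)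
  beta_reduce
  by_cases hv : pk B v = 0
  · rw [hv, zero_mul, zero_mul]
  · rw [h _ (norm_pos_of_pk_ne hB hv).1 (norm_pos_of_pk_ne hB hv).2]

lemma shell_eq (hB : 1 ≤ B) {a b u : ℝ} (hu : 0 < u) (ha : a * u ≤ exp (-(2 * nK K)))
    (hb : exp (2 * nK K) ≤ b * u) : shell K B a b u = Mk K B := by
  rw [shell_eq_of hB (c := 1) fun r h1 h2 => indicator_of_mem (mem_Icc.2
    ⟨(le_div_iff₀ hu).2 (ha.trans h1), (div_le_iff₀ hu).2 (h2.trans hb)⟩) 1, mul_one]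

lemma shell_eq_zero (hB : 1 ≤ B) {a b u : ℝ} (hu : 0 < u) (h : exp (2 * nK K) < a * u) :
    shell K B a b u = 0 := by
  rw [shell_eq_of hB (c := 0) fun r _ h2 => indicator_of_notMem
    (fun h3 => absurd ((le_div_iff₀ hu).1 h3.1) (by linarith)) 1, mul_zero]

lemma shell_le (hB : 1 ≤ B) (a b u : ℝ) : shell K B a b u ≤ Mk K B := by
  refine integral_mono_of_nonneg (.of_forall fun v => mul_nonneg (pk_nonneg B v)
    (indicator_nonneg (fun _ _ => zero_le_one) _)) (integrable_pk hB) (.of_forall fun v => ?_)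
  exact mul_le_of_le_one_right (pk_nonneg B v)
    (Set.indicator_apply_le' (fun _ => le_rfl) fun _ => zero_le_one)

lemma shell_mul {a b M u : ℝ} (hM : 0 < M) :
    shell K B a b (M * u) = shell K B (a * M) (b * M) u := by
  refine integral_congr_ae (.of_forall fun v => ?_)
  beta_reduce
  congr 1
  simp only [indicator, mem_Icc, Pi.one_apply, ← div_div, div_right_comm _ M u, le_div_iff₀ hM,
    div_le_iff₀ hM]

lemma mainT_mul (t : ℝ) {a b M : ℝ} (ha : 0 < a) (hb : 0 < b) (hM : 0 < M) :
    mainT K B t (a * M) (b * M) = (M : ℂ) ^ (t * I) * mainT K B t a b := by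
  have h1 : ∫ X in Set.Icc (log (a * M)) (log (b * M)), cexp (t * X * I) =
      (M : ℂ) ^ (t * I) * ∫ X in Set.Icc (log a) (log b), cexp (t * X * I) := by
    rw [← integral_const_mul, ← integral_indicator measurableSet_Icc,
      ← integral_indicator measurableSet_Icc, ← integral_add_right_eq_self _ (log M)]
    refine integral_congr_ae (.of_forall fun X => ?_)
    simp only [indicator, mem_Icc, Real.log_mul ha.ne' hM.ne', Real.log_mul hb.ne' hM.ne',
      add_le_add_iff_right]
    split_ifs
    · rw [cpow_eq_exp hM, ← exp_add]
      congr 1; push_cast; ring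
    · rfl
  rw [mainT, h1, mainT]
  ring

lemma mainT_zero {a b : ℝ} (hab : log a ≤ log b) :
    mainT K B 0 a b = kap K * Mk K B * (log b - log a) := by
  rw [mainT, Mk, ← integral_complex_ofReal]
  simp [hab]

/-- The mean of the main terms against the Fejér weight. -/
lemma norm_integral_mainT_le (hB : 1 ≤ B) {T : ℝ} (hT : 0 < T) (a b l : ℝ) :
    Integrable (fun u : ℝ => (tri u : ℂ) * (cexp (l * (T * u : ℝ) * I) * mainT K B (T * u) a b)) ∧
    ‖∫ u : ℝ, (tri u : ℂ) * (cexp (l * (T * u : ℝ) * I) * mainT K B (T * u) a b)‖ ≤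
      kap K * Mk K B * (5 * π / T) := by
  set ν := (mulHaar K).prod (volume.restrict (Set.Icc (log a) (log b))) with hν
  have hk : 0 ≤ kap K := kap_nonneg
  set Y : 𝓜 × ℝ → ℝ := fun p => T * (l - log (𝒩 p.1) + p.2) with hY
  have hYm : Measurable Y := by
    have : Measurable fun p : 𝓜 × ℝ => 𝒩 p.1 :=
      measurable_norm_mixed.comp measurable_fst
    fun_prop
  have hpi : Integrable (fun p : 𝓜 × ℝ => (pk B p.1 : ℂ)) ν := by
    simpa using (integrable_pk (K := K) hB).ofReal.mul_prod (integrable_const (1 : ℂ))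
  have h1 : ∀ u : ℝ, cexp (l * (T * u : ℝ) * I) * mainT K B (T * u) a b =
      kap K * ∫ p, (pk B p.1 : ℂ) * cexp (Y p * u * I) ∂ν := fun u => by
    rw [mainT, mul_assoc (kap K : ℂ), ← integral_prod_mul, mul_left_comm, ← integral_const_mul]
    congr 1
    refine integral_congr_ae (.of_forall fun p => ?_)
    beta_reduce
    rw [mul_assoc (pk B p.1 : ℂ), mul_left_comm, ← exp_add, ← exp_add]
    congr 2
    simp only [hY]; push_cast; ring
  have hj : Integrable (uncurry fun (u : ℝ) p =>
      (tri u : ℂ) * ((pk B p.1 : ℂ) * cexp (Y p * u * I))) (volume.prod ν) := by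
    have h3 : Integrable (fun q : ℝ × (𝓜 × ℝ) => (tri q.1 : ℂ) * (pk B q.2.1 : ℂ))
        (volume.prod ν) := integrable_tri.ofReal.mul_prod hpi
    refine (h3.mul_bdd (c := 1) (g := fun q => cexp (Y q.2 * q.1 * I)) ?_ ?_).congr
      (.of_forall fun q => ?_)
    · exact Measurable.aestronglyMeasurable (by
        have := hYm.comp (measurable_snd : Measurable (Prod.snd : ℝ × (𝓜 × ℝ) → _))
        fun_prop)
    · exact .of_forall fun q => by
        rw [← ofReal_mul, norm_exp_ofReal_mul_I]
    · simp only [uncurry]; ring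
  have h2 : ∫ u : ℝ, (tri u : ℂ) * (cexp (l * (T * u : ℝ) * I) * mainT K B (T * u) a b) =
      kap K * ∫ p, (pk B p.1 : ℂ) * fej (Y p) ∂ν := by
    simp only [h1, mul_left_comm (tri _ : ℂ) (kap K : ℂ)]
    rw [integral_const_mul]
    congr 1
    simp only [← integral_const_mul]
    rw [integral_integral_swap]
    · refine integral_congr_ae (.of_forall fun p => ?_)
      simp only [mul_left_comm (tri _ : ℂ) (pk B p.1 : ℂ)]
      rw [integral_const_mul, integral_tri]
    · exact hj
  have h3 : ∀ v : 𝓜, ∫ X in Set.Icc (log a) (log b), fej (Y (v, X)) ≤ 5 * π / T := by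
    intro v
    have hi := (integrable_fej.comp_mul_left' (R := T) hT.ne').comp_add_left
      (l - log (𝒩 v))
    refine (setIntegral_le_integral hi (.of_forall fun X => fej_nonneg _)).trans ?_
    rw [integral_add_left_eq_self (fun X => fej (T * X)), Measure.integral_comp_mul_left,
      abs_of_pos (inv_pos.2 hT), smul_eq_mul, ← div_eq_inv_mul]
    gcongr
    exact integral_fej_le
  have h4 : Integrable (fun p => pk B p.1 * fej (Y p)) ν := by
    refine (hpi.re.mul_bdd (c := 5) (g := fun p => fej (Y p)) ?_ ?_).congr (.of_forall fun p => ?_)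
    · exact (measurable_fej.comp hYm).aestronglyMeasurable
    · refine .of_forall fun p => ?_
      rw [norm_of_nonneg (fej_nonneg _)]
      refine (fej_le _).trans (mul_le_of_le_one_right (by norm_num) (inv_le_one_of_one_le₀ ?_))
      nlinarith
    · simp
  have h5 : ∫ p, pk B p.1 * fej (Y p) ∂ν ≤ Mk K B * (5 * π / T) := by
    rw [hν, integral_prod _ h4, Mk, ← integral_mul_const]
    refine integral_mono_of_nonneg (.of_forall fun v => ?_) ((integrable_pk hB).mul_const _)
      (.of_forall fun v => ?_)
    · exact integral_nonneg fun X => mul_nonneg (pk_nonneg B v) (fej_nonneg _)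
    · exact (integral_const_mul (pk B v) _).trans_le
        (mul_le_mul_of_nonneg_left (h3 v) (pk_nonneg B v))
  refine ⟨(hj.integral_prod_left.const_mul (kap K : ℂ)).congr (.of_forall fun u => ?_), ?_⟩
  · simp only [h1, mul_left_comm (tri _ : ℂ) (kap K : ℂ), uncurry, integral_const_mul]
  rw [h2, norm_mul, Complex.norm_real, norm_of_nonneg hk, mul_assoc]
  refine mul_le_mul_of_nonneg_left (le_trans ?_ h5) hk
  refine (norm_integral_le_integral_norm _).trans_eq (integral_congr_ae (.of_forall fun p => ?_))
  simp [abs_of_nonneg (pk_nonneg B p.1), abs_of_nonneg (fej_nonneg (Y p))]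

end shellFacts

/-- The sieve divisor sum of the weights `lam` at the ideal `𝔫`. -/
def sv (P : Finset ℐ) (lam : Finset ℐ → ℝ) (𝔫 : ℐ) : ℝ :=
  ∑ s ∈ P.powerset, if ∏ p ∈ s, p ∣ 𝔫 then lam s else 0

/-- A term of the smoothed Dirichlet series. -/
def tm {𝔣 : ℐ} (χ : PChar 𝔣) (B t a b : ℝ) (𝔫 : ℐ) : ℂ :=
  χ.toFun 𝔫 * ((absNorm 𝔫 : ℂ) ^ (-(1 + t * I)) * (shell K B a b (absNorm 𝔫) : ℂ))

lemma absNorm_pos' {𝔫 : ℐ} (h : 𝔫 ≠ ⊥) : (0 : ℝ) < absNorm 𝔫 := by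
  exact_mod_cast Nat.pos_of_ne_zero fun h0 => h (absNorm_eq_zero_iff.1 h0)

lemma norm_absNorm_cpow {𝔫 : ℐ} (h : 𝔫 ≠ ⊥) (t : ℝ) :
    ‖(absNorm 𝔫 : ℂ) ^ (-(1 + t * I))‖ = (absNorm 𝔫 : ℝ)⁻¹ := by
  rw [← ofReal_natCast, norm_cpow_eq_rpow_re_of_pos (absNorm_pos' h)]
  simp [Real.rpow_neg_one]

/-- The ideals that can contribute to a shell. -/
lemma exists_support (K : Type*) [Field K] [NumberField K] {B a : ℝ} (hB : 1 ≤ B) (ha : 0 < a) :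
    ∃ F : Finset {𝔫 : Ideal (𝓞 K) // 𝔫 ≠ ⊥},
      ∀ 𝔫, 𝔫 ∉ F → ∀ b, shell K B a b (absNorm 𝔫.1) = 0 := by
  have h1 : {𝔫 : Ideal (𝓞 K) | absNorm 𝔫 ≤ ⌊exp (2 * nK K) / a⌋₊}.Finite :=
    finite_setOfPred_absNorm_le _
  have h2 := h1.preimage (f := fun 𝔫 : {𝔫 : Ideal (𝓞 K) // 𝔫 ≠ ⊥} => 𝔫.1)
    Subtype.val_injective.injOn
  refine ⟨h2.toFinset, fun 𝔫 hn b => shell_eq_zero hB (absNorm_pos' 𝔫.2) ?_⟩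
  by_contra h
  refine hn (h2.mem_toFinset.2 (le_floor ?_))
  rw [le_div_iff₀ ha]; linarith

lemma tsum_dvd {𝔣 : ℐ} (χ : PChar 𝔣) (B t a b : ℝ) {𝔡 : ℐ} (h𝔡 : 𝔡 ≠ ⊥) :
    ∑' 𝔫 : ℐ₀, (if 𝔡 ∣ 𝔫.1 then tm χ B t a b 𝔫.1 else 0) =
      χ.toFun 𝔡 * (absNorm 𝔡 : ℂ) ^ (-(1 + t * I)) * ∑' 𝔫 : ℐ₀,
        tm χ B t (a * absNorm 𝔡) (b * absNorm 𝔡) 𝔫.1 := by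
  let g : ℐ₀ → ℐ₀ := fun 𝔪 =>
    ⟨𝔡 * 𝔪.1, show 𝔡 * 𝔪.1 ≠ ⊥ from mul_ne_zero h𝔡 𝔪.2⟩
  have hg : Function.Injective g := fun 𝔪 𝔪' h => Subtype.ext
    (mul_left_cancel₀ (a := 𝔡) h𝔡 (congrArg Subtype.val h))
  rw [← tsum_mul_left, ← hg.tsum_eq]
  · refine tsum_congr fun 𝔪 => ?_
    rw [if_pos (Dvd.intro _ rfl), tm, tm, χ.map_mul_of_ne _ _ h𝔡 𝔪.2, map_mul, cast_mul,
      cast_mul, shell_mul (absNorm_pos' h𝔡), natCast_mul_natCast_cpow]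
    ring
  · intro 𝔫 hn
    have h : 𝔡 ∣ 𝔫.1 := by by_contra h; simp [h] at hn
    obtain ⟨𝔪, hm⟩ := h
    exact ⟨⟨𝔪, fun h0 => 𝔫.2 (by rw [hm, h0, Ideal.mul_bot])⟩, Subtype.ext hm.symm⟩

lemma sv_sq {P : Finset ℐ} (hP : ∀ p ∈ P, p.IsPrime ∧ p ≠ ⊥)
    (lam : Finset ℐ → ℝ) (𝔫 : ℐ) :
    sv P lam 𝔫 ^ 2 = ∑ s ∈ P.powerset, ∑ t ∈ P.powerset,
      lam s * lam t * if ∏ p ∈ s ∪ t, p ∣ 𝔫 then 1 else 0 := by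
  rw [sq, sv, sum_mul_sum]
  refine sum_congr rfl fun s hs => sum_congr rfl fun t ht => ?_
  have hs' := fun p hp => hP p (mem_powerset.1 hs hp)
  have ht' := fun p hp => hP p (mem_powerset.1 ht hp)
  have h : (∏ p ∈ s ∪ t, p ∣ 𝔫) ↔ (∏ p ∈ s, p ∣ 𝔫) ∧ ∏ p ∈ t, p ∣ 𝔫 := by
    rw [prod_dvd_iff hs', prod_dvd_iff ht', prod_dvd_iff fun p hp =>
      (mem_union.1 hp).elim (hs' p) (ht' p)]
    simp [or_imp, forall_and]
  simp only [h]
  split_ifs <;> simp_all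

/-- The sieved smoothed sums. -/
theorem sieved_packet {η : ℝ} (hη : 0 < η) (hη' : η ≤ 1 / 8) : ∃ C : ℝ, 1 ≤ C ∧
    ∀ (K : Type) [Field K] [NumberField K] (𝔣 : Ideal (𝓞 K)) (χ : PChar 𝔣) (B t a b z : ℝ)
      (lam : Finset (Ideal (𝓞 K)) → ℝ), 𝔣 ≠ ⊥ → 1 ≤ B → |t| ≤ B ^ 2 → 0 < a → 0 < b → 1 ≤ z →
    (∀ s ∈ (primesLE K z).powerset, |lam s| ≤ 1) →
    (∀ s ∈ (primesLE K z).powerset, ¬ ∏ p ∈ s, (absNorm p : ℝ) ≤ z → lam s = 0) →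
    ‖∑' 𝔫 : {𝔫 : Ideal (𝓞 K) // 𝔫 ≠ ⊥}, (sv (primesLE K z) lam 𝔫.1 : ℂ) ^ 2 * tm χ B t a b 𝔫.1 -
      (if χ.IsTriv then mainT K B t a b * ((∑ s ∈ (primesLE K z).powerset,
        ∑ t ∈ (primesLE K z).powerset, lam s * lam t *
          (∏ p ∈ s ∪ t, (absNorm p : ℝ))⁻¹ : ℝ) : ℂ) else 0)‖ ≤
    C ^ nK K * (z ^ (1 + η)) ^ 2 * (z ^ 2) ^ η * (DK K * absNorm 𝔣) ^ (1 / 2 + η) *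
      b ^ (1 + η) * (B ^ 2) ^ (nK K * η) := by
  obtain ⟨C, hC, hpack⟩ := smooth_packet hη hη'
  set Z := exp (2 * ∑' m : ℕ, (m : ℝ) ^ (-(1 + η))) with hZ
  have hZ1 : 1 ≤ Z := Real.one_le_exp (mul_nonneg zero_le_two (tsum_nonneg fun m => by positivity))
  refine ⟨C * Z ^ 2, one_le_mul_of_one_le_of_one_le hC (one_le_pow₀ hZ1), ?_⟩
  intro K _ _ 𝔣 χ B t a b z lam h𝔣 hB ht ha hb hz hl1 hl0
  set P := primesLE K z with hP
  have hPp : ∀ p ∈ P, p.IsPrime ∧ p ≠ ⊥ := fun p hp =>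
    ⟨(mem_primesLE.1 hp).1, (mem_primesLE.1 hp).2.1⟩
  set D := P.powerset.filter fun s => ∏ p ∈ s, (absNorm p : ℝ) ≤ z with hD
  have hcard : (D.card : ℝ) ≤ z ^ (1 + η) * Z ^ nK K := card_squarefree_le hη (by linarith)
  set M : Finset (Ideal (𝓞 K)) → ℝ := fun s => ∏ p ∈ s, (absNorm p : ℝ) with hM
  set E := C ^ nK K * (z ^ 2) ^ η * (DK K * absNorm 𝔣) ^ (1 / 2 + η) *
    b ^ (1 + η) * (B ^ 2) ^ (nK K * η) with hE
  have hE0 : 0 ≤ E := by positivity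
  -- the contribution of one pair
  have hpair : ∀ s ∈ D, ∀ r ∈ D, ‖∑' 𝔫 : {𝔫 : Ideal (𝓞 K) // 𝔫 ≠ ⊥},
      (if ∏ p ∈ s ∪ r, p ∣ 𝔫.1 then tm χ B t a b 𝔫.1 else 0) -
      (if χ.IsTriv then mainT K B t a b * ((M (s ∪ r))⁻¹ : ℝ) else 0)‖ ≤ E := fun s hs r hr => by
    have hu : ∀ p ∈ s ∪ r, p ∈ P := fun p hp => (mem_union.1 hp).elim
      (fun h => mem_powerset.1 (mem_filter.1 hs).1 h)
      (fun h => mem_powerset.1 (mem_filter.1 hr).1 h)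
    have h𝔡 := prod_primes_ne_bot fun p hp => hPp p (hu p hp)
    set 𝔡 := ∏ p ∈ s ∪ r, p with h𝔡def
    have hMd : M (s ∪ r) = absNorm 𝔡 := by simp [hM, h𝔡def]
    have hd0 := absNorm_pos' h𝔡
    have hdz : (absNorm 𝔡 : ℝ) ≤ z ^ 2 := by
      rw [← hMd]
      have h1 : ∀ s ⊆ P, 1 ≤ M s := fun s hs => one_le_prod fun p hp => by
        exact_mod_cast Nat.one_le_iff_ne_zero.2 fun h => (hPp p (hs hp)).2 (absNorm_eq_zero_iff.1 h)
      have h2 : M (s ∪ r) * M (s ∩ r) = M s * M r := Finset.prod_union_inter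
      have h3 := h1 (s ∩ r) fun p hp => hu p (Finset.mem_union_left _ (Finset.mem_inter.1 hp).1)
      have h4 : 0 < M (s ∪ r) := by rw [hMd]; exact hd0
      have h5 : M s ≤ z := (mem_filter.1 hs).2
      have h6 : M r ≤ z := (mem_filter.1 hr).2
      have h7 : M s * M r ≤ z * z := mul_le_mul h5 h6
        (by have := h1 r fun p hp => hu p (Finset.mem_union_right _ hp); linarith) (by linarith)
      nlinarith
    have hp := hpack K 𝔣 χ B t (a * absNorm 𝔡) (b * absNorm 𝔡) h𝔣 hB ht
      (by positivity) (by positivity)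
    have hfac : (if χ.IsTriv then mainT K B t a b * ((M (s ∪ r))⁻¹ : ℝ) else 0) =
        χ.toFun 𝔡 * (absNorm 𝔡 : ℂ) ^ (-(1 + t * I)) * (if χ.IsTriv then
          mainT K B t (a * absNorm 𝔡) (b * absNorm 𝔡) else 0) := by
      split_ifs with hT
      · rw [hT 𝔡 h𝔡, mainT_mul t ha hb hd0, hMd, neg_add, ofReal_natCast, cpow_add _ _
          (by exact_mod_cast hd0.ne'), cpow_neg_one, one_mul, ofReal_inv, ofReal_natCast]
        have h1 : (absNorm 𝔡 : ℂ) ^ (-(t * I)) * (absNorm 𝔡 : ℂ) ^ (t * I) = 1 := by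
          rw [← cpow_add _ _ (by exact_mod_cast hd0.ne'), neg_add_cancel, cpow_zero]
        linear_combination (-(absNorm 𝔡 : ℂ)⁻¹ * mainT K B t a b) * h1
      · simp
    rw [tsum_dvd χ B t a b h𝔡, hfac, ← mul_sub, norm_mul, norm_mul, norm_absNorm_cpow h𝔡]
    calc _ ≤ 1 * (absNorm 𝔡 : ℝ)⁻¹ * (C ^ nK K * (DK K * absNorm 𝔣) ^ (1 / 2 + η) *
        (b * absNorm 𝔡) ^ (1 + η) * (B ^ 2) ^ (nK K * η)) := by
          gcongr
          · exact χ.norm_le_one h𝔡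
          · exact hp
      _ = (absNorm 𝔡 : ℝ) ^ η * (C ^ nK K * (DK K * absNorm 𝔣) ^ (1 / 2 + η) *
        b ^ (1 + η) * (B ^ 2) ^ (nK K * η)) := by
          rw [Real.mul_rpow hb.le hd0.le, add_comm 1 η, Real.rpow_add_one hd0.ne']
          field_simp
      _ ≤ (z ^ 2) ^ η * (C ^ nK K * (DK K * absNorm 𝔣) ^ (1 / 2 + η) *
        b ^ (1 + η) * (B ^ 2) ^ (nK K * η)) := by gcongr
      _ = E := by rw [hE]; ring
  -- reduce the double sums to `D`
  have hred : ∀ g : Finset (Ideal (𝓞 K)) → Finset (Ideal (𝓞 K)) → ℂ,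
      ∑ s ∈ P.powerset, ∑ r ∈ P.powerset, (lam s * lam r : ℂ) * g s r =
      ∑ s ∈ D, ∑ r ∈ D, (lam s * lam r : ℂ) * g s r := fun g => by
    have h1 : ∀ s ∈ P.powerset, s ∉ D → lam s = 0 := fun s hs hn =>
      hl0 s hs fun h => hn (mem_filter.2 ⟨hs, h⟩)
    rw [← sum_subset (show D ⊆ P.powerset from filter_subset _ _) fun s hs hn => by simp [h1 s hs hn]]
    refine sum_congr rfl fun s _ => ?_
    rw [← sum_subset (show D ⊆ P.powerset from filter_subset _ _) fun s hs hn => by simp [h1 s hs hn]]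
  obtain ⟨F, hF⟩ := exists_support K hB ha
  have htm : ∀ 𝔫 ∉ F, tm χ B t a b 𝔫.1 = 0 := fun 𝔫 hn => by simp [tm, hF 𝔫 hn b]
  have hsum : ∑' 𝔫 : {𝔫 : Ideal (𝓞 K) // 𝔫 ≠ ⊥}, (sv P lam 𝔫.1 : ℂ) ^ 2 * tm χ B t a b 𝔫.1 =
      ∑ s ∈ D, ∑ r ∈ D, (lam s * lam r : ℂ) * ∑' 𝔫 : {𝔫 : Ideal (𝓞 K) // 𝔫 ≠ ⊥},
        (if ∏ p ∈ s ∪ r, p ∣ 𝔫.1 then tm χ B t a b 𝔫.1 else 0) := by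
    rw [← hred, tsum_eq_sum (s := F) fun 𝔫 hn => by rw [htm 𝔫 hn, mul_zero]]
    have h1 : ∀ s r : Finset (Ideal (𝓞 K)), ∑' 𝔫 : {𝔫 : Ideal (𝓞 K) // 𝔫 ≠ ⊥},
        (if ∏ p ∈ s ∪ r, p ∣ 𝔫.1 then tm χ B t a b 𝔫.1 else 0) =
        ∑ 𝔫 ∈ F, (if ∏ p ∈ s ∪ r, p ∣ 𝔫.1 then tm χ B t a b 𝔫.1 else 0) := fun s r =>
      tsum_eq_sum fun 𝔫 hn => by rw [htm 𝔫 hn, ite_self]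
    simp only [h1, mul_sum]
    rw [sum_congr rfl fun s _ => sum_comm, sum_comm]
    refine sum_congr rfl fun 𝔫 _ => ?_
    rw [← ofReal_pow, sv_sq hPp, ofReal_sum, sum_mul]
    refine sum_congr rfl fun s _ => ?_
    rw [ofReal_sum, sum_mul]
    refine sum_congr rfl fun r _ => ?_
    by_cases h : ∏ p ∈ s ∪ r, p ∣ 𝔫.1
    · rw [if_pos h, if_pos h, ofReal_mul, ofReal_mul, ofReal_one, mul_one]
    · rw [if_neg h, if_neg h, mul_zero, mul_zero, ofReal_zero, zero_mul]
  have hmain : (if χ.IsTriv then mainT K B t a b * ((∑ s ∈ P.powerset, ∑ t ∈ P.powerset,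
      lam s * lam t * (∏ p ∈ s ∪ t, (absNorm p : ℝ))⁻¹ : ℝ) : ℂ) else 0) =
      ∑ s ∈ D, ∑ r ∈ D, (lam s * lam r : ℂ) *
        (if χ.IsTriv then mainT K B t a b * ((M (s ∪ r))⁻¹ : ℝ) else 0) := by
    rw [← hred]
    split_ifs
    · push_cast
      simp only [mul_sum]
      refine sum_congr rfl fun s _ => sum_congr rfl fun r _ => ?_
      simp only [hM]; push_cast; ring
    · simp
  rw [hsum, hmain, ← sum_sub_distrib]
  simp only [← sum_sub_distrib, ← mul_sub]
  calc _ ≤ ∑ s ∈ D, ∑ r ∈ D, E := by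
        refine norm_sum_le_of_le _ fun s hs => norm_sum_le_of_le _ fun r hr => ?_
        rw [norm_mul, norm_mul, norm_real, norm_real]
        have h1 := hl1 s (mem_filter.1 hs).1
        have h2 := hl1 r (mem_filter.1 hr).1
        exact (mul_le_of_le_one_left (norm_nonneg _) (mul_le_one₀ h1 (abs_nonneg _) h2)).trans
          (hpair s hs r hr)
    _ = (D.card : ℝ) ^ 2 * E := by rw [sum_const, sum_const, nsmul_eq_mul, nsmul_eq_mul]; ring
    _ ≤ (z ^ (1 + η) * Z ^ nK K) ^ 2 * E :=
      mul_le_mul_of_nonneg_right (pow_le_pow_left₀ (cast_nonneg _) hcard 2) hE0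
    _ = _ := by rw [hE, mul_pow C]; ring

/-- The sieve inequality for primes in a short interval on which the family of characters
agrees with its value at `𝔭₀`. -/
theorem sieve_raw {η : ℝ} (hη : 0 < η) (hη' : η ≤ 1 / 8) : ∃ C : ℝ, 1 ≤ C ∧
    ∀ (K : Type) [Field K] [NumberField K] (𝔮 : Ideal (𝓞 K))
      (H : CongClassGroup K 𝔮) (G : Finset (HeckeChar K 𝔮)) (𝔭₀ : Ideal (𝓞 K)) (x T z : ℝ)
      (W : Finset (Ideal (𝓞 K))), 𝔮 ≠ ⊥ → (∀ χ, χ ∈ G ↔ CharTrivOn χ H) → 0 < x → 1 ≤ T → 1 ≤ z →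
    (∀ 𝔭 ∈ W, 𝔭.IsPrime ∧ 𝔭 ≠ ⊥ ∧ IsCoprime 𝔭 𝔮 ∧ z < absNorm 𝔭 ∧
      |T * (log x - log (absNorm 𝔭))| ≤ 1 ∧
      ∑ χ ∈ G, (starRingEnd ℂ) (χ.toFun 𝔭₀) * χ.toFun 𝔭 = G.card) →
    G.card * W.card * (Mk K √T / (2 * (exp 1 * x))) ≤
      kap K * Mk K √T * (5 * π / T) *
        (selJ (primesLE K z) (fun p => (absNorm p : ℝ)) z)⁻¹ +
      G.card * (C ^ nK K * (z ^ (1 + η)) ^ 2 * (z ^ 2) ^ η * (DK K * QH H) ^ (1 / 2 + η) *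
        (exp (2 * nK K + 1) / x) ^ (1 + η) * T ^ (nK K * η)) := by
  obtain ⟨C, hC, hpack⟩ := sieved_packet hη hη'
  refine ⟨C, hC, ?_⟩
  intro K _ _ 𝔮 H G 𝔭₀ x T z W h𝔮 hG hx hT hz hW
  have hT0 : 0 < T := by linarith
  have hB : 1 ≤ √T := Real.one_le_sqrt.2 hT
  have hB2 : √T ^ 2 = T := Real.sq_sqrt hT0.le
  generalize √T = B at hB hB2 ⊢
  set N : Ideal (𝓞 K) → ℝ := fun p => (absNorm p : ℝ) with hN
  obtain ⟨hJ1, lam, hl0, hl1, hlz, hJ⟩ := selberg_weights (primesLE K z) N (fun p hp => by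
    have := mem_primesLE.1 hp
    exact Nat.one_lt_cast.2 (two_le_absNorm this.1 this.2.1)) hz
  set J := selJ (primesLE K z) N z with hJdef
  set a := exp (-(2 * nK K + 1)) / x with ha_def
  set b := exp (2 * nK K + 1) / x with hb_def
  have ha : 0 < a := by positivity
  have hb : 0 < b := by positivity
  set E := C ^ nK K * (z ^ (1 + η)) ^ 2 * (z ^ 2) ^ η * (DK K * QH H : ℝ) ^ (1 / 2 + η) *
        b ^ (1 + η) * T ^ (nK K * η) with hE
  have hE0 : 0 ≤ E := by positivity
  obtain ⟨F₀, hF₀⟩ := exists_support K hB ha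
  set l := log x with hl
  set P := primesLE K z with hP
  set c : HeckeChar K 𝔮 → ℂ := fun χ => (starRingEnd ℂ) (χ.toFun 𝔭₀) with hc
  have hc1 : ∀ χ, ‖c χ‖ ≤ 1 := fun χ => by
    rw [hc, RCLike.norm_conj]
    by_cases h : IsCoprime 𝔭₀ 𝔮
    · exact (χ.norm_one' _ h).le
    · simp [χ.eq_zero' _ h]
  choose r hr0 hr using fun 𝔫 : {𝔫 : Ideal (𝓞 K) // 𝔫 ≠ ⊥} => sum_pc_nonneg h𝔮 hG 𝔭₀ 𝔫.2
  set V : {𝔫 : Ideal (𝓞 K) // 𝔫 ≠ ⊥} → ℝ := fun 𝔫 => sv P lam 𝔫.1 ^ 2 * r 𝔫 * ((N 𝔫.1)⁻¹ *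
    shell K B a b (N 𝔫.1)) * fej (T * (l - log (N 𝔫.1))) with hV
  have hV0 : ∀ 𝔫, 0 ≤ V 𝔫 := fun 𝔫 => mul_nonneg (mul_nonneg (mul_nonneg (sq_nonneg _) (hr0 𝔫))
    (mul_nonneg (inv_nonneg.2 (cast_nonneg _)) (shell_nonneg _ _ _))) (fej_nonneg _)
  set F := F₀ ∪ W.attach.image fun 𝔭 => (⟨𝔭.1, (hW _ 𝔭.2).2.1⟩ : {𝔫 : Ideal (𝓞 K) // 𝔫 ≠ ⊥}) with hF
  set S : HeckeChar K 𝔮 → ℝ → ℂ := fun χ u => ∑ 𝔫 ∈ F, (sv P lam 𝔫.1 : ℂ) ^ 2 *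
    tm (χ.pc h𝔮) B (T * u) a b 𝔫.1 with hS
  -- each term of the integrand
  have hterm : ∀ χ u, (tri u : ℂ) * (cexp (l * (T * u : ℝ) * I) * S χ u) = ∑ 𝔫 ∈ F,
      ((sv P lam 𝔫.1 : ℂ) ^ 2 * (χ.pc h𝔮).toFun 𝔫.1 * ((N 𝔫.1)⁻¹ * shell K B a b (N 𝔫.1) : ℝ)) *
      ((tri u : ℂ) * cexp ((T * (l - log (N 𝔫.1)) : ℝ) * u * I)) := fun χ u => by
    rw [hS, mul_sum, mul_sum]
    refine sum_congr rfl fun 𝔫 _ => ?_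
    have h0 : 0 < N 𝔫.1 := absNorm_pos' 𝔫.2
    have h1 : (absNorm 𝔫.1 : ℂ) ^ (-(1 + (T * u : ℝ) * I)) * cexp (l * (T * u : ℝ) * I) =
        ((N 𝔫.1)⁻¹ : ℝ) * cexp ((T * (l - log (N 𝔫.1)) : ℝ) * u * I) := by
      have h2 : (((N 𝔫.1)⁻¹ : ℝ) : ℂ) = cexp (-(log (N 𝔫.1) : ℂ)) := by
        rw [← ofReal_neg, ← ofReal_exp, Real.exp_neg, Real.exp_log h0]
      rw [h2, ← ofReal_natCast, cpow_eq_exp h0, ← exp_add, ← exp_add]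
      congr 1
      push_cast; ring
    rw [tm, show (absNorm 𝔫.1 : ℝ) = N 𝔫.1 from rfl, ofReal_mul (N 𝔫.1)⁻¹]
    linear_combination (sv P lam 𝔫.1 : ℂ) ^ 2 * (χ.pc h𝔮).toFun 𝔫.1 *
      (shell K B a b (N 𝔫.1) : ℂ) * (tri u : ℂ) * h1
  have hint0 : ∀ s : ℝ, Integrable fun u : ℝ => (tri u : ℂ) * cexp (s * u * I) := fun s =>
    integrable_tri.ofReal.mul_bdd (c := 1) (by fun_prop) (.of_forall fun u => by
      rw [← ofReal_mul, norm_exp_ofReal_mul_I])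
  have hint : ∀ χ, Integrable fun u => (tri u : ℂ) * (cexp (l * (T * u : ℝ) * I) * S χ u) := fun χ => by
    simp only [hterm]
    exact integrable_finsetSum _ fun 𝔫 _ => (hint0 _).const_mul _
  have hsum : ((∑ 𝔫 ∈ F, V 𝔫 : ℝ) : ℂ) =
      ∑ χ ∈ G, c χ * ∫ u : ℝ, (tri u : ℂ) * (cexp (l * (T * u : ℝ) * I) * S χ u) := by
    simp only [hterm]
    have h1 : ∀ χ : HeckeChar K 𝔮, ∫ u : ℝ, ∑ 𝔫 ∈ F, ((sv P lam 𝔫.1 : ℂ) ^ 2 * (χ.pc h𝔮).toFun 𝔫.1 *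
        ((N 𝔫.1)⁻¹ * shell K B a b (N 𝔫.1) : ℝ)) *
        ((tri u : ℂ) * cexp ((T * (l - log (N 𝔫.1)) : ℝ) * u * I)) =
        ∑ 𝔫 ∈ F, ((sv P lam 𝔫.1 : ℂ) ^ 2 * (χ.pc h𝔮).toFun 𝔫.1 *
        ((N 𝔫.1)⁻¹ * shell K B a b (N 𝔫.1) : ℝ)) * fej (T * (l - log (N 𝔫.1))) := fun χ => by
      rw [integral_finsetSum _ fun 𝔫 _ => (hint0 _).const_mul _]
      refine sum_congr rfl fun 𝔫 _ => ?_
      rw [integral_const_mul, integral_tri]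
    simp only [h1, mul_sum]
    rw [sum_comm, ofReal_sum]
    refine sum_congr rfl fun 𝔫 _ => ?_
    simp only [hV]
    rw [ofReal_mul, ofReal_mul, ofReal_mul, ← hr 𝔫, mul_sum, sum_mul, sum_mul]
    refine sum_congr rfl fun χ _ => ?_
    push_cast; ring
  -- upper bound
  have hup1 : ∀ χ ∈ G, ‖∫ u : ℝ, (tri u : ℂ) * (cexp (l * (T * u : ℝ) * I) * S χ u)‖ ≤
      (if (χ.pc h𝔮).IsTriv then kap K * Mk K B * (5 * π / T) * J⁻¹ else 0) + E := by
    intro χ hχ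
    obtain ⟨hmi, hm⟩ := norm_integral_mainT_le (K := K) hB hT0 a b l
    set m : ℝ → ℂ := fun u => if (χ.pc h𝔮).IsTriv then
      ((tri u : ℂ) * (cexp (l * (T * u : ℝ) * I) * mainT K B (T * u) a b)) * (J⁻¹ : ℝ) else 0 with hmdef
    have hmi' : Integrable m := by
      rw [hmdef]
      by_cases h : (χ.pc h𝔮).IsTriv
      · simp only [if_pos h]; exact hmi.mul_const _
      · simp only [if_neg h]; exact integrable_zero _ _ _
    have hm' : ‖∫ u, m u‖ ≤ if (χ.pc h𝔮).IsTriv then kap K * Mk K B * (5 * π / T) * J⁻¹ else 0 := by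
      rw [hmdef]
      by_cases h : (χ.pc h𝔮).IsTriv
      · simp only [if_pos h]
        rw [integral_mul_const, norm_mul, norm_real, norm_of_nonneg (by positivity)]
        exact mul_le_mul_of_nonneg_right hm (by positivity)
      · simp [if_neg h]
    have hd : ‖∫ u, ((tri u : ℂ) * (cexp (l * (T * u : ℝ) * I) * S χ u) - m u)‖ ≤ E := by
      have h1 : ∀ u, ‖(tri u : ℂ) * (cexp (l * (T * u : ℝ) * I) * S χ u) - m u‖ ≤ tri u * E := fun u => by
        by_cases hu : 1 ≤ |u|
        · rw [hmdef]; simp [tri_eq_zero hu]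
        have hp := hpack K (χ.cd h𝔮) (χ.pc h𝔮) B (T * u) a b z lam
          (ne_bot_of_le_ne_bot h𝔮 (χ.pc_spec h𝔮).1) hB
          (by rw [hB2, abs_mul, abs_of_pos hT0]; nlinarith [not_le.1 hu]) ha hb hz hl1 hlz
        rw [tsum_eq_sum (s := F) fun 𝔫 hn => by
          rw [tm, hF₀ 𝔫 (fun h => hn (Finset.mem_union_left _ h)), ofReal_zero, mul_zero, mul_zero,
            mul_zero], hJ, hB2] at hp
        have h2 : (tri u : ℂ) * (cexp (l * (T * u : ℝ) * I) * S χ u) - m u = (tri u : ℂ) *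
            (cexp ((l * (T * u) : ℝ) * I) * (S χ u - if (χ.pc h𝔮).IsTriv then
              mainT K B (T * u) a b * (J⁻¹ : ℝ) else 0)) := by
          rw [hmdef]; beta_reduce
          split_ifs <;> push_cast <;> ring
        rw [h2, norm_mul, norm_mul, norm_exp_ofReal_mul_I, one_mul, norm_real,
          norm_of_nonneg (tri_nonneg u)]
        refine mul_le_mul_of_nonneg_left (hp.trans ?_) (tri_nonneg u)
        rw [hE]
        have hcd : (absNorm (χ.cd h𝔮) : ℝ) ≤ QH H := by
          exact_mod_cast absNorm_cd_le h𝔮 ((hG χ).1 hχ)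
        gcongr
      refine (norm_integral_le_of_norm_le (integrable_tri.mul_const E) (.of_forall h1)).trans_eq ?_
      have h3 : ∫ u, tri u = 1 := by
        have := integral_tri 0
        simp only [ofReal_zero, zero_mul, exp_zero, mul_one, fej, if_pos,
          integral_complex_ofReal] at this
        exact_mod_cast this
      rw [integral_mul_const, h3, one_mul]
    rw [integral_sub (hint χ) hmi'] at hd
    have := norm_le_norm_add_norm_sub' (∫ u : ℝ, (tri u : ℂ) * (cexp (l * (T * u : ℝ) * I) * S χ u))
      (∫ u, m u)
    linarith
  have hup : ∑ 𝔫 ∈ F, V 𝔫 ≤ kap K * Mk K B * (5 * π / T) * J⁻¹ + G.card * E := by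
    have hA : 0 ≤ kap K * Mk K B * (5 * π / T) * J⁻¹ := by
      have := kap_nonneg (K := K)
      have := Mk_pos (K := K) hB
      positivity
    have h1 : ‖((∑ 𝔫 ∈ F, V 𝔫 : ℝ) : ℂ)‖ ≤ ∑ χ ∈ G, ((if (χ.pc h𝔮).IsTriv then
        kap K * Mk K B * (5 * π / T) * J⁻¹ else 0) + E) := by
      rw [hsum]
      refine norm_sum_le_of_le _ fun χ hχ => ?_
      rw [norm_mul]
      exact (mul_le_of_le_one_left (norm_nonneg _) (hc1 χ)).trans (hup1 χ hχ)
    rw [norm_real, norm_of_nonneg (sum_nonneg fun 𝔫 _ => hV0 𝔫), sum_add_distrib,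
      sum_const, nsmul_eq_mul, ← sum_filter, sum_const, nsmul_eq_mul] at h1
    have h2 : (({χ ∈ G | (χ.pc h𝔮).IsTriv}).card : ℝ) ≤ 1 := by
      exact_mod_cast Finset.card_le_one.2 fun χ hχ ψ hψ =>
        pc_isTriv_unique h𝔮 (mem_filter.1 hχ).2 (mem_filter.1 hψ).2
    nlinarith
  refine le_trans ?_ hup
  -- lower bound
  have hlow : ∀ 𝔭 ∈ W.attach, (G.card : ℝ) * (Mk K B / (2 * (exp 1 * x))) ≤
      V ⟨𝔭.1, (hW _ 𝔭.2).2.1⟩ := by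
    rintro ⟨𝔭, hp⟩ -
    obtain ⟨h1, h2, h3, h4, h5, h6⟩ := hW 𝔭 hp
    have h0 : 0 < N 𝔭 := absNorm_pos' h2
    have hlog : |l - log (N 𝔭)| ≤ 1 := by
      rw [abs_mul, abs_of_pos hT0] at h5
      nlinarith [abs_nonneg (l - log (N 𝔭))]
    have hxN : x = exp l := (Real.exp_log hx).symm
    have hNe : N 𝔭 = exp (log (N 𝔭)) := (Real.exp_log h0).symm
    have hlog' := abs_le.1 hlog
    have hNx : N 𝔭 ≤ exp 1 * x := by
      rw [hNe, hxN, ← Real.exp_add]; exact exp_le_exp.2 (by linarith)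
    have hsh : shell K B a b (N 𝔭) = Mk K B := by
      refine shell_eq hB h0 ?_ ?_
      · rw [ha_def, hxN, hNe, ← Real.exp_sub, ← Real.exp_add]
        exact exp_le_exp.2 (by linarith)
      · rw [hb_def, hxN, hNe, ← Real.exp_sub, ← Real.exp_add]
        exact exp_le_exp.2 (by linarith)
    have hsv : sv P lam 𝔭 = 1 := by
      rw [sv, Finset.sum_eq_single ∅]
      · rw [prod_empty, if_pos (one_dvd _), hl0]
      · intro s hs hne
        obtain ⟨p, hps⟩ := Finset.nonempty_iff_ne_empty.2 hne
        have hpP := mem_primesLE.1 (mem_powerset.1 hs hps)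
        refine if_neg fun hd => ?_
        have hd' : p ∣ 𝔭 := (dvd_prod_of_mem (fun Q : Ideal (𝓞 K) => Q) hps).trans hd
        have : absNorm p = absNorm 𝔭 := by
          rw [(h1.isMaximal h2).eq_of_le hpP.1.ne_top (dvd_iff_le.1 hd')]
        rw [← this] at h4
        linarith [hpP.2.2]
      · exact fun h => absurd (Finset.empty_mem_powerset _) h
    have hrr : r ⟨𝔭, h2⟩ = G.card := by
      have := hr ⟨𝔭, h2⟩
      rw [sum_congr rfl fun χ _ => by rw [(χ.pc_spec h𝔮).2.2.2.1 𝔭 h2 h3], h6] at this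
      exact_mod_cast this.symm
    simp only [hV, hsv, hrr, hsh]
    have hf := half_le_fej h5
    have hM := Mk_pos (K := K) hB
    have hinv : (exp 1 * x)⁻¹ ≤ (N 𝔭)⁻¹ := inv_anti₀ h0 hNx
    calc _ = (G.card : ℝ) * ((exp 1 * x)⁻¹ * Mk K B) * (1 / 2) := by
          rw [div_eq_mul_inv, mul_inv]; ring
      _ ≤ G.card * ((N 𝔭)⁻¹ * Mk K B) * fej (T * (l - log (N 𝔭))) := by
          refine mul_le_mul (mul_le_mul_of_nonneg_left (mul_le_mul_of_nonneg_right hinv hM.le)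
            (cast_nonneg _)) hf (by norm_num) ?_
          exact mul_nonneg (cast_nonneg _) (mul_nonneg (inv_nonneg.2 h0.le) hM.le)
      _ = _ := by ring
  calc _ = ∑ 𝔭 ∈ W.attach, (G.card : ℝ) * (Mk K B / (2 * (exp 1 * x))) := by
        rw [sum_const, Finset.card_attach, nsmul_eq_mul]; ring
    _ ≤ ∑ 𝔭 ∈ W.attach, V ⟨𝔭.1, (hW _ 𝔭.2).2.1⟩ := sum_le_sum hlow
    _ = ∑ 𝔫 ∈ W.attach.image fun 𝔭 => (⟨𝔭.1, (hW _ 𝔭.2).2.1⟩ : {𝔫 : Ideal (𝓞 K) // 𝔫 ≠ ⊥}), V 𝔫 :=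
        (sum_image fun p _ q _ h => Subtype.ext (congrArg (fun s => s.1) h)).symm
    _ ≤ _ := Finset.sum_le_sum_of_subset_of_nonneg Finset.subset_union_right fun 𝔫 _ _ => hV0 𝔫

/-- The trivial primitive character. -/
def PChar.triv (K : Type*) [Field K] [NumberField K] : PChar (⊤ : Ideal (𝓞 K)) where
  toFun _ := 1
  map_mul_of_ne _ _ _ _ := (one_mul 1).symm
  eq_zero 𝔞 _ h := (h (isCoprime_top 𝔞).symm).elim
  norm_one _ _ _ := NormOneClass.norm_one
  ray_one _ _ _ _ := rfl
  prim _ h := (not_top_lt h).elim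

/-- The sieve dimension sum is large. -/
theorem selJ_lower {η : ℝ} (hη : 0 < η) (hη' : η ≤ 1 / 8) : ∃ C : ℝ, 1 ≤ C ∧
    ∀ (K : Type) [Field K] [NumberField K] (z : ℝ), 1 ≤ z →
    kap K * (log z - (2 + log (8 * C)) * nK K - (1 / 2 + η) * log (DK K)) ≤
      2 * selJ (primesLE K z) (fun p => (absNorm p : ℝ)) z := by
  obtain ⟨C, hC, hpack⟩ := smooth_packet hη hη'
  refine ⟨C, hC, fun K _ _ z hz => ?_⟩
  set J := selJ (primesLE K z) (fun p => (absNorm p : ℝ)) z with hJdef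
  have hJ1 : 1 ≤ J := (selberg_weights (primesLE K z) (fun p => (absNorm p : ℝ)) (fun p hp => by
    have := mem_primesLE.1 hp
    exact Nat.one_lt_cast.2 (two_le_absNorm this.1 this.2.1)) hz).1
  have hD : (1 : ℝ) ≤ DK K := by
    exact_mod_cast Nat.one_le_iff_ne_zero.2 (Int.natAbs_ne_zero.2 (NumberField.discr_ne_zero K))
  set b := ((8 * C) ^ nK K * (DK K : ℝ) ^ (1 / 2 + η))⁻¹ with hb
  set a := exp (2 * nK K) / z with ha
  have hDp : 1 ≤ (DK K : ℝ) ^ (1 / 2 + η) := Real.one_le_rpow hD (by positivity)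
  have hb0 : 0 < b := by positivity
  have hb1 : b ≤ 1 := inv_le_one_of_one_le₀ (one_le_mul_of_one_le_of_one_le
    (one_le_pow₀ (by linarith)) hDp)
  have hlog : log b - log a =
      log z - (2 + log (8 * C)) * nK K - (1 / 2 + η) * log (DK K) := by
    rw [hb, ha, Real.log_inv, Real.log_mul (by positivity) (by positivity), Real.log_pow,
      Real.log_rpow (by linarith), Real.log_div (by positivity) (by positivity), Real.log_exp]
    ring
  rw [← hlog]
  have hk := kap_nonneg (K := K)
  rcases le_or_gt (log b) (log a) with h | h
  · exact (mul_nonpos_of_nonneg_of_nonpos hk (by linarith)).trans (by linarith)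
  have hM := Mk_pos (K := K) le_rfl
  have hp := hpack K ⊤ (PChar.triv K) 1 0 a b top_ne_bot le_rfl (by simp) (by positivity) hb0
  rw [if_pos (show (PChar.triv K).IsTriv from fun 𝔫 _ => rfl), mainT_zero h.le] at hp
  obtain ⟨F, hF⟩ := exists_support K (B := 1) le_rfl (show 0 < a by positivity)
  have hs : ∑' 𝔫 : {𝔫 : Ideal (𝓞 K) // 𝔫 ≠ ⊥}, (PChar.triv K).toFun 𝔫.1 *
      ((absNorm 𝔫.1 : ℂ) ^ (-(1 + (0 : ℝ) * I)) * (shell K 1 a b (absNorm 𝔫.1) : ℂ)) =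
      ((∑ 𝔫 ∈ F, (absNorm 𝔫.1 : ℝ)⁻¹ * shell K 1 a b (absNorm 𝔫.1) : ℝ) : ℂ) := by
    rw [tsum_eq_sum (s := F) fun 𝔫 hn => by rw [hF 𝔫 hn, ofReal_zero, mul_zero, mul_zero], ofReal_sum]
    refine sum_congr rfl fun 𝔫 _ => ?_
    simp [PChar.triv, cpow_neg_one]
  have hup : ∑ 𝔫 ∈ F, (absNorm 𝔫.1 : ℝ)⁻¹ * shell K 1 a b (absNorm 𝔫.1) ≤ Mk K 1 * J := by
    have h1 := sum_inv_le_selJ (z := z) ((F.filter fun 𝔫 => (absNorm 𝔫.1 : ℝ) ≤ z).map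
      (Function.Embedding.subtype _)) fun 𝔫 h => by
        obtain ⟨𝔪, hm, rfl⟩ := Finset.mem_map.1 h
        exact ⟨𝔪.2, (mem_filter.1 hm).2⟩
    rw [Finset.sum_map, sum_filter] at h1
    refine le_trans ?_ (mul_le_mul_of_nonneg_left h1 hM.le)
    rw [mul_sum]
    refine sum_le_sum fun 𝔫 _ => ?_
    have h0 := absNorm_pos' 𝔫.2
    split_ifs with hz'
    · rw [mul_comm]
      exact mul_le_mul_of_nonneg_right (shell_le le_rfl _ _ _) (inv_nonneg.2 h0.le)
    · rw [shell_eq_zero le_rfl h0, mul_zero, mul_zero]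
      rw [ha, div_mul_eq_mul_div, lt_div_iff₀ (by linarith)]
      exact mul_lt_mul_of_pos_left (not_le.1 hz') (exp_pos _)
  have herr : C ^ nK K * (DK K * (absNorm (⊤ : Ideal (𝓞 K)) : ℝ)) ^ (1 / 2 + η) * b ^ (1 + η) *
      ((1 : ℝ) ^ 2) ^ (nK K * η) ≤ Mk K 1 := by
    have h1 : b ^ (1 + η) ≤ b := by
      simpa using Real.rpow_le_rpow_of_exponent_ge hb0 hb1 (show 1 ≤ 1 + η by linarith)
    rw [absNorm_top, Nat.cast_one, mul_one, one_pow, Real.one_rpow, mul_one]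
    refine (mul_le_mul_of_nonneg_left h1 (by positivity)).trans (le_trans (le_of_eq ?_) (Mk_lower le_rfl))
    rw [hb, mul_pow, inv_one, div_pow, one_pow]
    field_simp
  rw [hs, ← ofReal_sub, ← ofReal_mul, ← ofReal_mul, ← ofReal_sub, norm_real, norm_eq_abs] at hp
  have h2 := (abs_le.1 (hp.trans herr)).1
  nlinarith

/-- The choice of parameters. -/
lemma parameters {ε c : ℝ} (hε : 0 < ε) (hε1 : ε ≤ 1) (hc : 0 ≤ c) {n : ℕ} (hn : 1 ≤ n)
    {g D Q T x z : ℝ} (hg : 1 ≤ g) (hD : 1 ≤ D) (hQ : 1 ≤ Q) (hT : 1 ≤ T)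
    (hx : (g * D ^ (3 / 2 : ℝ) * Q ^ (1 / 2 : ℝ) * T ^ ((n : ℝ) / 2 + 1)) ^ (1 + ε) *
      exp (100 * (c + 4) / ε * n) ≤ x) (hz : z = D ^ (1 / 2 : ℝ) * x ^ (ε / 20)) :
    1 ≤ log x ∧ 1 ≤ z ∧ exp 1 * z < x ∧
    ε / 40 * log x ≤ log z - c * n - (1 / 2 + ε / 100) * log D ∧
    log x * (exp c ^ n * √T ^ n * T * g * ((z ^ (1 + ε / 100)) ^ 2 * (z ^ 2) ^ (ε / 100) *
      (D * Q) ^ (1 / 2 + ε / 100) * (exp (2 * n + 1) / x) ^ (1 + ε / 100) *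
      T ^ (n * (ε / 100)))) ≤ 10 / ε := by
  have hx0 : 0 < x := lt_of_lt_of_le (by positivity) hx
  have hex : ∀ {u : ℝ}, 1 ≤ u → ∃ l, 0 ≤ l ∧ u = exp l := fun h =>
    ⟨_, log_nonneg h, (Real.exp_log (by linarith)).symm⟩
  obtain ⟨lg, hlg, rfl⟩ := hex hg
  obtain ⟨ld, hld, rfl⟩ := hex hD
  obtain ⟨lq, hlq, rfl⟩ := hex hQ
  obtain ⟨lt, hlt, rfl⟩ := hex hT
  obtain ⟨lx, rfl⟩ : ∃ l, x = exp l := ⟨_, (Real.exp_log hx0).symm⟩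
  subst hz
  simp only [← Real.exp_half, ← Real.exp_mul, ← Real.exp_add, ← Real.exp_sub, ← Real.exp_nat_mul,
    Real.log_exp, exp_le_exp, Real.exp_lt_exp, Real.one_le_exp_iff] at hx ⊢
  have hn' : (1 : ℝ) ≤ n := by exact_mod_cast hn
  set M := lg + ld * (3 / 2) + lq * (1 / 2) + lt * ((n : ℝ) / 2 + 1) with hM
  have hM0 : 0 ≤ M := by positivity
  have hMd : ld * (3 / 2) ≤ M := by
    have : 0 ≤ lg + lq * (1 / 2) + lt * ((n : ℝ) / 2 + 1) := by positivity
    linarith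
  have hcn : 100 * (c + 4) * n ≤ ε * lx := by
    have : 100 * (c + 4) / ε * n ≤ lx := by nlinarith
    rw [div_mul_eq_mul_div, div_le_iff₀ hε] at this
    linarith
  have hcn0 : 0 ≤ c * n := by positivity
  have hx400 : 400 ≤ lx := by nlinarith
  have hMx : (1 + ε) * M ≤ lx := by
    have : 0 ≤ 100 * (c + 4) / ε * n := by positivity
    linarith
  have hMx' : M ≤ lx := by nlinarith
  have hεx : ε * lx ≤ lx := by nlinarith
  have hεd : ε * ld ≤ ε * lx := by nlinarith
  refine ⟨by linarith, by positivity, by linarith, by nlinarith, ?_⟩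
  have h1 : lx * (ε / 10) ≤ exp (lx * (ε / 10)) := by linarith [Real.add_one_le_exp (lx * (ε / 10))]
  have h2 : (1 + ε / 50) * M ≤ (1 - 48 / 100 * ε) * lx := by
    have : 1 + ε / 50 ≤ (1 - 48 / 100 * ε) * (1 + ε) := by nlinarith
    calc _ ≤ (1 - 48 / 100 * ε) * (1 + ε) * M := mul_le_mul_of_nonneg_right this hM0
      _ = (1 - 48 / 100 * ε) * ((1 + ε) * M) := by ring
      _ ≤ _ := mul_le_mul_of_nonneg_left hMx (by linarith)
  calc lx * exp _ ≤ 10 / ε * exp (lx * (ε / 10)) * exp (-(lx * (ε / 10))) := by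
        refine mul_le_mul ?_ (exp_le_exp.2 ?_) (exp_pos _).le (by positivity)
        · rw [div_mul_eq_mul_div, le_div_iff₀ hε]; linarith
        · push_cast
          have h3 : ε * ε * lx ≤ ε * lx := by nlinarith
          have h4 : 0 ≤ ε * lt := by positivity
          have h5 : 0 ≤ ε * lg := by positivity
          have h6 : ε * n ≤ n := by nlinarith
          rw [hM] at h2
          ring_nf at h2 ⊢
          linarith
    _ = 10 / ε := by rw [mul_assoc, ← Real.exp_add, add_neg_cancel, Real.exp_zero, mul_one]

lemma one_le_DK : (1 : ℝ) ≤ DK K := by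
  exact_mod_cast Nat.one_le_iff_ne_zero.2 (Int.natAbs_ne_zero.2 (NumberField.discr_ne_zero K))

/-- The number of primes near `x` on which the characters of the family agree with `𝔭₀`. -/
theorem sieve_count {ε : ℝ} (hε : 0 < ε) (hε1 : ε ≤ 1) : ∃ C₁ C₂ : ℝ, 0 < C₁ ∧ 0 < C₂ ∧
    ∀ (K : Type) [Field K] [NumberField K] (𝔮 : Ideal (𝓞 K))
      (H : CongClassGroup K 𝔮) (G : Finset (HeckeChar K 𝔮)) (𝔭₀ : Ideal (𝓞 K)) (x T : ℝ)
      (W : Finset (Ideal (𝓞 K))), 𝔮 ≠ ⊥ → G.Nonempty → (∀ χ, χ ∈ G ↔ CharTrivOn χ H) →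
      G.card ≤ hH H → 1 ≤ T →
    ((hH H : ℝ) * (nK K : ℝ) ^ (5 * (nK K : ℝ) / 4) * (DK K : ℝ) ^ ((3 : ℝ) / 2) *
      (QH H : ℝ) ^ ((1 : ℝ) / 2) * T ^ ((nK K : ℝ) / 2 + 1)) ^ (1 + ε) *
        exp (C₁ * (nK K : ℝ)) ≤ x →
    (∀ 𝔭 ∈ W, 𝔭.IsPrime ∧ 𝔭 ≠ ⊥ ∧ IsCoprime 𝔭 𝔮 ∧
      |T * (log x - log (absNorm 𝔭))| ≤ 1 ∧
      ∑ χ ∈ G, (starRingEnd ℂ) (χ.toFun 𝔭₀) * χ.toFun 𝔭 = G.card) →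
    1 ≤ log x ∧ G.card * W.card ≤ C₂ * (x / (T * log x)) := by
  obtain ⟨A, hA, hraw⟩ := sieve_raw (η := ε / 100) (by positivity) (by linarith)
  obtain ⟨A', hA', hlow⟩ := selJ_lower (η := ε / 100) (by positivity) (by linarith)
  have hlA : 0 ≤ log (8 * A) := log_nonneg (by linarith)
  have hlA' : 0 ≤ log (8 * A') := log_nonneg (by linarith)
  set c := 2 + log (8 * A') + log (8 * A) with hc
  refine ⟨100 * (c + 4) / ε, 2 * exp 1 * ((400 * π + 10) / ε), by positivity, by positivity, ?_⟩
  intro K _ _ 𝔮 H G 𝔭₀ x T W h𝔮 hG0 hG hGh hT hx hW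
  have hn : 1 ≤ nK K := finrank_pos
  have hn' : (1 : ℝ) ≤ nK K := by exact_mod_cast hn
  have hQ : (1 : ℝ) ≤ QH H := by exact_mod_cast one_le_QH h𝔮 H
  have hD := one_le_DK (K := K)
  have hT0 : 0 < T := by linarith
  have hg : (1 : ℝ) ≤ G.card := by exact_mod_cast hG0.card_pos
  obtain ⟨hx1, hz1, hzx, hlog, herr⟩ := parameters hε hε1 (c := c) (by positivity) hn (x := x) hg hD hQ hT
    (le_trans (by
      gcongr ?_ ^ (1 + ε) * _
      gcongr ?_ * _ * _ * _
      · calc (G.card : ℝ) ≤ hH H := by exact_mod_cast hGh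
          _ ≤ _ := le_mul_of_one_le_right (cast_nonneg _) (Real.one_le_rpow hn' (by positivity))) hx) rfl
  set z := (DK K : ℝ) ^ (1 / 2 : ℝ) * x ^ (ε / 20) with hz
  have hx0 : 0 < x := (by positivity : 0 < exp 1 * z).trans hzx
  have hL : 0 < log x := by linarith
  have hr := hraw K 𝔮 H G 𝔭₀ x T z W h𝔮 hG hx0 hT hz1 fun 𝔭 hp => by
    obtain ⟨h1, h2, h3, h4, h5⟩ := hW 𝔭 hp
    refine ⟨h1, h2, h3, ?_, h4, h5⟩
    have hN := absNorm_pos' h2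
    have h6 : log x - log (absNorm 𝔭) ≤ 1 := by
      rw [abs_mul, abs_of_pos hT0] at h4
      have := (le_mul_of_one_le_left (abs_nonneg _) hT).trans h4
      exact (le_abs_self _).trans this
    have h7 : x ≤ exp 1 * absNorm 𝔭 := by
      rw [← Real.exp_log hx0, ← Real.exp_log hN, ← Real.exp_add, exp_le_exp]
      linarith
    exact lt_of_mul_lt_mul_left (hzx.trans_le h7) (exp_pos 1).le
  have hk := kap_nonneg (K := K)
  have hB : 1 ≤ √T := Real.one_le_sqrt.2 hT
  have hM := Mk_pos (K := K) hB
  have hMl := Mk_lower (K := K) hB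
  have hl := hlow K z hz1
  have hJ1 : 1 ≤ selJ (primesLE K z) (fun p => (absNorm p : ℝ)) z :=
    (selberg_weights (primesLE K z) (fun p => (absNorm p : ℝ)) (fun p hp => by
      have := mem_primesLE.1 hp
      exact Nat.one_lt_cast.2 (two_le_absNorm this.1 this.2.1)) hz1).1
  set J := selJ (primesLE K z) (fun p => (absNorm p : ℝ)) z
  set X := (z ^ (1 + ε / 100)) ^ 2 * (z ^ 2) ^ (ε / 100) * (DK K * QH H : ℝ) ^ (1 / 2 + ε / 100) *
    (exp (2 * nK K + 1) / x) ^ (1 + ε / 100) * T ^ (nK K * (ε / 100)) with hX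
  have hX0 : 0 ≤ X := by positivity
  have hkJ : kap K * J⁻¹ ≤ 80 / ε / log x := by
    have h1 : kap K * (ε / 40 * log x) ≤ 2 * J := by
      refine le_trans (mul_le_mul_of_nonneg_left (hlog.trans ?_) hk) hl
      have : 0 ≤ log (8 * A) * nK K := by positivity
      rw [hc]; linarith
    rw [div_div, ← div_eq_mul_inv, div_le_div_iff₀ (by linarith) (by positivity)]
    linarith
  have hMi : A ^ nK K * (Mk K √T)⁻¹ ≤ exp c ^ nK K * √T ^ nK K := by
    have h1 : (Mk K √T)⁻¹ ≤ (8 * √T) ^ nK K := by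
      refine (inv_anti₀ (by positivity) hMl).trans (le_of_eq ?_)
      rw [← inv_pow]; congr 1; field_simp
    have h2 : 8 * A ≤ exp c := by
      rw [← Real.log_le_iff_le_exp (by positivity)]
      linarith
    calc A ^ nK K * (Mk K √T)⁻¹ ≤ A ^ nK K * (8 * √T) ^ nK K := by gcongr
      _ = (8 * A) ^ nK K * √T ^ nK K := by rw [← mul_pow, ← mul_pow]; ring
      _ ≤ _ := by gcongr
  have hX' : (G.card * X * (A ^ nK K * (Mk K √T)⁻¹)) ≤ 10 / ε / (T * log x) := by
    rw [le_div_iff₀ (by positivity)]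
    refine le_trans ?_ herr
    calc _ ≤ G.card * X * (exp c ^ nK K * √T ^ nK K) * (T * log x) := by gcongr
      _ = _ := by ring
  have e : (G.card * W.card : ℝ) = G.card * W.card * (Mk K √T / (2 * (exp 1 * x))) *
      ((Mk K √T)⁻¹ * (2 * (exp 1 * x))) := by
    have := hM.ne'
    have := hx0.ne'
    field_simp
  refine ⟨hx1, ?_⟩
  rw [e]
  calc _ ≤ (kap K * Mk K √T * (5 * π / T) * J⁻¹ + G.card * (A ^ nK K * X)) *
        ((Mk K √T)⁻¹ * (2 * (exp 1 * x))) := by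
        refine mul_le_mul_of_nonneg_right (hr.trans (le_of_eq ?_)) (by positivity)
        rw [hX]; ring
    _ = (kap K * J⁻¹ * (5 * π / T) + G.card * X * (A ^ nK K * (Mk K √T)⁻¹)) *
        (2 * (exp 1 * x)) := by
        linear_combination (2 * (exp 1 * x) * kap K * J⁻¹ * (5 * π / T)) *
          mul_inv_cancel₀ hM.ne'
    _ ≤ (80 / ε / log x * (5 * π / T) + 10 / ε / (T * log x)) *
        (2 * (exp 1 * x)) := by gcongr
    _ = _ := by field_simp; ring

/-- The mean square of a finite exponential sum is at most a quadratic form with kernel `tri`. -/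
lemma integral_norm_sq_le {ι : Type*} (F : Finset ι) (a : ι → ℂ) (l : ι → ℝ) {T : ℝ} (hT : 0 < T) :
    ∫ t in Set.Icc (-T) T, ‖∑ i ∈ F, a i * cexp (-t * I * l i)‖ ^ 2 ≤
      2 * (∑ i ∈ F, ∑ j ∈ F, conj (a i) * a j * (2 * π * T * tri (T * (l i - l j)) : ℝ)).re := by
  set f : ℝ → ℂ := fun t => ∑ i ∈ F, a i * cexp (-t * I * l i) with hf
  have hfc : Continuous f := by fun_prop
  have hk : Integrable fun t : ℝ => fej (t / T) := integrable_fej.comp_div hT.ne'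
  have hcexp : ∀ (s : ℝ), Integrable fun t : ℝ => (fej (t / T) : ℂ) * cexp (s * t * I) := fun s =>
    hk.ofReal.mul_bdd (c := 1) (by fun_prop) (.of_forall fun t => by
      rw [← ofReal_mul, norm_exp_ofReal_mul_I])
  have hint : ∀ s : ℝ, ∫ t : ℝ, (fej (t / T) : ℂ) * cexp (s * t * I) =
      (2 * π * T * tri (T * s) : ℝ) := fun s => by
    have h1 := Measure.integral_comp_div (fun u : ℝ => (fej u : ℂ) * cexp ((T * s : ℝ) * u * I)) T
    rw [integral_fej_mul, abs_of_pos hT] at h1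
    rw [show (fun t : ℝ => (fej (t / T) : ℂ) * cexp (s * t * I)) =
      fun t : ℝ => (fej (t / T) : ℂ) * cexp ((T * s : ℝ) * (t / T : ℝ) * I) from funext fun t => by
        rw [← ofReal_mul, ← ofReal_mul]; congr 4; field_simp, h1, real_smul]
    push_cast; ring
  have hexp : ∀ t : ℝ, ((fej (t / T) * ‖f t‖ ^ 2 : ℝ) : ℂ) = ∑ i ∈ F, ∑ j ∈ F, conj (a i) * a j *
      ((fej (t / T) : ℂ) * cexp ((l i - l j : ℝ) * t * I)) := fun t => by
    rw [ofReal_mul, ofReal_pow, ← conj_mul', hf, map_sum, sum_mul_sum, mul_sum]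
    refine sum_congr rfl fun i _ => ?_
    rw [mul_sum]
    refine sum_congr rfl fun j _ => ?_
    rw [map_mul, ← exp_conj, show ((l i - l j : ℝ) : ℂ) * t * I =
      conj (-(t : ℂ) * I * l i) + -t * I * l j by simp; ring, exp_add]
    ring
  have hsum : (∫ t, fej (t / T) * ‖f t‖ ^ 2 : ℝ) =
      (∑ i ∈ F, ∑ j ∈ F, conj (a i) * a j * (2 * π * T * tri (T * (l i - l j)) : ℝ)).re := by
    rw [← ofReal_re (∫ t, _), ← integral_complex_ofReal]
    simp_rw [hexp]
    rw [integral_finsetSum _ fun i _ => integrable_finsetSum _ fun j _ => (hcexp _).const_mul _]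
    simp_rw [integral_finsetSum F fun j _ => (hcexp _).const_mul _, integral_const_mul, hint]
  have hbd : ∀ t, ‖‖f t‖ ^ 2‖ ≤ (∑ i ∈ F, ‖a i‖) ^ 2 := fun t => by
    rw [norm_pow, norm_norm]
    gcongr
    refine (norm_sum_le _ _).trans (sum_le_sum fun i _ => ?_)
    rw [norm_mul, show -(t : ℂ) * I * l i = (-t * l i : ℝ) * I by push_cast; ring,
      norm_exp_ofReal_mul_I, mul_one]
  have hi : Integrable fun t => fej (t / T) * ‖f t‖ ^ 2 :=
    hk.mul_bdd (by fun_prop) (.of_forall hbd)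
  rw [← hsum, ← integral_const_mul]
  refine (setIntegral_mono_on (Continuous.integrableOn_Icc (by fun_prop)) (hi.const_mul 2).integrableOn
    measurableSet_Icc fun t ht => ?_).trans (setIntegral_le_integral (hi.const_mul 2)
      (.of_forall fun t => mul_nonneg two_pos.le (mul_nonneg (fej_nonneg _) (sq_nonneg _))))
  have := half_le_fej (s := t / T) (by
    rw [abs_div, abs_of_pos hT, div_le_one hT]; exact abs_le.2 ht)
  nlinarith [sq_nonneg ‖f t‖]

/-- Schur's bound for a symmetric kernel. -/
lemma schur_bound {ι : Type*} (F : Finset ι) (β r : ι → ℝ) (M : ι → ι → ℝ)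
    (hM : ∀ i j, 0 ≤ M i j) (hs : ∀ i j, M i j = M j i)
    (hr : ∀ i ∈ F, β i ≠ 0 → ∑ j ∈ F, M i j ≤ r i) :
    ∑ i ∈ F, ∑ j ∈ F, β i * β j * M i j ≤ ∑ i ∈ F, β i ^ 2 * r i := by
  have h1 : ∑ i ∈ F, ∑ j ∈ F, β i * β j * M i j ≤
      ∑ i ∈ F, ∑ j ∈ F, (β i ^ 2 / 2 * M i j + β j ^ 2 / 2 * M j i) := by
    refine sum_le_sum fun i _ => sum_le_sum fun j _ => ?_
    rw [hs j i, ← add_mul]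
    exact mul_le_mul_of_nonneg_right (by nlinarith [sq_nonneg (β i - β j)]) (hM i j)
  refine h1.trans ?_
  simp only [sum_add_distrib]
  rw [sum_comm (f := fun i j => β j ^ 2 / 2 * M j i), ← sum_add_distrib]
  refine sum_le_sum fun i hi => ?_
  rw [← mul_sum]
  by_cases h : β i = 0
  · simp [h]
  · nlinarith [mul_le_mul_of_nonneg_left (hr i hi h) (sq_nonneg (β i))]

/-- The large sieve inequality for finitely supported coefficients. -/
theorem large_sieve_finite {ε : ℝ} (hε : 0 < ε) (hε1 : ε ≤ 1) : ∃ C₁ C₂ : ℝ, 0 < C₁ ∧ 0 < C₂ ∧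
    ∀ (K : Type) [Field K] [NumberField K] (𝔮 : Ideal (𝓞 K))
      (H : CongClassGroup K 𝔮) (b : Ideal (𝓞 K) → ℂ) (y T : ℝ), 𝔮 ≠ ⊥ →
    (∀ 𝔭 : Ideal (𝓞 K), (absNorm 𝔭 : ℝ) ≤ y → b 𝔭 = 0) → 1 ≤ T →
    ((hH H : ℝ) * (nK K : ℝ) ^ (5 * (nK K : ℝ) / 4) * (DK K : ℝ) ^ ((3 : ℝ) / 2) *
      (QH H : ℝ) ^ ((1 : ℝ) / 2) * T ^ ((nK K : ℝ) / 2 + 1)) ^ (1 + ε) *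
        exp (C₁ * (nK K : ℝ)) ≤ y →
    ∀ (S : Finset (HeckeChar K 𝔮)) (F : Finset {I : Ideal (𝓞 K) // I.IsPrime ∧ I ≠ ⊥}),
      S.Nonempty → (∀ χ ∈ S, CharTrivOn χ H) → 0 < log y ∧
      ∑ χ ∈ S, ∫ t in Set.Icc (-T) T, ‖∑ 𝔭 ∈ F, b 𝔭.1 * χ.toFun 𝔭.1 *
        (absNorm 𝔭.1 : ℂ) ^ (-(t : ℂ) * Complex.I)‖ ^ 2 ≤
      C₂ / log y * ∑ 𝔭 ∈ F, (absNorm 𝔭.1 : ℝ) * ‖b 𝔭.1‖ ^ 2 := by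
  obtain ⟨C₁, C₂, h₁, h₂, hsc⟩ := sieve_count hε hε1
  refine ⟨C₁, 4 * π * C₂, h₁, by positivity, ?_⟩
  intro K _ _ 𝔮 H b y T h𝔮 hby hT hy S F ⟨χ₀, hχ₀⟩ hS
  obtain ⟨G, hG, hGc⟩ := exists_family h𝔮 H
  have hG0 : G.Nonempty := ⟨χ₀, (hG _).2 (hS _ hχ₀)⟩
  have hSG : S ⊆ G := fun χ h => (hG χ).2 (hS χ h)
  have hmul : ∀ χ ∈ G, ∀ ψ ∈ G, χ.mul ψ ∈ G := fun χ h ψ h' =>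
    (hG _).2 (((hG _).1 h).mul ((hG _).1 h'))
  have hT0 : 0 < T := by linarith
  have hy1 : 1 ≤ log y := (hsc K 𝔮 H G ⊥ y T ∅ h𝔮 hG0 hG hGc hT hy (by simp)).1
  have hy0 : 0 < y := lt_of_lt_of_le (by
    have : 0 < hH H := hG0.card_pos.trans_le hGc
    have := one_le_QH h𝔮 H
    have : 0 < nK K := finrank_pos
    have := one_le_DK (K := K)
    positivity) hy
  refine ⟨by linarith, ?_⟩
  set N : {I : Ideal (𝓞 K) // I.IsPrime ∧ I ≠ ⊥} → ℝ := fun p => (absNorm p.1 : ℝ) with hN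
  set s : {I : Ideal (𝓞 K) // I.IsPrime ∧ I ≠ ⊥} → {I : Ideal (𝓞 K) // I.IsPrime ∧ I ≠ ⊥} → ℂ :=
    fun i j => ∑ χ ∈ G, conj (χ.toFun i.1) * χ.toFun j.1 with hs
  set M : {I : Ideal (𝓞 K) // I.IsPrime ∧ I ≠ ⊥} → {I : Ideal (𝓞 K) // I.IsPrime ∧ I ≠ ⊥} → ℝ :=
    fun i j => 2 * π * T * tri (T * (log (N i) - log (N j))) * ‖s i j‖ with hM
  have hM0 : ∀ i j, 0 ≤ M i j := fun i j => by
    have := tri_nonneg (T * (log (N i) - log (N j)))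
    positivity
  have hsym : ∀ i j, M i j = M j i := fun i j => by
    have h1 : s i j = conj (s j i) := by
      simp only [hs, map_sum, map_mul, conj_conj, mul_comm]
    simp only [hM, h1, RCLike.norm_conj]
    rw [show tri (T * (log (N i) - log (N j))) = tri (T * (log (N j) - log (N i))) by
      rw [tri, tri, ← abs_neg]; congr 3; ring]
  have hrow : ∀ i ∈ F, ‖b i.1‖ ≠ 0 → ∑ j ∈ F, M i j ≤
      2 * π * T * (C₂ * (N i / (T * log y))) := fun i _ hbi => by
    have hyi : y ≤ N i := by
      by_contra h
      exact hbi (by rw [hby _ (not_le.1 h).le, norm_zero])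
    set W := F.filter fun j => IsCoprime j.1 𝔮 ∧
      |T * (log (N i) - log (N j))| ≤ 1 ∧ s i j = G.card with hW
    have hc := (hsc K 𝔮 H G i.1 (N i) T (W.map (Function.Embedding.subtype _)) h𝔮 hG0 hG hGc hT
      (hy.trans hyi) fun 𝔭 h => by
        obtain ⟨j, hj, rfl⟩ := Finset.mem_map.1 h
        obtain ⟨-, h1, h2, h3⟩ := mem_filter.1 hj
        exact ⟨j.2.1, j.2.2, h1, h2, h3⟩).2
    rw [card_map] at hc
    calc ∑ j ∈ F, M i j ≤ ∑ j ∈ F, if j ∈ W then 2 * π * T * G.card else 0 := by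
          refine sum_le_sum fun j hj => ?_
          split_ifs with h
          · have h3 := (mem_filter.1 h).2.2.2
            simp only [hM, h3, norm_natCast]
            have := tri_le_one (T * (log (N i) - log (N j)))
            exact mul_le_mul_of_nonneg_right (mul_le_of_le_one_right (by positivity) this)
              (cast_nonneg _)
          · refine le_of_eq ?_
            simp only [hW, mem_filter, not_and] at h
            simp only [hM, mul_eq_zero, norm_eq_zero]
            by_cases h1 : IsCoprime j.1 𝔮
            · by_cases h2 : |T * (log (N i) - log (N j))| ≤ 1
              · exact Or.inr ((sum_zero_or_card hmul (fun χ => conj (χ.toFun i.1) * χ.toFun j.1)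
                  fun χ _ ψ _ => by simp only [HeckeChar.mul, map_mul]; ring).resolve_right (h hj h1 h2))
              · exact Or.inl (Or.inr (tri_eq_zero (not_le.1 h2).le))
            · exact Or.inr (sum_eq_zero fun χ _ => by rw [χ.eq_zero' _ h1, mul_zero])
      _ = 2 * π * T * (G.card * W.card) := by
          rw [Finset.sum_ite_mem, Finset.inter_eq_right.2 (filter_subset _ _), sum_const,
            nsmul_eq_mul]
          ring
      _ ≤ 2 * π * T * (C₂ * (N i / (T * log (N i)))) := by gcongr
      _ ≤ _ := by
          have := Real.log_le_log hy0 hyi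
          have : 0 ≤ N i := cast_nonneg _
          gcongr
  have hpt : ∀ (χ : HeckeChar K 𝔮), ∫ t in Set.Icc (-T) T, ‖∑ 𝔭 ∈ F, b 𝔭.1 * χ.toFun 𝔭.1 *
        (absNorm 𝔭.1 : ℂ) ^ (-(t : ℂ) * Complex.I)‖ ^ 2 ≤
      2 * (∑ i ∈ F, ∑ j ∈ F, conj (b i.1 * χ.toFun i.1) * (b j.1 * χ.toFun j.1) *
        (2 * π * T * tri (T * (log (N i) - log (N j))) : ℝ)).re := fun χ => by
    refine le_trans (le_of_eq ?_) (integral_norm_sq_le F (fun i => b i.1 * χ.toFun i.1)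
      (fun i => log (N i)) hT0)
    congr 1; funext t; congr 2
    refine sum_congr rfl fun i _ => ?_
    rw [← cpow_eq_exp (absNorm_pos' i.2.2), ofReal_natCast]
  calc _ ≤ ∑ χ ∈ G, ∫ t in Set.Icc (-T) T, ‖∑ 𝔭 ∈ F, b 𝔭.1 * χ.toFun 𝔭.1 *
        (absNorm 𝔭.1 : ℂ) ^ (-(t : ℂ) * Complex.I)‖ ^ 2 :=
        Finset.sum_le_sum_of_subset_of_nonneg hSG fun χ _ _ => integral_nonneg fun t => sq_nonneg _
    _ ≤ _ := sum_le_sum fun χ _ => hpt χ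
    _ = 2 * (∑ i ∈ F, ∑ j ∈ F, conj (b i.1) * b j.1 *
        (2 * π * T * tri (T * (log (N i) - log (N j))) : ℝ) * s i j).re := by
        rw [← mul_sum, ← re_sum, sum_comm]
        congr 2
        refine sum_congr rfl fun i _ => ?_
        rw [sum_comm]
        refine sum_congr rfl fun j _ => ?_
        rw [hs, mul_sum]
        refine sum_congr rfl fun χ _ => ?_
        rw [map_mul]; ring
    _ ≤ 2 * ∑ i ∈ F, ∑ j ∈ F, ‖b i.1‖ * ‖b j.1‖ * M i j := by
        refine mul_le_mul_of_nonneg_left ((re_le_norm _).trans ((norm_sum_le _ _).trans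
          (sum_le_sum fun i _ => (norm_sum_le _ _).trans (sum_le_sum fun j _ =>
            le_of_eq ?_)))) two_pos.le
        have := tri_nonneg (T * (log (N i) - log (N j)))
        rw [norm_mul, norm_mul, norm_mul, RCLike.norm_conj, norm_real, norm_of_nonneg (by positivity),
          hM]
        ring
    _ ≤ 2 * ∑ i ∈ F, ‖b i.1‖ ^ 2 * (2 * π * T * (C₂ * (N i / (T * log y)))) :=
        mul_le_mul_of_nonneg_left (schur_bound F _ _ M hM0 hsym hrow) two_pos.le
    _ = _ := by
        rw [mul_sum, mul_sum]
        refine sum_congr rfl fun i _ => ?_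
        have : log y ≠ 0 := by positivity
        field_simp
        ring

/-- **Large sieve inequality for Hecke characters** (Theorem 3.1). For `ε > 0` there are
constants `C₁ = C₁(ε), C₂ = C₂(ε) > 0` such that: if `b` is supported on prime ideals with
`Σ_𝔭 |b(𝔭)| < ∞` and `b(𝔭) = 0` for `N𝔭 ≤ y`, `H (mod 𝔮)` is a primitive congruence class
group, `T ≥ 1` and `y ≥ {h_H n_K^{5n_K/4} D_K^{3/2} Q^{1/2} T^{n_K/2+1}}^{1+ε} e^{C₁ n_K}`,
then `Σ_{χ(H)=1} ∫_{-T}^T |Σ_𝔭 b(𝔭)χ(𝔭)N𝔭^{-it}|² dt ≤ (C₂/log y) Σ_𝔭 N𝔭 |b(𝔭)|²`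
(the sum over characters being expressed via arbitrary finite subfamilies). -/
theorem large_sieve_for_hecke_characters :
    ∀ ε : ℝ, 0 < ε →
    ∃ C₁ C₂ : ℝ, 0 < C₁ ∧ 0 < C₂ ∧
      ∀ (K : Type) [Field K] [NumberField K] (𝔮 : Ideal (𝓞 K))
        (H : CongClassGroup K 𝔮) (b : Ideal (𝓞 K) → ℂ) (y T : ℝ),
        IsPrimitiveCCG H →
        (∀ 𝔭 : Ideal (𝓞 K), ¬ (𝔭.IsPrime ∧ 𝔭 ≠ ⊥) → b 𝔭 = 0) →
        Summable (fun 𝔭 : {I : Ideal (𝓞 K) // I.IsPrime ∧ I ≠ ⊥} => ‖b 𝔭.1‖) →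
        (∀ 𝔭 : Ideal (𝓞 K), (Ideal.absNorm 𝔭 : ℝ) ≤ y → b 𝔭 = 0) →
        1 ≤ T →
        ((hH H : ℝ) * (nK K : ℝ) ^ (5 * (nK K : ℝ) / 4) * (DK K : ℝ) ^ ((3 : ℝ) / 2) *
            (QH H : ℝ) ^ ((1 : ℝ) / 2) * T ^ ((nK K : ℝ) / 2 + 1)) ^ (1 + ε) *
          Real.exp (C₁ * (nK K : ℝ)) ≤ y →
        ∀ S : Finset (HeckeChar K 𝔮), (∀ χ ∈ S, CharTrivOn χ H) →
          ENNReal.ofReal (∑ χ ∈ S, ∫ t in Set.Icc (-T) T,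
              ‖∑' 𝔭 : {I : Ideal (𝓞 K) // I.IsPrime ∧ I ≠ ⊥},
                b 𝔭.1 * χ.toFun 𝔭.1 *
                  (Ideal.absNorm 𝔭.1 : ℂ) ^ (-(t : ℂ) * Complex.I)‖ ^ 2) ≤
            ENNReal.ofReal (C₂ / Real.log y) *
              ∑' 𝔭 : {I : Ideal (𝓞 K) // I.IsPrime ∧ I ≠ ⊥},
                ENNReal.ofReal ((Ideal.absNorm 𝔭.1 : ℝ) * ‖b 𝔭.1‖ ^ 2) := by
  intro ε hε
  obtain ⟨C₁, C₂, h₁, h₂, hls⟩ := large_sieve_finite (lt_min hε one_pos) (min_le_right ε 1)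
  refine ⟨C₁, C₂, h₁, h₂, ?_⟩
  intro K _ _ 𝔮 H b y T hprim _ hsum hby hT hy S hS
  have h𝔮 := ne_bot_of_primitive hprim
  rcases S.eq_empty_or_nonempty with rfl | hS0
  · simp
  obtain ⟨G, hG, hGc⟩ := exists_family h𝔮 H
  have hh : (1 : ℝ) ≤ hH H := by
    obtain ⟨χ, hχ⟩ := hS0
    exact_mod_cast (Finset.card_pos.2 ⟨χ, (hG χ).2 (hS χ hχ)⟩).trans_le hGc
  have hn : (1 : ℝ) ≤ nK K := by exact_mod_cast (finrank_pos : 0 < nK K)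
  have hQ : (1 : ℝ) ≤ QH H := by exact_mod_cast one_le_QH h𝔮 H
  have hy' := (mul_le_mul_of_nonneg_right (Real.rpow_le_rpow_of_exponent_le
    (one_le_mul_of_one_le_of_one_le (one_le_mul_of_one_le_of_one_le (one_le_mul_of_one_le_of_one_le
      (one_le_mul_of_one_le_of_one_le hh (Real.one_le_rpow hn (by positivity)))
      (Real.one_le_rpow one_le_DK (by positivity))) (Real.one_le_rpow hQ (by positivity)))
      (Real.one_le_rpow hT (by positivity))) (add_le_add_right (min_le_left ε 1) 1))
    (exp_pos (C₁ * nK K)).le).trans hy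
  set φ : HeckeChar K 𝔮 → ℝ → {I : Ideal (𝓞 K) // I.IsPrime ∧ I ≠ ⊥} → ℂ := fun χ t 𝔭 =>
    b 𝔭.1 * χ.toFun 𝔭.1 * (absNorm 𝔭.1 : ℂ) ^ (-(t : ℂ) * Complex.I) with hφ
  have hφ1 : ∀ χ t 𝔭, ‖φ χ t 𝔭‖ ≤ ‖b 𝔭.1‖ := fun χ t 𝔭 => by
    rw [hφ, norm_mul, norm_mul, norm_natCast_cpow_of_pos (by exact_mod_cast absNorm_pos' 𝔭.2.2)]
    have h1 : ‖χ.toFun 𝔭.1‖ ≤ 1 := by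
      by_cases h : IsCoprime 𝔭.1 𝔮
      · exact (χ.norm_one' _ h).le
      · simp [χ.eq_zero' _ h]
    simpa using mul_le_of_le_one_right (norm_nonneg _) h1
  have hK := countable_field K
  have hO : Countable (𝓞 K) := RingOfIntegers.coe_injective.countable
  have hc : Countable (Ideal (𝓞 K)) := Function.Surjective.countable
    (f := fun s : Finset (𝓞 K) => span (s : Set (𝓞 K))) fun I => IsNoetherian.noetherian I
  have hlim : Tendsto (fun F : Finset {I : Ideal (𝓞 K) // I.IsPrime ∧ I ≠ ⊥} =>
      ∑ χ ∈ S, ∫ t in Set.Icc (-T) T, ‖∑ 𝔭 ∈ F, φ χ t 𝔭‖ ^ 2) atTop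
      (𝓝 (∑ χ ∈ S, ∫ t in Set.Icc (-T) T, ‖∑' 𝔭, φ χ t 𝔭‖ ^ 2)) := by
    refine tendsto_finsetSum _ fun χ _ => ?_
    refine tendsto_integral_filter_of_dominated_convergence
      (fun _ => (∑' 𝔭 : {I : Ideal (𝓞 K) // I.IsPrime ∧ I ≠ ⊥}, ‖b 𝔭.1‖) ^ 2) ?_ ?_ (by simp) ?_
    · refine .of_forall fun F => Continuous.aestronglyMeasurable ?_
      refine (continuous_norm.comp (continuous_finsetSum _ fun 𝔭 _ => ?_)).pow 2
      refine continuous_const.mul (Continuous.const_cpow (by fun_prop) (Or.inl ?_))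
      exact_mod_cast (absNorm_pos' 𝔭.2.2).ne'
    · refine .of_forall fun F => .of_forall fun t => ?_
      rw [norm_pow, norm_norm]
      gcongr
      exact (norm_sum_le _ _).trans ((sum_le_sum fun 𝔭 _ => hφ1 χ t 𝔭).trans
        (hsum.sum_le_tsum _ fun _ _ => norm_nonneg _))
    · exact .of_forall fun t => ((hsum.of_norm_bounded (hφ1 χ t)).hasSum.norm).pow 2
  refine le_of_tendsto' (ENNReal.tendsto_ofReal hlim) fun F => ?_
  obtain ⟨hy0, hF⟩ := hls K 𝔮 H b y T h𝔮 hby hT hy' S F hS0 hS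
  refine (ENNReal.ofReal_le_ofReal hF).trans ?_
  rw [ENNReal.ofReal_mul (by positivity), ENNReal.ofReal_sum_of_nonneg fun _ _ => by positivity]
  gcongr
  exact ENNReal.sum_le_tsum F

end RTZ
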